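/- Let n ≥ 2 be an integer, ℓ a prime, and K a degree-n field. Write |Cl_K[ℓ]| = ℓ^r. Then the number of degree-(nℓ) fields M inside ℚ̄ with K ⊆ M and D_M = D_K^{ℓ} is at least (ℓ^r − 1)/(ℓ − 1), i.e. at least (|Cl_K[ℓ]| − 1)/(ℓ − 1). -/

import Mathlib

open NumberField Filter

-- The absolute value of the discriminant of an intermediate field `K` of `ℚ̄/ℚ`
-- (junk value `0` in the irrelevant case that `K/ℚ` is infinite-dimensional).
open scoped Classical in
noncomputable def absDisc (K : IntermediateField ℚ (AlgebraicClosure ℚ)) : ℕ :=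
  if h : FiniteDimensional ℚ K then
    letI : NumberField K := { to_charZero := inferInstance, to_finiteDimensional := h }
    (NumberField.discr K).natAbs
  else 0

/-- The cardinality `|Cl_K[m]|` of the `m`-torsion subgroup of the class group of `K`. -/
noncomputable def clTors (K : IntermediateField ℚ (AlgebraicClosure ℚ)) (m : ℕ) : ℕ :=
  Nat.card {x : ClassGroup (𝓞 K) // x ^ m = 1}

section P1
namespace CFT

section Herbrand

variable {C : Type*} [AddCommGroup C]

theorem q_mul (f g : C →+ C) :
    (f.comp g).range.index * Nat.card f.ker * Nat.card g.ker =
    f.range.index * g.range.index * Nat.card (f.comp g).ker := by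
  have h1 : (f.comp g).range = g.range.map f := by
    ext x; simp [AddMonoidHom.mem_range]
  have h2 := AddSubgroup.index_map g.range f
  have h3 := AddSubgroup.relIndex_mul_index (show g.range ≤ g.range ⊔ f.ker from le_sup_left)
  rw [AddSubgroup.relIndex_sup_left] at h3
  have h4 : Nat.card f.ker = Nat.card ↥(g.range ⊓ f.ker) * g.range.relIndex f.ker := by
    have := AddSubgroup.relIndex_mul_relIndex ⊥ (g.range ⊓ f.ker) f.ker bot_le inf_le_right
    rw [AddSubgroup.relIndex_bot_left, AddSubgroup.relIndex_bot_left,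
      AddSubgroup.inf_relIndex_right] at this
    exact this.symm
  have h5 : Nat.card (f.comp g).ker = Nat.card g.ker * Nat.card ↥(g.range ⊓ f.ker) := by
    have hle : g.ker ≤ (f.comp g).ker := by
      intro x hx
      have hx' : g x = 0 := hx
      change f (g x) = 0
      rw [hx', map_zero]
    have := AddSubgroup.relIndex_mul_relIndex ⊥ g.ker (f.comp g).ker bot_le hle
    rw [AddSubgroup.relIndex_bot_left, AddSubgroup.relIndex_bot_left,
      AddSubgroup.relIndex_ker] at this
    have e : (f.comp g).ker.map g = g.range ⊓ f.ker := by
      ext x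
      constructor
      · rintro ⟨y, hy, rfl⟩
        exact ⟨⟨y, rfl⟩, hy⟩
      · rintro ⟨⟨y, rfl⟩, hy⟩
        exact ⟨y, hy, rfl⟩
    rw [e] at this
    exact this.symm
  rw [h1, h2, h4, h5, ← h3]
  ring

theorem finite_ker_comp (f g : C →+ C) (hf : Finite f.ker) (hg : Finite g.ker) :
    Finite (f.comp g).ker := by
  let r : (f.comp g).ker →+ f.ker :=
    (g.comp (AddSubgroup.subtype _)).codRestrict _ (by
      rintro ⟨x, hx⟩
      exact hx)
  have : Finite r.ker := by
    refine Finite.of_injective (fun x : r.ker => (⟨x.1.1, ?_⟩ : g.ker)) ?_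
    · have h := x.2
      rw [AddMonoidHom.mem_ker] at h
      exact congrArg Subtype.val h
    · intro x y hxy
      have h : x.1.1 = y.1.1 := congrArg (fun z : g.ker => z.1) hxy
      exact Subtype.ext (Subtype.ext h)
  exact (AddMonoidHom.finite_iff_finite_ker_range r).2 ⟨this, inferInstance⟩

theorem q_pow (f : Module.End ℤ C) (hk : Finite f.toAddMonoidHom.ker) (n : ℕ) :
    Finite (f ^ n).toAddMonoidHom.ker ∧
    (f ^ n).toAddMonoidHom.range.index * Nat.card f.toAddMonoidHom.ker ^ n =
    f.toAddMonoidHom.range.index ^ n * Nat.card (f ^ n).toAddMonoidHom.ker := by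
  induction n with
  | zero =>
    have h0 : (f ^ 0).toAddMonoidHom = AddMonoidHom.id C := by
      ext x; rfl
    have hr : (AddMonoidHom.id C).range = ⊤ := by
      ext x; simp [AddMonoidHom.mem_range]
    have hk0 : (AddMonoidHom.id C).ker = ⊥ := by
      ext x; simp [AddMonoidHom.mem_ker]
    rw [h0, hr, hk0]
    refine ⟨inferInstance, by simp⟩
  | succ n ih =>
    obtain ⟨hfin, ih⟩ := ih
    have hs : (f ^ (n+1)).toAddMonoidHom = (f ^ n).toAddMonoidHom.comp f.toAddMonoidHom := by
      rw [pow_succ]; rfl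
    have key := q_mul (f ^ n).toAddMonoidHom f.toAddMonoidHom
    rw [← hs] at key
    have hfin' : Finite (f ^ (n+1)).toAddMonoidHom.ker := by
      rw [hs]; exact finite_ker_comp _ _ hfin hk
    refine ⟨hfin', ?_⟩
    have hpos : 0 < Nat.card (f ^ n).toAddMonoidHom.ker := Nat.card_pos
    apply Nat.eq_of_mul_eq_mul_right hpos
    generalize (f ^ (n+1)).toAddMonoidHom.range.index = x1 at *
    generalize Nat.card (f ^ (n+1)).toAddMonoidHom.ker = x2 at *
    generalize (f ^ n).toAddMonoidHom.range.index = x3 at *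
    generalize Nat.card (f ^ n).toAddMonoidHom.ker = x4 at *
    generalize Nat.card f.toAddMonoidHom.ker = x5 at *
    generalize f.toAddMonoidHom.range.index = x6 at *
    calc _ = (x1 * x4 * x5) * x5 ^ n := by ring
      _ = (x3 * x5 ^ n) * x6 * x2 := by rw [key]; ring
      _ = _ := by rw [ih]; ring

/-- an endomorphism of a finitely generated group with finite kernel -/
theorem card_ker_le_index (g : C →+ C) [Module.Finite ℤ C]
    (hk : Finite (g.ker)) (hidx : g.range.index ≠ 0) :
    Nat.card (g.ker) ≤ g.range.index := by
  set τ : AddSubgroup C := AddCommGroup.torsion C with hτ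
  have hfinτ : Finite τ := by
    have : Module.Finite ℤ τ := by
      have : Module.Finite ℤ (AddSubgroup.toIntSubmodule τ) := inferInstance
      exact this
    have h2 : IsAddTorsion τ := AddCommMonoid.addTorsion.isAddTorsion
    have : AddGroup.FG τ := Module.Finite.iff_addGroup_fg.1 this
    exact AddCommGroup.finite_of_fg_isAddTorsion _ h2
  have hkτ : g.ker ≤ τ := by
    intro x hx
    have := isOfFinAddOrder_of_finite (⟨x, hx⟩ : g.ker)
    exact (AddSubmonoid.isOfFinAddOrder_coe (x := (⟨x, hx⟩ : g.ker))).2 this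
  have hmap : g.range ⊓ τ = τ.map g := by
    ext x
    constructor
    · rintro ⟨⟨y, rfl⟩, hy⟩
      refine ⟨y, ?_, rfl⟩
      have hy' : IsOfFinAddOrder (g y) := hy
      obtain ⟨n, hn, hn'⟩ := isOfFinAddOrder_iff_nsmul_eq_zero.1 hy'
      have : n • y ∈ g.ker := by
        change g (n • y) = 0
        rw [map_nsmul, hn']
      have := hkτ this
      have h3 : IsOfFinAddOrder (n • y) := this
      obtain ⟨m, hm, hm'⟩ := isOfFinAddOrder_iff_nsmul_eq_zero.1 h3
      refine isOfFinAddOrder_iff_nsmul_eq_zero.2 ⟨m * n, Nat.mul_pos hm hn, ?_⟩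
      rw [mul_nsmul', hm']
    · rintro ⟨y, hy, rfl⟩
      refine ⟨⟨y, rfl⟩, ?_⟩
      have hy' : IsOfFinAddOrder y := hy
      exact AddMonoidHom.isOfFinAddOrder g hy'
  have h1 : g.range.relIndex τ ≤ g.range.index := by
    rw [← AddSubgroup.relIndex_top_right]
    exact AddSubgroup.relIndex_le_of_le_right le_top (by rwa [AddSubgroup.relIndex_top_right])
  refine le_trans ?_ h1
  rw [← AddSubgroup.inf_relIndex_right, hmap]
  have h2 : Nat.card (τ.map g) * (τ.map g).relIndex τ = Nat.card τ := by
    have hle : τ.map g ≤ τ := by rw [← hmap]; exact inf_le_right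
    have := AddSubgroup.relIndex_mul_relIndex ⊥ (τ.map g) τ bot_le hle
    rwa [AddSubgroup.relIndex_bot_left, AddSubgroup.relIndex_bot_left] at this
  have h3 : Nat.card (g.ker) * Nat.card (τ.map g) = Nat.card τ := by
    have := AddSubgroup.relIndex_mul_relIndex ⊥ (g.ker) τ bot_le hkτ
    rwa [AddSubgroup.relIndex_bot_left, AddSubgroup.relIndex_bot_left,
      AddSubgroup.relIndex_ker] at this
  have : 0 < Nat.card (τ.map g) := by
    rcases Nat.eq_zero_or_pos (Nat.card (τ.map g)) with h | h
    · rw [h] at h3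
      have := Nat.card_pos (α := τ)
      omega
    · exact h
  apply le_of_eq
  apply Nat.eq_of_mul_eq_mul_left this
  rw [h2, mul_comm, h3]

end Herbrand
end CFT
end P1

section P1b
namespace CFT
section Herbrand

variable {C : Type*} [AddCommGroup C]

theorem finrank_int_of_finite (D : Type*) [AddCommGroup D] [Finite D] : Module.finrank ℤ D = 0 := by
  rw [Module.finrank_eq_zero_iff_isTorsion]
  intro x
  obtain ⟨n, hn, hn'⟩ := isOfFinAddOrder_iff_nsmul_eq_zero.1 (isOfFinAddOrder_of_finite x)
  refine ⟨⟨(n : ℤ), mem_nonZeroDivisors_of_ne_zero (by exact_mod_cast hn.ne')⟩, ?_⟩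
  change (n : ℤ) • x = 0
  rw [natCast_zsmul, hn']

/-- additivity of rank for a hom of f.g. abelian groups -/
theorem finrank_range_add_ker {D : Type*} [AddCommGroup D] [Module.Finite ℤ C] (f : C →ₗ[ℤ] D) :
    Module.finrank ℤ (LinearMap.range f) + Module.finrank ℤ (LinearMap.ker f)
      = Module.finrank ℤ C := by
  rw [← Submodule.finrank_quotient_add_finrank (LinearMap.ker f),
    (f.quotKerEquivRange).finrank_eq]

theorem q_nsmul_aux {D : Type*} [AddCommGroup D] [Finite D] (n ℓ : ℕ) (hℓ : ℓ ≠ 0)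
    (E : C ≃+ (Fin n → ℤ) × D) :
    Finite (nsmulAddMonoidHom (α := C) ℓ).ker ∧ (nsmulAddMonoidHom (α := C) ℓ).range.index =
    ℓ ^ (Module.finrank ℤ C) * Nat.card (nsmulAddMonoidHom (α := C) ℓ).ker := by
  have hfin : Module.Finite ℤ C := Module.Finite.equiv E.symm.toIntLinearEquiv
  have hr : Module.finrank ℤ C = n := by
    rw [E.toIntLinearEquiv.finrank_eq,
      ← finrank_range_add_ker (LinearMap.fst ℤ (Fin n → ℤ) D), LinearMap.range_eq_top.2 LinearMap.fst_surjective, finrank_top,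
      LinearMap.ker_fst,
      ← (LinearEquiv.ofInjective (LinearMap.inr ℤ (Fin n → ℤ) D) LinearMap.inr_injective).finrank_eq,
      finrank_int_of_finite D]
    simp
  have hrange : (nsmulAddMonoidHom (α := C) ℓ).range.map (E : C →+ (Fin n → ℤ) × D) =
      (AddSubgroup.pi Set.univ (fun _ : Fin n => AddSubgroup.zmultiples (ℓ : ℤ))).prod
        (nsmulAddMonoidHom (α := D) ℓ).range := by
    ext ⟨x, y⟩
    simp only [AddSubgroup.mem_map, AddMonoidHom.mem_range, AddSubgroup.mem_prod,
      AddSubgroup.mem_pi, nsmulAddMonoidHom_apply]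
    constructor
    · rintro ⟨_, ⟨z, rfl⟩, h⟩
      have h' : ℓ • E z = (x, y) := by rw [← h]; simp
      obtain ⟨rfl, rfl⟩ := Prod.ext_iff.1 h'
      refine ⟨fun i _ => ?_, (E z).2, rfl⟩
      exact Int.mem_zmultiples_iff.2 ⟨(E z).1 i, by simp⟩
    · rintro ⟨h1, z, hz⟩
      choose f hf using fun i => Int.mem_zmultiples_iff.1 (h1 i trivial)
      refine ⟨_, ⟨E.symm (f, z), rfl⟩, ?_⟩
      have : (E : C →+ (Fin n → ℤ) × D) (ℓ • E.symm (f, z)) = ℓ • (f, z) := by simp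
      rw [this]
      ext i
      · simp [hf i]
      · simpa using hz
  have hidx : (nsmulAddMonoidHom (α := C) ℓ).range.index =
      ℓ ^ n * (nsmulAddMonoidHom (α := D) ℓ).range.index := by
    rw [← AddSubgroup.index_map_equiv _ E, hrange, AddSubgroup.index_prod, AddSubgroup.index_pi]
    simp
  have hfk : ∀ x, x ∈ (nsmulAddMonoidHom (α := C) ℓ).ker ↔ (E x).1 = 0 ∧ ℓ • (E x).2 = 0 := by
    intro x
    rw [AddMonoidHom.mem_ker, nsmulAddMonoidHom_apply, ← E.map_eq_zero_iff, map_nsmul,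
      Prod.ext_iff]
    have h0 : (ℓ • E x).1 = 0 ↔ (E x).1 = 0 := by
      rw [Prod.smul_fst, smul_eq_zero]
      simp [hℓ]
    rw [Prod.fst_zero, Prod.snd_zero, h0, Prod.smul_snd]
  let e : (nsmulAddMonoidHom (α := C) ℓ).ker ≃ (nsmulAddMonoidHom (α := D) ℓ).ker :=
    { toFun := fun x => ⟨(E x.1).2, ((hfk _).1 x.2).2⟩
      invFun := fun y => ⟨E.symm (0, y.1), (hfk _).2 (by
        have := y.2
        rw [AddMonoidHom.mem_ker, nsmulAddMonoidHom_apply] at this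
        simpa using this)⟩
      left_inv := by
        intro x
        ext
        apply E.injective
        simp only [AddEquiv.apply_symm_apply]
        ext1
        · exact ((hfk _).1 x.2).1.symm
        · rfl
      right_inv := by intro y; ext; simp }
  refine ⟨Finite.of_equiv _ e.symm, ?_⟩
  rw [hidx, hr, Nat.card_congr e]
  congr 1
  have h1 := AddSubgroup.card_mul_index (nsmulAddMonoidHom (α := D) ℓ).range
  have h2 := AddSubgroup.card_mul_index (nsmulAddMonoidHom (α := D) ℓ).ker
  rw [AddSubgroup.index_ker] at h2
  have hpos : 0 < Nat.card (nsmulAddMonoidHom (α := D) ℓ).range := Nat.card_pos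
  apply Nat.eq_of_mul_eq_mul_left hpos
  rw [h1, ← h2, mul_comm]

theorem q_nsmul [Module.Finite ℤ C] (ℓ : ℕ) (hℓ : ℓ ≠ 0) :
    Finite (nsmulAddMonoidHom (α := C) ℓ).ker ∧ (nsmulAddMonoidHom (α := C) ℓ).range.index =
    ℓ ^ (Module.finrank ℤ C) * Nat.card (nsmulAddMonoidHom (α := C) ℓ).ker := by
  have hfg : AddGroup.FG C := Module.Finite.iff_addGroup_fg.1 inferInstance
  obtain ⟨n, ι, hι, p, hp, e, ⟨E⟩⟩ := AddCommGroup.equiv_free_prod_directSum_zmod C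
  have hD : Finite (DirectSum ι fun i => ZMod (p i ^ e i)) := by
    have : ∀ i, NeZero (p i ^ e i) := fun i => ⟨pow_ne_zero _ (hp i).ne_zero⟩
    classical
    exact Finite.of_equiv _ (DirectSum.addEquivProd (fun i => ZMod (p i ^ e i))).symm.toEquiv
  exact q_nsmul_aux n ℓ hℓ (E.trans
    (AddEquiv.prodCongr (Finsupp.linearEquivFunOnFinite ℤ ℤ (Fin n)).toAddEquiv (AddEquiv.refl _)))

theorem finrank_eq_of_nsmul_le {A : Type*} [AddCommGroup A] [Module.Finite ℤ A]
    (P Q : Submodule ℤ A) (hPQ : P ≤ Q) (ℓ : ℕ) (hℓ : ℓ ≠ 0) (h : ∀ x ∈ Q, ℓ • x ∈ P) :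
    Module.finrank ℤ P = Module.finrank ℤ Q := by
  have h1 := Submodule.finrank_quotient_add_finrank (P.comap Q.subtype)
  have h2 : Module.finrank ℤ (Q ⧸ (P.comap Q.subtype)) = 0 := by
    rw [Module.finrank_eq_zero_iff_isTorsion]
    intro x
    induction x using Submodule.Quotient.induction_on with | H x =>
    refine ⟨⟨(ℓ : ℤ), mem_nonZeroDivisors_of_ne_zero (by exact_mod_cast hℓ)⟩, ?_⟩
    change (ℓ : ℤ) • (Submodule.Quotient.mk x : Q ⧸ (P.comap Q.subtype)) = 0
    rw [← Submodule.Quotient.mk_smul, Submodule.Quotient.mk_eq_zero]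
    simpa using h x x.2
  rw [h2, zero_add] at h1
  rw [← h1]
  exact (Submodule.comapSubtypeEquivOfLe hPQ).symm.finrank_eq

theorem exists_poly (ℓ : ℕ) (hℓ : ℓ.Prime) : ∃ G : Polynomial ℤ,
    (Polynomial.X - 1) ^ (ℓ - 1) = (∑ i ∈ Finset.range ℓ, Polynomial.X ^ i) +
      Polynomial.C (ℓ : ℤ) * G := by
  have : Fact ℓ.Prime := ⟨hℓ⟩
  have h : Polynomial.C (ℓ : ℤ) ∣ ((Polynomial.X - 1) ^ (ℓ - 1) -
      (∑ i ∈ Finset.range ℓ, Polynomial.X ^ i) : Polynomial ℤ) := by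
    rw [Polynomial.C_dvd_iff_dvd_coeff]
    intro i
    rw [← ZMod.intCast_zmod_eq_zero_iff_dvd]
    rw [← eq_intCast (Int.castRingHom (ZMod ℓ)), ← Polynomial.coeff_map]
    have : Polynomial.map (Int.castRingHom (ZMod ℓ)) ((Polynomial.X - 1) ^ (ℓ - 1) -
      (∑ i ∈ Finset.range ℓ, Polynomial.X ^ i) : Polynomial ℤ) = 0 := by
      simp only [Polynomial.map_sub, Polynomial.map_pow, Polynomial.map_X, Polynomial.map_one,
        Polynomial.map_sum]
      have hX : (Polynomial.X - 1 : Polynomial (ZMod ℓ)) ≠ 0 := Polynomial.X_sub_C_ne_zero 1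
      apply mul_right_cancel₀ hX
      rw [sub_mul, geom_sum_mul, ← pow_succ, Nat.sub_add_cancel hℓ.one_le, zero_mul,
        sub_pow_char, one_pow, sub_self]
    rw [this]; simp
  obtain ⟨G, hG⟩ := h
  exact ⟨G, by rw [← hG]; ring⟩

end Herbrand
end CFT
end P1b

section P1c
namespace CFT
section Herbrand

/-- key estimate on the kernel of the norm -/
theorem index_sub_one {C : Type*} [AddCommGroup C] [Module.Finite ℤ C] (ℓ : ℕ) (hℓ : ℓ.Prime)
    (σ : Module.End ℤ C) (hN : ∑ i ∈ Finset.range ℓ, σ ^ i = 0) (b : ℕ)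
    (hb : Module.finrank ℤ C = (ℓ - 1) * b) :
    ℓ ^ b * Nat.card (σ - 1).toAddMonoidHom.ker ≤ (σ - 1).toAddMonoidHom.range.index := by
  set S : Module.End ℤ C := σ - 1 with hS
  obtain ⟨G, hG⟩ := exists_poly ℓ hℓ
  set g : Module.End ℤ C := Polynomial.aeval σ G with hg
  have hSg : S ^ (ℓ - 1) = (ℓ : Module.End ℤ C) * g := by
    have := congrArg (Polynomial.aeval σ) hG
    simpa [hN, ← hS] using this
  have hcomm : Commute (ℓ : Module.End ℤ C) g := Nat.cast_commute ℓ g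
  have hℓmap : ∀ x, (ℓ : Module.End ℤ C) x = ℓ • x := fun x => by simp
  have hℓhom : (ℓ : Module.End ℤ C).toAddMonoidHom = nsmulAddMonoidHom ℓ := by
    ext x; exact hℓmap x
  obtain ⟨hfinℓ, hidxℓ⟩ := q_nsmul (C := C) ℓ hℓ.ne_zero
  -- kernel of S is killed by ℓ
  have hkerS : S.toAddMonoidHom.ker ≤ (nsmulAddMonoidHom (α := C) ℓ).ker := by
    intro x hx
    have hx' : σ x = x := by
      have : (σ - 1) x = 0 := hx
      rw [LinearMap.sub_apply, sub_eq_zero] at this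
      exact this
    have hpow : ∀ i, (σ ^ i) x = x := by
      intro i
      induction i with
      | zero => rfl
      | succ i ih => rw [pow_succ, Module.End.mul_apply, hx', ih]
    have := congrArg (fun f : Module.End ℤ C => f x) hN
    simp only [LinearMap.sum_apply, hpow, Finset.sum_const, Finset.card_range,
      LinearMap.zero_apply] at this
    exact this
  have hfinS : Finite S.toAddMonoidHom.ker :=
    Finite.of_injective (fun x => (⟨x.1, hkerS x.2⟩ : (nsmulAddMonoidHom (α := C) ℓ).ker))
      (fun x y h => Subtype.ext (congrArg (fun z : (nsmulAddMonoidHom (α := C) ℓ).ker => z.1) h))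
  -- ℓ C ⊆ S C
  have hrangeS : (nsmulAddMonoidHom (α := C) ℓ).range ≤ S.toAddMonoidHom.range := by
    have hdiv : ∃ H : Polynomial ℤ, Polynomial.C (ℓ : ℤ) - ∑ i ∈ Finset.range ℓ, Polynomial.X ^ i
        = (Polynomial.X - Polynomial.C 1) * H := by
      apply (Polynomial.dvd_iff_isRoot).2
      simp [Polynomial.IsRoot, Polynomial.eval_finsetSum]
    obtain ⟨H, hH⟩ := hdiv
    have := congrArg (Polynomial.aeval σ) hH
    have h2 : (ℓ : Module.End ℤ C) = S * Polynomial.aeval σ H := by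
      simpa [hN, ← hS] using this
    rintro _ ⟨x, rfl⟩
    refine ⟨(Polynomial.aeval σ H) x, ?_⟩
    change (S * Polynomial.aeval σ H) x = _
    rw [← h2]; exact hℓmap x
  have hidxℓ0 : (nsmulAddMonoidHom (α := C) ℓ).range.index ≠ 0 := by
    rw [hidxℓ]
    exact mul_ne_zero (pow_ne_zero _ hℓ.ne_zero) Nat.card_pos.ne'
  have hidxS : S.toAddMonoidHom.range.index ≠ 0 := by
    intro h
    have := AddSubgroup.index_dvd_of_le hrangeS
    rw [h] at this
    exact hidxℓ0 (Nat.eq_zero_of_zero_dvd this)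
  obtain ⟨hfinP, hqP⟩ := q_pow S hfinS (ℓ - 1)
  have hidxP : (S ^ (ℓ - 1)).toAddMonoidHom.range.index ≠ 0 := by
    intro h
    rw [h, zero_mul] at hqP
    exact mul_ne_zero (pow_ne_zero _ hidxS) Nat.card_pos.ne' hqP.symm
  have hcomp : (S ^ (ℓ - 1)).toAddMonoidHom =
      (nsmulAddMonoidHom (α := C) ℓ).comp g.toAddMonoidHom := by
    rw [hSg]; ext x
    exact hℓmap (g x)
  have hfing : Finite g.toAddMonoidHom.ker := by
    have : g.toAddMonoidHom.ker ≤ (S ^ (ℓ - 1)).toAddMonoidHom.ker := by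
      intro x hx
      have hx' : g.toAddMonoidHom x = 0 := hx
      rw [hcomp, AddMonoidHom.mem_ker, AddMonoidHom.comp_apply, hx', map_zero]
    exact Finite.of_injective (fun x => (⟨x.1, this x.2⟩ : (S ^ (ℓ - 1)).toAddMonoidHom.ker))
      (fun x y h => Subtype.ext (congrArg (fun z : (S ^ (ℓ - 1)).toAddMonoidHom.ker => z.1) h))
  have hidxg : g.toAddMonoidHom.range.index ≠ 0 := by
    intro h
    have hle : (S ^ (ℓ - 1)).toAddMonoidHom.range ≤ g.toAddMonoidHom.range := by
      rintro _ ⟨x, rfl⟩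
      refine ⟨ℓ • x, ?_⟩
      rw [hcomp]
      simp
    have := AddSubgroup.index_dvd_of_le hle
    rw [h] at this
    exact hidxP (Nat.eq_zero_of_zero_dvd this)
  have hle := card_ker_le_index g.toAddMonoidHom hfing hidxg
  have hm := q_mul (nsmulAddMonoidHom (α := C) ℓ) g.toAddMonoidHom
  rw [← hcomp, hidxℓ, hb] at hm
  have hp1 : 0 < Nat.card (nsmulAddMonoidHom (α := C) ℓ).ker := Nat.card_pos
  have hp2 : 0 < Nat.card g.toAddMonoidHom.ker := Nat.card_pos
  have hp3 : 0 < Nat.card (S ^ (ℓ - 1)).toAddMonoidHom.ker := Nat.card_pos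
  generalize Nat.card (nsmulAddMonoidHom (α := C) ℓ).ker = x1 at *
  generalize Nat.card g.toAddMonoidHom.ker = x2 at *
  generalize Nat.card (S ^ (ℓ - 1)).toAddMonoidHom.ker = x3 at *
  generalize g.toAddMonoidHom.range.index = x4 at *
  generalize (S ^ (ℓ - 1)).toAddMonoidHom.range.index = x5 at *
  generalize Nat.card S.toAddMonoidHom.ker = x6 at *
  generalize S.toAddMonoidHom.range.index = x7 at *
  have h1 : ℓ ^ ((ℓ - 1) * b) * x3 ≤ x5 := by
    apply Nat.le_of_mul_le_mul_right _ (Nat.mul_pos hp1 hp2)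
    calc ℓ ^ ((ℓ - 1) * b) * x3 * (x1 * x2) = ℓ ^ ((ℓ - 1) * b) * x1 * x2 * x3 := by ring
      _ ≤ ℓ ^ ((ℓ - 1) * b) * x1 * x4 * x3 := by gcongr
      _ = x5 * (x1 * x2) := by rw [← hm]; ring
  have h2 : (ℓ ^ b * x6) ^ (ℓ - 1) ≤ x7 ^ (ℓ - 1) := by
    apply Nat.le_of_mul_le_mul_right _ hp3
    calc (ℓ ^ b * x6) ^ (ℓ - 1) * x3 = (ℓ ^ ((ℓ - 1) * b) * x3) * x6 ^ (ℓ - 1) := by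
          rw [mul_pow, ← pow_mul, mul_comm b]; ring
      _ ≤ x5 * x6 ^ (ℓ - 1) := by gcongr
      _ = _ := hqP
  exact (Nat.pow_le_pow_iff_left (by have := hℓ.two_le; omega)).1 h2

/-- The Herbrand quotient inequality. -/
theorem herbrand {A : Type*} [AddCommGroup A] [Module.Finite ℤ A] (ℓ : ℕ) (hℓ : ℓ.Prime)
    (σ : Module.End ℤ A) (hσ : σ ^ ℓ = 1) (N : Module.End ℤ A)
    (hN : N = ∑ i ∈ Finset.range ℓ, σ ^ i) (a : ℕ)
    (ha : Module.finrank ℤ (LinearMap.ker (σ - 1)) = a)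
    (hA : Module.finrank ℤ A = a + (ℓ - 1) * (a + 1)) :
    N.toAddMonoidHom.range.relIndex (σ - 1).toAddMonoidHom.ker ≠ 0 ∧
    ℓ * N.toAddMonoidHom.range.relIndex (σ - 1).toAddMonoidHom.ker ≤
      (σ - 1).toAddMonoidHom.range.relIndex N.toAddMonoidHom.ker := by
  set S : Module.End ℤ A := σ - 1 with hS
  have hgs : N * S = 0 := by rw [hN, hS, geom_sum_mul, hσ, sub_self]
  have hgs' : S * N = 0 := by rw [hN, hS, mul_geom_sum, hσ, sub_self]
  have hNS : ∀ x, N (S x) = 0 := fun x => congrArg (fun f : Module.End ℤ A => f x) hgs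
  have hSN : ∀ x, S (N x) = 0 := fun x => congrArg (fun f : Module.End ℤ A => f x) hgs'
  have hfix : ∀ x, S x = 0 → N x = ℓ • x := by
    intro x hx
    have hx' : σ x = x := by
      rw [hS, LinearMap.sub_apply, sub_eq_zero] at hx
      exact hx
    have hpow : ∀ i, (σ ^ i) x = x := by
      intro i
      induction i with
      | zero => rfl
      | succ i ih => rw [pow_succ, Module.End.mul_apply, hx', ih]
    rw [hN]
    simp only [LinearMap.sum_apply, hpow, Finset.sum_const, Finset.card_range]
  set F := S.toAddMonoidHom.ker with hF
  set C := N.toAddMonoidHom.ker with hC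
  have memF : ∀ x, x ∈ F ↔ S x = 0 := fun x => Iff.rfl
  have memC : ∀ x, x ∈ C ↔ N x = 0 := fun x => Iff.rfl
  obtain ⟨hfinA, hidxA⟩ := q_nsmul (C := A) ℓ hℓ.ne_zero
  -- J
  have hJ0 : (F ⊔ C).index ≠ 0 := by
    have hle : (nsmulAddMonoidHom (α := A) ℓ).range ≤ F ⊔ C := by
      rintro _ ⟨x, rfl⟩
      have : ℓ • x = N x + (ℓ • x - N x) := by abel
      change ℓ • x ∈ _
      rw [this]
      refine AddSubgroup.add_mem_sup ((memF _).2 (hSN x)) ((memC _).2 ?_)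
      rw [map_sub, map_nsmul, hfix _ (hSN x), sub_self]
    intro h
    have := AddSubgroup.index_dvd_of_le hle
    rw [h, hidxA] at this
    exact (mul_ne_zero (pow_ne_zero _ hℓ.ne_zero) Nat.card_pos.ne') (Nat.eq_zero_of_zero_dvd this)
  have hJN : (F.map (nsmulAddMonoidHom ℓ)).relIndex N.toAddMonoidHom.range = (F ⊔ C).index := by
    have h1 : (F ⊔ C).map N.toAddMonoidHom = F.map (nsmulAddMonoidHom ℓ) := by
      rw [AddSubgroup.map_sup]
      have h2 : C.map N.toAddMonoidHom = ⊥ := by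
        rw [eq_bot_iff]; rintro _ ⟨x, hx, rfl⟩; exact hx
      rw [h2, sup_bot_eq]
      ext y
      constructor
      · rintro ⟨x, hx, rfl⟩; exact ⟨x, hx, (hfix x hx).symm⟩
      · rintro ⟨x, hx, rfl⟩; exact ⟨x, hx, (hfix x hx)⟩
    rw [← h1, AddMonoidHom.range_eq_map, AddSubgroup.relIndex_map_map, ← hC]
    simp
  have hJS : (C.map S.toAddMonoidHom).relIndex S.toAddMonoidHom.range = (F ⊔ C).index := by
    have h1 : (F ⊔ C).map S.toAddMonoidHom = C.map S.toAddMonoidHom := by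
      rw [AddSubgroup.map_sup]
      have h2 : F.map S.toAddMonoidHom = ⊥ := by
        rw [eq_bot_iff]; rintro _ ⟨x, hx, rfl⟩; exact hx
      rw [h2, bot_sup_eq]
    rw [← h1, AddMonoidHom.range_eq_map, AddSubgroup.relIndex_map_map, ← hF]
    rw [sup_right_comm, sup_idem]
    simp
  have h1 := AddSubgroup.relIndex_mul_relIndex (F.map (nsmulAddMonoidHom ℓ)) N.toAddMonoidHom.range F
    (by rintro _ ⟨x, hx, rfl⟩; exact ⟨x, hfix x hx⟩)
    (by rintro _ ⟨x, rfl⟩; exact hSN x)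
  have h2 := AddSubgroup.relIndex_mul_relIndex (C.map S.toAddMonoidHom) S.toAddMonoidHom.range C
    (by rintro _ ⟨x, hx, rfl⟩; exact ⟨x, rfl⟩)
    (by rintro _ ⟨x, rfl⟩; exact hNS x)
  rw [hJN] at h1
  rw [hJS] at h2
  -- index of ℓ F in F
  have hFfin : Module.Finite ℤ F := inferInstanceAs (Module.Finite ℤ (LinearMap.ker S))
  obtain ⟨hfinF, hidxF⟩ := q_nsmul (C := F) ℓ hℓ.ne_zero
  have hidxF' : (F.map (nsmulAddMonoidHom ℓ)).relIndex F =
      (nsmulAddMonoidHom (α := F) ℓ).range.index := by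
    rw [AddSubgroup.relIndex]
    congr 1
    ext ⟨x, hx⟩
    constructor
    · rintro ⟨y, hy, hxy⟩
      exact ⟨⟨y, hy⟩, Subtype.ext hxy⟩
    · rintro ⟨⟨y, hy⟩, hxy⟩
      exact ⟨y, hy, congrArg Subtype.val hxy⟩
  have hrF : Module.finrank ℤ F = a := ha
  -- the group C
  have hCfin : Module.Finite ℤ C := inferInstanceAs (Module.Finite ℤ (LinearMap.ker N))
  have hσC : ∀ x ∈ LinearMap.ker N, σ x ∈ LinearMap.ker N := by
    intro x hx
    rw [LinearMap.mem_ker] at hx ⊢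
    have : σ x = S x + x := by rw [hS, LinearMap.sub_apply]; simp
    rw [this, map_add, hNS, hx, add_zero]
  set σC : Module.End ℤ (LinearMap.ker N) := σ.restrict hσC with hσCdef
  have hNC : ∑ i ∈ Finset.range ℓ, σC ^ i = 0 := by
    ext x
    have hpow : ∀ i, (((σC ^ i) x : LinearMap.ker N) : A) = (σ ^ i) x := by
      intro i
      induction i with
      | zero => rfl
      | succ i ih => rw [pow_succ', pow_succ', Module.End.mul_apply, Module.End.mul_apply, ← ih]; rfl
    simp only [LinearMap.sum_apply, AddSubmonoidClass.coe_finsetSum, hpow]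
    have := x.2
    rw [LinearMap.mem_ker] at this
    have h5 := congrArg (fun f : Module.End ℤ A => f x.1) hN
    simp only [LinearMap.sum_apply] at h5
    rw [← h5]
    exact this
  have hrC : Module.finrank ℤ (LinearMap.ker N) = (ℓ - 1) * (a + 1) := by
    have h3 := finrank_range_add_ker N
    have h4 : Module.finrank ℤ (LinearMap.range N) = Module.finrank ℤ (LinearMap.ker S) := by
      apply finrank_eq_of_nsmul_le _ _ _ ℓ hℓ.ne_zero
      · intro x hx; exact ⟨x, hfix x hx⟩
      · rintro _ ⟨x, rfl⟩; exact hSN x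
    rw [h4, ha, hA] at h3
    omega
  have hmain := index_sub_one ℓ hℓ σC hNC (a + 1) hrC
  have hidxC : (C.map S.toAddMonoidHom).relIndex C = (σC - 1).toAddMonoidHom.range.index := by
    rw [AddSubgroup.relIndex]
    congr 1
    ext ⟨x, hx⟩
    constructor
    · rintro ⟨y, hy, hxy⟩
      exact ⟨⟨y, hy⟩, Subtype.ext hxy⟩
    · rintro ⟨⟨y, hy⟩, hxy⟩
      exact ⟨y, hy, congrArg Subtype.val hxy⟩
  have hcard : Nat.card (σC - 1).toAddMonoidHom.ker = Nat.card (nsmulAddMonoidHom (α := F) ℓ).ker := by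
    refine Nat.card_congr
      { toFun := fun x => ⟨⟨x.1.1, ?_⟩, ?_⟩
        invFun := fun x => ⟨⟨x.1.1, ?_⟩, ?_⟩
        left_inv := fun x => rfl
        right_inv := fun x => rfl }
    · exact congrArg Subtype.val x.2
    · have hS0 : S x.1.1 = 0 := congrArg Subtype.val x.2
      have := hfix _ hS0
      rw [AddMonoidHom.mem_ker]
      ext
      change ℓ • x.1.1 = 0
      rw [← this]
      exact x.1.2
    · have h0 : ℓ • x.1.1 = 0 := congrArg Subtype.val x.2
      rw [LinearMap.mem_ker, hfix _ x.1.2, h0]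
    · rw [AddMonoidHom.mem_ker]
      ext
      exact x.1.2
  rw [hidxF', hidxF, hrF] at h1
  rw [hidxC] at h2
  rw [hcard] at hmain
  have hpos : 0 < Nat.card (nsmulAddMonoidHom (α := F) ℓ).ker := Nat.card_pos
  constructor
  · intro h
    rw [h, mul_zero] at h1
    exact (mul_ne_zero (pow_ne_zero _ hℓ.ne_zero) hpos.ne') h1.symm
  · apply Nat.le_of_mul_le_mul_left _ (Nat.pos_of_ne_zero hJ0)
    rw [h2]
    refine le_trans (le_of_eq ?_) hmain
    rw [mul_left_comm, h1]; ring

end Herbrand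
end CFT
end P1c

section P2a
open NumberField IsDedekindDomain HeightOneSpectrum
open scoped nonZeroDivisors
namespace CFT

/-- The finite places of a number field. -/
abbrev HS (K : Type*) [Field K] := HeightOneSpectrum (𝓞 K)

section
variable {K : Type*} [Field K] [NumberField K]

/-- The normalised additive valuation attached to a finite place. -/
noncomputable def ord (v : HS K) (x : Kˣ) : ℤ := -(v.valuationOfNeZero x).toAdd

lemma ord_mul (v : HS K) (x y : Kˣ) : ord v (x * y) = ord v x + ord v y := by
  simp [ord]; ring
lemma ord_one (v : HS K) : ord v 1 = 0 := by simp [ord]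
lemma ord_inv (v : HS K) (x : Kˣ) : ord v x⁻¹ = - ord v x := by simp [ord]
lemma ord_div (v : HS K) (x y : Kˣ) : ord v (x / y) = ord v x - ord v y := by
  rw [div_eq_mul_inv, ord_mul, ord_inv]; ring
lemma ord_pow (v : HS K) (x : Kˣ) (n : ℕ) : ord v (x ^ n) = n * ord v x := by
  simp [ord]
lemma ord_zpow (v : HS K) (x : Kˣ) (n : ℤ) : ord v (x ^ n) = n * ord v x := by
  simp [ord]

lemma val_eq (v : HS K) (x : Kˣ) : v.valuation K (x : K) = WithZero.exp (-(ord v x)) := by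
  rw [← valuationOfNeZero_eq, ord, neg_neg]; rfl

lemma ord_eq_iff (v : HS K) (x : Kˣ) (n : ℤ) :
    ord v x = n ↔ v.valuation K (x : K) = WithZero.exp (-n) := by
  rw [val_eq, WithZero.exp_inj]; omega

lemma ord_eq_zero_iff (v : HS K) (x : Kˣ) : ord v x = 0 ↔ v.valuation K (x : K) = 1 := by
  rw [ord_eq_iff]; simp

lemma ord_nonneg_iff (v : HS K) (x : Kˣ) : 0 ≤ ord v x ↔ v.valuation K (x : K) ≤ 1 := by
  rw [val_eq, ← WithZero.exp_zero, WithZero.exp_le_exp]; omega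

lemma le_ord_iff (v : HS K) (x : Kˣ) (n : ℤ) :
    n ≤ ord v x ↔ v.valuation K (x : K) ≤ WithZero.exp (-n) := by
  rw [val_eq, WithZero.exp_le_exp]; omega

lemma ord_eq_count (v : HS K) (x : Kˣ) :
    FractionalIdeal.count K v (FractionalIdeal.spanSingleton (𝓞 K)⁰ (x : K)) = ord v x := by
  have key : ∀ (r : 𝓞 K) (u : Kˣ), algebraMap (𝓞 K) K r = u →
      FractionalIdeal.count K v (FractionalIdeal.spanSingleton (𝓞 K)⁰ (u : K)) = ord v u := by
    classical
    intro r u h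
    have hr : r ≠ 0 := by rintro rfl; exact u.ne_zero (by rw [← h]; simp)
    rw [← h, ← FractionalIdeal.coeIdeal_span_singleton, FractionalIdeal.count_coe K v (by simpa)]
    symm
    rw [ord_eq_iff, ← h, valuation_of_algebraMap, intValuation_if_neg v hr]
  obtain ⟨a, b, hb, h⟩ := IsFractionRing.div_surjective (A := 𝓞 K) (x : K)
  have hb0 : algebraMap (𝓞 K) K b ≠ 0 := by simpa using nonZeroDivisors.ne_zero hb
  have ha0 : algebraMap (𝓞 K) K a ≠ 0 := by
    intro h0; rw [h0, zero_div] at h; exact x.ne_zero h.symm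
  have hx : x * Units.mk0 _ hb0 = Units.mk0 _ ha0 := by
    ext; simp [← h]; field_simp
  have h1 := key a (Units.mk0 _ ha0) rfl
  have h2 := key b (Units.mk0 _ hb0) rfl
  rw [← hx, ord_mul, Units.val_mul, ← FractionalIdeal.spanSingleton_mul_spanSingleton,
    FractionalIdeal.count_mul K v (FractionalIdeal.spanSingleton_ne_zero_iff.2 x.ne_zero)
      (FractionalIdeal.spanSingleton_ne_zero_iff.2 (Units.ne_zero _)), h2] at h1
  omega

lemma ord_finite (x : Kˣ) : {v : HS K | ord v x ≠ 0}.Finite := by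
  have := FractionalIdeal.finite_factors (FractionalIdeal.spanSingleton (𝓞 K)⁰ (x : K))
  simp only [ord_eq_count] at this
  exact this

/-- The divisor of an element. -/
noncomputable def dv (x : Kˣ) : HS K →₀ ℤ :=
  Finsupp.ofSupportFinite (fun v => ord v x) (ord_finite x)

@[simp] lemma dv_apply (x : Kˣ) (v : HS K) : dv x v = ord v x := rfl
lemma dv_mul (x y : Kˣ) : dv (x * y) = dv x + dv y := by ext v; simp [ord_mul]
lemma dv_inv (x : Kˣ) : dv x⁻¹ = - dv x := by ext v; simp [ord_inv]
lemma dv_pow (x : Kˣ) (n : ℕ) : dv (x ^ n) = n • dv x := by ext v; simp [ord_pow]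
lemma dv_one : dv (1 : Kˣ) = 0 := by ext v; simp [ord_one]

lemma exists_unit_of_dv_eq_zero (x : Kˣ) (h : ∀ v, ord v x = 0) :
    ∃ u : (𝓞 K)ˣ, algebraMap (𝓞 K) K u = x := by
  obtain ⟨a, ha⟩ := mem_integers_of_valuation_le_one (R := 𝓞 K) K (x : K)
    (fun v => ((ord_eq_zero_iff v x).1 (h v)).le)
  obtain ⟨b, hb⟩ := mem_integers_of_valuation_le_one (R := 𝓞 K) K ((x⁻¹ : Kˣ) : K)
    (fun v => ((ord_eq_zero_iff v x⁻¹).1 (by rw [ord_inv, h, neg_zero])).le)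
  refine ⟨⟨a, b, ?_, ?_⟩, ha⟩ <;> apply FaithfulSMul.algebraMap_injective (𝓞 K) K <;>
    rw [map_mul, ha, hb] <;> simp

lemma ord_unit (v : HS K) (u : (𝓞 K)ˣ) (x : Kˣ) (h : (x : K) = algebraMap (𝓞 K) K u) :
    ord v x = 0 := by
  have : x = Units.map (algebraMap (𝓞 K) K : 𝓞 K →* K) u := by ext; simpa using h
  rw [ord, this, valuation_of_unit_eq]; rfl

/-- a finite place as an invertible fractional ideal -/
noncomputable def plI (v : HS K) : (FractionalIdeal (𝓞 K)⁰ K)ˣ :=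
  Units.mk0 (v.asIdeal : FractionalIdeal (𝓞 K)⁰ K) (by simpa using v.ne_bot)

/-- The ideal of a divisor -/
noncomputable def idl : (HS K →₀ ℤ) →+ Additive (FractionalIdeal (𝓞 K)⁰ K)ˣ :=
  Finsupp.liftAddHom fun v => zmultiplesHom _ (Additive.ofMul (plI v))

/-- The divisor class map. -/
noncomputable def cl : (HS K →₀ ℤ) →+ Additive (ClassGroup (𝓞 K)) :=
  (ClassGroup.mk K).toAdditive.comp idl

lemma idl_coe (D : HS K →₀ ℤ) : ((idl D).toMul : FractionalIdeal (𝓞 K)⁰ K) =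
    D.prod (fun v n => (v.asIdeal : FractionalIdeal (𝓞 K)⁰ K) ^ n) := by
  simp only [idl, Finsupp.liftAddHom_apply, Finsupp.sum, Finsupp.prod, toMul_sum, Units.coe_prod]
  apply Finset.prod_congr rfl
  intro v _
  simp [plI]

lemma idl_count (D : HS K →₀ ℤ) (v : HS K) :
    FractionalIdeal.count K v ((idl D).toMul : FractionalIdeal (𝓞 K)⁰ K) = D v := by
  rw [idl_coe, FractionalIdeal.count_finsuppProd]

lemma idl_ext (I J : FractionalIdeal (𝓞 K)⁰ K) (hI : I ≠ 0) (hJ : J ≠ 0)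
    (h : ∀ v, FractionalIdeal.count K v I = FractionalIdeal.count K v J) : I = J := by
  rw [← FractionalIdeal.finprod_heightOneSpectrum_factorization' K hI,
    ← FractionalIdeal.finprod_heightOneSpectrum_factorization' K hJ]
  simp_rw [h]

lemma cl_eq_zero_iff (D : HS K →₀ ℤ) : cl D = 0 ↔ ∃ x : Kˣ, dv x = D := by
  have h1 : cl D = 0 ↔ ClassGroup.mk K (idl D).toMul = 1 := Iff.rfl
  rw [h1, ClassGroup.mk_eq_one_iff]
  constructor
  · intro h
    obtain ⟨x, hx⟩ := h.principal
    have hx' : ((idl D).toMul : FractionalIdeal (𝓞 K)⁰ K)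
        = FractionalIdeal.spanSingleton (𝓞 K)⁰ x := by
      apply Subtype.coe_injective
      simpa [FractionalIdeal.coe_spanSingleton] using hx
    have hx0 : x ≠ 0 := by
      rintro rfl
      exact (idl D).toMul.ne_zero (by rw [hx']; simp)
    refine ⟨Units.mk0 x hx0, ?_⟩
    ext v
    rw [dv_apply, ← ord_eq_count, ← idl_count D v, hx']; rfl
  · rintro ⟨x, hx⟩
    have : ((idl D).toMul : FractionalIdeal (𝓞 K)⁰ K)
        = FractionalIdeal.spanSingleton (𝓞 K)⁰ (x : K) := by
      apply idl_ext _ _ (Units.ne_zero _) (FractionalIdeal.spanSingleton_ne_zero_iff.2 x.ne_zero)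
      intro v
      rw [idl_count, ord_eq_count, ← hx, dv_apply]
    rw [this]
    exact ⟨⟨(x : K), by simp [FractionalIdeal.coe_spanSingleton]⟩⟩

lemma cl_dv (x : Kˣ) : cl (dv x) = 0 := (cl_eq_zero_iff _).2 ⟨x, rfl⟩

lemma cl_surjective : Function.Surjective (cl (K := K)) := by
  intro c
  obtain ⟨I, hI⟩ := ClassGroup.mk0_surjective c.toMul
  set J : (FractionalIdeal (𝓞 K)⁰ K)ˣ := FractionalIdeal.mk0 K I with hJ
  refine ⟨Finsupp.ofSupportFinite (fun v => FractionalIdeal.count K v (J : FractionalIdeal (𝓞 K)⁰ K))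
    (FractionalIdeal.finite_factors _), ?_⟩
  have : (idl (Finsupp.ofSupportFinite (fun v => FractionalIdeal.count K v
      (J : FractionalIdeal (𝓞 K)⁰ K)) (FractionalIdeal.finite_factors _))).toMul = J := by
    ext1
    apply idl_ext _ _ (Units.ne_zero _) (Units.ne_zero _)
    intro v
    rw [idl_count]; rfl
  change Additive.ofMul (ClassGroup.mk K (idl _).toMul) = c
  rw [this, hJ, ClassGroup.mk_mk0, hI]; rfl

end
end CFT
end P2a

section P2b
open NumberField IsDedekindDomain HeightOneSpectrum
open scoped nonZeroDivisors
namespace CFT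
section
variable {K : Type*} [Field K] [NumberField K]

/-- `S`-units -/
noncomputable def SU (S : Finset (HS K)) : Subgroup Kˣ where
  carrier := {x | ∀ v ∉ S, ord v x = 0}
  one_mem' := fun v _ => ord_one v
  mul_mem' := fun {x y} hx hy v hv => by rw [ord_mul, hx v hv, hy v hv, add_zero]
  inv_mem' := fun {x} hx v hv => by rw [ord_inv, hx v hv, neg_zero]

lemma mem_SU {S : Finset (HS K)} {x : Kˣ} : x ∈ SU S ↔ ∀ v ∉ S, ord v x = 0 := Iff.rfl

/-- valuations at `S` of `S`-units -/
noncomputable def suOrd (S : Finset (HS K)) : Additive (SU S) →ₗ[ℤ] (S → ℤ) :=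
  AddMonoidHom.toIntLinearMap
  { toFun := fun x v => ord v.1 (x.toMul : Kˣ)
    map_zero' := by ext v; exact ord_one _
    map_add' := fun x y => by ext v; exact ord_mul _ _ _ }

/-- integral units are `S`-units -/
noncomputable def unitsToSU (S : Finset (HS K)) : Additive (𝓞 K)ˣ →ₗ[ℤ] Additive (SU S) :=
  AddMonoidHom.toIntLinearMap (MonoidHom.toAdditive
  ((Units.map (algebraMap (𝓞 K) K : 𝓞 K →* K)).codRestrict (SU S)
    (fun u v _ => ord_unit v u _ rfl)))

lemma unitsToSU_coe (S : Finset (HS K)) (u : Additive (𝓞 K)ˣ) :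
    (((unitsToSU S u).toMul : Kˣ) : K) = algebraMap (𝓞 K) K (u.toMul : 𝓞 K) := rfl

lemma unitsToSU_injective (S : Finset (HS K)) : Function.Injective (unitsToSU S) := by
  intro u v h
  have : (((unitsToSU S u).toMul : Kˣ) : K) = (((unitsToSU S v).toMul : Kˣ) : K) := by rw [h]
  rw [unitsToSU_coe, unitsToSU_coe] at this
  exact Additive.toMul.injective (Units.ext (FaithfulSMul.algebraMap_injective (𝓞 K) K this))

lemma range_unitsToSU (S : Finset (HS K)) :
    LinearMap.range (unitsToSU S) = LinearMap.ker (suOrd S) := by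
  ext x
  simp only [LinearMap.mem_range, LinearMap.mem_ker]
  constructor
  · rintro ⟨u, rfl⟩
    ext v
    exact ord_unit v.1 u.toMul _ rfl
  · intro h
    obtain ⟨u, hu⟩ := exists_unit_of_dv_eq_zero (x.toMul : Kˣ) (fun v => by
      by_cases hv : v ∈ S
      · exact congrFun h ⟨v, hv⟩
      · exact x.toMul.2 v hv)
    refine ⟨Additive.ofMul u, ?_⟩
    apply Additive.toMul.injective
    ext
    rw [unitsToSU_coe]; exact hu

instance finite_SU (S : Finset (HS K)) : Module.Finite ℤ (Additive (SU S)) := by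
  have h1 : (LinearMap.ker (suOrd S)).FG := by
    rw [← range_unitsToSU]
    exact Module.Finite.iff_fg.1 inferInstance
  have h2 : (LinearMap.range (suOrd S)).FG := IsNoetherian.noetherian _
  exact ⟨Submodule.fg_of_fg_map_of_fg_inf_ker (suOrd S)
    (by rwa [← LinearMap.range_eq_map]) (by simpa using h1)⟩

lemma finrank_SU (S : Finset (HS K)) :
    Module.finrank ℤ (Additive (SU S)) + 1 = Fintype.card (InfinitePlace K) + S.card := by
  classical
  have h := finrank_range_add_ker (suOrd S)
  have hk : Module.finrank ℤ (LinearMap.ker (suOrd S)) = Units.rank K := by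
    rw [← range_unitsToSU, LinearMap.finrank_range_of_inj (unitsToSU_injective S),
      Units.finrank_eq]
  have hr : Module.finrank ℤ (LinearMap.range (suOrd S)) = S.card := by
    have hh : Fintype.card (ClassGroup (𝓞 K)) ≠ 0 := Fintype.card_ne_zero
    have := finrank_eq_of_nsmul_le (LinearMap.range (suOrd S)) ⊤ le_top
      (Fintype.card (ClassGroup (𝓞 K))) hh (by
        intro f _
        set D : HS K →₀ ℤ := Finsupp.ofSupportFinite (fun v => if h : v ∈ S then f ⟨v, h⟩ else 0)
          (S.finite_toSet.subset (by
            intro v hv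
            by_contra h
            exact hv (dif_neg h))) with hD
        have hc : cl (Fintype.card (ClassGroup (𝓞 K)) • D) = 0 := by
          rw [map_nsmul]
          exact (pow_card_eq_one : (cl D).toMul ^ Fintype.card (ClassGroup (𝓞 K)) = 1)
        obtain ⟨x, hx⟩ := (cl_eq_zero_iff _).1 hc
        have hx' : ∀ v, ord v x = Fintype.card (ClassGroup (𝓞 K)) •
            (if h : v ∈ S then f ⟨v, h⟩ else 0) := fun v => DFunLike.congr_fun hx v
        refine ⟨Additive.ofMul ⟨x, fun v hv => ?_⟩, ?_⟩
        · rw [hx', dif_neg hv, smul_zero]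
        · ext v
          change ord v.1 x = _
          rw [hx', dif_pos v.2]; rfl)
    rw [this, finrank_top]; simp
  have hpos : 0 < Fintype.card (InfinitePlace K) := Fintype.card_pos
  rw [hk, hr, Units.rank] at h
  omega
end
end CFT
end P2b

section P2c
open NumberField IsDedekindDomain HeightOneSpectrum
open scoped nonZeroDivisors Pointwise
set_option linter.unusedSectionVars false
namespace CFT
section
variable {K M : Type*} [Field K] [NumberField K] [Field M] [NumberField M] [Algebra K M]

/-- Galois action on finite places -/
noncomputable def gact (σ : M ≃ₐ[K] M) (w : HS M) : HS M where
  asIdeal := σ • w.asIdeal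
  isPrime := inferInstance
  ne_bot := by
    intro h
    apply w.ne_bot
    have : σ⁻¹ • (σ • w.asIdeal) = σ⁻¹ • (⊥ : Ideal (𝓞 M)) := by rw [h]
    rwa [inv_smul_smul, Ideal.smul_bot] at this

lemma int_smul_val (σ : M ≃ₐ[K] M) (w : HS M) (r : 𝓞 M) :
    (gact σ w).intValuation (σ • r) = w.intValuation r := by
  by_cases hr : r = 0
  · simp [hr]
  have key : ∀ n : ℕ, (gact σ w).intValuation (σ • r) ≤ WithZero.exp (-(n:ℤ)) ↔
      w.intValuation r ≤ WithZero.exp (-(n:ℤ)) := by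
    intro n
    rw [intValuation_le_pow_iff_mem, intValuation_le_pow_iff_mem]
    have : (gact σ w).asIdeal ^ n = σ • (w.asIdeal ^ n) := by
      rw [smul_pow']; rfl
    rw [this, Ideal.smul_mem_pointwise_smul_iff]
  have hr' : σ • r ≠ 0 := by
    intro h; exact hr (by simpa using congrArg (fun z => σ⁻¹ • z) h)
  rw [intValuation_eq_exp_neg_multiplicity _ hr, intValuation_eq_exp_neg_multiplicity _ hr'] at key ⊢
  simp only [WithZero.exp_le_exp, neg_le_neg_iff, Nat.cast_le] at key
  rw [WithZero.exp_inj]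
  have h1 := (key _).1 le_rfl
  have h2 := (key _).2 le_rfl
  omega

lemma ord_gact (σ : M ≃ₐ[K] M) (w : HS M) (x : Mˣ) : ord (gact σ w) (σ • x) = ord w x := by
  rw [ord_eq_iff, ← val_eq]
  obtain ⟨a, b, hb, h⟩ := IsFractionRing.div_surjective (A := 𝓞 M) (x : M)
  have h2 : ((σ • x : Mˣ) : M) = algebraMap (𝓞 M) M (σ • a) / algebraMap (𝓞 M) M (σ • b) := by
    have : ((σ • x : Mˣ) : M) = σ (x : M) := rfl
    rw [this, ← h, map_div₀]; rfl
  rw [h2, ← h, map_div₀, map_div₀, valuation_of_algebraMap, valuation_of_algebraMap,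
    valuation_of_algebraMap, valuation_of_algebraMap, int_smul_val, int_smul_val]

/-- The place below. -/
noncomputable abbrev und (K : Type*) {M : Type*} [Field K] [NumberField K] [Field M] [NumberField M]
  [Algebra K M] (w : HS M) : HS K := w.under (𝓞 K)

/-- ramification index -/
noncomputable def eram (K : Type*) {M : Type*} [Field K] [NumberField K] [Field M] [NumberField M]
    [Algebra K M] (w : HS M) : ℕ := (und K w).asIdeal.ramificationIdx' w.asIdeal

instance (w : HS M) : w.asIdeal.LiesOver (und K w).asIdeal := ⟨rfl⟩

lemma ord_algebraMap (w : HS M) (x : Kˣ) :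
    ord w (Units.map (algebraMap K M : K →* M) x) = eram K w * ord (und K w) x := by
  have h := valuation_liesOver M (und K w) w (x : K)
  rw [ord_eq_iff]
  change w.valuation M (algebraMap K M x) = _
  rw [← h, val_eq, ← WithZero.exp_nsmul, eram]
  simp

lemma eram_ne_zero (w : HS M) : eram K w ≠ 0 :=
  Ideal.IsDedekindDomain.ramificationIdx'_ne_zero_of_liesOver w.asIdeal (und K w).ne_bot

instance smulCommInt : SMulCommClass (M ≃ₐ[K] M) (𝓞 K) (𝓞 M) := ⟨fun σ a x => by
  apply FaithfulSMul.algebraMap_injective (𝓞 M) M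
  rw [Algebra.smul_def, Algebra.smul_def, smul_mul']
  rw [map_mul, map_mul]
  congr 1
  exact σ.commutes (a : K)⟩

lemma und_gact (σ : M ≃ₐ[K] M) (w : HS M) : und K (gact σ w) = und K w := by
  ext1
  exact Ideal.under_smul _ _ _

lemma exists_gact [IsGalois K M] (w w' : HS M) (h : und K w = und K w') :
    ∃ σ : M ≃ₐ[K] M, gact σ w = w' := by
  have : w'.asIdeal.LiesOver (und K w).asIdeal := h ▸ inferInstance
  obtain ⟨σ, hσ⟩ := Ideal.exists_smul_eq_of_isGaloisGroup (und K w).asIdeal w.asIdeal w'.asIdeal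
    (M ≃ₐ[K] M)
  exact ⟨σ, HeightOneSpectrum.ext hσ⟩

lemma eram_gact (σ : M ≃ₐ[K] M) (w : HS M) : eram K (gact σ w) = eram K w := by
  obtain ⟨π, hπ⟩ := (und K w).valuation_exists_uniformizer K
  have h0 : π ≠ 0 := by rintro rfl; rw [map_zero] at hπ; exact WithZero.exp_ne_zero hπ.symm
  have h1 : ord (und K w) (Units.mk0 π h0) = 1 := by
    rw [ord_eq_iff]; exact hπ
  have h2 := ord_algebraMap (M := M) w (Units.mk0 π h0)
  have h3 := ord_algebraMap (M := M) (gact σ w) (Units.mk0 π h0)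
  rw [und_gact] at h3
  have h4 : σ • (Units.map (algebraMap K M : K →* M) (Units.mk0 π h0)) =
    Units.map (algebraMap K M : K →* M) (Units.mk0 π h0) := by
    ext; exact σ.commutes _
  rw [← h4, ord_gact, h2, h1] at h3
  omega

lemma exists_over (v : HS K) : ∃ w : HS M, und K w = v := by
  obtain ⟨⟨Q, hQ, hQv⟩⟩ := (inferInstance : Nonempty (Ideal.primesOver v.asIdeal (𝓞 M)))
  refine ⟨⟨Q, hQ, ?_⟩, ?_⟩
  · rintro rfl
    exact v.ne_bot (by rw [hQv.over]; simp)
  · ext1; exact hQv.over.symm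

end
end CFT
end P2c

section P2d
open NumberField IsDedekindDomain HeightOneSpectrum
open scoped nonZeroDivisors Pointwise
set_option linter.unusedSectionVars false
namespace CFT
section
variable {K M : Type*} [Field K] [NumberField K] [Field M] [NumberField M] [Algebra K M]

lemma ord_const [IsGalois K M] {σ : M ≃ₐ[K] M} (hσ : ∀ g, g ∈ Subgroup.zpowers σ) (b : Mˣ)
    (w w' : HS M) (hww : und K w = und K w')
    (hb : ∀ u : HS M, und K u = und K w → ord u (σ • b) = ord u b) : ord w b = ord w' b := by
  obtain ⟨g, rfl⟩ := exists_gact w w' hww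
  have hb' : ∀ u : HS M, und K u = und K w → ord (gact σ u) b = ord u b := by
    intro u hu
    rw [← hb _ (by rw [und_gact, hu]), ord_gact]
  have hmul : ∀ (g h : M ≃ₐ[K] M) (u : HS M), gact (g * h) u = gact g (gact h u) := by
    intro g h u; ext1; exact mul_smul _ _ _
  have hone : ∀ (u : HS M), gact (1 : M ≃ₐ[K] M) u = u := by
    intro u; ext1; exact one_smul _ _
  suffices ∀ g ∈ Subgroup.zpowers σ, ∀ u : HS M, und K u = und K w → ord (gact g u) b = ord u b from
    (this g (hσ g) w rfl).symm
  intro g hg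
  rw [Subgroup.zpowers_eq_closure] at hg
  induction hg using Subgroup.closure_induction with
  | mem x hx => rw [Set.mem_singleton_iff.1 hx]; exact hb'
  | one => intro u _; rw [hone]
  | mul x y _ _ hx hy => intro u hu; rw [hmul, hx _ (by rw [und_gact, hu]), hy _ hu]
  | inv x _ hx =>
    intro u hu
    rw [← hx (gact x⁻¹ u) (by rw [und_gact, hu]), ← hmul, mul_inv_cancel, hone]

/-- action of a Galois element on `S`-units -/
noncomputable def suAct (TM : Finset (HS M)) (T : Finset (HS K)) (hTM : ∀ w, w ∈ TM ↔ und K w ∈ T)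
    (σ : M ≃ₐ[K] M) : Module.End ℤ (Additive (SU TM)) :=
  AddMonoidHom.toIntLinearMap (MonoidHom.toAdditive
  (((MulDistribMulAction.toMonoidHom Mˣ σ).comp (SU TM).subtype).codRestrict (SU TM) (by
    intro x w hw
    change ord w (σ • (x : Mˣ)) = 0
    have : w = gact σ (gact σ⁻¹ w) := by
      ext1; exact (smul_inv_smul _ _).symm
    rw [this, ord_gact]
    apply x.2
    rwa [hTM, und_gact, ← hTM])))

lemma suAct_coe (TM : Finset (HS M)) (T : Finset (HS K)) (hTM : ∀ w, w ∈ TM ↔ und K w ∈ T)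
    (σ : M ≃ₐ[K] M) (x : Additive (SU TM)) :
    (((suAct TM T hTM σ x).toMul : SU TM) : Mˣ) = σ • (x.toMul : Mˣ) := rfl

lemma suAct_pow_coe (TM : Finset (HS M)) (T : Finset (HS K)) (hTM : ∀ w, w ∈ TM ↔ und K w ∈ T)
    (σ : M ≃ₐ[K] M) (x : Additive (SU TM)) (n : ℕ) :
    ((((suAct TM T hTM σ ^ n) x).toMul : SU TM) : Mˣ) = (σ ^ n) • (x.toMul : Mˣ) := by
  induction n with
  | zero => simp
  | succ n ih => rw [pow_succ', Module.End.mul_apply, suAct_coe, ih, pow_succ', mul_smul]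

lemma prod_pow_eq_norm [IsGalois K M] {ℓ : ℕ} (hdeg : Nat.card (M ≃ₐ[K] M) = ℓ)
    {σ : M ≃ₐ[K] M} (hσ : ∀ g, g ∈ Subgroup.zpowers σ) (x : M) :
    ∏ i ∈ Finset.range ℓ, (σ ^ i) x = algebraMap K M (Algebra.norm K x) := by
  classical
  rw [Algebra.norm_eq_prod_automorphisms]
  have ho : orderOf σ = ℓ := by rw [orderOf_eq_card_of_forall_mem_zpowers hσ, hdeg]
  refine Finset.prod_bij (fun i _ => σ ^ i) (fun _ _ => Finset.mem_univ _) ?_ ?_ (fun _ _ => rfl)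
  · intro i hi j hj h
    rw [Finset.mem_range, ← ho] at hi hj
    exact pow_injOn_Iio_orderOf hi hj h
  · intro g _
    have := mem_powers_iff_mem_zpowers.2 (hσ g)
    rw [mem_powers_iff_mem_range_orderOf, Finset.mem_image] at this
    obtain ⟨i, hi, h⟩ := this
    exact ⟨i, by rwa [← ho], h⟩

/-- the `S`-units below are the invariants -/
noncomputable def suBelow (TM : Finset (HS M)) (T : Finset (HS K))
    (hTM : ∀ w, w ∈ TM ↔ und K w ∈ T) : Additive (SU T) →ₗ[ℤ] Additive (SU TM) :=
  AddMonoidHom.toIntLinearMap (MonoidHom.toAdditive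
  (((Units.map (algebraMap K M : K →* M)).comp (SU T).subtype).codRestrict (SU TM) (by
    intro x w hw
    change ord w (Units.map (algebraMap K M : K →* M) (x : Kˣ)) = 0
    rw [ord_algebraMap, x.2 _ (by rwa [← hTM]), mul_zero])))

lemma suBelow_coe (TM : Finset (HS M)) (T : Finset (HS K)) (hTM : ∀ w, w ∈ TM ↔ und K w ∈ T)
    (x : Additive (SU T)) : ((((suBelow TM T hTM x).toMul : SU TM) : Mˣ) : M) =
      algebraMap K M ((x.toMul : Kˣ) : K) := rfl

lemma suBelow_injective (TM : Finset (HS M)) (T : Finset (HS K))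
    (hTM : ∀ w, w ∈ TM ↔ und K w ∈ T) : Function.Injective (suBelow TM T hTM) := by
  intro x y h
  have h1 := suBelow_coe TM T hTM x
  rw [h, suBelow_coe] at h1
  exact Additive.toMul.injective (Subtype.ext (Units.ext ((algebraMap K M).injective h1.symm)))

lemma suBelow_range [IsGalois K M] (TM : Finset (HS M)) (T : Finset (HS K))
    (hTM : ∀ w, w ∈ TM ↔ und K w ∈ T) {σ : M ≃ₐ[K] M} (hσ : ∀ g, g ∈ Subgroup.zpowers σ) :
    LinearMap.range (suBelow TM T hTM) = LinearMap.ker (suAct TM T hTM σ - 1) := by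
  ext x
  rw [LinearMap.mem_range, LinearMap.mem_ker, LinearMap.sub_apply, sub_eq_zero]
  constructor
  · rintro ⟨y, rfl⟩
    apply Additive.toMul.injective
    ext
    exact σ.commutes _
  · intro h
    have hx : σ (((x.toMul : SU TM) : Mˣ) : M) = (((x.toMul : SU TM) : Mˣ) : M) := by
      have := congrArg (fun z : Additive (SU TM) => (((z.toMul : SU TM) : Mˣ) : M)) h
      exact this
    have hfix : ∀ g : M ≃ₐ[K] M, g (((x.toMul : SU TM) : Mˣ) : M) = (((x.toMul : SU TM) : Mˣ) : M) := by
      intro g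
      have hle : Subgroup.zpowers σ ≤ MulAction.stabilizer (M ≃ₐ[K] M) (((x.toMul : SU TM) : Mˣ) : M) := by
        rw [Subgroup.zpowers_le]; exact hx
      exact hle (hσ g)
    obtain ⟨y, hy⟩ := (IsGalois.mem_range_algebraMap_iff_fixed (F := K) _).2 hfix
    have hy0 : y ≠ 0 := by rintro rfl; rw [map_zero] at hy; exact Units.ne_zero _ hy.symm
    refine ⟨Additive.ofMul ⟨Units.mk0 y hy0, ?_⟩, ?_⟩
    · intro v hv
      obtain ⟨w, hw⟩ := exists_over (M := M) v
      have h1 := ord_algebraMap (M := M) w (Units.mk0 y hy0)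
      have h2 : Units.map (algebraMap K M : K →* M) (Units.mk0 y hy0) = (x.toMul : Mˣ) := by
        ext; exact hy
      rw [h2, x.toMul.2 w (by rw [hTM, hw]; exact hv), hw] at h1
      have := eram_ne_zero (K := K) w
      have h3 : (eram K w : ℤ) ≠ 0 := by exact_mod_cast this
      exact (mul_eq_zero.1 h1.symm).resolve_left h3
    · apply Additive.toMul.injective
      ext
      exact hy
end
end CFT
end P2d

section P2e
open NumberField IsDedekindDomain HeightOneSpectrum
open scoped nonZeroDivisors Pointwise
set_option linter.unusedSectionVars false
namespace CFT
section
variable {K M : Type} [Field K] [NumberField K] [Field M] [NumberField M] [Algebra K M]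

/-- elements `b` with `σ b / b` an `S`-unit. -/
noncomputable def Bs (TM : Finset (HS M)) (σ : M ≃ₐ[K] M) : Subgroup Mˣ :=
  (SU TM).comap ((MulDistribMulAction.toMonoidHom Mˣ σ) / MonoidHom.id _)

lemma mem_Bs {TM : Finset (HS M)} {σ : M ≃ₐ[K] M} {b : Mˣ} : b ∈ Bs TM σ ↔ σ • b / b ∈ SU TM :=
  Iff.rfl

/-- `b ↦ σ b / b`. -/
noncomputable def bsD (TM : Finset (HS M)) (σ : M ≃ₐ[K] M) : Additive (Bs TM σ) →+ Additive (SU TM) :=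
  MonoidHom.toAdditive
    ((((MulDistribMulAction.toMonoidHom Mˣ σ) / MonoidHom.id _).comp (Bs TM σ).subtype).codRestrict
      (SU TM) (fun b => b.2))

lemma bsD_coe (TM : Finset (HS M)) (σ : M ≃ₐ[K] M) (b : Additive (Bs TM σ)) :
    (((bsD TM σ b).toMul : SU TM) : Mˣ) = σ • (b.toMul : Mˣ) / (b.toMul : Mˣ) := rfl

/-- valuations mod `ℓ` -/
noncomputable def bsPsi (ℓ : ℕ) {ι : Type*} (w : ι → HS M) (TM : Finset (HS M)) (σ : M ≃ₐ[K] M) :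
    Additive (Bs TM σ) →+ (ι → ZMod ℓ) where
  toFun b i := (ord (w i) (b.toMul : Mˣ) : ZMod ℓ)
  map_zero' := by ext i; simp [ord_one]
  map_add' x y := by ext i; simp [ord_mul]

lemma FI_upper [IsGalois K M] {ℓ : ℕ} (hℓ : ℓ.Prime) (hdeg : Nat.card (M ≃ₐ[K] M) = ℓ)
    {σ : M ≃ₐ[K] M} (hσ : ∀ g, g ∈ Subgroup.zpowers σ)
    (T : Finset (HS K)) (TM : Finset (HS M)) (hTM : ∀ w, w ∈ TM ↔ und K w ∈ T)
    (Ram : Finset (HS K)) (he1 : ∀ w : HS M, und K w ∉ Ram → eram K w = 1)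
    (heℓ : ∀ w : HS M, und K w ∈ Ram → eram K w = ℓ)
    (h' : ℕ) (hh' : Nat.Coprime h' ℓ)
    (H1 : ∀ D : HS K →₀ ℤ, ∃ γ : Kˣ, ∀ u ∉ T, ord u γ = h' * D u)
    (N : Module.End ℤ (Additive (SU TM)))
    (hN : N = ∑ i ∈ Finset.range ℓ, (suAct TM T hTM σ) ^ i) :
    (suAct TM T hTM σ - 1).toAddMonoidHom.range.relIndex N.toAddMonoidHom.ker ≤ ℓ ^ Ram.card := by
  classical
  have : NeZero ℓ := ⟨hℓ.ne_zero⟩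
  choose wR hwR using fun v : Ram => exists_over (M := M) v.1
  have hNcoe : ∀ x : Additive (SU TM), ((((N x).toMul : SU TM) : Mˣ) : M) =
      algebraMap K M (Algebra.norm K ((x.toMul : Mˣ) : M)) := by
    intro x
    rw [← prod_pow_eq_norm hdeg hσ, hN, LinearMap.sum_apply, toMul_sum, Subgroup.val_finsetProd,
      Units.coe_prod]
    refine Finset.prod_congr rfl fun i _ => ?_
    rw [suAct_pow_coe]; rfl
  have hker : ∀ b, bsD TM σ b ∈ N.toAddMonoidHom.ker := by
    intro b
    rw [AddMonoidHom.mem_ker]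
    apply Additive.toMul.injective
    ext
    refine (hNcoe _).trans ?_
    rw [bsD_coe]
    have : ((σ • (b.toMul : Mˣ) / (b.toMul : Mˣ) : Mˣ) : M) = σ ((b.toMul : Mˣ) : M) / ((b.toMul : Mˣ) : M) := by
      rw [Units.val_div_eq_div_val]; rfl
    rw [this, div_eq_mul_inv, map_mul, Algebra.norm_inv, Algebra.norm_eq_of_algEquiv,
      mul_inv_cancel₀, map_one]
    · rfl
    · rw [Algebra.norm_ne_zero_iff]; exact Units.ne_zero _
  set D : Additive (Bs TM σ) →+ N.toAddMonoidHom.ker := (bsD TM σ).codRestrict _ hker with hD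
  have hDsurj : Function.Surjective D := by
    rintro ⟨c, hc⟩
    have : Fact ℓ.Prime := ⟨hℓ⟩
    have : IsCyclic (M ≃ₐ[K] M) := ⟨σ, hσ⟩
    have hc1 : Algebra.norm K ((c.toMul : Mˣ) : M) = 1 := by
      apply (algebraMap K M).injective
      rw [← hNcoe, show N c = 0 from hc]
      simp
    have hc2 : Algebra.norm K (((c.toMul : Mˣ) : M)⁻¹) = 1 := by
      rw [Algebra.norm_inv, hc1, inv_one]
    obtain ⟨y, hy⟩ := groupCohomology.exists_div_of_norm_eq_one hσ hc2
    have hyy : σ • y / y = ((c.toMul : SU TM) : Mˣ) := by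
      ext
      rw [Units.val_div_eq_div_val]
      rw [← inv_inj, ← hy, inv_div]; rfl
    refine ⟨Additive.ofMul ⟨y, by rw [mem_Bs, hyy]; exact c.toMul.2⟩, ?_⟩
    ext1
    apply Additive.toMul.injective
    ext1
    exact hyy
  set Q := (suAct TM T hTM σ - 1).toAddMonoidHom.range.addSubgroupOf N.toAddMonoidHom.ker with hQ
  have hQi : (suAct TM T hTM σ - 1).toAddMonoidHom.range.relIndex N.toAddMonoidHom.ker = Q.index := rfl
  rw [hQi, ← AddSubgroup.index_comap_of_surjective Q hDsurj]
  set Ψ := bsPsi ℓ wR TM σ with hΨ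
  have hle : Ψ.ker ≤ Q.comap D := by
    intro b hb
    rw [AddMonoidHom.mem_ker] at hb
    set b' : Mˣ := b.toMul.1 with hb'
    have hmem : σ • b' / b' ∈ SU TM := b.toMul.2
    -- invariance of the valuation
    have hinv : ∀ u : HS M, und K u ∉ T → ord u (σ • b') = ord u b' := by
      intro u hu
      have := hmem u (by rwa [hTM])
      rw [ord_div] at this; omega
    have hconst : ∀ w w' : HS M, und K w = und K w' → und K w ∉ T → ord w b' = ord w' b' := by
      intro w w' hww hw
      exact ord_const hσ b' w w' hww (fun u hu => hinv u (by rwa [hu]))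
    choose wv hwv using fun v : HS K => exists_over (M := M) v
    have hdvd : ∀ w : HS M, und K w ∉ T → (eram K w : ℤ) ∣ ord w b' := by
      intro w hw
      by_cases hr : und K w ∈ Ram
      · rw [heℓ w hr]
        have h1 := congrFun hb ⟨und K w, hr⟩
        have h2 : ((ord (wR ⟨und K w, hr⟩) b' : ℤ) : ZMod ℓ) = 0 := h1
        rw [ZMod.intCast_zmod_eq_zero_iff_dvd] at h2
        rwa [hconst w (wR ⟨und K w, hr⟩) (hwR ⟨und K w, hr⟩).symm hw]
      · rw [he1 w hr]; simp
    set Dv : HS K →₀ ℤ := Finsupp.ofSupportFinite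
      (fun v => ord (wv v) b' / eram K (wv v)) (by
        have hf := (ord_finite b').image (und K)
        refine hf.subset ?_
        intro v hv
        refine ⟨wv v, ?_, hwv v⟩
        intro h0
        apply hv
        simp [h0]) with hDv
    obtain ⟨γ, hγ⟩ := H1 Dv
    set γM : Mˣ := Units.map (algebraMap K M : K →* M) γ with hγM
    have hγσ : σ • γM = γM := by ext; exact σ.commutes _
    have hA : b' ^ h' / γM ∈ SU TM := by
      intro w hw
      rw [hTM] at hw
      have hDvw : Dv (und K w) = ord (wv (und K w)) b' / eram K (wv (und K w)) := rfl
      obtain ⟨g, hg⟩ := exists_gact w (wv (und K w)) (hwv _).symm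
      have he : eram K (wv (und K w)) = eram K w := by rw [← hg, eram_gact]
      rw [ord_div, ord_pow, hγM, ord_algebraMap, hγ _ hw, hDvw, he,
        ← hconst w (wv (und K w)) (hwv _).symm hw]
      have := Int.mul_ediv_cancel' (hdvd w hw)
      linear_combination (-(h':ℤ)) * this
    -- c^h' and c^ℓ are in the image
    set R := (suAct TM T hTM σ - 1).toAddMonoidHom.range with hR
    set c : Additive (SU TM) := bsD TM σ b with hc
    have hcker : N c = 0 := hker b
    have h1 : h' • c ∈ R := by
      refine ⟨Additive.ofMul ⟨_, hA⟩, ?_⟩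
      apply Additive.toMul.injective
      ext1
      change σ • (b' ^ h' / γM) / (b' ^ h' / γM) = (σ • b' / b') ^ h'
      rw [smul_div', hγσ, smul_pow', div_pow]
      simp
    have h2 : ℓ • c ∈ R := by
      have hgeom : ∀ i : ℕ, ((suAct TM T hTM σ) ^ i - 1) c ∈ R := by
        intro i
        have : (suAct TM T hTM σ) ^ i - 1 =
          (suAct TM T hTM σ - 1) * ∑ j ∈ Finset.range i, (suAct TM T hTM σ) ^ j :=
          (mul_geom_sum _ _).symm
        rw [this]
        exact ⟨_, rfl⟩
      have hs : ∑ i ∈ Finset.range ℓ, ((suAct TM T hTM σ) ^ i - 1) c ∈ R :=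
        R.sum_mem fun i _ => hgeom i
      have hs2 : ∑ i ∈ Finset.range ℓ, ((suAct TM T hTM σ) ^ i - 1) c = N c - ℓ • c := by
        rw [hN]
        simp [LinearMap.sum_apply, Finset.sum_sub_distrib]
      rw [hs2, hcker, zero_sub] at hs
      simpa using R.neg_mem hs
    have h3 : c ∈ R := by
      obtain ⟨x, y, hxy⟩ := (Nat.isCoprime_iff_coprime.2 hh')
      have : c = x • (h' • c) + y • (ℓ • c) := by
        rw [← natCast_zsmul, ← natCast_zsmul, ← mul_zsmul', ← mul_zsmul', ← add_zsmul]
        rw [show ((h':ℤ) * x + (ℓ : ℤ) * y) = 1 by linear_combination hxy, one_zsmul]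
      rw [this]
      exact R.add_mem (R.zsmul_mem h1 _) (R.zsmul_mem h2 _)
    exact h3
  have hΨi : Ψ.ker.index ≤ ℓ ^ Ram.card ∧ Ψ.ker.index ≠ 0 := by
    rw [AddSubgroup.index_ker]
    refine ⟨?_, Nat.card_pos.ne'⟩
    refine (Nat.card_le_card_of_injective _ (Subtype.val_injective)).trans ?_
    simp
  exact (Nat.le_of_dvd (Nat.pos_of_ne_zero hΨi.2) (AddSubgroup.index_dvd_of_le hle)).trans hΨi.1

end
end CFT
end P2e

section P2f
open NumberField IsDedekindDomain HeightOneSpectrum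
open scoped nonZeroDivisors Pointwise
set_option linter.unusedSectionVars false
namespace CFT
section
variable {K M : Type} [Field K] [NumberField K] [Field M] [NumberField M] [Algebra K M]

/-- The first inequality. -/
theorem FI [IsGalois K M] {ℓ : ℕ} (hℓ : ℓ.Prime) (hdeg : Nat.card (M ≃ₐ[K] M) = ℓ)
    (hinf : Fintype.card (InfinitePlace M) = ℓ * Fintype.card (InfinitePlace K))
    (T : Finset (HS K)) (TM : Finset (HS M)) (hTM : ∀ w, w ∈ TM ↔ und K w ∈ T)
    (hcard : TM.card = ℓ * T.card)
    (Ram : Finset (HS K)) (he1 : ∀ w : HS M, und K w ∉ Ram → eram K w = 1)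
    (heℓ : ∀ w : HS M, und K w ∈ Ram → eram K w = ℓ)
    (h' : ℕ) (hh' : Nat.Coprime h' ℓ)
    (H1 : ∀ D : HS K →₀ ℤ, ∃ γ : Kˣ, ∀ u ∉ T, ord u γ = h' * D u)
    (θ : SU T →* (Ram → Multiplicative (ZMod ℓ))) (hθ : Function.Surjective θ)
    (hθN : ∀ (x : SU TM) (y : SU T), Algebra.norm K ((x : Mˣ) : M) = ((y : Kˣ) : K) → θ y = 1) :
    False := by
  classical
  have : Fact ℓ.Prime := ⟨hℓ⟩
  have : NeZero ℓ := ⟨hℓ.ne_zero⟩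
  have hcyc : IsCyclic (M ≃ₐ[K] M) := isCyclic_of_prime_card hdeg
  obtain ⟨σ, hσ⟩ := hcyc.exists_generator
  set s := suAct TM T hTM σ with hs
  set N : Module.End ℤ (Additive (SU TM)) := ∑ i ∈ Finset.range ℓ, s ^ i with hN
  have hsl : s ^ ℓ = 1 := by
    refine LinearMap.ext fun x => ?_
    apply Additive.toMul.injective
    apply Subtype.ext
    rw [suAct_pow_coe, ← hdeg, pow_card_eq_one', one_smul]; rfl
  have hU := finrank_SU T
  have hA := finrank_SU TM
  have hU' : Module.finrank ℤ (LinearMap.ker (s - 1)) = Module.finrank ℤ (Additive (SU T)) := by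
    rw [← suBelow_range TM T hTM hσ, LinearMap.finrank_range_of_inj (suBelow_injective TM T hTM)]
  have hrk : Module.finrank ℤ (Additive (SU TM)) = Module.finrank ℤ (Additive (SU T)) +
      (ℓ - 1) * (Module.finrank ℤ (Additive (SU T)) + 1) := by
    rw [hinf, hcard, ← mul_add, ← hU] at hA
    obtain ⟨m, rfl⟩ : ∃ m, ℓ = m + 1 := ⟨ℓ - 1, (Nat.succ_pred_prime hℓ).symm⟩
    simp only [Nat.add_sub_cancel]
    nlinarith
  obtain ⟨hne, hle⟩ := herbrand ℓ hℓ s hsl N hN _ hU' hrk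
  have hup := FI_upper hℓ hdeg hσ T TM hTM Ram he1 heℓ h' hh' H1 N hN
  have hNcoe : ∀ x : Additive (SU TM), ((((N x).toMul : SU TM) : Mˣ) : M) =
      algebraMap K M (Algebra.norm K ((x.toMul : Mˣ) : M)) := by
    intro x
    rw [← prod_pow_eq_norm hdeg hσ, hN, LinearMap.sum_apply, toMul_sum, Subgroup.val_finsetProd,
      Units.coe_prod]
    refine Finset.prod_congr rfl fun i _ => ?_
    rw [suAct_pow_coe]; rfl
  -- lower bound
  have hlow : ℓ ^ Ram.card ≤ N.toAddMonoidHom.range.relIndex (s - 1).toAddMonoidHom.ker := by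
    let ι : Additive (SU T) ≃ₗ[ℤ] LinearMap.ker (s - 1) :=
      (LinearEquiv.ofInjective _ (suBelow_injective TM T hTM)).trans
        (LinearEquiv.ofEq _ _ (suBelow_range TM T hTM hσ))
    have hι : ∀ y, ((ι y : Additive (SU TM))) = suBelow TM T hTM y := fun y => rfl
    let ψ : (s - 1).toAddMonoidHom.ker →+ Additive (Ram → Multiplicative (ZMod ℓ)) :=
      (MonoidHom.toAdditive θ).comp (ι.symm.toLinearMap.toAddMonoidHom)
    have hψs : Function.Surjective ψ := by
      intro z
      obtain ⟨y, hy⟩ := hθ z.toMul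
      refine ⟨ι (Additive.ofMul y), ?_⟩
      change Additive.ofMul (θ (ι.symm (ι (Additive.ofMul y))).toMul) = z
      rw [ι.symm_apply_apply]
      exact congrArg Additive.ofMul hy
    have hψk : (N.toAddMonoidHom.range.addSubgroupOf (s - 1).toAddMonoidHom.ker) ≤ ψ.ker := by
      rintro ⟨z, hz⟩ ⟨x, hx⟩
      rw [AddMonoidHom.mem_ker]
      change Additive.ofMul (θ (ι.symm ⟨z, hz⟩).toMul) = 0
      have := hθN x.toMul (ι.symm ⟨z, hz⟩).toMul (by
        apply (algebraMap K M).injective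
        rw [← hNcoe, ← suBelow_coe TM T hTM, ← hι, ι.apply_symm_apply]
        exact congrArg (fun a : Additive (SU TM) => (((a.toMul : SU TM) : Mˣ) : M)) hx)
      rw [this]; rfl
    have hidx : ψ.ker.index = ℓ ^ Ram.card := by
      rw [AddSubgroup.index_ker, AddMonoidHom.range_eq_top.2 hψs]
      have : Nat.card (Additive (Ram → Multiplicative (ZMod ℓ))) = ℓ ^ Ram.card := by
        rw [Nat.card_congr (Additive.toMul (α := Ram → Multiplicative (ZMod ℓ))), Nat.card_pi]
        simp
      rw [← this]
      exact Nat.card_congr (AddSubgroup.topEquiv).toEquiv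
    rw [← hidx]
    exact Nat.le_of_dvd (Nat.pos_of_ne_zero hne) (AddSubgroup.index_dvd_of_le hψk)
  have h2 := hℓ.two_le
  have hp : 0 < ℓ ^ Ram.card := pow_pos hℓ.pos _
  have h3 : ℓ * ℓ ^ Ram.card ≤ ℓ ^ Ram.card :=
    (Nat.mul_le_mul_left ℓ hlow).trans (hle.trans hup)
  nlinarith
end
end CFT
end P2f

section P3a
open NumberField IsDedekindDomain HeightOneSpectrum
open scoped nonZeroDivisors Pointwise
set_option linter.unusedSectionVars false
namespace CFT
section
variable {K : Type*} [Field K] [NumberField K]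

/-- `x` has valuation at least `n` at `v`. -/
def Ge (v : HS K) (n : ℤ) (x : K) : Prop := v.valuation K x ≤ WithZero.exp (-n)

variable {v : HS K} {m n : ℤ} {x y : K}

lemma Ge.add (hx : Ge v n x) (hy : Ge v n y) : Ge v n (x + y) :=
  ((v.valuation K).map_add x y).trans (max_le hx hy)
lemma Ge.neg (hx : Ge v n x) : Ge v n (-x) := by
  unfold Ge; rw [Valuation.map_neg]; exact hx
lemma Ge.sub (hx : Ge v n x) (hy : Ge v n y) : Ge v n (x - y) := by
  rw [sub_eq_add_neg]; exact hx.add hy.neg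
lemma Ge.mul (hx : Ge v m x) (hy : Ge v n y) : Ge v (m + n) (x * y) := by
  unfold Ge; rw [map_mul, neg_add, WithZero.exp_add]; exact mul_le_mul' hx hy
lemma Ge.mono (hx : Ge v m x) (h : n ≤ m) : Ge v n x :=
  le_trans hx (by rw [WithZero.exp_le_exp]; omega)
lemma Ge.zero : Ge v n 0 := by unfold Ge; rw [map_zero]; exact zero_le
lemma Ge.pow (hx : Ge v m x) (k : ℕ) : Ge v (k * m) (x ^ k) := by
  induction k with
  | zero => simp [Ge]
  | succ k ih => rw [pow_succ]; convert ih.mul hx using 1; push_cast; ring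
lemma Ge.one : Ge v 0 1 := by simp [Ge]
lemma Ge.int (r : 𝓞 K) : Ge v 0 (r : K) := by
  unfold Ge; simpa using v.valuation_le_one (K := K) r
lemma Ge.natCast (n : ℕ) : Ge v 0 (n : K) := by
  have := Ge.int (v := v) (n : 𝓞 K)
  simpa using this
lemma ge_unit (u : Kˣ) : Ge v n (u : K) ↔ n ≤ ord v u := (le_ord_iff v u n).symm
lemma Ge.self (u : Kˣ) : Ge v (ord v u) (u : K) := (ge_unit u).2 le_rfl
lemma ge_int_iff (r : 𝓞 K) (k : ℕ) : Ge v k (r : K) ↔ r ∈ v.asIdeal ^ k := by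
  unfold Ge
  rw [← intValuation_le_pow_iff_mem]
  change v.valuation K (algebraMap (𝓞 K) K r) ≤ _ ↔ _
  rw [valuation_of_algebraMap]
lemma ge_int_one_iff (r : 𝓞 K) : Ge v 1 (r : K) ↔ r ∈ v.asIdeal := by
  have := ge_int_iff (v := v) r 1
  simpa using this
lemma ge_mul_unit (u : Kˣ) (h : ord v u = m) : Ge v (n + m) (x * u) ↔ Ge v n x := by
  constructor
  · intro hx
    have h1 : Ge v (-m) ((u⁻¹ : Kˣ) : K) := by rw [ge_unit, ord_inv, h]
    have := hx.mul h1
    simpa using this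
  · intro hx
    exact hx.mul (by rw [ge_unit, h])
lemma ge_div_unit (u : Kˣ) (h : ord v u = m) : Ge v (n - m) (x / u) ↔ Ge v n x := by
  have := ge_mul_unit (x := x) (v := v) (n := n) (m := -m) u⁻¹ (by rw [ord_inv, h])
  rw [← this, Units.val_inv_eq_inv_val, div_eq_mul_inv, sub_eq_add_neg]

lemma ord_eq_of_ge (u : Kˣ) (h1 : Ge v n (u : K)) (h2 : ¬ Ge v (n+1) (u : K)) : ord v u = n := by
  rw [ge_unit] at h1 h2; omega

/-- principal units: `x ≡ 1` mod `v^n`, `n ≥ 1` -/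
lemma ord_zero_of_ge_sub_one (u : Kˣ) (h : Ge v 1 ((u : K) - 1)) : ord v u = 0 := by
  have h1 : Ge v 0 (u : K) := by
    have := (h.mono (show (0:ℤ) ≤ 1 by norm_num)).add Ge.one
    simpa using this
  apply ord_eq_of_ge u h1
  intro h2
  have := h2.sub h
  simp only [sub_sub_cancel, zero_add] at this
  have h3 := (ge_unit (v := v) (n := 1) (1 : Kˣ)).1 (by simpa using this)
  rw [ord_one] at h3; omega

/-- Units congruent to one modulo `v^n` (with `n ≥ 0`). -/
noncomputable def PU (v : HS K) (n : ℕ) : Subgroup Kˣ where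
  carrier := {u | ord v u = 0 ∧ Ge v n ((u : K) - 1)}
  one_mem' := ⟨ord_one v, by simpa using Ge.zero⟩
  mul_mem' := fun {x y} hx hy => ⟨by rw [ord_mul, hx.1, hy.1, add_zero], by
    have h1 : Ge v n (((x:K) - 1) * y) := by
      simpa using hx.2.mul (Ge.self y |>.mono hy.1.ge)
    have := h1.add hy.2
    convert this using 1; push_cast; ring⟩
  inv_mem' := fun {x} hx => ⟨by rw [ord_inv, hx.1, neg_zero], by
    have h1 : Ge v n (((x:K) - 1) * ((x⁻¹ : Kˣ) : K)) := by
      simpa using hx.2.mul ((Ge.self x⁻¹).mono (show (0:ℤ) ≤ ord v x⁻¹ by rw [ord_inv, hx.1]; simp))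
    have := h1.neg
    convert this using 1
    rw [sub_mul, one_mul, Units.mul_inv]; ring⟩

lemma mem_PU {n : ℕ} {u : Kˣ} : u ∈ PU v n ↔ ord v u = 0 ∧ Ge v n ((u : K) - 1) := Iff.rfl
lemma PU_mono {m n : ℕ} (h : m ≤ n) : PU v n ≤ PU v m := fun _ hu =>
  ⟨hu.1, hu.2.mono (by exact_mod_cast h)⟩
lemma mem_PU_zero {u : Kˣ} : u ∈ PU v 0 ↔ ord v u = 0 := by
  refine ⟨fun h => h.1, fun h => ⟨h, ?_⟩⟩
  exact_mod_cast ((Ge.self u).mono h.ge).sub Ge.one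

lemma mem_PU_div {n : ℕ} {x y : Kˣ} (hx : ord v x = 0) (hy : ord v y = 0) :
    x / y ∈ PU v n ↔ Ge v n ((x : K) - y) := by
  rw [mem_PU, ord_div, hx, hy, sub_self]
  have : ((x / y : Kˣ) : K) - 1 = ((x : K) - y) / y := by
    rw [Units.val_div_eq_div_val, sub_div, div_self y.ne_zero]
  rw [this]
  have h2 := ge_div_unit (v := v) (n := n) (x := (x:K) - y) y hy
  rw [sub_zero] at h2
  rw [h2]; simp

/-- integral approximation -/
lemma exists_int_approx (n : ℕ) (hx : Ge v 0 x) : ∃ r : 𝓞 K, Ge v n (x - r) := by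
  obtain ⟨r, hr⟩ := v.exists_valuation_sub_lt_of_integer (K := K) (x := x) (by simpa [Ge] using hx)
    (Units.mk0 (WithZero.exp (-(n:ℤ))) WithZero.exp_ne_zero)
  refine ⟨r, ?_⟩
  rw [Valuation.map_sub_swap] at hr
  exact hr.le

end
end CFT
end P3a

section P3b
open NumberField IsDedekindDomain HeightOneSpectrum
open scoped nonZeroDivisors Pointwise
set_option linter.unusedSectionVars false
namespace CFT
section
variable {K : Type*} [Field K] [NumberField K]
variable {v : HS K} {m n : ℤ} {x y : K}

lemma Ge.sum {ι : Type*} (s : Finset ι) (f : ι → K) (h : ∀ i ∈ s, Ge v n (f i)) :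
    Ge v n (∑ i ∈ s, f i) := by
  classical
  induction s using Finset.induction_on with
  | empty => simpa using Ge.zero
  | insert a s ha ih =>
    rw [Finset.sum_insert ha]
    exact (h a (Finset.mem_insert_self _ _)).add (ih fun i hi => h i (Finset.mem_insert_of_mem hi))

lemma Ge.prod {ι : Type*} (s : Finset ι) (f : ι → K) (h : ∀ i ∈ s, Ge v n (f i)) :
    Ge v (s.card * n) (∏ i ∈ s, f i) := by
  classical
  induction s using Finset.induction_on with
  | empty => simpa using Ge.one
  | insert a s ha ih =>
    rw [Finset.prod_insert ha, Finset.card_insert_of_notMem ha]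
    have := (h a (Finset.mem_insert_self _ _)).mul
      (ih fun i hi => h i (Finset.mem_insert_of_mem hi))
    convert this using 1; push_cast; ring

lemma ge_root_of_unity {ζ : K} {ℓ : ℕ} (hℓ : 0 < ℓ) (h : ζ ^ ℓ = 1) : Ge v 0 ζ := by
  have : IsIntegral ℤ ζ := IsIntegral.of_pow hℓ (by rw [h]; exact isIntegral_one)
  exact Ge.int (v := v) ⟨ζ, this⟩

/-- the valuation of `ℓ` versus that of `1-ζ` -/
lemma ge_prime {ζ : K} {ℓ : ℕ} (hℓ : ℓ.Prime) (hζ : IsPrimitiveRoot ζ ℓ) (h : Ge v m (1 - ζ)) :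
    Ge v ((ℓ - 1) * m) (ℓ : K) := by
  obtain ⟨k, rfl⟩ : ∃ k, ℓ = k + 1 := ⟨ℓ - 1, by have := hℓ.pos; omega⟩
  have h1 := hζ.prod_one_sub_pow_eq_order
  have h2 := Ge.prod (v := v) (n := m) (Finset.range k) (fun i => 1 - ζ ^ (i+1)) (by
    intro i _
    have h3 : 1 - ζ ^ (i+1) = (1 - ζ) * (∑ j ∈ Finset.range (i+1), ζ ^ j) := by
      rw [mul_neg_geom_sum]
    change Ge v m (1 - ζ ^ (i+1))
    rw [h3]
    have := h.mul (Ge.sum (v := v) (n := 0) (Finset.range (i+1)) (fun j => ζ^j) (fun j _ => by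
      have := (ge_root_of_unity (v := v) hℓ.pos hζ.pow_eq_one).pow j
      simpa using this))
    simpa using this)
  rw [h1] at h2
  push_cast
  simpa using h2

/-- `(1+x)^ℓ` -/
lemma PU_pow {ζ : K} {ℓ : ℕ} (hℓ : ℓ.Prime) (hζ : IsPrimitiveRoot ζ ℓ) {k : ℕ}
    (h : Ge v k (1 - ζ)) {u : Kˣ} (hu : u ∈ PU v k) : u ^ ℓ ∈ PU v (ℓ * k) := by
  refine ⟨by rw [ord_pow, hu.1]; simp, ?_⟩
  have hl := ge_prime hℓ hζ h
  set x : K := (u : K) - 1 with hx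
  have h1 : ((u ^ ℓ : Kˣ) : K) - 1 = ∑ j ∈ Finset.range ℓ, x ^ (j+1) * (ℓ.choose (j+1)) := by
    have : (u : K) = x + 1 := by rw [hx]; ring
    rw [Units.val_pow_eq_pow_val, this, add_pow, Finset.sum_range_succ']
    simp
  rw [h1]
  apply Ge.sum
  intro j hj
  have hj' := Finset.mem_range.1 hj
  have h2 := hu.2.pow (j+1)
  rw [← hx] at h2
  rcases Nat.lt_or_ge (j+1) ℓ with h3 | h3
  · obtain ⟨c, hc⟩ := hℓ.dvd_choose_self (Nat.succ_ne_zero j) h3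
    have h4 := h2.mul (hl.mul (Ge.natCast (v := v) c))
    rw [hc]
    push_cast at h4 ⊢
    apply h4.mono
    have : (0:ℤ) ≤ j * k := by positivity
    linarith
  · have : j + 1 = ℓ := by omega
    rw [this] at h2 ⊢
    have h4 := h2.mul (Ge.natCast (v := v) (ℓ.choose ℓ))
    push_cast
    simpa using h4

/-- reduction map on `v`-units -/
noncomputable def apx (v : HS K) (k : ℕ) (u : PU v 0) : 𝓞 K :=
  (exists_int_approx (v := v) (x := ((u : Kˣ) : K)) k ((Ge.self (u : Kˣ)).mono u.2.1.ge)).choose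
lemma apx_spec (k : ℕ) (u : PU v 0) : Ge v k (((u : Kˣ) : K) - apx v k u) :=
  (exists_int_approx (v := v) (x := ((u : Kˣ) : K)) k ((Ge.self (u : Kˣ)).mono u.2.1.ge)).choose_spec

lemma mk_eq_iff (k : ℕ) (r s : 𝓞 K) : Ideal.Quotient.mk (v.asIdeal ^ k) r =
    Ideal.Quotient.mk (v.asIdeal ^ k) s ↔ Ge v k ((r : K) - s) := by
  rw [Ideal.Quotient.eq, ← ge_int_iff]; simp

lemma apx_mk (k : ℕ) (u : PU v 0) (r : 𝓞 K) (h : Ge v k (((u : Kˣ) : K) - r)) :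
    Ideal.Quotient.mk (v.asIdeal ^ k) (apx v k u) = Ideal.Quotient.mk (v.asIdeal ^ k) r := by
  rw [mk_eq_iff]
  have := h.sub (apx_spec k u)
  convert this using 1; ring

noncomputable def resv (v : HS K) (k : ℕ) : PU v 0 →* (𝓞 K ⧸ v.asIdeal ^ k) where
  toFun u := Ideal.Quotient.mk _ (apx v k u)
  map_one' := by
    rw [apx_mk k 1 1 (by simpa using Ge.zero), map_one]
  map_mul' x y := by
    rw [← map_mul]
    apply apx_mk
    have h1 := (apx_spec k x).mul ((Ge.self (y : Kˣ)).mono y.2.1.ge)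
    have h2 := (Ge.int (v := v) (apx v k x)).mul (apx_spec k y)
    have h3 := (h1.mono (by simp)).add (h2.mono (n := k) (by simp))
    convert h3 using 1
    push_cast; ring

lemma resv_eq (k : ℕ) (u : PU v 0) (r : 𝓞 K) (h : Ge v k (((u : Kˣ) : K) - r)) :
    resv v k u = Ideal.Quotient.mk _ r := apx_mk k u r h

lemma resv_eq_one_iff (k : ℕ) (u : PU v 0) : resv v k u = 1 ↔ (u : Kˣ) ∈ PU v k := by
  have h0 := apx_spec k u
  rw [← map_one (Ideal.Quotient.mk (v.asIdeal ^ k))]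
  change Ideal.Quotient.mk (v.asIdeal ^ k) (apx v k u) = _ ↔ _
  rw [mk_eq_iff, mem_PU]
  constructor
  · intro h
    refine ⟨u.2.1, ?_⟩
    convert h.add h0 using 1; push_cast; ring
  · intro h
    convert h.2.sub h0 using 1; push_cast; ring

lemma ord_int_zero_iff (r : 𝓞 K) (hr : (r : K) ≠ 0) :
    ord v (Units.mk0 (r : K) hr) = 0 ↔ r ∉ v.asIdeal := by
  rw [← ge_int_one_iff]
  have h := ge_unit (v := v) (n := 1) (Units.mk0 (r : K) hr)
  have h' := ge_unit (v := v) (n := 0) (Units.mk0 (r : K) hr)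
  have := Ge.int (v := v) r
  rw [Units.val_mk0] at h h'
  rw [h]
  rw [h'] at this
  omega

lemma mk_isUnit_iff {k : ℕ} (hk : k ≠ 0) (r : 𝓞 K) :
    IsUnit (Ideal.Quotient.mk (v.asIdeal ^ k) r) ↔ r ∉ v.asIdeal := by
  constructor
  · intro h hr
    have h1 : IsUnit (Ideal.Quotient.mk v.asIdeal r) := by
      have := h.map (Ideal.Quotient.factor (Ideal.pow_le_self hk : v.asIdeal ^ k ≤ v.asIdeal))
      simpa using this
    rw [Ideal.Quotient.eq_zero_iff_mem.2 hr] at h1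
    exact not_isUnit_zero h1
  · intro hr
    have h1 : IsCoprime (Ideal.span {r}) (v.asIdeal ^ k) := by
      apply IsCoprime.pow_right
      rw [Ideal.isCoprime_iff_codisjoint, codisjoint_iff]
      by_contra hne
      have h2 : Ideal.span {r} ⊔ v.asIdeal = v.asIdeal :=
        (v.isMaximal.eq_of_le hne le_sup_right).symm
      exact hr (h2 ▸ (le_sup_left : _ ≤ Ideal.span {r} ⊔ v.asIdeal) (Ideal.mem_span_singleton_self r))
    obtain ⟨i, hi, j, hj, hij⟩ := Ideal.isCoprime_iff_exists.1 h1
    obtain ⟨c, rfl⟩ := Ideal.mem_span_singleton.1 hi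
    refine IsUnit.of_mul_eq_one (Ideal.Quotient.mk _ c) ?_
    rw [← map_mul, ← map_one (Ideal.Quotient.mk _), ← hij, map_add,
      Ideal.Quotient.eq_zero_iff_mem.2 hj, add_zero]

/-- every unit is a reduction -/
lemma resv_surj {k : ℕ} (hk : k ≠ 0) (y : (𝓞 K ⧸ v.asIdeal ^ k)ˣ) : ∃ u, resv v k u = y := by
  obtain ⟨r, hr⟩ := Ideal.Quotient.mk_surjective (y : 𝓞 K ⧸ v.asIdeal ^ k)
  have h1 : r ∉ v.asIdeal := by
    rw [← mk_isUnit_iff hk, hr]; exact y.isUnit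
  have h0 : (r : K) ≠ 0 := by
    intro h
    have : r = 0 := by exact_mod_cast h
    exact h1 (this ▸ zero_mem _)
  refine ⟨⟨Units.mk0 (r : K) h0, mem_PU_zero.2 ((ord_int_zero_iff r h0).2 h1)⟩, ?_⟩
  rw [resv_eq k _ r (by simpa using Ge.zero), hr]

lemma card_units_quot {k : ℕ} (hk : k ≠ 0) :
    Nat.card (𝓞 K ⧸ v.asIdeal ^ k)ˣ + (Ideal.absNorm v.asIdeal) ^ (k - 1) =
      (Ideal.absNorm v.asIdeal) ^ k := by
  have hq : Ideal.absNorm v.asIdeal ≠ 0 := by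
    rw [Ne, Ideal.absNorm_eq_zero_iff]; exact v.ne_bot
  have hc : Nat.card (𝓞 K ⧸ v.asIdeal ^ k) = (Ideal.absNorm v.asIdeal) ^ k := by
    rw [← map_pow]; rfl
  have hfin : Finite (𝓞 K ⧸ v.asIdeal ^ k) := Nat.finite_of_card_ne_zero (by
    rw [hc]; exact pow_ne_zero _ hq)
  let f := Ideal.Quotient.factor (Ideal.pow_le_self hk : v.asIdeal ^ k ≤ v.asIdeal)
  have hf : Function.Surjective f := Ideal.Quotient.factor_surjective _
  have h1 : Nat.card f.toAddMonoidHom.ker * Nat.card (𝓞 K ⧸ v.asIdeal) =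
      Nat.card (𝓞 K ⧸ v.asIdeal ^ k) := by
    rw [← AddSubgroup.card_mul_index f.toAddMonoidHom.ker, AddSubgroup.index_ker,
      show f.toAddMonoidHom.range = ⊤ from AddMonoidHom.range_eq_top.2 hf]
    simp
  have hN : Nat.card (𝓞 K ⧸ v.asIdeal) = Ideal.absNorm v.asIdeal := rfl
  have h2 : Nat.card f.toAddMonoidHom.ker = (Ideal.absNorm v.asIdeal) ^ (k-1) := by
    rw [hc, hN] at h1
    have : (Ideal.absNorm v.asIdeal) ^ k = (Ideal.absNorm v.asIdeal) ^ (k-1) *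
      Ideal.absNorm v.asIdeal := by rw [← pow_succ]; congr 1; omega
    rw [this] at h1
    exact Nat.eq_of_mul_eq_mul_right (Nat.pos_of_ne_zero hq) h1
  have h3 : ∀ x, x ∈ f.toAddMonoidHom.ker ↔ ¬ IsUnit x := by
    intro x
    obtain ⟨r, rfl⟩ := Ideal.Quotient.mk_surjective x
    rw [mk_isUnit_iff hk, not_not, AddMonoidHom.mem_ker]
    exact Ideal.Quotient.eq_zero_iff_mem
  rw [← hc, ← h2]
  have e1 : (𝓞 K ⧸ v.asIdeal ^ k)ˣ ≃ {x : 𝓞 K ⧸ v.asIdeal ^ k // IsUnit x} :=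
    Equiv.ofBijective (fun u => ⟨u, u.isUnit⟩) ⟨fun a b h => Units.ext (congrArg Subtype.val h),
      fun ⟨x, hx⟩ => ⟨hx.unit, rfl⟩⟩
  rw [Nat.card_congr e1]
  have e2 : f.toAddMonoidHom.ker ≃ {x : 𝓞 K ⧸ v.asIdeal ^ k // ¬ IsUnit x} :=
    Equiv.subtypeEquivRight h3
  rw [Nat.card_congr e2, ← Nat.card_sum]
  classical
  exact Nat.card_congr (Equiv.sumCompl _)

/-- index of the principal units -/
lemma index_PU {k : ℕ} (hk : k ≠ 0) : (PU v k).relIndex (PU v 0) +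
    (Ideal.absNorm v.asIdeal) ^ (k - 1) = (Ideal.absNorm v.asIdeal) ^ k := by
  rw [← card_units_quot hk]
  congr 1
  have h1 : (resv v k).toHomUnits.ker = (PU v k).subgroupOf (PU v 0) := by
    ext u
    rw [MonoidHom.mem_ker, Subgroup.mem_subgroupOf, ← resv_eq_one_iff, Units.ext_iff]
    rfl
  rw [Subgroup.relIndex, ← h1, Subgroup.index_ker]
  have : (resv v k).toHomUnits.range = ⊤ := by
    rw [MonoidHom.range_eq_top]
    intro y
    obtain ⟨u, hu⟩ := resv_surj hk y
    exact ⟨u, Units.ext hu⟩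
  rw [this]; simp

end
end CFT
end P3b

section P3c
open NumberField IsDedekindDomain HeightOneSpectrum
open scoped nonZeroDivisors Pointwise
set_option linter.unusedSectionVars false
namespace CFT

lemma exists_dual_aux {Q : Type*} [AddCommGroup Q] (ℓ : ℕ) [Fact ℓ.Prime] [Module (ZMod ℓ) Q]
    {a : Q} (ha : a ≠ 0) : ∃ f : Q →+ ZMod ℓ, f a ≠ 0 := by
  have h1 := mt (Module.forall_dual_apply_eq_zero_iff (ZMod ℓ) a).1 ha
  push Not at h1
  obtain ⟨f, hf⟩ := h1
  exact ⟨f.toAddMonoidHom, hf⟩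

/-- characters of exponent `ℓ` separate points from a subgroup -/
lemma exists_char {A : Type*} [CommGroup A] {ℓ : ℕ} (hℓ : ℓ.Prime) (H : Subgroup A)
    (hH : ∀ a, a ^ ℓ ∈ H) (a : A) (ha : a ∉ H) :
    ∃ θ : A →* Multiplicative (ZMod ℓ), (∀ h ∈ H, θ h = 1) ∧ θ a ≠ 1 := by
  have := Fact.mk hℓ
  let Q := Additive (A ⧸ H)
  let _ : Module (ZMod ℓ) Q := AddCommGroup.zmodModule (by
    intro x
    obtain ⟨y, hy⟩ := QuotientGroup.mk_surjective x.toMul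
    have : x = Additive.ofMul (y : A ⧸ H) := by rw [hy]; rfl
    rw [this, ← ofMul_pow, ← QuotientGroup.mk_pow, (QuotientGroup.eq_one_iff _).2 (hH y)]; rfl)
  have hne : (Additive.ofMul (a : A ⧸ H) : Q) ≠ 0 := by
    intro h
    apply ha
    rw [← QuotientGroup.eq_one_iff]
    exact h
  obtain ⟨f, hf⟩ := exists_dual_aux ℓ hne
  refine ⟨(AddMonoidHom.toMultiplicativeRight f).comp (QuotientGroup.mk' H), ?_, ?_⟩
  · intro h hh
    have : QuotientGroup.mk' H h = 1 := (QuotientGroup.eq_one_iff _).2 hh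
    rw [MonoidHom.comp_apply, this, map_one]
  · intro h
    exact hf h

lemma surj_of_ne_one {A : Type*} [Group A] {ℓ : ℕ} (hℓ : ℓ.Prime) (θ : A →* Multiplicative (ZMod ℓ))
    (a : A) (ha : θ a ≠ 1) : Function.Surjective θ := by
  have := Fact.mk hℓ
  rw [← MonoidHom.range_eq_top]
  have : Fact (Nat.card (Multiplicative (ZMod ℓ))).Prime := ⟨by simpa using hℓ⟩
  rcases θ.range.eq_bot_or_eq_top_of_prime_card with h | h
  · have h2 : θ a ∈ θ.range := ⟨a, rfl⟩
    rw [h, Subgroup.mem_bot] at h2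
    exact absurd h2 ha
  · exact h

section
variable {K M : Type*} [Field K] [NumberField K] [Field M] [NumberField M] [Algebra K M] [IsGalois K M]

lemma eram_eq (w : HS M) : eram K w = w.asIdeal.ramificationIdx (𝓞 K) :=
  Ideal.ramificationIdx'_eq_ramificationIdx _ _ (und K w).ne_bot

lemma card_inertia (w : HS M) : Nat.card (w.asIdeal.inertia (M ≃ₐ[K] M)) = eram K w := by
  rw [Ideal.card_inertia_eq_ramificationIdxIn (und K w).asIdeal, eram_eq,
    Ideal.ramificationIdxIn_eq_ramificationIdx (und K w).asIdeal w.asIdeal (M ≃ₐ[K] M)]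

lemma absNorm_und (w : HS M) : Ideal.absNorm w.asIdeal =
    Ideal.absNorm (und K w).asIdeal ^ (w.asIdeal.inertiaDeg (𝓞 K)) := by
  have := (und K w).isMaximal
  have := w.isMaximal
  rw [← Ideal.inertiaDeg'_eq_inertiaDeg (und K w).asIdeal]
  exact Ideal.absNorm_eq_pow_inertiaDeg'_of_liesOver _ _ (und K w).isPrime (und K w).ne_bot

lemma fund_id (w : HS M) : ((und K w).asIdeal.primesOver (𝓞 M)).ncard * eram K w *
    w.asIdeal.inertiaDeg (𝓞 K) = Nat.card (M ≃ₐ[K] M) := by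
  have := Ideal.ncard_primesOver_mul_card_inertia_mul_finrank (G := M ≃ₐ[K] M) (und K w).asIdeal w.asIdeal
  rwa [card_inertia] at this

lemma mem_inertia_iff (w : HS M) (σ : M ≃ₐ[K] M) :
    σ ∈ w.asIdeal.inertia (M ≃ₐ[K] M) ↔ ∀ r : 𝓞 M, σ • r - r ∈ w.asIdeal := Iff.rfl

lemma ncard_primesOver_pos (v : HS K) : 0 < (v.asIdeal.primesOver (𝓞 M)).ncard := by
  obtain ⟨w, rfl⟩ := exists_over (M := M) v
  have := fund_id (K := K) w
  rcases Nat.eq_zero_or_pos ((und K w).asIdeal.primesOver (𝓞 M)).ncard with h | h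
  · rw [h] at this
    have h2 : 0 < Nat.card (M ≃ₐ[K] M) := Nat.card_pos
    omega
  · exact h

lemma total_inertia (w : HS M) (h : eram K w = Nat.card (M ≃ₐ[K] M)) (σ : M ≃ₐ[K] M) (r : 𝓞 M) :
    σ • r - r ∈ w.asIdeal := by
  have h1 := card_inertia (K := K) w
  rw [h] at h1
  have h2 : w.asIdeal.inertia (M ≃ₐ[K] M) = ⊤ := Subgroup.eq_top_of_card_eq _ h1
  have : σ ∈ w.asIdeal.inertia (M ≃ₐ[K] M) := h2 ▸ Subgroup.mem_top σ
  exact this r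

lemma gact_of_total (w : HS M) (h : eram K w = Nat.card (M ≃ₐ[K] M)) (σ : M ≃ₐ[K] M) :
    gact σ w = w := by
  ext1
  have h1 : w.asIdeal ≤ σ • w.asIdeal := by
    intro x hx
    rw [Ideal.mem_pointwise_smul_iff_inv_smul_mem]
    have := add_mem (total_inertia w h σ⁻¹ x) hx
    simpa using this
  exact (w.isMaximal.eq_of_le (gact σ w).isPrime.ne_top h1).symm

lemma absNorm_of_total (w : HS M) (h : eram K w = Nat.card (M ≃ₐ[K] M)) :
    Ideal.absNorm w.asIdeal = Ideal.absNorm (und K w).asIdeal := by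
  have h1 := fund_id (K := K) w
  have h2 : 0 < Nat.card (M ≃ₐ[K] M) := Nat.card_pos
  rw [h] at h1
  have h3 : ((und K w).asIdeal.primesOver (𝓞 M)).ncard * w.asIdeal.inertiaDeg (𝓞 K) = 1 := by
    apply Nat.eq_of_mul_eq_mul_right h2
    rw [one_mul, mul_right_comm, h1]
  rw [absNorm_und (K := K), Nat.eq_one_of_mul_eq_one_left h3, pow_one]

lemma coe_smul_units (σ : M ≃ₐ[K] M) (x : Mˣ) : ((σ • x : Mˣ) : M) = σ (x : M) := rfl

lemma ge_smul {w : HS M} {σ : M ≃ₐ[K] M} (hw : gact σ w = w) {n : ℤ} {x : M} (hx : Ge w n x) :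
    Ge w n (σ x) := by
  by_cases h0 : x = 0
  · rw [h0, map_zero]; exact Ge.zero
  · have h1 := (ge_unit (v := w) (n := n) (Units.mk0 x h0)).1 hx
    have h2 := ord_gact σ w (Units.mk0 x h0)
    rw [hw] at h2
    rw [← h2, ← ge_unit] at h1
    exact h1

lemma ge_algebraMap {w : HS M} {n : ℤ} {x : K} :
    Ge w n (algebraMap K M x) → x ≠ 0 → ∀ (e : x ≠ 0), n ≤ eram K w * ord (und K w) (Units.mk0 x e) := by
  intro h _ e
  rw [← ord_algebraMap, ← ge_unit]
  exact h

end
end CFT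
end P3c

section P3d
open NumberField IsDedekindDomain HeightOneSpectrum
open scoped nonZeroDivisors Pointwise
set_option linter.unusedSectionVars false
namespace CFT
section
variable {K M : Type*} [Field K] [NumberField K] [Field M] [NumberField M] [Algebra K M] [IsGalois K M]

/-- the map `u ↦ σ u / u` -/
noncomputable def dmap (σ : M ≃ₐ[K] M) (u : Mˣ) : Mˣ := σ • u / u

lemma dmap_mul (σ : M ≃ₐ[K] M) (u u' : Mˣ) : dmap σ (u * u') = dmap σ u * dmap σ u' := by
  unfold dmap; rw [smul_mul', mul_div_mul_comm]

lemma dmap_spec (σ : M ≃ₐ[K] M) (u : Mˣ) : σ • u = dmap σ u * u := by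
  unfold dmap; rw [div_mul_cancel]

/-- linear version -/
noncomputable def sigEnd (σ : M ≃ₐ[K] M) : Module.End ℤ (Additive Mˣ) :=
  (MonoidHom.toAdditive (MulDistribMulAction.toMonoidHom Mˣ σ)).toIntLinearMap

lemma sigEnd_apply (σ : M ≃ₐ[K] M) (u : Mˣ) :
  sigEnd σ (Additive.ofMul u) = Additive.ofMul (σ • u) := rfl

lemma sigEnd_pow (σ : M ≃ₐ[K] M) (i : ℕ) (u : Mˣ) :
    (sigEnd σ ^ i) (Additive.ofMul u) = Additive.ofMul (σ ^ i • u) := by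
  induction i generalizing u with
  | zero => simp
  | succ i ih =>
    rw [pow_succ, Module.End.mul_apply, sigEnd_apply, ih, pow_succ, mul_smul]

lemma subEnd_pow (σ : M ≃ₐ[K] M) (i : ℕ) (u : Mˣ) :
    ((sigEnd σ - 1) ^ i) (Additive.ofMul u) = Additive.ofMul ((dmap σ)^[i] u) := by
  induction i generalizing u with
  | zero => simp
  | succ i ih =>
    rw [pow_succ, Module.End.mul_apply, Function.iterate_succ_apply, ← ih]
    rfl

lemma norm_formula {ℓ : ℕ} (hdeg : Nat.card (M ≃ₐ[K] M) = ℓ)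
    {σ : M ≃ₐ[K] M} (hσ : ∀ g, g ∈ Subgroup.zpowers σ) (u : Mˣ) :
    Units.map (algebraMap K M : K →* M) (Units.map (Algebra.norm K) u) =
      ∏ j ∈ Finset.range ℓ, ((dmap σ)^[j] u) ^ (ℓ.choose (j+1)) := by
  have h1 : Units.map (algebraMap K M : K →* M) (Units.map (Algebra.norm K) u) =
      ∏ i ∈ Finset.range ℓ, σ ^ i • u := by
    ext
    rw [Units.coe_prod]
    exact (prod_pow_eq_norm hdeg hσ (u : M)).symm
  rw [h1]
  have h2 := congrArg (Polynomial.aeval (sigEnd σ - 1))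
    (Polynomial.geom_sum_X_comp_X_add_one_eq_sum (R := ℤ) ℓ)
  rw [Polynomial.aeval_comp] at h2
  simp only [map_sum, map_pow, map_add, map_one, map_mul, map_natCast, Polynomial.aeval_X,
    sub_add_cancel] at h2
  have h3 := congrArg (fun f : Module.End ℤ (Additive Mˣ) => f (Additive.ofMul u)) h2
  simp only [LinearMap.sum_apply, Module.End.mul_apply, sigEnd_pow, subEnd_pow,
    Module.End.natCast_apply] at h3
  apply Additive.ofMul.injective
  rw [ofMul_prod, ofMul_prod, h3]
  rfl

variable {w : HS M} {σ : M ≃ₐ[K] M}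

lemma ext_int (hw : gact σ w = w) {k : ℕ} (hk : ∀ r : 𝓞 M, Ge w k (σ (r : M) - r)) {x : M}
    (hx : Ge w 0 x) : Ge w k (σ x - x) := by
  obtain ⟨r, hr⟩ := exists_int_approx k hx
  have h1 := ge_smul hw hr
  have h2 := (h1.sub hr).add (hk r)
  convert h2 using 1
  rw [map_sub]; ring

lemma dmap_unif (hw : gact σ w = w) {k : ℕ} (hk0 : k ≠ 0)
    (hk : ∀ r : 𝓞 M, Ge w k (σ (r : M) - r)) (z : Mˣ) : dmap σ z ∈ PU w (k - 1) := by
  have hd : ∀ z : Mˣ, ord w (dmap σ z) = 0 := by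
    intro z
    have := ord_gact σ w z
    rw [hw] at this
    rw [dmap, ord_div, this, sub_self]
  have hsub : ∀ z : Mˣ, ((dmap σ z : Mˣ) : M) - 1 = (σ (z : M) - z) / z := by
    intro z
    rw [sub_div, div_self z.ne_zero, dmap, Units.val_div_eq_div_val]; rfl
  have key : ∀ z : Mˣ, 0 ≤ ord w z → ord w z ≤ 1 → dmap σ z ∈ PU w (k-1) := by
    intro z h0 h1
    refine ⟨hd z, ?_⟩
    rw [hsub]
    have h2 := ext_int hw hk (x := (z : M)) ((ge_unit z).2 h0)
    rw [← ge_div_unit z rfl] at h2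
    exact h2.mono (by rw [Nat.cast_sub (by omega)]; push_cast; omega)
  obtain ⟨π, hπ⟩ := w.valuation_exists_uniformizer M
  have h0 : π ≠ 0 := by rintro rfl; rw [map_zero] at hπ; exact WithZero.exp_ne_zero hπ.symm
  have h1 : ord w (Units.mk0 π h0) = 1 := by
    rw [ord_eq_iff]; exact hπ
  let D : Mˣ →* Mˣ := MonoidHom.mk' (dmap σ) (dmap_mul σ)
  have hD : ∀ z, dmap σ z = D z := fun _ => rfl
  have hz : z = (z / (Units.mk0 π h0) ^ (ord w z)) * (Units.mk0 π h0) ^ (ord w z) := by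
    rw [div_mul_cancel]
  rw [hz, hD, map_mul, map_zpow]
  refine mul_mem (key _ ?_ ?_) (zpow_mem (key _ ?_ ?_) _)
  · rw [ord_div, ord_zpow, h1]; simp
  · rw [ord_div, ord_zpow, h1]; simp
  · rw [h1]; norm_num
  · rw [h1]

lemma dmap_PU (hw : gact σ w = w) {k : ℕ} (hk0 : k ≠ 0)
    (hk : ∀ r : 𝓞 M, Ge w k (σ (r : M) - r)) {m : ℕ} {u : Mˣ} (hu : u ∈ PU w m) :
    dmap σ u ∈ PU w (m + (k - 1)) := by
  refine ⟨(dmap_unif hw hk0 hk u).1, ?_⟩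
  have h1 : ((dmap σ u : Mˣ) : M) - 1 = (σ ((u : M) - 1) - ((u:M) - 1)) / u := by
    rw [dmap, Units.val_div_eq_div_val, map_sub, map_one, coe_smul_units]
    field_simp; ring
  by_cases h0 : (u : M) - 1 = 0
  · rw [h1, h0]; simpa using Ge.zero
  have h2 := (dmap_unif hw hk0 hk (Units.mk0 _ h0)).2
  have h3 : σ ((u : M) - 1) - ((u:M) - 1) =
      ((u : M) - 1) * (((dmap σ (Units.mk0 _ h0) : Mˣ) : M) - 1) := by
    rw [dmap, Units.val_div_eq_div_val, coe_smul_units, Units.val_mk0]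
    field_simp
  have h4 := hu.2.mul h2
  rw [← h3, ← ge_div_unit u hu.1, ← h1] at h4
  exact_mod_cast (by simpa using h4)

lemma iter_PU (hw : gact σ w = w) {k : ℕ} (hk0 : k ≠ 0)
    (hk : ∀ r : 𝓞 M, Ge w k (σ (r : M) - r)) {u : Mˣ} (hu : u ∈ PU w k) (j : ℕ) :
    (dmap σ)^[j] u ∈ PU w (k + j * (k - 1)) := by
  induction j with
  | zero => simpa using hu
  | succ j ih =>
    rw [Function.iterate_succ_apply']
    have := dmap_PU hw hk0 hk ih
    convert this using 2; ring

lemma norm_PU {ℓ : ℕ} (hℓ : ℓ.Prime) (hdeg : Nat.card (M ≃ₐ[K] M) = ℓ)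
    (hσ : ∀ g, g ∈ Subgroup.zpowers σ) (he : eram K w = ℓ) (hw : gact σ w = w) {k : ℕ} (hk0 : k ≠ 0)
    (hk : ∀ r : 𝓞 M, Ge w k (σ (r : M) - r)) {ζ : M} (hζ : IsPrimitiveRoot ζ ℓ)
    (h : Ge w k (1 - ζ)) {u : Mˣ} (hu : u ∈ PU w k) :
    Units.map (Algebra.norm K) u ∈ PU (und K w) k := by
  have h1 : Units.map (algebraMap K M : K →* M) (Units.map (Algebra.norm K) u) ∈
      PU w (ℓ * (k - 1) + 1) := by
    rw [norm_formula hdeg hσ]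
    apply Subgroup.prod_mem
    intro j hj
    have hj' := Finset.mem_range.1 hj
    have h2 := iter_PU hw hk0 hk hu j
    rcases Nat.lt_or_ge (j+1) ℓ with h3 | h3
    · obtain ⟨c, hc⟩ := hℓ.dvd_choose_self (Nat.succ_ne_zero j) h3
      rw [hc, pow_mul]
      apply Subgroup.pow_mem
      have h4 := PU_pow hℓ hζ h (PU_mono (Nat.le_add_right _ _) h2)
      apply PU_mono _ h4
      obtain ⟨k', rfl⟩ := Nat.exists_eq_succ_of_ne_zero hk0
      have := hℓ.pos
      simp only [Nat.succ_eq_add_one, add_tsub_cancel_right]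
      nlinarith
    · have : j + 1 = ℓ := by omega
      apply Subgroup.pow_mem
      apply PU_mono _ h2
      obtain ⟨k', rfl⟩ := Nat.exists_eq_succ_of_ne_zero hk0
      rw [← this]
      simp only [Nat.succ_eq_add_one, add_tsub_cancel_right]
      apply le_of_eq; ring
  have hl0 : (0:ℤ) < ℓ := by exact_mod_cast hℓ.pos
  refine ⟨?_, ?_⟩
  · have h2 := h1.1
    rw [ord_algebraMap, he] at h2
    rcases mul_eq_zero.1 h2 with h3 | h3
    · omega
    · exact h3
  · have h2 := h1.2
    set y := ((Units.map (Algebra.norm K) u : Kˣ) : K)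
    have h3 : ((Units.map (algebraMap K M : K →* M) (Units.map (Algebra.norm K) u) : Mˣ) : M) - 1 =
      algebraMap K M (y - 1) := by rw [map_sub, map_one]; rfl
    rw [h3] at h2
    by_cases h0 : y - 1 = 0
    · rw [h0]; exact Ge.zero
    have h4 := ge_algebraMap (K := K) h2 h0 h0
    have h5 := ge_unit (v := und K w) (n := k) (Units.mk0 _ h0)
    rw [Units.val_mk0] at h5
    rw [h5]
    rw [he] at h4
    push_cast [Nat.cast_sub (Nat.one_le_iff_ne_zero.2 hk0)] at h4
    by_contra hlt
    push Not at hlt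
    have : ord (und K w) (Units.mk0 (y-1) h0) ≤ k - 1 := by omega
    nlinarith

end
end CFT
end P3d

section P3e
open NumberField IsDedekindDomain HeightOneSpectrum
open scoped nonZeroDivisors Pointwise
set_option linter.unusedSectionVars false
namespace CFT
section
variable {K M : Type*} [Field K] [NumberField K] [Field M] [NumberField M] [Algebra K M] [IsGalois K M]

lemma residue_surj (w : HS M) (h : Ideal.absNorm w.asIdeal = Ideal.absNorm (und K w).asIdeal)
    (r : 𝓞 M) : ∃ c : 𝓞 K, r - algebraMap (𝓞 K) (𝓞 M) c ∈ w.asIdeal := by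
  let f : (𝓞 K ⧸ (und K w).asIdeal) →+* (𝓞 M ⧸ w.asIdeal) :=
    algebraMap _ _
  have hinj : Function.Injective f := by
    have := (und K w).isMaximal
    letI := Ideal.Quotient.field (und K w).asIdeal
    exact f.injective
  have hN : Ideal.absNorm w.asIdeal ≠ 0 := by
    rw [Ne, Ideal.absNorm_eq_zero_iff]; exact w.ne_bot
  have hfin : Finite (𝓞 M ⧸ w.asIdeal) := Nat.finite_of_card_ne_zero hN
  have hbij := (Nat.bijective_iff_injective_and_card f).2 ⟨hinj, h.symm⟩
  obtain ⟨c, hc⟩ := hbij.2 (Ideal.Quotient.mk _ r)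
  obtain ⟨c, rfl⟩ := Ideal.Quotient.mk_surjective c
  refine ⟨c, ?_⟩
  rw [← Ideal.Quotient.eq, ← hc]
  rfl

lemma ord_norm_zero {ℓ : ℕ} (hℓ : ℓ.Prime) (hdeg : Nat.card (M ≃ₐ[K] M) = ℓ)
    {σ : M ≃ₐ[K] M} (hσ : ∀ g, g ∈ Subgroup.zpowers σ) {w : HS M} (hw : ∀ σ : M ≃ₐ[K] M, gact σ w = w)
    {x : Mˣ} (hx : ord w x = 0) : ord (und K w) (Units.map (Algebra.norm K) x) = 0 := by
  have h1 := ord_algebraMap (K := K) w (Units.map (Algebra.norm K) x)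
  have h2 : Units.map (algebraMap K M : K →* M) (Units.map (Algebra.norm K) x) ∈ PU w 0 := by
    have : Units.map (algebraMap K M : K →* M) (Units.map (Algebra.norm K) x) =
        ∏ i ∈ Finset.range ℓ, σ ^ i • x := by
      ext
      rw [Units.coe_prod]
      exact (prod_pow_eq_norm hdeg hσ (x : M)).symm
    rw [this]
    apply Subgroup.prod_mem
    intro i _
    rw [mem_PU_zero]
    have := ord_gact (σ ^ i) w x
    rwa [hw, hx] at this
  rw [mem_PU_zero.1 h2] at h1
  have := eram_ne_zero (K := K) w
  rcases mul_eq_zero.1 h1.symm with h3 | h3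
  · exact absurd (by exact_mod_cast h3) this
  · exact h3

lemma ker_le_aux {A : Type*} [Group A] {P Q : Subgroup A} (h : P ≤ Q) (hi : Q.index = P.index)
    (h0 : Q.index ≠ 0) {x : A} (hx : x ∈ Q) : x ∈ P := by
  have hri := Subgroup.relIndex_mul_index h
  rw [← hi] at hri
  have h1 : P.relIndex Q = 1 :=
    Nat.eq_of_mul_eq_mul_right (Nat.pos_of_ne_zero h0) (by rw [hri, one_mul])
  rw [Subgroup.relIndex_eq_one] at h1
  exact h1 hx

set_option maxHeartbeats 1000000 in
theorem wild {ℓ : ℕ} (hℓ : ℓ.Prime) (hdeg : Nat.card (M ≃ₐ[K] M) = ℓ) {ζ : K}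
    (hζ : IsPrimitiveRoot ζ ℓ) (w : HS M) (he : eram K w = ℓ) {σ : M ≃ₐ[K] M}
    (hσ : ∀ g, g ∈ Subgroup.zpowers σ) (a : Mˣ) (ha : ord w a = 0)
    (hσa : σ (a : M) = algebraMap K M ζ * a) (lam : Kˣ) (hlam : (lam : K) = 1 - ζ) :
    ∃ θ : PU (und K w) 0 →* Multiplicative (ZMod ℓ), Function.Surjective θ ∧
      (∀ (u : PU (und K w) 0) (n : ℕ), (n : ℤ) = ℓ * ord (und K w) lam →
        (u : Kˣ) ∈ PU (und K w) n → θ u = 1) ∧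
      (∀ x : Mˣ, ord w x = 0 → ∀ y : PU (und K w) 0, Units.map (Algebra.norm K) x = y →
        θ y = 1) := by
  have htot : eram K w = Nat.card (M ≃ₐ[K] M) := by rw [he, hdeg]
  have hw := gact_of_total (K := K) w htot
  have hN := absNorm_of_total (K := K) w htot
  have hζM : IsPrimitiveRoot (algebraMap K M ζ) ℓ := hζ.map_of_injective (algebraMap K M).injective
  have hlM : ((Units.map (algebraMap K M : K →* M) lam : Mˣ) : M) = 1 - algebraMap K M ζ := by
    change algebraMap K M lam = _
    rw [hlam, map_sub, map_one]
  let P : ℕ → Prop := fun j => ∀ r : 𝓞 M, Ge w j (σ (r : M) - r)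
  have hP1 : P 1 := by
    intro r
    have := total_inertia w htot σ r
    rw [← ge_int_one_iff] at this
    change Ge w ((1:ℕ):ℤ) _
    rw [Nat.cast_one]
    exact this
  have hPle : ∀ j, P j → (j : ℤ) ≤ ℓ * ord (und K w) lam := by
    intro j hj
    have h1 := ext_int (hw σ) hj (x := (a : M)) ((ge_unit a).2 ha.ge)
    have h2 : σ (a : M) - a = -((1 - algebraMap K M ζ) * a) := by rw [hσa]; ring
    rw [h2] at h1
    have h3 := h1.neg
    rw [neg_neg, ← add_zero (j : ℤ), ge_mul_unit a ha, ← hlM, ge_unit, ord_algebraMap, he] at h3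
    exact h3
  obtain ⟨k, hk0, hk, hk'⟩ : ∃ k, k ≠ 0 ∧ P k ∧ ¬ P (k+1) := by
    by_contra hcon
    push Not at hcon
    have hall : ∀ j, P (j+1) := by
      intro j
      induction j with
      | zero => exact hP1
      | succ j ih => exact hcon _ (Nat.succ_ne_zero _) ih
    have h1 := hPle _ (hall (ℓ * ord (und K w) lam).toNat)
    have h2 := Int.self_le_toNat (ℓ * ord (und K w) lam)
    push_cast at h1
    omega
  have hkle := hPle k hk
  have hkζ : Ge w k (1 - algebraMap K M ζ) := by
    rw [← hlM, ge_unit, ord_algebraMap, he]; exact hkle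
  -- a good uniformizer
  obtain ⟨p, hp1, hpk⟩ : ∃ p : Mˣ, ord w p = 1 ∧ ¬ Ge w ((k+1 : ℕ)) (σ (p : M) - p) := by
    have hk2 : ∃ r : 𝓞 M, ¬ Ge w ((k+1 : ℕ)) (σ (r : M) - r) := by
      by_contra h; push Not at h; exact hk' h
    obtain ⟨r, hr⟩ := hk2
    obtain ⟨c, hc⟩ := residue_surj (K := K) w hN r
    set x' : M := ((r - algebraMap (𝓞 K) (𝓞 M) c : 𝓞 M) : M) with hx'
    have hx1 : Ge w 1 x' := by rw [hx', ge_int_one_iff]; exact hc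
    have hx2 : σ x' - x' = σ (r : M) - r := by
      have : x' = r - algebraMap K M c := by rw [hx']; push_cast; rfl
      rw [this, map_sub, AlgEquiv.commutes]; ring
    by_cases h2 : Ge w 2 x'
    · obtain ⟨π, hπ⟩ := w.valuation_exists_uniformizer M
      have h0 : π ≠ 0 := by rintro rfl; rw [map_zero] at hπ; exact WithZero.exp_ne_zero hπ.symm
      have h1 : ord w (Units.mk0 π h0) = 1 := by
        rw [ord_eq_iff]; exact hπ
      have hg1 := (ge_unit (v := w) (n := 1) (Units.mk0 π h0)).2 h1.ge
      have hg2 := mt (ge_unit (v := w) (n := 2) (Units.mk0 π h0)).1 (by rw [h1]; norm_num)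
      rw [Units.val_mk0] at hg1 hg2
      by_cases h3 : Ge w ((k+1 : ℕ)) (σ π - π)
      · have hn2 : ¬ Ge w 2 (π + x') := by
          intro h; apply hg2
          have := h.sub h2
          simpa using this
        have h0' : π + x' ≠ 0 := by
          intro h; rw [h] at hn2; exact hn2 Ge.zero
        refine ⟨Units.mk0 _ h0', ord_eq_of_ge _ (hg1.add hx1) hn2, ?_⟩
        intro h
        apply hr
        rw [← hx2]
        have := h.sub h3
        convert this using 1
        rw [Units.val_mk0, map_add]; ring
      · exact ⟨Units.mk0 π h0, h1, h3⟩
    · have h0 : x' ≠ 0 := by rintro h; rw [h] at h2; exact h2 Ge.zero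
      refine ⟨Units.mk0 x' h0, ord_eq_of_ge _ hx1 h2, ?_⟩
      rw [Units.val_mk0, hx2]; exact hr
  have hx0 : dmap σ p ∈ PU w 0 := PU_mono (Nat.zero_le _) (dmap_unif (hw σ) hk0 hk p)
  have hxk : dmap σ p ∉ PU w k := by
    intro h
    apply hpk
    have h1 := h.2.mul (Ge.self (v := w) p)
    rw [hp1] at h1
    rw [Nat.cast_succ]
    convert h1 using 1
    rw [sub_mul, one_mul, dmap, Units.val_div_eq_div_val, div_mul_cancel₀ _ p.ne_zero]; rfl
  have hxN : Units.map (Algebra.norm K) (dmap σ p) = 1 := by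
    rw [dmap, map_div, div_eq_one]
    ext
    exact Algebra.norm_eq_of_algEquiv σ (p : M)
  -- the induced map
  let N : PU w 0 →* PU (und K w) 0 :=
    ((Units.map (Algebra.norm K)).comp (PU w 0).subtype).codRestrict (PU (und K w) 0)
      (fun x => mem_PU_zero.2 (ord_norm_zero hℓ hdeg hσ hw x.2.1))
  let H : Subgroup (PU (und K w) 0) := N.range ⊔ (PU (und K w) k).subgroupOf (PU (und K w) 0)
  have hHpow : ∀ y, y ^ ℓ ∈ H := by
    intro y
    apply Subgroup.mem_sup_left
    have hy : Units.map (algebraMap K M : K →* M) (y : Kˣ) ∈ PU w 0 := by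
      rw [mem_PU_zero, ord_algebraMap, y.2.1, mul_zero]
    refine ⟨⟨_, hy⟩, ?_⟩
    ext
    change Algebra.norm K (algebraMap K M _) = _
    rw [Algebra.norm_algebraMap, ← IsGalois.card_aut_eq_finrank, hdeg]
    simp
  have hHne : H ≠ ⊤ := by
    intro hH
    let φ : PU w 0 →* PU (und K w) 0 ⧸ (PU (und K w) k).subgroupOf (PU (und K w) 0) :=
      (QuotientGroup.mk' _).comp N
    have hφ : Function.Surjective φ := by
      intro z
      obtain ⟨y, rfl⟩ := QuotientGroup.mk_surjective z
      have hy : y ∈ H := hH ▸ Subgroup.mem_top y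
      obtain ⟨_, ⟨x, rfl⟩, z, hz, rfl⟩ := Subgroup.mem_sup.1 hy
      refine ⟨x, ?_⟩
      change QuotientGroup.mk (N x) = _
      rw [QuotientGroup.eq]
      simpa using hz
    have hle : (PU w k).subgroupOf (PU w 0) ≤ φ.ker := by
      intro u hu
      rw [MonoidHom.mem_ker]
      change QuotientGroup.mk (N u) = _
      rw [QuotientGroup.eq_one_iff, Subgroup.mem_subgroupOf]
      exact norm_PU hℓ hdeg hσ he (hw σ) hk0 hk hζM hkζ hu
    have hmem : (⟨_, hx0⟩ : PU w 0) ∈ φ.ker := by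
      rw [MonoidHom.mem_ker]
      change QuotientGroup.mk (N _) = _
      have : N ⟨_, hx0⟩ = 1 := by ext; exact congrArg Units.val hxN
      rw [this]; rfl
    have hidx : φ.ker.index = ((PU w k).subgroupOf (PU w 0)).index := by
      rw [Subgroup.index_ker, MonoidHom.range_eq_top.2 hφ]
      have h1 := index_PU (v := w) hk0
      have h2 := index_PU (v := und K w) hk0
      rw [hN] at h1
      rw [Subgroup.card_top]
      change (PU (und K w) k).relIndex (PU (und K w) 0) = (PU w k).relIndex (PU w 0)
      omega
    have hpos : φ.ker.index ≠ 0 := by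
      rw [hidx]
      have h1 := index_PU (v := w) hk0
      have hq : 1 < Ideal.absNorm w.asIdeal := by
        have h3 : Ideal.absNorm w.asIdeal ≠ 0 := by
          rw [Ne, Ideal.absNorm_eq_zero_iff]; exact w.ne_bot
        have h4 : Ideal.absNorm w.asIdeal ≠ 1 := by
          rw [Ne, Ideal.absNorm_eq_one_iff]; exact w.isPrime.ne_top
        omega
      have h2 : Ideal.absNorm w.asIdeal ^ (k-1) < Ideal.absNorm w.asIdeal ^ k :=
        Nat.pow_lt_pow_right hq (by omega)
      change (PU w k).relIndex (PU w 0) ≠ 0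
      omega
    have h1 := ker_le_aux hle hidx hpos hmem
    exact hxk (Subgroup.mem_subgroupOf.1 h1)
  obtain ⟨y, hy⟩ : ∃ y, y ∉ H := by
    by_contra h; push Not at h
    exact hHne (Subgroup.eq_top_iff' H |>.2 h)
  obtain ⟨θ, hθ1, hθ2⟩ := exists_char hℓ H hHpow y hy
  refine ⟨θ, surj_of_ne_one hℓ θ y hθ2, ?_, ?_⟩
  · intro u n hn hu
    apply hθ1
    apply Subgroup.mem_sup_right
    rw [Subgroup.mem_subgroupOf]
    exact PU_mono (by have := hkle; rw [← hn] at this; exact_mod_cast this) hu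
  · intro x hx y hy
    apply hθ1
    apply Subgroup.mem_sup_left
    exact ⟨⟨x, mem_PU_zero.2 hx⟩, Subtype.ext hy⟩

end
end CFT
end P3e

section P4a
open NumberField IsDedekindDomain HeightOneSpectrum
open scoped nonZeroDivisors Pointwise
set_option linter.unusedSectionVars false
namespace CFT
section
variable {K : Type*} [Field K] [NumberField K]

lemma crt_int (S : Finset (HS K)) (n : HS K → ℕ) (x : HS K → 𝓞 K) :
    ∃ y : 𝓞 K, ∀ v ∈ S, Ge v (n v) ((y : K) - x v) := by
  obtain ⟨y, hy⟩ := IsDedekindDomain.exists_forall_sub_mem_ideal (s := S)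
    (fun v => v.asIdeal) n (fun v _ => v.prime) (fun v _ u _ h h' => h (HeightOneSpectrum.ext h'))
    (fun v => x v)
  refine ⟨y, fun v hv => ?_⟩
  have := hy v hv
  rw [← ge_int_iff] at this
  simpa using this

lemma approx_unit (S : Finset (HS K)) (n : HS K → ℕ) (x : HS K → Kˣ) (hx : ∀ v ∈ S, ord v (x v) = 0) :
    ∃ y : Kˣ, ∀ v ∈ S, y / x v ∈ PU v (n v) := by
  classical
  rcases S.eq_empty_or_nonempty with rfl | ⟨v0, hv0⟩
  · exact ⟨1, by simp⟩
  have h1 : ∀ v, ∃ r : 𝓞 K, v ∈ S → Ge v ((n v + 1 : ℕ)) ((x v : K) - r) := by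
    intro v
    by_cases hv : v ∈ S
    · obtain ⟨r, hr⟩ := exists_int_approx (v := v) (n v + 1) ((Ge.self (x v)).mono (hx v hv).ge)
      exact ⟨r, fun _ => hr⟩
    · exact ⟨0, fun h => absurd h hv⟩
  choose r hr using h1
  obtain ⟨y, hy⟩ := crt_int S (fun v => n v + 1) r
  have key : ∀ v ∈ S, Ge v ((n v + 1 : ℕ)) ((y : K) - x v) := by
    intro v hv
    have := (hy v hv).sub (hr v hv)
    simpa using this
  have hn1 : ∀ v ∈ S, ¬ Ge v 1 (y : K) := by
    intro v hv h
    have h2 := h.sub ((key v hv).mono (show (1:ℤ) ≤ _ by push_cast; omega))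
    rw [sub_sub_cancel, ge_unit, hx v hv] at h2
    omega
  have hy0 : (y : K) ≠ 0 := by
    intro h; apply hn1 v0 hv0; rw [h]; exact Ge.zero
  refine ⟨Units.mk0 _ hy0, fun v hv => ?_⟩
  have ho : ord v (Units.mk0 _ hy0) = 0 := ord_eq_of_ge _ (Ge.int y) (by simpa using hn1 v hv)
  rw [mem_PU_div ho (hx v hv)]
  exact (key v hv).mono (by push_cast; omega)

lemma exists_unif (S : Finset (HS K)) (v : HS K) :
    ∃ y : Kˣ, ord v y = 1 ∧ ∀ u ∈ S, u ≠ v → ord u y = 0 := by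
  classical
  obtain ⟨π, hπ⟩ := v.intValuation_exists_uniformizer
  obtain ⟨y, hy⟩ := crt_int (insert v S) (fun _ => 2) (fun u => if u = v then π else 1)
  have hv := hy v (by simp)
  simp only [if_true] at hv
  have hp1 : Ge v 1 (π : K) := by
    unfold Ge; change v.valuation K (algebraMap (𝓞 K) K π) ≤ _
    rw [valuation_of_algebraMap, hπ]
  have hp2 : ¬ Ge v 2 (π : K) := by
    unfold Ge; change ¬ v.valuation K (algebraMap (𝓞 K) K π) ≤ _
    rw [valuation_of_algebraMap, hπ, WithZero.exp_le_exp]; norm_num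
  have h1 : Ge v 1 (y : K) := by
    have := (hv.mono (show (1:ℤ) ≤ ((2:ℕ):ℤ) by norm_num)).add hp1
    simpa using this
  have h2 : ¬ Ge v 2 (y : K) := by
    intro h
    apply hp2
    have := h.sub hv
    simpa using this
  have hy0 : (y : K) ≠ 0 := by
    intro h; apply h2; rw [h]; exact Ge.zero
  refine ⟨Units.mk0 _ hy0, ord_eq_of_ge _ h1 h2, fun u hu huv => ?_⟩
  have := hy u (by simp [hu])
  rw [if_neg huv] at this
  apply ord_zero_of_ge_sub_one
  have := this.mono (show (1:ℤ) ≤ ((2:ℕ):ℤ) by norm_num)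
  simpa using this

lemma approx_ord (S : Finset (HS K)) (D : HS K → ℤ) : ∃ y : Kˣ, ∀ v ∈ S, ord v y = D v := by
  classical
  choose p hp1 hp2 using exists_unif S
  have hprod : ∀ (s : Finset (HS K)) (f : HS K → Kˣ) v, ord v (∏ u ∈ s, f u) = ∑ u ∈ s, ord v (f u) := by
    intro s f v
    induction s using Finset.induction_on with
    | empty => simp [ord_one]
    | insert a s ha ih => rw [Finset.prod_insert ha, Finset.sum_insert ha, ord_mul, ih]
  refine ⟨∏ u ∈ S, p u ^ D u, fun v hv => ?_⟩
  rw [hprod, Finset.sum_eq_single v]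
  · rw [ord_zpow, hp1, mul_one]
  · intro u hu huv
    rw [ord_zpow, hp2 u v hv huv.symm, mul_zero]
  · intro h; exact absurd hv h

lemma approx (S : Finset (HS K)) (n : HS K → ℕ) (x : HS K → Kˣ) :
    ∃ y : Kˣ, ∀ v ∈ S, y / x v ∈ PU v (n v) := by
  obtain ⟨z, hz⟩ := approx_ord S (fun v => ord v (x v))
  obtain ⟨y, hy⟩ := approx_unit S n (fun v => x v / z) (fun v hv => by rw [ord_div, hz v hv, sub_self])
  refine ⟨y * z, fun v hv => ?_⟩
  have := hy v hv
  rwa [div_div_eq_mul_div] at this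

/-- every class has a divisor avoiding `S` -/
lemma cl_off (S : Finset (HS K)) (D : HS K →₀ ℤ) : ∃ (E : HS K →₀ ℤ) (y : Kˣ), (∀ v ∈ S, E v = 0) ∧
    cl E = cl D ∧ D = E + dv y := by
  obtain ⟨y, hy⟩ := approx_ord S D
  refine ⟨D - dv y, y, fun v hv => by simp [hy v hv], by rw [map_sub, cl_dv, sub_zero], by abel⟩

end
end CFT
end P4a

section P4b
open NumberField IsDedekindDomain HeightOneSpectrum
open scoped nonZeroDivisors Pointwise
set_option linter.unusedSectionVars false
namespace CFT

lemma relIndex_pow_aux {A : Type*} [CommGroup A] (ℓ : ℕ) (B P : Subgroup A) (hP : P ≤ B)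
    (h0 : P.relIndex B ≠ 0) :
    (P ⊔ B.map (powMonoidHom ℓ)).relIndex B = P.relIndex (P.comap (powMonoidHom ℓ) ⊓ B) := by
  have hle : B.map (powMonoidHom ℓ) ≤ B := by
    rintro _ ⟨x, hx, rfl⟩; exact B.pow_mem hx ℓ
  have h1 : P.relIndex (P ⊔ B.map (powMonoidHom ℓ)) = (P.comap (powMonoidHom ℓ) ⊓ B).relIndex B := by
    rw [Subgroup.inf_relIndex_right, Subgroup.relIndex_comap, Subgroup.relIndex_sup_left]
  have h2 := Subgroup.relIndex_mul_relIndex P (P ⊔ B.map (powMonoidHom ℓ)) B le_sup_left (sup_le hP hle)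
  have h3 := Subgroup.relIndex_mul_relIndex P (P.comap (powMonoidHom ℓ) ⊓ B) B
    (le_inf (fun x hx => P.pow_mem hx ℓ) hP) inf_le_right
  have h4 : (P.comap (powMonoidHom ℓ) ⊓ B).relIndex B ≠ 0 := by
    intro h; rw [h, mul_zero] at h3; exact h0 h3.symm
  rw [h1, ← h3, mul_comm] at h2
  exact Nat.eq_of_mul_eq_mul_right (Nat.pos_of_ne_zero h4) h2

lemma prod_sub_pow {F : Type*} [Field F] {ζ : F} {ℓ : ℕ} (hℓ : 0 < ℓ) (hζ : IsPrimitiveRoot ζ ℓ) (x : F) :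
    ∏ i ∈ Finset.range ℓ, (x - ζ ^ i) = x ^ ℓ - 1 := by
  classical
  have h := hζ.pow_sub_pow_eq_prod_sub_mul x 1 hℓ
  rw [one_pow] at h
  rw [h]
  have hinj : Set.InjOn (fun i => ζ ^ i) (Finset.range ℓ : Set ℕ) := by
    intro i hi j hj hij
    exact hζ.pow_inj (by simpa using hi) (by simpa using hj) hij
  have him : (Finset.range ℓ).image (fun i => ζ ^ i) = Polynomial.nthRootsFinset ℓ (1 : F) := by
    apply Finset.eq_of_subset_of_card_le
    · intro y hy
      obtain ⟨i, _, rfl⟩ := Finset.mem_image.1 hy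
      rw [Polynomial.mem_nthRootsFinset hℓ, ← pow_mul, mul_comm, pow_mul, hζ.pow_eq_one, one_pow]
    · rw [Finset.card_image_of_injOn hinj, hζ.card_nthRootsFinset]; simp
  rw [← him, Finset.prod_image hinj]
  simp

section
variable {K : Type*} [Field K] [NumberField K]

/-- primes dividing `lam` -/
noncomputable def Lam (lam : Kˣ) : Finset (HS K) := (ord_finite lam).toFinset
lemma mem_Lam {lam : Kˣ} {v : HS K} : v ∈ Lam lam ↔ ord v lam ≠ 0 := by simp [Lam]

noncomputable def Bn (lam : Kˣ) (k : ℕ) : Subgroup Kˣ :=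
  ⨅ v : Lam lam, PU v.1 (k * (ord v.1 lam).toNat)
lemma mem_Bn {lam : Kˣ} {k : ℕ} {x : Kˣ} :
    x ∈ Bn lam k ↔ ∀ v ∈ Lam lam, x ∈ PU v (k * (ord v lam).toNat) := by
  simp [Bn, Subgroup.mem_iInf]
lemma mem_B0 {lam : Kˣ} {x : Kˣ} : x ∈ Bn lam 0 ↔ ∀ v ∈ Lam lam, ord v x = 0 := by
  simp [mem_Bn, mem_PU_zero]
lemma Bn_mono {lam : Kˣ} {j k : ℕ} (h : j ≤ k) : Bn lam k ≤ Bn lam j := by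
  intro x hx
  rw [mem_Bn] at hx ⊢
  exact fun v hv => PU_mono (Nat.mul_le_mul_right _ h) (hx v hv)

lemma absNorm_gt_one (v : HS K) : 1 < Ideal.absNorm v.asIdeal := by
  have h3 : Ideal.absNorm v.asIdeal ≠ 0 := by
    rw [Ne, Ideal.absNorm_eq_zero_iff]; exact v.ne_bot
  have h4 : Ideal.absNorm v.asIdeal ≠ 1 := by
    rw [Ne, Ideal.absNorm_eq_one_iff]; exact v.isPrime.ne_top
  omega

lemma relIndex_PU_ne_zero (v : HS K) (k : ℕ) : (PU v k).relIndex (PU v 0) ≠ 0 := by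
  rcases eq_or_ne k 0 with rfl | hk0
  · simp
  have h1 := index_PU (v := v) hk0
  have h2 : Ideal.absNorm v.asIdeal ^ (k-1) < Ideal.absNorm v.asIdeal ^ k :=
    Nat.pow_lt_pow_right (absNorm_gt_one v) (by omega)
  omega

lemma relIndex_PU (v : HS K) {j k : ℕ} (hj : j ≠ 0) (h : j ≤ k) :
    (PU v k).relIndex (PU v j) = Ideal.absNorm v.asIdeal ^ (k - j) := by
  have h1 := index_PU (v := v) (k := k) (by omega)
  have h2 := index_PU (v := v) hj
  have h3 := Subgroup.relIndex_mul_relIndex (PU v k) (PU v j) (PU v 0) (PU_mono h) (PU_mono (Nat.zero_le _))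
  have h4 := relIndex_PU_ne_zero v j
  apply Nat.eq_of_mul_eq_mul_right (Nat.pos_of_ne_zero h4)
  rw [h3]
  have h5 : Ideal.absNorm v.asIdeal ^ k = Ideal.absNorm v.asIdeal ^ (k - j) * Ideal.absNorm v.asIdeal ^ j := by
    rw [← pow_add]; congr 1; omega
  have h6 : Ideal.absNorm v.asIdeal ^ (k-1) = Ideal.absNorm v.asIdeal ^ (k - j) * Ideal.absNorm v.asIdeal ^ (j-1) := by
    rw [← pow_add]; congr 1; omega
  rw [h5, h6, ← h2, mul_add] at h1
  omega

lemma relIndex_Bn_ne_zero (lam : Kˣ) (j k : ℕ) : (Bn lam k).relIndex (Bn lam j) ≠ 0 := by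
  have : (Bn lam k).relIndex (Bn lam 0) ≠ 0 := by
    apply Subgroup.relIndex_iInf_ne_zero
    intro v h
    apply relIndex_PU_ne_zero v.1 (k * (ord v.1 lam).toNat)
    apply Subgroup.relIndex_eq_zero_of_le_right _ h
    intro x hx
    rw [mem_PU_zero]; exact mem_B0.1 hx v.1 v.2
  intro h
  exact this (Subgroup.relIndex_eq_zero_of_le_right (Bn_mono (Nat.zero_le _)) h)

/-- if `x^ℓ ≡ 1 mod λ^ℓ` then `x ≡ 1 mod λ` -/
lemma PU_of_pow {v : HS K} {ζ : K} {ℓ : ℕ} (hℓ : ℓ.Prime) (hζ : IsPrimitiveRoot ζ ℓ) {m : ℕ}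
    (h : Ge v m (1 - ζ)) {u : Kˣ} (hu0 : ord v u = 0) (hu : u ^ ℓ ∈ PU v (ℓ * m)) : u ∈ PU v m := by
  refine ⟨hu0, ?_⟩
  by_contra hcon
  have hne : (u : K) - 1 ≠ 0 := by intro h; rw [h] at hcon; exact hcon Ge.zero
  set d := Units.mk0 _ hne with hd
  have hdm : ord v d < m := by
    rw [← not_le, ← ge_unit]; exact hcon
  have hi : ∀ i : ℕ, Ge v m (1 - ζ ^ i) := by
    intro i
    have := (mul_geom_sum ζ i)
    have h2 : 1 - ζ ^ i = (1 - ζ) * ∑ j ∈ Finset.range i, ζ ^ j := by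
      have := mul_neg_geom_sum ζ i; rw [this]
    rw [h2, ← add_zero (m : ℤ)]
    apply h.mul
    apply Ge.sum
    intro j _
    have := (ge_root_of_unity (v := v) hℓ.pos hζ.pow_eq_one).pow j
    simpa using this
  have hfac : ∀ i : ℕ, ∃ e : Kˣ, (e : K) = u - ζ ^ i ∧ ord v e = ord v d := by
    intro i
    have h1 : ¬ Ge v (ord v d + 1) ((u : K) - ζ ^ i) := by
      intro h1
      have := h1.sub ((hi i).mono (show ord v d + 1 ≤ m by omega))
      have h2 : (u : K) - ζ ^ i - (1 - ζ ^ i) = d := by rw [hd, Units.val_mk0]; ring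
      rw [h2, ge_unit] at this
      omega
    have h2 : Ge v (ord v d) ((u : K) - ζ ^ i) := by
      have := (Ge.self (v := v) d).add ((hi i).mono hdm.le)
      have h2 : (d : K) + (1 - ζ ^ i) = (u : K) - ζ ^ i := by rw [hd, Units.val_mk0]; ring
      rwa [h2] at this
    have h0 : (u : K) - ζ ^ i ≠ 0 := by intro h; rw [h] at h1; exact h1 Ge.zero
    exact ⟨Units.mk0 _ h0, rfl, ord_eq_of_ge _ h2 h1⟩
  choose e he1 he2 using hfac
  have hprod : ((∏ i ∈ Finset.range ℓ, e i : Kˣ) : K) = (u : K) ^ ℓ - 1 := by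
    rw [Units.coe_prod, ← prod_sub_pow hℓ.pos hζ]
    exact Finset.prod_congr rfl (fun i _ => he1 i)
  have hord : ord v (∏ i ∈ Finset.range ℓ, e i) = ℓ * ord v d := by
    have : ∀ s : Finset ℕ, ord v (∏ i ∈ s, e i) = s.card * ord v d := by
      intro s
      classical
      induction s using Finset.induction_on with
      | empty => simp [ord_one]
      | insert a s ha ih => rw [Finset.prod_insert ha, Finset.card_insert_of_notMem ha, ord_mul, ih, he2]
                            push_cast; ring
    rw [this]; simp
  have hfin := hu.2
  rw [Units.val_pow_eq_pow_val, ← hprod, ge_unit, hord] at hfin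
  push_cast at hfin
  have := hℓ.pos
  have : (m : ℤ) ≤ ord v d := le_of_mul_le_mul_left hfin (by exact_mod_cast this)
  omega

lemma ge_lam {ζ : K} {lam : Kˣ} (hlam : (lam : K) = 1 - ζ) (v : HS K) : Ge v (ord v lam) (1 - ζ) := by
  rw [← hlam]; exact Ge.self lam

lemma ord_lam_nonneg {ζ : K} {ℓ : ℕ} (hℓ : ℓ.Prime) (hζ : IsPrimitiveRoot ζ ℓ) {lam : Kˣ}
    (hlam : (lam : K) = 1 - ζ) (v : HS K) : 0 ≤ ord v lam := by
  rw [← ge_unit, hlam]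
  exact Ge.one.sub (ge_root_of_unity hℓ.pos hζ.pow_eq_one)

lemma index_B_aux {ζ : K} {ℓ : ℕ} (hℓ : ℓ.Prime) (hζ : IsPrimitiveRoot ζ ℓ) {lam : Kˣ}
    (hlam : (lam : K) = 1 - ζ) :
    Ideal.absNorm (∏ v ∈ Lam lam, v.asIdeal ^ ((ℓ - 1) * (ord v lam).toNat)) ≤ ℓ ^ Module.finrank ℚ K := by
  have hnn := ord_lam_nonneg hℓ hζ hlam
  have hto : ∀ v : HS K, ((ord v lam).toNat : ℤ) = ord v lam := fun v => Int.toNat_of_nonneg (hnn v)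
  have h4 : Ideal.absNorm (Ideal.span {((ℓ : ℕ) : 𝓞 K)}) = ℓ ^ Module.finrank ℚ K := by
    rw [Ideal.absNorm_span_singleton]
    have := Algebra.norm_algebraMap (S := 𝓞 K) (R := ℤ) (ℓ : ℤ)
    simp only [algebraMap_int_eq, eq_intCast, Int.cast_natCast] at this
    rw [this, Int.natAbs_pow, Int.natAbs_natCast, RingOfIntegers.rank]
  rw [← h4]
  apply Nat.le_of_dvd
  · rw [h4]; exact pow_pos hℓ.pos _
  · apply Ideal.absNorm_dvd_absNorm_of_le
    rw [← Ideal.dvd_iff_le]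
    apply Finset.prod_dvd_of_coprime
    · intro u _ v _ huv
      rw [Function.onFun]
      apply IsCoprime.pow
      rw [Ideal.isCoprime_iff_sup_eq]
      exact Ideal.IsMaximal.coprime_of_ne u.isMaximal v.isMaximal (fun h => huv (HeightOneSpectrum.ext h))
    · intro v _
      rw [Ideal.dvd_iff_le, Ideal.span_singleton_le_iff_mem, ← ge_int_iff]
      have := ge_prime hℓ hζ (ge_lam hlam v)
      have h5 : (((ℓ - 1) * (ord v lam).toNat : ℕ) : ℤ) = (ℓ - 1) * ord v lam := by
        rw [Nat.cast_mul, hto, Nat.cast_sub hℓ.one_le]; simp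
      rw [h5]
      simpa using this

/-- inequality (i) -/
theorem index_B {ζ : K} {ℓ : ℕ} (hℓ : ℓ.Prime) (hζ : IsPrimitiveRoot ζ ℓ) {lam : Kˣ}
    (hlam : (lam : K) = 1 - ζ) :
    (Bn lam ℓ ⊔ (Bn lam 0).map (powMonoidHom ℓ)).relIndex (Bn lam 0) ≤ ℓ ^ Module.finrank ℚ K := by
  have hnn := ord_lam_nonneg hℓ hζ hlam
  have hto : ∀ v : HS K, ((ord v lam).toNat : ℤ) = ord v lam := fun v => Int.toNat_of_nonneg (hnn v)
  rw [relIndex_pow_aux ℓ (Bn lam 0) (Bn lam ℓ) (Bn_mono (Nat.zero_le _)) (relIndex_Bn_ne_zero lam _ _)]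
  have h1 : (Bn lam ℓ).comap (powMonoidHom ℓ) ⊓ Bn lam 0 ≤ Bn lam 1 := by
    rintro x ⟨hx1, hx2⟩
    rw [mem_Bn]
    intro v hv
    rw [one_mul]
    apply PU_of_pow hℓ hζ (by rw [hto]; exact ge_lam hlam v) (mem_B0.1 hx2 v hv)
    have hx3 : x ^ ℓ ∈ Bn lam ℓ := hx1
    exact mem_Bn.1 hx3 v hv
  refine (Subgroup.relIndex_le_of_le_right h1 (relIndex_Bn_ne_zero lam _ _)).trans ?_
  have h2 : (Bn lam ℓ).relIndex (Bn lam 1) ≤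
      ∏ v : Lam lam, Ideal.absNorm v.1.asIdeal ^ ((ℓ - 1) * (ord v.1 lam).toNat) := by
    have h0 : (Bn lam ℓ).relIndex (Bn lam 1) ≤
      ∏ v : Lam lam, (PU v.1 (ℓ * (ord v.1 lam).toNat)).relIndex (Bn lam 1) :=
        Subgroup.relIndex_iInf_le (L := Bn lam 1) (fun v : Lam lam => PU v.1 (ℓ * (ord v.1 lam).toNat))
    refine h0.trans ?_
    apply Finset.prod_le_prod (fun _ _ => Nat.zero_le _)
    intro v _
    have hv := mem_Lam.1 v.2
    have h3 := relIndex_PU v.1 (j := 1 * (ord v.1 lam).toNat) (k := ℓ * (ord v.1 lam).toNat)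
      (by have := hto v.1; omega) (Nat.mul_le_mul_right _ hℓ.one_le)
    rw [← Nat.sub_mul] at h3
    rw [← h3]
    apply Subgroup.relIndex_le_of_le_right
    · intro x hx; exact mem_Bn.1 hx v.1 v.2
    · rw [h3]; exact pow_ne_zero _ (by have := absNorm_gt_one v.1; omega)
  refine h2.trans ?_
  have h3 : ∏ v : Lam lam, Ideal.absNorm v.1.asIdeal ^ ((ℓ - 1) * (ord v.1 lam).toNat) =
      Ideal.absNorm (∏ v ∈ Lam lam, v.asIdeal ^ ((ℓ - 1) * (ord v lam).toNat)) := by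
    rw [map_prod]
    simp only [map_pow]
    exact Finset.prod_coe_sort (Lam lam)
      (fun v => Ideal.absNorm v.asIdeal ^ ((ℓ - 1) * (ord v lam).toNat))
  rw [h3]
  exact index_B_aux hℓ hζ hlam

end
end CFT
end P4b

section P4c
open NumberField IsDedekindDomain HeightOneSpectrum
open scoped nonZeroDivisors Pointwise
set_option linter.unusedSectionVars false
namespace CFT
section
variable {K : Type*} [Field K] [NumberField K]

/-- number of ℓ-torsion classes -/
noncomputable def ctors (K : Type*) [Field K] [NumberField K] (ℓ : ℕ) : ℕ :=
  Nat.card {x : ClassGroup (𝓞 K) // x ^ ℓ = 1}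

noncomputable def WW (ℓ : ℕ) (lam : Kˣ) : Subgroup Kˣ where
  carrier := {x | x ∈ Bn lam 0 ∧ ∀ v : HS K, (ℓ : ℤ) ∣ ord v x}
  one_mem' := ⟨one_mem _, fun v => by rw [ord_one]; exact dvd_zero _⟩
  mul_mem' := fun hx hy => ⟨mul_mem hx.1 hy.1, fun v => by rw [ord_mul]; exact dvd_add (hx.2 v) (hy.2 v)⟩
  inv_mem' := fun hx => ⟨inv_mem hx.1, fun v => by rw [ord_inv]; exact (dvd_neg).2 (hx.2 v)⟩

lemma mem_WW {ℓ : ℕ} {lam x : Kˣ} : x ∈ WW ℓ lam ↔ x ∈ Bn lam 0 ∧ ∀ v : HS K, (ℓ : ℤ) ∣ ord v x := Iff.rfl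

noncomputable def dvd' (ℓ : ℕ) (x : Kˣ) : HS K →₀ ℤ := (dv x).mapRange (· / (ℓ : ℤ)) (by simp)
lemma dvd'_spec {ℓ : ℕ} {lam x : Kˣ} (hx : x ∈ WW ℓ lam) : ℓ • dvd' ℓ x = dv x := by
  ext v
  simp only [dvd', Finsupp.smul_apply, Finsupp.mapRange_apply, dv_apply, nsmul_eq_mul]
  exact Int.mul_ediv_cancel' (hx.2 v)

lemma nsmul_inj {ℓ : ℕ} (hℓ : ℓ ≠ 0) {D E : HS K →₀ ℤ} (h : ℓ • D = ℓ • E) : D = E := by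
  ext v
  have := DFunLike.congr_fun h v
  simp only [Finsupp.smul_apply, nsmul_eq_mul] at this
  exact mul_left_cancel₀ (by exact_mod_cast hℓ) this

/-- the map `α ↦ [(α)^{1/ℓ}]` -/
noncomputable def kap {ℓ : ℕ} (hℓ : ℓ ≠ 0) (lam : Kˣ) : WW ℓ lam →* ClassGroup (𝓞 K) where
  toFun x := (cl (dvd' ℓ (x : Kˣ))).toMul
  map_one' := by
    have : dvd' ℓ ((1 : WW ℓ lam) : Kˣ) = 0 := nsmul_inj hℓ (by
      rw [dvd'_spec (1 : WW ℓ lam).2, smul_zero]; exact dv_one)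
    rw [this, map_zero]; rfl
  map_mul' x y := by
    have : dvd' ℓ ((x * y : WW ℓ lam) : Kˣ) = dvd' ℓ (x : Kˣ) + dvd' ℓ (y : Kˣ) := nsmul_inj hℓ (by
      rw [smul_add, dvd'_spec (x * y).2, dvd'_spec x.2, dvd'_spec y.2]; exact dv_mul _ _)
    rw [this, map_add]; rfl

lemma kap_range {ℓ : ℕ} (hℓ : ℓ ≠ 0) (lam : Kˣ) (c : ClassGroup (𝓞 K)) :
    c ∈ (kap hℓ lam).range ↔ c ^ ℓ = 1 := by
  constructor
  · rintro ⟨x, rfl⟩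
    have : ℓ • cl (dvd' ℓ (x : Kˣ)) = 0 := by
      rw [← map_nsmul, dvd'_spec x.2, cl_dv]
    exact this
  · intro hc
    obtain ⟨D, hD⟩ := cl_surjective (Additive.ofMul c)
    obtain ⟨E, y, hE1, hE2, -⟩ := cl_off (Lam lam) D
    have h1 : cl (ℓ • E) = 0 := by rw [map_nsmul, hE2, hD]; exact hc
    obtain ⟨x, hx⟩ := (cl_eq_zero_iff _).1 h1
    have hxv : ∀ v, ord v x = ℓ * E v := by
      intro v; rw [← dv_apply, hx]; simp
    have hxW : x ∈ WW ℓ lam := ⟨mem_B0.2 (fun v hv => by rw [hxv, hE1 v hv, mul_zero]),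
      fun v => ⟨_, hxv v⟩⟩
    refine ⟨⟨x, hxW⟩, ?_⟩
    have : dvd' ℓ x = E := nsmul_inj hℓ (by rw [dvd'_spec hxW, hx])
    change (cl (dvd' ℓ x)).toMul = c
    rw [this, hE2, hD]; rfl

lemma kap_ker {ℓ : ℕ} (hℓ : ℓ ≠ 0) (lam : Kˣ) (x : WW ℓ lam) :
    x ∈ (kap hℓ lam).ker ↔ (x : Kˣ) ∈ SU ∅ ⊔ (Bn lam 0).map (powMonoidHom ℓ) := by
  have h0 : x ∈ (kap hℓ lam).ker ↔ cl (dvd' ℓ (x : Kˣ)) = 0 := Iff.rfl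
  rw [h0, cl_eq_zero_iff]
  constructor
  · rintro ⟨y, hy⟩
    have h1 : ∀ v, ord v (x : Kˣ) = ℓ * ord v y := by
      intro v
      have := dvd'_spec x.2
      rw [← hy] at this
      have := DFunLike.congr_fun this v
      simpa using this.symm
    have hx : (x : Kˣ) = (x / y ^ ℓ) * y ^ ℓ := by simp
    rw [hx]
    apply Subgroup.mul_mem_sup
    · rw [mem_SU]; intro v _; rw [ord_div, ord_pow, h1, sub_self]
    · refine ⟨y, ?_, rfl⟩
      change y ∈ Bn lam 0
      rw [mem_B0]
      intro v hv
      have h2 := mem_B0.1 x.2.1 v hv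
      rw [h1] at h2
      rcases mul_eq_zero.1 h2 with h3 | h3
      · exact absurd (by exact_mod_cast h3) hℓ
      · exact h3
  · intro h
    obtain ⟨u, hu, _, ⟨y, hy, rfl⟩, hxy⟩ := Subgroup.mem_sup.1 h
    refine ⟨y, nsmul_inj hℓ ?_⟩
    rw [dvd'_spec x.2, ← hxy]
    ext v
    simp [ord_mul, ord_pow, hu v (Finset.notMem_empty v)]

lemma SU_le_WW {ℓ : ℕ} (lam : Kˣ) : SU ∅ ≤ WW ℓ lam := fun x hx =>
  ⟨mem_B0.2 (fun v _ => hx v (Finset.notMem_empty v)), fun v => by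
    rw [hx v (Finset.notMem_empty v)]; exact dvd_zero _⟩
lemma pow_le_WW {ℓ : ℕ} (lam : Kˣ) : (Bn lam 0).map (powMonoidHom ℓ) ≤ WW ℓ lam := by
  rintro _ ⟨x, hx, rfl⟩
  exact ⟨Subgroup.pow_mem _ hx ℓ, fun v => ⟨ord v x, ord_pow v x ℓ⟩⟩

lemma index_W_cl {ℓ : ℕ} (hℓ : ℓ ≠ 0) (lam : Kˣ) :
    (SU ∅ ⊔ (Bn lam 0).map (powMonoidHom ℓ)).relIndex (WW ℓ lam) = ctors K ℓ := by
  have h1 : (SU ∅ ⊔ (Bn lam 0).map (powMonoidHom ℓ)).subgroupOf (WW ℓ lam) = (kap hℓ lam).ker := by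
    ext x
    rw [kap_ker, Subgroup.mem_subgroupOf]
  rw [Subgroup.relIndex, h1, Subgroup.index_ker]
  exact Nat.card_congr (Equiv.subtypeEquivRight (kap_range hℓ lam))

lemma index_units {ζ : K} {ℓ : ℕ} (hℓ : ℓ.Prime) (hζ : IsPrimitiveRoot ζ ℓ) (lam : Kˣ) :
    ℓ ^ Fintype.card (InfinitePlace K) ≤ ((Bn lam 0).map (powMonoidHom ℓ)).relIndex (SU ∅) := by
  obtain ⟨hf, hi⟩ := q_nsmul (C := Additive (SU (∅ : Finset (HS K)))) ℓ hℓ.ne_zero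
  have hr := finrank_SU (∅ : Finset (HS K))
  have h1 : (((Bn lam 0).map (powMonoidHom ℓ)).relIndex (SU ∅)) =
      (nsmulAddMonoidHom (α := Additive (SU (∅ : Finset (HS K)))) ℓ).range.index := by
    have h2 : ((Bn lam 0).map (powMonoidHom ℓ)).subgroupOf (SU ∅) =
        (powMonoidHom (α := SU (∅ : Finset (HS K))) ℓ).range := by
      ext x
      rw [Subgroup.mem_subgroupOf]
      constructor
      · rintro ⟨y, hy, hyx⟩
        refine ⟨⟨y, ?_⟩, Subtype.ext hyx⟩
        intro v hv
        have h3 := x.2 v hv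
        rw [← hyx] at h3
        change ord v (y ^ ℓ) = 0 at h3
        rw [ord_pow] at h3
        rcases mul_eq_zero.1 h3 with h4 | h4
        · exact absurd (by exact_mod_cast h4) hℓ.ne_zero
        · exact h4
      · rintro ⟨y, rfl⟩
        exact ⟨y, mem_B0.2 (fun v _ => y.2 v (Finset.notMem_empty v)), rfl⟩
    rw [Subgroup.relIndex, h2]
    rfl
  rw [h1, hi]
  have hz : 1 < ℓ := hℓ.one_lt
  have hker : ℓ ≤ Nat.card (nsmulAddMonoidHom (α := Additive (SU (∅ : Finset (HS K)))) ℓ).ker := by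
    have hz0 : ζ ≠ 0 := hζ.ne_zero hℓ.ne_zero
    have hzu : ∀ v : HS K, ord v (Units.mk0 ζ hz0) = 0 := by
      intro v
      have h5 : ord v ((Units.mk0 ζ hz0) ^ ℓ) = 0 := by
        have : (Units.mk0 ζ hz0) ^ ℓ = 1 := by ext; simpa using hζ.pow_eq_one
        rw [this, ord_one]
      rw [ord_pow] at h5
      rcases mul_eq_zero.1 h5 with h4 | h4
      · exact absurd (by exact_mod_cast h4) hℓ.ne_zero
      · exact h4
    let z : SU (∅ : Finset (HS K)) := ⟨Units.mk0 ζ hz0, fun v _ => hzu v⟩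
    have hzp : z ^ ℓ = 1 := by
      ext; change (ζ ^ ℓ : K) = 1; exact hζ.pow_eq_one
    let f : Fin ℓ → (nsmulAddMonoidHom (α := Additive (SU (∅ : Finset (HS K)))) ℓ).ker :=
      fun i => ⟨Additive.ofMul (z ^ (i : ℕ)), by
        rw [AddMonoidHom.mem_ker]
        change (z ^ (i : ℕ)) ^ ℓ = 1
        rw [← pow_mul, mul_comm, pow_mul, hzp, one_pow]⟩
    have hfi : Function.Injective f := by
      intro i j hij
      have h1 : z ^ (i : ℕ) = z ^ (j : ℕ) := congrArg Subtype.val hij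
      have h2 : ζ ^ (i : ℕ) = ζ ^ (j : ℕ) := by
        have := congrArg (fun t : SU (∅ : Finset (HS K)) => ((t : Kˣ) : K)) h1
        simp only [Subgroup.coe_pow, Units.val_pow_eq_pow_val] at this
        exact this
      exact Fin.ext (hζ.pow_inj i.2 j.2 h2)
    have := Nat.card_le_card_of_injective f hfi
    simpa using this
  calc ℓ ^ Fintype.card (InfinitePlace K) = ℓ ^ Module.finrank ℤ (Additive (SU (∅ : Finset (HS K)))) * ℓ := by
        rw [← pow_succ, hr]; simp
    _ ≤ _ := Nat.mul_le_mul_left _ hker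

theorem index_W {ζ : K} {ℓ : ℕ} (hℓ : ℓ.Prime) (hζ : IsPrimitiveRoot ζ ℓ) (lam : Kˣ) :
    ℓ ^ Fintype.card (InfinitePlace K) * ctors K ℓ ≤ ((Bn lam 0).map (powMonoidHom ℓ)).relIndex (WW ℓ lam) := by
  have h1 : SU ∅ ⊔ (Bn lam 0).map (powMonoidHom ℓ) ≤ WW ℓ lam :=
    sup_le (SU_le_WW (ℓ := ℓ) lam) (pow_le_WW (ℓ := ℓ) lam)
  have h2 : (Bn lam 0).map (powMonoidHom ℓ) ≤ SU ∅ ⊔ (Bn lam 0).map (powMonoidHom ℓ) := le_sup_right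
  have h3 := Subgroup.relIndex_mul_relIndex _ _ _ h2 h1
  rw [index_W_cl hℓ.ne_zero, Subgroup.relIndex_sup_right] at h3
  rw [← h3]
  exact Nat.mul_le_mul_right _ (index_units hℓ hζ lam)

lemma ctors_pos (ℓ : ℕ) : 0 < ctors K ℓ := by
  unfold ctors
  have : Nonempty {x : ClassGroup (𝓞 K) // x ^ ℓ = 1} := ⟨⟨1, one_pow _⟩⟩
  exact Nat.card_pos

end
end CFT
end P4c

section P4d
open NumberField IsDedekindDomain HeightOneSpectrum
open scoped nonZeroDivisors Pointwise
set_option linter.unusedSectionVars false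
namespace CFT

lemma prime_le_relIndex {A : Type*} [CommGroup A] {ℓ : ℕ} (hℓ : ℓ.Prime) (J : Subgroup A) (s : A)
    (hs : s ∉ J) (hp : s ^ ℓ ∈ J) (h0 : J.relIndex (Subgroup.zpowers s) ≠ 0) :
    ℓ ≤ J.relIndex (Subgroup.zpowers s) := by
  have hfact : Fact ℓ.Prime := ⟨hℓ⟩
  let Z := Subgroup.zpowers s
  let g : Z ⧸ J.subgroupOf Z := QuotientGroup.mk ⟨s, Subgroup.mem_zpowers s⟩
  have hg1 : g ≠ 1 := by
    intro h
    rw [QuotientGroup.eq_one_iff, Subgroup.mem_subgroupOf] at h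
    exact hs h
  have hgp : g ^ ℓ = 1 := by
    change QuotientGroup.mk (⟨s, Subgroup.mem_zpowers s⟩ ^ ℓ : Z) = _
    rw [QuotientGroup.eq_one_iff, Subgroup.mem_subgroupOf]
    exact hp
  have h1 := orderOf_eq_prime hgp hg1
  have h2 := orderOf_dvd_natCard g
  rw [h1] at h2
  exact Nat.le_of_dvd (Nat.pos_of_ne_zero h0) h2

lemma exists_gens {A : Type*} [CommGroup A] {ℓ : ℕ} (hℓ : ℓ.Prime) (I : Subgroup A) (S : Set A)
    (hS : Subgroup.closure S = I) : ∀ (N : ℕ) (J : Subgroup A), J ≤ I → (∀ x ∈ I, x ^ ℓ ∈ J) →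
    J.relIndex I = N → N ≠ 0 → 
    ∃ T : Finset A, (T : Set A) ⊆ S ∧ I ≤ J ⊔ Subgroup.closure (T : Set A) ∧ ℓ ^ T.card ≤ N := by
  classical
  intro N
  induction N using Nat.strong_induction_on with
  | _ N ih =>
    intro J hJI hpow hN hN0
    by_cases hIJ : S ⊆ J
    · refine ⟨∅, by simp, ?_, by simpa using Nat.one_le_iff_ne_zero.2 hN0⟩
      rw [← hS]
      exact ((Subgroup.closure_le J).2 hIJ).trans le_sup_left
    · obtain ⟨s, hsS, hsJ⟩ := Set.not_subset.1 hIJ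
      have hsI : s ∈ I := hS ▸ Subgroup.subset_closure hsS
      have hZ : Subgroup.zpowers s ≤ I := by
        rw [Subgroup.zpowers_le]; exact hsI
      have h1 := Subgroup.relIndex_mul_relIndex J (J ⊔ Subgroup.zpowers s) I le_sup_left (sup_le hJI hZ)
      rw [Subgroup.relIndex_sup_left, hN] at h1
      have hne1 : J.relIndex (Subgroup.zpowers s) ≠ 0 := by
        intro h; rw [h, zero_mul] at h1; exact hN0 h1.symm
      have hne2 : (J ⊔ Subgroup.zpowers s).relIndex I ≠ 0 := by
        intro h; rw [h, mul_zero] at h1; exact hN0 h1.symm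
      have hge := prime_le_relIndex hℓ J s hsJ (hpow s hsI) hne1
      have hmul : ℓ * (J ⊔ Subgroup.zpowers s).relIndex I ≤ N := by
        rw [← h1]; exact Nat.mul_le_mul_right _ hge
      obtain ⟨T, hT1, hT2, hT3⟩ := ih ((J ⊔ Subgroup.zpowers s).relIndex I) (by
        have := hℓ.two_le
        have h3 := Nat.pos_of_ne_zero hne2
        nlinarith) _ (sup_le hJI hZ) (fun x hx => Subgroup.mem_sup_left (hpow x hx)) rfl hne2
      refine ⟨insert s T, ?_, ?_, ?_⟩
      · rw [Finset.coe_insert]; exact Set.insert_subset hsS hT1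
      · rw [Finset.coe_insert, Set.insert_eq, Subgroup.closure_union, ← Subgroup.zpowers_eq_closure,
          ← sup_assoc]
        exact hT2
      · calc ℓ ^ (insert s T).card ≤ ℓ ^ (T.card + 1) :=
            Nat.pow_le_pow_right hℓ.pos (Finset.card_insert_le _ _)
          _ = ℓ * ℓ ^ T.card := by ring
          _ ≤ ℓ * (J ⊔ Subgroup.zpowers s).relIndex I := Nat.mul_le_mul_left _ hT3
          _ ≤ N := hmul

section
variable {K : Type*} [Field K] [NumberField K]

/-- divisor map, multiplicative -/
noncomputable def dvM : Kˣ →* Multiplicative (HS K →₀ ℤ) where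
  toFun x := Multiplicative.ofAdd (dv x)
  map_one' := by rw [dv_one]; rfl
  map_mul' x y := by rw [dv_mul]; rfl

noncomputable def clM : Multiplicative (HS K →₀ ℤ) →* ClassGroup (𝓞 K) where
  toFun D := (cl D.toAdd).toMul
  map_one' := by simp
  map_mul' x y := by simp

/-- divisors off `S` -/
noncomputable def II (S : Finset (HS K)) : Subgroup (Multiplicative (HS K →₀ ℤ)) where
  carrier := {D | ∀ v ∈ S, D.toAdd v = 0}
  one_mem' := by simp
  mul_mem' := fun {a b} ha hb v hv => by simp [ha v hv, hb v hv]
  inv_mem' := fun {a} ha v hv => by simp [ha v hv]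

lemma mem_II {S : Finset (HS K)} {D : Multiplicative (HS K →₀ ℤ)} :
    D ∈ II S ↔ ∀ v ∈ S, D.toAdd v = 0 := Iff.rfl

/-- the prime divisor -/
noncomputable def pd (v : HS K) : Multiplicative (HS K →₀ ℤ) := Multiplicative.ofAdd (Finsupp.single v 1)

lemma pd_inj : Function.Injective (pd (K := K)) := by
  intro u v h
  have : Finsupp.single u (1:ℤ) = Finsupp.single v 1 := h
  exact Finsupp.single_left_injective one_ne_zero this

lemma closure_pd (S : Finset (HS K)) : Subgroup.closure (pd '' {v | v ∉ S}) = II S := by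
  apply le_antisymm
  · rw [Subgroup.closure_le]
    rintro _ ⟨v, hv, rfl⟩ u hu
    have : v ≠ u := by rintro rfl; exact hv hu
    simp [pd, this]
  · intro D hD
    have h1 : D = D.toAdd.support.prod (fun v => pd v ^ (D.toAdd v)) := by
      apply Multiplicative.toAdd.injective
      rw [toAdd_prod]
      conv_lhs => rw [← Finsupp.sum_single D.toAdd]
      apply Finset.sum_congr rfl
      intro v _
      rw [toAdd_zpow]
      simp [pd]
    rw [h1]
    apply Subgroup.prod_mem
    intro v hv
    apply Subgroup.zpow_mem
    apply Subgroup.subset_closure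
    refine ⟨v, ?_, rfl⟩
    intro hvS
    exact (Finsupp.mem_support_iff.1 hv) (hD v hvS)

noncomputable def Jn (ℓ : ℕ) (lam : Kˣ) (k : ℕ) : Subgroup (Multiplicative (HS K →₀ ℤ)) :=
  (II (Lam lam)).map (powMonoidHom ℓ) ⊔ (Bn lam k).map dvM

lemma Jn_le (ℓ : ℕ) (lam : Kˣ) (k : ℕ) : Jn ℓ lam k ≤ II (Lam lam) := by
  apply sup_le
  · rintro _ ⟨x, hx, rfl⟩; exact Subgroup.pow_mem _ hx ℓ
  · rintro _ ⟨x, hx, rfl⟩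
    exact fun v hv => mem_B0.1 (Bn_mono (Nat.zero_le _) hx) v hv

lemma index_J0 (ℓ : ℕ) (lam : Kˣ) : (Jn ℓ lam 0).relIndex (II (Lam lam)) = ctors K ℓ := by
  let P : Subgroup (ClassGroup (𝓞 K)) := (powMonoidHom ℓ).range
  have hP : P.index = ctors K ℓ := by
    have h1 := Subgroup.index_mul_card P
    have h2 := Subgroup.index_mul_card (powMonoidHom (α := ClassGroup (𝓞 K)) ℓ).ker
    rw [Subgroup.index_ker, ← h1, mul_comm] at h2
    exact (Nat.eq_of_mul_eq_mul_right Nat.card_pos h2).symm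
  have hsurj : (II (Lam lam)).map clM = ⊤ := by
    rw [Subgroup.eq_top_iff']
    intro c
    obtain ⟨D, hD⟩ := cl_surjective (Additive.ofMul c)
    obtain ⟨E, y, hE1, hE2, -⟩ := cl_off (Lam lam) D
    refine ⟨Multiplicative.ofAdd E, hE1, ?_⟩
    change (cl E).toMul = c
    rw [hE2, hD]; rfl
  have hJ : P.comap clM ⊓ II (Lam lam) = Jn ℓ lam 0 := by
    apply le_antisymm
    · rintro D ⟨⟨c, hc⟩, hD2⟩
      have : c ∈ (II (Lam lam)).map clM := hsurj ▸ Subgroup.mem_top c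
      obtain ⟨E, hE, rfl⟩ := this
      have h1 : clM (D / E ^ ℓ) = 1 := by
        rw [map_div, map_pow, ← hc]; exact div_self' _
      have h2 : cl (D / E ^ ℓ).toAdd = 0 := h1
      obtain ⟨x, hx⟩ := (cl_eq_zero_iff _).1 h2
      have hx' : dvM x = D / E ^ ℓ := congrArg Multiplicative.ofAdd hx
      have hDE : D = E ^ ℓ * dvM x := by rw [hx']; simp
      rw [hDE]
      apply Subgroup.mul_mem_sup
      · exact ⟨E, hE, rfl⟩
      · refine ⟨x, ?_, rfl⟩
        have h3 : dvM x ∈ II (Lam lam) := by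
          rw [hx']; exact Subgroup.div_mem _ hD2 (Subgroup.pow_mem _ hE ℓ)
        exact mem_B0.2 h3
    · refine le_inf ?_ (Jn_le ℓ lam 0)
      apply sup_le
      · rintro _ ⟨E, _, rfl⟩
        exact ⟨clM E, (map_pow clM E ℓ).symm⟩
      · rintro _ ⟨x, _, rfl⟩
        have : clM (dvM x) = 1 := cl_dv x
        rw [Subgroup.mem_comap, this]; exact one_mem _
  rw [← hJ, Subgroup.inf_relIndex_right, Subgroup.relIndex_comap, hsurj, Subgroup.relIndex_top_right, hP]

lemma index_J (ℓ : ℕ) (lam : Kˣ) : (Jn ℓ lam ℓ).relIndex (Jn ℓ lam 0) =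
    (Bn lam ℓ ⊔ WW ℓ lam).relIndex (Bn lam 0) := by
  have h1 : Jn ℓ lam 0 = Jn ℓ lam ℓ ⊔ (Bn lam 0).map dvM := by
    unfold Jn
    rw [sup_assoc]
    congr 1
    rw [sup_eq_right.2]
    exact Subgroup.map_mono (Bn_mono (Nat.zero_le _))
  have h2 : (Jn ℓ lam ℓ).comap dvM ⊓ Bn lam 0 = Bn lam ℓ ⊔ WW ℓ lam := by
    apply le_antisymm
    · rintro x ⟨hx1, hx2⟩
      obtain ⟨_, ⟨E, hE, rfl⟩, _, ⟨y, hy, rfl⟩, hxy⟩ := Subgroup.mem_sup.1 hx1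
      have : x = y * (x / y) := by simp
      rw [this]
      apply Subgroup.mul_mem_sup hy
      refine ⟨Subgroup.div_mem _ hx2 (Bn_mono (Nat.zero_le _) hy), fun v => ?_⟩
      have h3 : dvM (x / y) = E ^ ℓ := by
        rw [map_div, ← hxy]; simp
      have h4 := DFunLike.congr_fun (congrArg Multiplicative.toAdd h3) v
      change ord v (x / y) = _ at h4
      rw [h4]
      exact ⟨E.toAdd v, by rw [toAdd_pow]; simp⟩
    · apply sup_le
      · intro x hx
        exact ⟨Subgroup.mem_sup_right ⟨x, hx, rfl⟩, Bn_mono (Nat.zero_le _) hx⟩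
      · intro x hx
        refine ⟨Subgroup.mem_sup_left ⟨Multiplicative.ofAdd (dvd' ℓ x), ?_, ?_⟩, hx.1⟩
        · intro v hv
          have : ord v x = 0 := mem_B0.1 hx.1 v hv
          simp [dvd', this]
        · exact congrArg Multiplicative.ofAdd (dvd'_spec hx)
  rw [h1, Subgroup.relIndex_sup_left, ← h2, Subgroup.inf_relIndex_right, Subgroup.relIndex_comap]

lemma index_R (ℓ : ℕ) (lam : Kˣ) : (Jn ℓ lam ℓ).relIndex (II (Lam lam)) =
    (Bn lam ℓ ⊔ WW ℓ lam).relIndex (Bn lam 0) * ctors K ℓ := by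
  rw [← index_J, ← index_J0 ℓ lam]
  refine (Subgroup.relIndex_mul_relIndex (Jn ℓ lam ℓ) (Jn ℓ lam 0) _ ?_ (Jn_le ℓ lam 0)).symm
  exact sup_le_sup_left (Subgroup.map_mono (Bn_mono (Nat.zero_le _))) _

end
end CFT
end P4d

section P4e
open NumberField IsDedekindDomain HeightOneSpectrum
open scoped nonZeroDivisors Pointwise
set_option linter.unusedSectionVars false
namespace CFT

lemma pow_mem_of_div {A : Type*} [CommGroup A] {ℓ : ℕ} (hℓ : ℓ.Prime) (I Q : Subgroup A) (hQI : Q ≤ I)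
    (h0 : Q.relIndex I ≠ 0) (hdiv : I ≤ I.map (powMonoidHom ℓ) ⊔ Q) :
    ∃ h' : ℕ, Nat.Coprime h' ℓ ∧ ∀ x ∈ I, x ^ h' ∈ Q := by
  obtain ⟨k, h', hh, hm⟩ := Nat.exists_eq_pow_mul_and_not_dvd h0 ℓ hℓ.ne_one
  refine ⟨h', (Nat.Coprime.symm ((Nat.Prime.coprime_iff_not_dvd hℓ).2 hh)), ?_⟩
  have h1 : ∀ j : ℕ, ∀ x ∈ I, ∃ y ∈ I, x / y ^ (ℓ ^ j) ∈ Q := by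
    intro j
    induction j with
    | zero => intro x hx; exact ⟨x, hx, by simp⟩
    | succ j ih =>
      intro x hx
      obtain ⟨y, hy, hxy⟩ := ih x hx
      obtain ⟨_, ⟨z, hz, rfl⟩, q, hq, hzq⟩ := Subgroup.mem_sup.1 (hdiv hy)
      refine ⟨z, hz, ?_⟩
      have : x / z ^ (ℓ ^ (j+1)) = x / y ^ (ℓ ^ j) * q ^ (ℓ ^ j) := by
        rw [← hzq, powMonoidHom_apply, mul_pow, ← pow_mul, ← pow_succ', ← div_div, div_mul_cancel]
      rw [this]
      exact Subgroup.mul_mem _ hxy (Subgroup.pow_mem _ hq _)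
  intro x hx
  obtain ⟨y, hy, hxy⟩ := h1 k x hx
  have h2 : y ^ (Q.relIndex I) ∈ Q := by
    have := Subgroup.pow_index_mem (Q.subgroupOf I) (⟨y, hy⟩ : I)
    rw [Subgroup.mem_subgroupOf] at this
    exact this
  have h3 : x ^ h' = (x / y ^ (ℓ ^ k)) ^ h' * y ^ (Q.relIndex I) := by
    rw [hm, div_pow, ← pow_mul, div_mul_cancel]
  rw [h3]
  exact Subgroup.mul_mem _ (Subgroup.pow_mem _ hxy _) h2

section
variable {K : Type*} [Field K] [NumberField K]

lemma index_dvB_ne_zero (lam : Kˣ) (k : ℕ) : ((Bn lam k).map dvM).relIndex (II (Lam lam)) ≠ 0 := by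
  have h1 : ((Bn lam 0).map dvM).relIndex (II (Lam lam)) ≠ 0 := by
    have h2 : (clM (K := K)).ker ⊓ II (Lam lam) ≤ (Bn lam 0).map dvM := by
      rintro D ⟨hD1, hD2⟩
      obtain ⟨x, hx⟩ := (cl_eq_zero_iff D.toAdd).1 hD1
      have hx' : dvM x = D := congrArg Multiplicative.ofAdd hx
      refine ⟨x, ?_, hx'⟩
      rw [← hx'] at hD2
      exact mem_B0.2 hD2
    intro h3
    have h4 := Subgroup.relIndex_eq_zero_of_le_left h2 h3
    rw [Subgroup.inf_relIndex_right] at h4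
    have h5 : (clM (K := K)).ker.index ≠ 0 := by
      rw [Subgroup.index_ker]; exact Nat.card_pos.ne'
    have h6 := Subgroup.relIndex_dvd_index_of_normal (clM (K := K)).ker (II (Lam lam))
    rw [h4] at h6
    exact h5 (Nat.eq_zero_of_zero_dvd h6)
  have h2 : ((Bn lam k).map dvM).relIndex ((Bn lam 0).map dvM) ≠ 0 := by
    rw [← Subgroup.relIndex_comap]
    intro h
    exact relIndex_Bn_ne_zero lam 0 k (Subgroup.relIndex_eq_zero_of_le_left (Subgroup.le_comap_map dvM _) h)
  exact Subgroup.relIndex_ne_zero_trans h2 h1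

/-- Choice of the auxiliary set `T`. -/
theorem exists_T {ℓ : ℕ} (hℓ : ℓ.Prime) (lam : Kˣ) : ∃ (T : Finset (HS K)) (h' : ℕ),
    (∀ v ∈ T, v ∉ Lam lam) ∧
    ℓ ^ T.card ≤ (Bn lam ℓ ⊔ WW ℓ lam).relIndex (Bn lam 0) * ctors K ℓ ∧
    Nat.Coprime h' ℓ ∧
    ∀ D : HS K →₀ ℤ, (∀ v ∈ Lam lam, D v = 0) → ∃ γ ∈ Bn lam ℓ, ∀ u ∉ T, ord u γ = h' * D u := by
  classical
  have hR : (Jn ℓ lam ℓ).relIndex (II (Lam lam)) ≠ 0 := by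
    intro h
    exact index_dvB_ne_zero lam ℓ (Subgroup.relIndex_eq_zero_of_le_left le_sup_right h)
  obtain ⟨T0, hT1, hT2, hT3⟩ := exists_gens hℓ (II (Lam lam)) _ (closure_pd (Lam lam)) _ (Jn ℓ lam ℓ)
    (Jn_le ℓ lam ℓ) (fun x hx => Subgroup.mem_sup_left ⟨x, hx, rfl⟩) rfl hR
  let T : Finset (HS K) := T0.preimage pd pd_inj.injOn
  have hTT : (T0 : Set _) = pd '' (T : Set (HS K)) := by
    ext D
    constructor
    · intro h
      obtain ⟨v, _, rfl⟩ := hT1 h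
      exact ⟨v, by simpa [T] using h, rfl⟩
    · rintro ⟨v, hv, rfl⟩
      simpa [T] using hv
  have hTL : ∀ v ∈ T, v ∉ Lam lam := by
    intro v hv
    have h1 : pd v ∈ (T0 : Set _) := by rw [hTT]; exact ⟨v, hv, rfl⟩
    obtain ⟨u, hu, huv⟩ := hT1 h1
    rw [← pd_inj huv]; exact hu
  have hcard : T.card = T0.card := by
    have h1 : T0 = T.image pd := by
      apply Finset.coe_injective; rw [hTT, Finset.coe_image]
    rw [h1, Finset.card_image_of_injective _ pd_inj]
  have hTI : Subgroup.closure (T0 : Set (Multiplicative (HS K →₀ ℤ))) ≤ II (Lam lam) := by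
    rw [← closure_pd]; exact Subgroup.closure_mono hT1
  let Q := (Bn lam ℓ).map dvM ⊔ Subgroup.closure (T0 : Set (Multiplicative (HS K →₀ ℤ)))
  have hQI : Q ≤ II (Lam lam) := sup_le (le_sup_right.trans (Jn_le ℓ lam ℓ)) hTI
  obtain ⟨h', hc, hh⟩ := pow_mem_of_div hℓ (II (Lam lam)) Q hQI
    (fun h => index_dvB_ne_zero lam ℓ (Subgroup.relIndex_eq_zero_of_le_left le_sup_left h))
    (by rw [← sup_assoc]; exact hT2)
  refine ⟨T, h', hTL, ?_, hc, ?_⟩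
  · rw [hcard, ← index_R]; exact hT3
  · intro D hD
    obtain ⟨_, ⟨γ, hγ, rfl⟩, E, hE, hgE⟩ := Subgroup.mem_sup.1 (hh (Multiplicative.ofAdd D) hD)
    refine ⟨γ, hγ, fun u hu => ?_⟩
    have hE0 : E.toAdd u = 0 := by
      have h1 : Subgroup.closure (T0 : Set (Multiplicative (HS K →₀ ℤ))) ≤ II {u} := by
        rw [Subgroup.closure_le, hTT]
        rintro _ ⟨v, hv, rfl⟩ u' hu'
        rw [Finset.mem_singleton] at hu'
        have : v ≠ u' := by rintro rfl; rw [hu'] at hv; exact hu hv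
        simp [pd, this]
      exact h1 hE u (Finset.mem_singleton_self u)
    have h2 := DFunLike.congr_fun (congrArg Multiplicative.toAdd hgE) u
    rw [toAdd_mul, toAdd_pow, Finsupp.add_apply, hE0, add_zero] at h2
    change ord u γ = _ at h2
    rw [h2]; simp

end
end CFT
end P4e

section P4f
open NumberField IsDedekindDomain HeightOneSpectrum
open scoped nonZeroDivisors Pointwise
set_option linter.unusedSectionVars false
namespace CFT
section
variable {K : Type*} [Field K] [NumberField K]

lemma ge_prim {w : HS K} {ℓ : ℕ} (hℓ : ℓ.Prime) {ζ η : K} (hζ : IsPrimitiveRoot ζ ℓ)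
    (hη : η ^ ℓ = 1) (hη1 : η ≠ 1) {m : ℤ} (h : Ge w m (η - 1)) : Ge w m (1 - ζ) := by
  have : NeZero ℓ := ⟨hℓ.ne_zero⟩
  have hη' : IsPrimitiveRoot η ℓ := by
    have h1 := orderOf_dvd_of_pow_eq_one hη
    rcases (Nat.dvd_prime hℓ).1 h1 with h2 | h2
    · exact absurd (orderOf_eq_one_iff.1 h2) hη1
    · rw [← h2]; exact IsPrimitiveRoot.orderOf η
  obtain ⟨i, -, rfl⟩ := hη'.eq_pow_of_pow_eq_one hζ.pow_eq_one
  have h2 : 1 - η ^ i = (η - 1) * (- ∑ j ∈ Finset.range i, η ^ j) := by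
    have := geom_sum_mul η i
    linear_combination this
  have h3 : Ge w 0 (- ∑ j ∈ Finset.range i, η ^ j) := by
    refine Ge.neg (Ge.sum _ _ fun j _ => ?_)
    simpa using (ge_root_of_unity (v := w) hℓ.pos hη).pow j
  rw [h2]
  simpa using h.mul h3

lemma exists_ge_of_prod {w : HS K} {ι : Type*} (s : Finset ι) (f : ι → K) (hf : ∀ i ∈ s, Ge w 0 (f i))
    (h : Ge w 1 (∏ i ∈ s, f i)) : ∃ i ∈ s, Ge w 1 (f i) := by
  classical
  by_contra hcon
  push Not at hcon
  have hne : ∀ i ∈ s, f i ≠ 0 := fun i hi h0 => hcon i hi (by rw [h0]; exact Ge.zero)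
  have key : ∀ t ⊆ s, ∃ u : Kˣ, (u : K) = ∏ i ∈ t, f i ∧ ord w u = 0 := by
    intro t
    induction t using Finset.induction_on with
    | empty => intro _; exact ⟨1, by simp, ord_one w⟩
    | insert a t ha ih =>
      intro hts
      obtain ⟨u, hu, hu0⟩ := ih (fun x hx => hts (Finset.mem_insert_of_mem hx))
      have has := hts (Finset.mem_insert_self a t)
      refine ⟨Units.mk0 _ (hne a has) * u, ?_, ?_⟩
      · rw [Finset.prod_insert ha, Units.val_mul, hu]; rfl
      · rw [ord_mul, hu0, add_zero]
        exact ord_eq_of_ge _ (hf a has) (by simpa using hcon a has)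
  obtain ⟨u, hu, hu0⟩ := key s subset_rfl
  rw [← hu, ge_unit, hu0] at h
  omega
end

section
variable {K M : Type*} [Field K] [NumberField K] [Field M] [NumberField M] [Algebra K M]

lemma ge_map {w : HS M} {n : ℤ} {x : K} (h : Ge (und K w) n x) : Ge w (eram K w * n) (algebraMap K M x) := by
  by_cases h0 : x = 0
  · rw [h0, map_zero]; exact Ge.zero
  · have h1 := (ge_unit (v := und K w) (n := n) (Units.mk0 x h0)).1 h
    have h2 := ord_algebraMap (M := M) w (Units.mk0 x h0)
    have h3 : eram K w * n ≤ ord w (Units.map (algebraMap K M : K →* M) (Units.mk0 x h0)) := by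
      rw [h2]; exact mul_le_mul_of_nonneg_left h1 (by positivity)
    rw [← ge_unit] at h3
    exact h3

lemma PU_map {w : HS M} {n : ℕ} {x : Kˣ} (h : x ∈ PU (und K w) n) :
    Units.map (algebraMap K M : K →* M) x ∈ PU w (eram K w * n) := by
  refine ⟨by rw [ord_algebraMap, h.1, mul_zero], ?_⟩
  have := ge_map h.2
  rw [map_sub, map_one] at this
  push_cast
  exact this

lemma gact_of_inertia {w : HS M} {τ : M ≃ₐ[K] M} (h : ∀ r : 𝓞 M, τ • r - r ∈ w.asIdeal) :
    gact τ w = w := by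
  ext1
  have h' : w.asIdeal ≤ τ⁻¹ • w.asIdeal := by
    intro x hx
    rw [Ideal.mem_pointwise_smul_iff_inv_smul_mem, inv_inv]
    simpa using add_mem (h x) hx
  have h1 : w.asIdeal = τ⁻¹ • w.asIdeal := w.isMaximal.eq_of_le (gact τ⁻¹ w).isPrime.ne_top h'
  change τ • w.asIdeal = w.asIdeal
  nth_rw 1 [h1]
  rw [smul_inv_smul]

lemma inert_ge [IsGalois K M] {w : HS M} {τ : M ≃ₐ[K] M} (h : ∀ r : 𝓞 M, τ • r - r ∈ w.asIdeal) {x : M}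
    (hx : Ge w 0 x) : Ge w 1 (τ x - x) := by
  have := ext_int (σ := τ) (gact_of_inertia h) (k := 1) (fun r => by
    have := (ge_int_one_iff (v := w) _).2 (h r)
    exact this) hx
  simpa using this

lemma kum_fix [IsGalois K M] {ℓ : ℕ} (hℓ : ℓ.Prime) {ζ : M} (hζ : IsPrimitiveRoot ζ ℓ) (lam : Mˣ) (hlam : (lam : M) = 1 - ζ)
    {w : HS M} {τ : M ≃ₐ[K] M} (h : ∀ r : 𝓞 M, τ • r - r ∈ w.asIdeal) (hτζ : τ ζ = ζ)
    {a : Mˣ} {m : ℕ} (hm : (m : ℤ) = ord w lam) (ha : a ^ ℓ ∈ PU w (ℓ * m)) {η : M} (hη : η ^ ℓ = 1)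
    (hτa : τ a = η * a) : τ a = a := by
  by_contra hcon
  have hη1 : η ≠ 1 := by rintro rfl; exact hcon (by rw [hτa, one_mul])
  have ha0 : ord w a = 0 := by
    have := ha.1
    rw [ord_pow] at this
    rcases mul_eq_zero.1 this with h | h
    · exact absurd (by exact_mod_cast h) hℓ.ne_zero
    · exact h
  have haP : a ∈ PU w m := PU_of_pow hℓ hζ (by rw [hm]; exact ge_lam hlam w) ha0 ha
  have hb : Ge w 0 (((a : M) - 1) / lam) := by
    have := (ge_div_unit (v := w) lam hm.symm).2 haP.2
    simpa using this
  have h1 := inert_ge h hb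
  have h2 : τ (((a : M) - 1) / lam) - ((a : M) - 1) / lam = (η - 1) * a / lam := by
    have : τ (lam : M) = lam := by rw [hlam, map_sub, map_one, hτζ]
    rw [map_div₀, map_sub, map_one, this, hτa, ← sub_div]; ring
  rw [h2] at h1
  have h3 : Ge w ((m : ℤ) + 1) ((η - 1) * a) := by
    have := ge_div_unit (v := w) (n := (m:ℤ)+1) (x := (η - 1) * a) lam hm.symm
    rw [← this]; simpa using h1
  have h4 : Ge w ((m : ℤ) + 1) (η - 1) := by
    have := ge_mul_unit (v := w) (n := (m : ℤ) + 1) (x := η - 1) a ha0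
    rw [← this]; simpa using h3
  have h5 := ge_prim hℓ hζ hη hη1 h4
  rw [← hlam, ge_unit] at h5
  omega

lemma kum_split [IsGalois K M] {ℓ : ℕ} (hℓ : ℓ.Prime) {ζ : M} (hζ : IsPrimitiveRoot ζ ℓ) (lam : Mˣ) (hlam : (lam : M) = 1 - ζ)
    {w : HS M} (hm : ord w lam = 0) {τ : M ≃ₐ[K] M} (h : gact τ w = w) (hτζ : τ ζ = ζ)
    {a : Mˣ} (ha : a ^ ℓ ∈ PU w 1) {η : M} (hη : η ^ ℓ = 1) (hτa : τ a = η * a) : τ a = a := by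
  by_contra hcon
  have hη1 : η ≠ 1 := by rintro rfl; exact hcon (by rw [hτa, one_mul])
  have ha0 : ord w a = 0 := by
    have := ha.1
    rw [ord_pow] at this
    rcases mul_eq_zero.1 this with h | h
    · exact absurd (by exact_mod_cast h) hℓ.ne_zero
    · exact h
  have hp := prod_sub_pow hℓ.pos hζ (a : M)
  have ha1 := ha.2
  rw [Units.val_pow_eq_pow_val, ← hp] at ha1
  obtain ⟨i, -, hi⟩ := exists_ge_of_prod _ _ (fun i _ => by
    refine ((Ge.self a).mono ha0.ge).sub ?_
    simpa using (ge_root_of_unity (v := w) hℓ.pos hζ.pow_eq_one).pow i) ha1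
  have h1 := ge_smul h hi
  rw [map_sub, map_pow, hτζ, hτa] at h1
  have h2 := h1.sub hi
  have h4 : Ge w 1 (η - 1) := by
    have := ge_mul_unit (v := w) (n := 1) (x := η - 1) a ha0
    rw [← this]; simp only [add_zero]; convert h2 using 1; ring
  have h5 := ge_prim hℓ hζ hη hη1 h4
  rw [← hlam, ge_unit] at h5
  omega

lemma gact_mul (σ τ : M ≃ₐ[K] M) (w : HS M) : gact (σ * τ) w = gact σ (gact τ w) := by
  ext1; exact mul_smul σ τ w.asIdeal

lemma card_over [IsGalois K M] (v : HS K) (hst : ∀ (w : HS M), und K w = v → ∀ τ : M ≃ₐ[K] M, gact τ w = w → τ = 1) :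
    Nat.card {w : HS M // und K w = v} = Nat.card (M ≃ₐ[K] M) := by
  obtain ⟨w, hw⟩ := exists_over (M := M) v
  refine (Nat.card_congr (Equiv.ofBijective (fun σ : M ≃ₐ[K] M =>
    (⟨gact σ w, by rw [und_gact, hw]⟩ : {w : HS M // und K w = v})) ⟨?_, ?_⟩)).symm
  · intro σ τ h
    have h1 : gact σ w = gact τ w := congrArg Subtype.val h
    have h2 : gact (τ⁻¹ * σ) w = w := by
      rw [gact_mul, h1, ← gact_mul, inv_mul_cancel]; ext1; exact one_smul _ w.asIdeal
    have h3 := hst w hw _ h2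
    exact (inv_mul_eq_one.1 h3).symm
  · rintro ⟨w', hw'⟩
    obtain ⟨σ, hσ⟩ := exists_gact (K := K) w w' (by rw [hw, hw'])
    exact ⟨σ, Subtype.ext hσ⟩

lemma finite_over (v : HS K) : Finite {w : HS M // und K w = v} := by
  obtain ⟨y, hy, -⟩ := exists_unif ∅ v
  refine Set.Finite.subset (ord_finite (K := M) (Units.map (algebraMap K M : K →* M) y)) ?_
  intro w hw
  change und K w = v at hw
  change ord w _ ≠ 0
  rw [ord_algebraMap, hw, hy, mul_one]
  exact_mod_cast eram_ne_zero w
end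
end CFT
end P4f

section P4g
open NumberField IsDedekindDomain HeightOneSpectrum
open scoped nonZeroDivisors Pointwise
set_option linter.unusedSectionVars false
namespace CFT
section
variable {K M : Type*} [Field K] [NumberField K] [Field M] [NumberField M] [Algebra K M]

lemma exists_TM [IsGalois K M] (T : Finset (HS K))
    (hst : ∀ (w : HS M), und K w ∈ T → ∀ τ : M ≃ₐ[K] M, gact τ w = w → τ = 1) :
    ∃ TM : Finset (HS M), (∀ w, w ∈ TM ↔ und K w ∈ T) ∧ TM.card = Nat.card (M ≃ₐ[K] M) * T.card := by
  classical
  have hfin : {w : HS M | und K w ∈ T}.Finite := by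
    have : {w : HS M | und K w ∈ T} = ⋃ v ∈ T, {w : HS M | und K w = v} := by ext w; simp
    rw [this]
    exact Set.Finite.biUnion T.finite_toSet fun v _ => finite_over v
  refine ⟨hfin.toFinset, fun w => by simp, ?_⟩
  rw [Finset.card_eq_sum_card_fiberwise (f := und K) (t := T) (fun w hw => by simpa using hw),
    Finset.sum_const_nat (m := Nat.card (M ≃ₐ[K] M)), mul_comm]
  intro v hv
  rw [← card_over v (fun w hw τ h => hst w (hw ▸ hv) τ h)]
  refine (Nat.subtype_card _ fun w => ?_).symm
  simp only [Finset.mem_filter, Set.Finite.mem_toFinset, Set.mem_setOf_eq]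
  exact ⟨fun h => h.2, fun h => ⟨h ▸ hv, h⟩⟩

lemma eram_const [IsGalois K M] (w w' : HS M) (h : und K w = und K w') : eram K w = eram K w' := by
  obtain ⟨σ, rfl⟩ := exists_gact (K := K) w w' h
  rw [eram_gact]

lemma eram_dvd [IsGalois K M] (w : HS M) : eram K w ∣ Nat.card (M ≃ₐ[K] M) := by
  rw [← fund_id (K := K) w, mul_right_comm]; exact dvd_mul_left _ _
end

section
variable {K M : Type} [Field K] [NumberField K] [Field M] [NumberField M] [Algebra K M]

theorem FIK [IsGalois K M] {ℓ : ℕ} (hℓ : ℓ.Prime) (hdeg : Nat.card (M ≃ₐ[K] M) = ℓ)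
    (hinf : Fintype.card (InfinitePlace M) = ℓ * Fintype.card (InfinitePlace K)) {ζ : K}
    (hζ : IsPrimitiveRoot ζ ℓ) (lam : Kˣ) (hlam : (lam : K) = 1 - ζ)
    (a : Mˣ) (α : Kˣ) (haα : a ^ ℓ = Units.map (algebraMap K M : K →* M) α) {σ : M ≃ₐ[K] M}
    (hσa : σ (a : M) = algebraMap K M ζ * a) (hα : α ∈ WW ℓ lam)
    (T : Finset (HS K)) (h' : ℕ) (hTL : ∀ v ∈ T, v ∉ Lam lam) (hcop : Nat.Coprime h' ℓ)
    (hgen : ∀ D : HS K →₀ ℤ, (∀ v ∈ Lam lam, D v = 0) → ∃ γ ∈ Bn lam ℓ, ∀ u ∉ T, ord u γ = h' * D u)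
    (hT : ∀ v ∈ T, ∃ c : Kˣ, α / c ^ ℓ ∈ PU v 1) : False := by
  classical
  have : Fact ℓ.Prime := ⟨hℓ⟩
  have : NeZero ℓ := ⟨hℓ.ne_zero⟩
  set j : Kˣ →* Mˣ := Units.map (algebraMap K M : K →* M) with hj
  have hjv : ∀ x : Kˣ, ((j x : Mˣ) : M) = algebraMap K M x := fun x => rfl
  have hζM : IsPrimitiveRoot (algebraMap K M ζ) ℓ := hζ.map_of_injective (algebraMap K M).injective
  have hlamM : ((j lam : Mˣ) : M) = 1 - algebraMap K M ζ := by rw [hjv, hlam, map_sub, map_one]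
  have hσ1 : σ ≠ 1 := by
    rintro rfl
    have h1 : algebraMap K M ζ = 1 := by
      apply mul_right_cancel₀ a.ne_zero; rw [← hσa, one_mul]; rfl
    exact hζM.ne_one hℓ.one_lt h1
  have hσ : ∀ g, g ∈ Subgroup.zpowers σ := fun g => mem_zpowers_of_prime_card hdeg hσ1
  have hfix : ∀ τ : M ≃ₐ[K] M, τ (a : M) = a → τ = 1 := by
    intro τ hτ
    by_contra hne
    have h1 : σ ∈ Subgroup.zpowers τ := mem_zpowers_of_prime_card hdeg hne
    have h2 : Subgroup.zpowers τ ≤ MulAction.stabilizer (M ≃ₐ[K] M) (a : M) := by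
      rw [Subgroup.zpowers_le]; exact hτ
    have h3 : σ (a : M) = a := h2 h1
    have h4 : algebraMap K M ζ = 1 := by
      apply mul_right_cancel₀ a.ne_zero; rw [← hσa, h3, one_mul]
    exact hζM.ne_one hℓ.one_lt h4
  have hη : ∀ τ : M ≃ₐ[K] M, ∃ η : M, η ^ ℓ = 1 ∧ τ (a : M) = η * a := by
    intro τ
    refine ⟨τ a / a, ?_, by rw [div_mul_cancel₀ _ a.ne_zero]⟩
    have h1 : (a : M) ^ ℓ = algebraMap K M α := by rw [← Units.val_pow_eq_pow_val, haα, hjv]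
    rw [div_pow, ← map_pow, h1, τ.commutes, div_self]
    rw [← h1]; exact pow_ne_zero _ a.ne_zero
  have hη' : ∀ (c : Kˣ) (τ : M ≃ₐ[K] M), ∃ η : M, η ^ ℓ = 1 ∧ τ ((a / j c : Mˣ) : M) = η * (a / j c : Mˣ) := by
    intro c τ
    obtain ⟨η, h1, h2⟩ := hη τ
    refine ⟨η, h1, ?_⟩
    rw [Units.val_div_eq_div_val, map_div₀, h2, hjv, τ.commutes, mul_div_assoc]
  have hfix' : ∀ (c : Kˣ) (τ : M ≃ₐ[K] M), τ ((a / j c : Mˣ) : M) = (a / j c : Mˣ) → τ = 1 := by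
    intro c τ h
    apply hfix
    rw [Units.val_div_eq_div_val, map_div₀, hjv, τ.commutes] at h
    exact (div_left_inj' ((map_ne_zero _).2 c.ne_zero)).1 h
  have hpow : ∀ c : Kˣ, (a / j c) ^ ℓ = j (α / c ^ ℓ) := by
    intro c; rw [div_pow, haα, map_div, map_pow]
  have hLam0 : ∀ w : HS M, und K w ∉ Lam lam → ord w (j lam) = 0 := by
    intro w hw
    rw [mem_Lam, not_not] at hw
    rw [hj, ord_algebraMap, hw, mul_zero]
  -- splitting at T
  obtain ⟨TM, hTM, hTMc⟩ := exists_TM (K := K) (M := M) T (by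
    intro w hw τ hτ
    obtain ⟨c, hc⟩ := hT _ hw
    obtain ⟨η, h1, h2⟩ := hη' c τ
    apply hfix' c
    refine kum_split hℓ hζM (j lam) hlamM (hLam0 w (hTL _ hw)) hτ (τ.commutes _) ?_ h1 h2
    rw [hpow]
    refine PU_mono ?_ (PU_map hc)
    rw [mul_one]; exact Nat.one_le_iff_ne_zero.2 (eram_ne_zero w))
  rw [hdeg] at hTMc
  -- unramified off Lam
  have hunr : ∀ w : HS M, und K w ∉ Lam lam → eram K w = 1 := by
    intro w hw
    rw [← card_inertia, Subgroup.card_eq_one, eq_bot_iff]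
    intro τ hτ
    obtain ⟨k, hk⟩ := hα.2 (und K w)
    obtain ⟨c, hc⟩ := approx_ord {und K w} (fun _ => k)
    have hc' := hc _ (Finset.mem_singleton_self _)
    obtain ⟨η, h1, h2⟩ := hη' c τ
    refine hfix' c τ ?_
    refine kum_fix hℓ hζM (j lam) hlamM hτ (τ.commutes _) (m := 0) (by rw [hLam0 w hw]; rfl) ?_ h1 h2
    rw [hpow, mul_zero, mem_PU_zero, hj, ord_algebraMap, ord_div, ord_pow, hc', hk]; simp
  set Ram : Finset (HS K) := (Lam lam).filter (fun v => ∃ w : HS M, und K w = v ∧ eram K w = ℓ) with hRam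
  have heℓ : ∀ w : HS M, und K w ∈ Ram → eram K w = ℓ := by
    intro w hw
    obtain ⟨-, w', hw', h1⟩ := Finset.mem_filter.1 hw
    rw [eram_const w w' hw'.symm, h1]
  have he1 : ∀ w : HS M, und K w ∉ Ram → eram K w = 1 := by
    intro w hw
    by_cases h1 : und K w ∈ Lam lam
    · have h2 := eram_dvd (K := K) w
      rw [hdeg] at h2
      rcases (Nat.dvd_prime hℓ).1 h2 with h3 | h3
      · exact h3
      · exact absurd (Finset.mem_filter.2 ⟨h1, w, rfl, h3⟩) hw
    · exact hunr w h1
  have hRL : ∀ v ∈ Ram, v ∈ Lam lam := fun v hv => (Finset.mem_filter.1 hv).1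
  have hRT : ∀ v ∈ Ram, v ∉ T := fun v hv hvT => hTL v hvT (hRL v hv)
  have H1 : ∀ D : HS K →₀ ℤ, ∃ γ : Kˣ, ∀ u ∉ T, ord u γ = h' * D u := by
    intro D
    obtain ⟨y, hy⟩ := approx_ord (Lam lam) D
    obtain ⟨γ, -, hγ⟩ := hgen (D - dv y) (fun v hv => by simp [hy v hv])
    refine ⟨γ * y ^ h', fun u hu => ?_⟩
    rw [ord_mul, hγ u hu, ord_pow]; simp; ring
  have hth : ∀ v : Ram, ∃ θ : PU v.1 0 →* Multiplicative (ZMod ℓ), Function.Surjective θ ∧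
      (∀ u : PU v.1 0, (u : Kˣ) ∈ PU v.1 (ℓ * (ord v.1 lam).toNat) → θ u = 1) ∧
      (∀ x : Mˣ, (∀ w : HS M, und K w = v.1 → ord w x = 0) → ∀ y : PU v.1 0,
        Units.map (Algebra.norm K) x = y → θ y = 1) := by
    rintro ⟨v, hv⟩
    obtain ⟨w, rfl⟩ := exists_over (M := M) v
    have h0 : ord (und K w) α = 0 := (mem_B0.1 hα.1) _ (hRL _ hv)
    have ha0 : ord w a = 0 := by
      have h1 : ord w (a ^ ℓ) = 0 := by rw [haα, hj, ord_algebraMap, h0, mul_zero]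
      rw [ord_pow] at h1
      rcases mul_eq_zero.1 h1 with h | h
      · exact absurd (by exact_mod_cast h) hℓ.ne_zero
      · exact h
    obtain ⟨θ, h1, h2, h3⟩ := wild hℓ hdeg hζ w (heℓ w hv) hσ a ha0 hσa lam hlam
    refine ⟨θ, h1, fun u hu => h2 u _ ?_ hu, fun x hx y hxy => h3 x (hx w rfl) y hxy⟩
    rw [Nat.cast_mul, Int.toNat_of_nonneg (ord_lam_nonneg hℓ hζ hlam _)]
  choose θ hθ1 hθ2 hθ3 using hth
  have hle : ∀ v : Ram, SU T ≤ PU v.1 0 := fun v x hx => mem_PU_zero.2 (hx v.1 (hRT _ v.2))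
  let Θ : SU T →* (Ram → Multiplicative (ZMod ℓ)) :=
    MonoidHom.pi fun v => (θ v).comp (Subgroup.inclusion (hle v))
  have hΘ : ∀ x v, Θ x v = θ v ⟨x, hle v x.2⟩ := fun x v => rfl
  refine FI hℓ hdeg hinf T TM hTM hTMc Ram he1 heℓ h' hcop H1 Θ ?_ ?_
  · intro t
    have hcard : (Nat.card (Multiplicative (ZMod ℓ))).Coprime h' := by
      rw [Nat.card_eq_fintype_card, Fintype.card_multiplicative, ZMod.card]; exact hcop.symm
    have hs : ∀ v, ∃ x : PU (v : Ram).1 0, (θ v x) ^ h' = t v := by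
      intro v
      obtain ⟨s, hs⟩ := (powCoprime hcard).surjective (t v)
      obtain ⟨x, hx⟩ := hθ1 v s
      exact ⟨x, by rw [hx]; exact hs⟩
    choose x hx using hs
    obtain ⟨y, hy⟩ := approx (Lam lam) (fun v => ℓ * (ord v lam).toNat)
      (fun v => if h : v ∈ Ram then (x ⟨v, h⟩ : Kˣ) else 1)
    have hy0 : ∀ v ∈ Lam lam, ord v y = 0 := by
      intro v hv
      have h1 := (hy v hv).1
      rw [ord_div] at h1
      split_ifs at h1 with h
      · have h2 := mem_PU_zero.1 (x ⟨v, h⟩).2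
        change ord v y - ord v _ = 0 at h1
        rw [h2] at h1; omega
      · rw [ord_one] at h1; omega
    obtain ⟨γ, hγ1, hγ2⟩ := hgen (dv y) (fun v hv => by rw [dv_apply, hy0 v hv])
    refine ⟨⟨y ^ h' / γ, ?_⟩, ?_⟩
    · rw [mem_SU]; intro v hv
      rw [ord_div, ord_pow, hγ2 v hv, dv_apply, sub_self]
    · funext v
      have hvL := hRL _ v.2
      rw [hΘ]
      have hyx := hy v.1 hvL
      rw [dif_pos v.2] at hyx
      have hγ := (mem_Bn.1 hγ1) v.1 hvL
      have e1 : θ v ⟨_, PU_mono (Nat.zero_le _) hyx⟩ = 1 := hθ2 v _ hyx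
      have e2 : θ v ⟨_, PU_mono (Nat.zero_le _) hγ⟩ = 1 := hθ2 v _ hγ
      rw [← hx v]
      have e3 : (⟨y ^ h' / γ, hle v (by
          rw [mem_SU]; intro v hv
          rw [ord_div, ord_pow, hγ2 v hv, dv_apply, sub_self])⟩ : PU v.1 0) =
        (⟨_, PU_mono (Nat.zero_le _) hyx⟩ * x v) ^ h' / ⟨_, PU_mono (Nat.zero_le _) hγ⟩ := by
        apply Subtype.ext
        simp
      rw [e3, map_div, map_pow, map_mul, e1, e2, one_mul, div_one]
  · intro x y hxy
    funext v
    rw [hΘ]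
    refine hθ3 v x (fun w hw => x.2 w ?_) _ ?_
    · rw [hTM, hw]; exact hRT _ v.2
    · ext; exact hxy
end
end CFT
end P4g

section P4h
open NumberField IsDedekindDomain HeightOneSpectrum
open scoped nonZeroDivisors Pointwise
set_option linter.unusedSectionVars false
namespace CFT
section
variable {K M : Type*} [Field K] [NumberField K] [Field M] [NumberField M] [Algebra K M]

def TP (α : Kˣ) : Prop := ∀ v : InfinitePlace K, v.IsReal → 0 < (v.embedding (α : K)).re

lemma card_inf [IsGalois K M] {ℓ : ℕ} (hℓ : ℓ.Prime) (hdeg : Nat.card (M ≃ₐ[K] M) = ℓ)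
    (a : Mˣ) (α : Kˣ) (haα : (a : M) ^ ℓ = algebraMap K M α)
    (hfix : ∀ τ : M ≃ₐ[K] M, τ (a : M) = a → τ = 1) (hα : TP α) :
    Fintype.card (InfinitePlace M) = ℓ * Fintype.card (InfinitePlace K) := by
  have hur : IsUnramifiedAtInfinitePlaces K M := by
    rcases hℓ.eq_two_or_odd' with rfl | hodd
    · constructor
      intro w
      rw [InfinitePlace.isUnramified_iff_stabilizer_eq_bot, eq_bot_iff]
      intro τ hτ
      rw [← InfinitePlace.mk_embedding w, InfinitePlace.mem_stabilizer_mk_iff] at hτ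
      rcases hτ with hτ | hτ
      · exact hτ
      by_cases hτ1 : τ = 1
      · exact hτ1
      exfalso
      set φ := w.embedding
      have hc : ∀ x, φ (τ x) = (starRingEnd ℂ) (φ x) := fun x => hτ.eq x
      have hre : ComplexEmbedding.IsReal (φ.comp (algebraMap K M)) := by
        rw [ComplexEmbedding.isReal_iff]
        ext x
        rw [ComplexEmbedding.conjugate_coe_eq, RingHom.comp_apply, ← hc, τ.commutes]
      have h1 := hα (InfinitePlace.mk (φ.comp (algebraMap K M))) ⟨_, hre, rfl⟩
      rw [InfinitePlace.embedding_mk_eq_of_isReal hre, RingHom.comp_apply, ← haα, map_pow] at h1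
      have h2 : τ (a : M) = a ∨ τ (a : M) = - a := by
        apply sq_eq_sq_iff_eq_or_eq_neg.1
        rw [← map_pow, haα, τ.commutes]
      have h3 : (starRingEnd ℂ) (φ a) = - φ a := by
        rw [← hc]
        rcases h2 with h2 | h2
        · exact absurd (hfix τ h2) hτ1
        · rw [h2, map_neg]
      have h4 : (φ a).re = 0 := by
        have := congrArg Complex.re h3
        simp at this; linarith
      rw [sq, Complex.mul_re, h4] at h1
      nlinarith [sq_nonneg (φ a).im]
    · exact IsUnramifiedAtInfinitePlaces_of_odd_card_aut (by rw [hdeg]; exact hodd)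
  rw [IsUnramifiedAtInfinitePlaces.card_infinitePlace K M, mul_comm, ← hdeg, IsGalois.card_aut_eq_finrank]
end

section
variable {K : Type} [Field K] [NumberField K]

theorem exists_root {ℓ : ℕ} (hℓ : ℓ.Prime) {ζ : K}
    (hζ : IsPrimitiveRoot ζ ℓ) (lam : Kˣ) (hlam : (lam : K) = 1 - ζ) (α : Kˣ) (hα : α ∈ WW ℓ lam) (hα' : TP α)
    (T : Finset (HS K)) (h' : ℕ) (hTL : ∀ v ∈ T, v ∉ Lam lam) (hcop : Nat.Coprime h' ℓ)
    (hgen : ∀ D : HS K →₀ ℤ, (∀ v ∈ Lam lam, D v = 0) → ∃ γ ∈ Bn lam ℓ, ∀ u ∉ T, ord u γ = h' * D u)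
    (hT : ∀ v ∈ T, ∃ c : Kˣ, α / c ^ ℓ ∈ PU v 1) : ∃ b : Kˣ, b ^ ℓ = α := by
  by_contra hcon
  have hirr : Irreducible (Polynomial.X ^ ℓ - Polynomial.C (α : K)) := by
    apply X_pow_sub_C_irreducible_of_prime hℓ
    intro b hb
    have hb0 : b ≠ 0 := by
      rintro rfl
      rw [zero_pow hℓ.ne_zero] at hb
      exact α.ne_zero hb.symm
    exact hcon ⟨Units.mk0 b hb0, by ext; exact hb⟩
  have : Fact (Irreducible (Polynomial.X ^ ℓ - Polynomial.C (α : K))) := ⟨hirr⟩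
  have : NeZero ℓ := ⟨hℓ.ne_zero⟩
  have : Fact ℓ.Prime := ⟨hℓ⟩
  have hne : (primitiveRoots ℓ K).Nonempty := ⟨ζ, (mem_primitiveRoots hℓ.pos).2 hζ⟩
  let M := AdjoinRoot (Polynomial.X ^ ℓ - Polynomial.C (α : K))
  have : Polynomial.IsSplittingField K M (Polynomial.X ^ ℓ - Polynomial.C (α : K)) :=
    isSplittingField_AdjoinRoot_X_pow_sub_C hne hirr
  have : IsGalois K M := isGalois_of_isSplittingField_X_pow_sub_C hne hirr M
  have hfr : Module.finrank K M = ℓ := finrank_of_isSplittingField_X_pow_sub_C hne hirr M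
  have : FiniteDimensional K M := Module.finite_of_finrank_pos (by rw [hfr]; exact hℓ.pos)
  have : CharZero M := charZero_of_injective_algebraMap (algebraMap K M).injective
  have : IsScalarTower ℚ K M := IsScalarTower.of_algebraMap_eq' (Subsingleton.elim _ _)
  have : FiniteDimensional ℚ M := FiniteDimensional.trans ℚ K M
  have : NumberField M := ⟨⟩
  have hdeg : Nat.card (M ≃ₐ[K] M) = ℓ := by rw [IsGalois.card_aut_eq_finrank, hfr]
  set a0 : M := AdjoinRoot.root _ with ha0
  have ha0α : a0 ^ ℓ = algebraMap K M α := root_X_pow_sub_C_pow ℓ (α : K)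
  have ha00 : a0 ≠ 0 := by
    intro h
    rw [h, zero_pow hℓ.ne_zero] at ha0α
    exact (map_ne_zero _).2 α.ne_zero ha0α.symm
  have hζu : IsUnit ζ := hζ.isUnit hℓ.ne_zero
  let η : rootsOfUnity ℓ K := ⟨hζu.unit, by
    rw [mem_rootsOfUnity']; exact hζ.pow_eq_one⟩
  let σ : M ≃ₐ[K] M := autAdjoinRootXPowSubC ℓ (α : K) η
  have hσ : σ a0 = algebraMap K M ζ * a0 := by
    have := autAdjoinRootXPowSubC_root (α : K) η
    rw [Algebra.smul_def] at this
    exact this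
  have hfix : ∀ τ : M ≃ₐ[K] M, τ a0 = a0 → τ = 1 := by
    intro τ hτ
    have : (τ : M →ₐ[K] M) = AlgHom.id K M := AdjoinRoot.algHom_ext hτ
    ext x
    exact congrArg (fun f : M →ₐ[K] M => f x) this
  refine FIK hℓ hdeg (card_inf hℓ hdeg (Units.mk0 a0 ha00) α ha0α hfix hα') hζ lam hlam
    (Units.mk0 a0 ha00) α ?_ hσ hα T h' hTL hcop hgen hT
  ext; exact ha0α
end
end CFT
end P4h

section P4i
open NumberField IsDedekindDomain HeightOneSpectrum
open scoped nonZeroDivisors Pointwise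
set_option linter.unusedSectionVars false
namespace CFT
section
variable {K : Type*} [Field K] [NumberField K]

noncomputable def Hv (ℓ : ℕ) (v : HS K) : Subgroup Kˣ := PU v 1 ⊔ (⊤ : Subgroup Kˣ).map (powMonoidHom ℓ)

lemma mem_Hv {ℓ : ℕ} {v : HS K} {x : Kˣ} (hx : x ∈ Hv ℓ v) : ∃ c : Kˣ, x / c ^ ℓ ∈ PU v 1 := by
  obtain ⟨y, hy, _, ⟨c, -, rfl⟩, rfl⟩ := Subgroup.mem_sup.1 hx
  exact ⟨c, by simpa using hy⟩

lemma exists_gen_PU (v : HS K) : ∃ g : PU v 0, ∀ u : PU v 0, ∃ i : ℕ, (u / g ^ i : Kˣ) ∈ PU v 1 := by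
  have hp : (v.asIdeal ^ 1).IsPrime := by rw [pow_one]; exact v.isPrime
  have hne : v.asIdeal ^ 1 ≠ ⊥ := by rw [pow_one]; exact v.ne_bot
  have : Finite (𝓞 K ⧸ v.asIdeal ^ 1) := Ring.HasFiniteQuotients.finiteQuotient hne
  have hd : IsDomain (𝓞 K ⧸ v.asIdeal ^ 1) := Ideal.Quotient.isDomain _
  obtain ⟨g0, hg0⟩ := (inferInstance : IsCyclic (𝓞 K ⧸ v.asIdeal ^ 1)ˣ).exists_generator
  obtain ⟨g, hg⟩ := resv_surj one_ne_zero g0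
  refine ⟨g, fun u => ?_⟩
  obtain ⟨i, hi⟩ := (mem_powers_iff_mem_zpowers.2 (hg0 ((resv v 1).toHomUnits u)))
  refine ⟨i, ?_⟩
  have h1 : (resv v 1).toHomUnits (u / g ^ i) = 1 := by
    have hgg : (resv v 1).toHomUnits g = g0 := Units.ext hg
    rw [map_div, map_pow, div_eq_one, ← hi, hgg]
  have h2 := (resv_eq_one_iff 1 (u / g ^ i)).1 (by
    have := congrArg Units.val h1; exact this)
  simpa using h2

lemma relIndex_Hv {ℓ : ℕ} (hℓ : ℓ.Prime) (v : HS K) : (Hv ℓ v).relIndex (PU v 0) ≠ 0 ∧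
    (Hv ℓ v).relIndex (PU v 0) ≤ ℓ := by
  obtain ⟨g, hg⟩ := exists_gen_PU v
  set N := (Hv ℓ v).subgroupOf (PU v 0) with hN
  have h1 : ∀ x : (PU v 0) ⧸ N, x ∈ Subgroup.zpowers (QuotientGroup.mk' N g) := by
    intro x
    obtain ⟨u, rfl⟩ := QuotientGroup.mk'_surjective N x
    obtain ⟨i, hi⟩ := hg u
    refine ⟨i, ?_⟩
    simp only [zpow_natCast]
    rw [← map_pow]
    apply (QuotientGroup.eq (s := N)).2
    rw [hN, Subgroup.mem_subgroupOf]
    apply Subgroup.mem_sup_left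
    rw [div_eq_inv_mul] at hi
    simpa using hi
  have h2 : (QuotientGroup.mk' N g) ^ ℓ = 1 := by
    rw [← map_pow]
    apply (QuotientGroup.eq_one_iff (N := N) _).2
    rw [hN, Subgroup.mem_subgroupOf]
    exact Subgroup.mem_sup_right ⟨(g : Kˣ), trivial, rfl⟩
  have h3 : (Hv ℓ v).relIndex (PU v 0) = orderOf (QuotientGroup.mk' N g) := by
    rw [orderOf_eq_card_of_forall_mem_zpowers h1]; rfl
  rw [h3]
  exact ⟨(isOfFinOrder_iff_pow_eq_one.2 ⟨ℓ, hℓ.pos, h2⟩).orderOf_pos.ne', orderOf_le_of_pow_eq_one hℓ.pos h2⟩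

lemma relIndex_Hv_W {ℓ : ℕ} (hℓ : ℓ.Prime) (lam : Kˣ) (v : HS K) : (Hv ℓ v).relIndex (WW ℓ lam) ≠ 0 ∧
    (Hv ℓ v).relIndex (WW ℓ lam) ≤ ℓ := by
  have h1 : WW ℓ lam ≤ PU v 0 ⊔ Hv ℓ v := by
    intro x hx
    obtain ⟨k, hk⟩ := hx.2 v
    obtain ⟨c, hc⟩ := approx_ord {v} (fun _ => k)
    have hc' := hc v (Finset.mem_singleton_self _)
    have : x = (x / c ^ ℓ) * c ^ ℓ := by simp
    rw [this]
    refine Subgroup.mul_mem_sup ?_ (Subgroup.mem_sup_right ⟨c, trivial, rfl⟩)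
    rw [mem_PU_zero, ord_div, ord_pow, hc', hk]; simp
  have h2 : (Hv ℓ v).relIndex (PU v 0 ⊔ Hv ℓ v) = (Hv ℓ v).relIndex (PU v 0) := Subgroup.relIndex_sup_right _ _
  have h3 := relIndex_Hv hℓ v
  rw [← h2] at h3
  exact ⟨fun h => h3.1 (Subgroup.relIndex_eq_zero_of_le_right h1 h),
    (Subgroup.relIndex_le_of_le_right h1 h3.1).trans h3.2⟩

noncomputable def sgnHom {v : InfinitePlace K} (hv : v.IsReal) : Kˣ →* SignTypeˣ :=
  (Units.map ((signHom : ℝ →*₀ SignType) : ℝ →* SignType)).comp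
    (Units.map ((InfinitePlace.embedding_of_isReal hv : K →+* ℝ) : K →* ℝ))

lemma sgn_index {v : InfinitePlace K} (hv : v.IsReal) : (sgnHom hv).ker.index ≠ 0 ∧ (sgnHom hv).ker.index ≤ 2 := by
  have h1 : (sgnHom hv).ker.index = Nat.card (sgnHom hv).range := Subgroup.index_ker _
  rw [h1]
  refine ⟨Nat.card_pos.ne', ?_⟩
  have h2 : Nat.card (sgnHom hv).range ≤ Nat.card SignTypeˣ := Subgroup.card_le_card_group _
  have h3 : Nat.card SignTypeˣ = 2 := by rw [Nat.card_eq_fintype_card]; decide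
  omega

lemma sgn_pos {v : InfinitePlace K} (hv : v.IsReal) {x : Kˣ} (hx : x ∈ (sgnHom hv).ker) :
    0 < (v.embedding (x : K)).re := by
  have h1 : SignType.sign (InfinitePlace.embedding_of_isReal hv (x : K)) = 1 := congrArg Units.val (MonoidHom.mem_ker.1 hx)
  rw [sign_eq_one_iff] at h1
  rw [← InfinitePlace.embedding_of_isReal_apply hv, Complex.ofReal_re]
  exact h1

end

section
variable {K : Type} [Field K] [NumberField K]

lemma index_W_le {ℓ : ℕ} (hℓ : ℓ.Prime) {ζ : K}
    (hζ : IsPrimitiveRoot ζ ℓ) (lam : Kˣ) (hlam : (lam : K) = 1 - ζ) 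
    (T : Finset (HS K)) (h' : ℕ) (hTL : ∀ v ∈ T, v ∉ Lam lam) (hcop : Nat.Coprime h' ℓ)
    (hgen : ∀ D : HS K →₀ ℤ, (∀ v ∈ Lam lam, D v = 0) → ∃ γ ∈ Bn lam ℓ, ∀ u ∉ T, ord u γ = h' * D u) :
    ((Bn lam 0).map (powMonoidHom ℓ)).relIndex (WW ℓ lam) ≤ ℓ ^ T.card * ℓ ^ (InfinitePlace.nrRealPlaces K) := by
  classical
  set A : Subgroup Kˣ := ⨅ v : T, Hv ℓ v.1
  set P : Subgroup Kˣ := ⨅ v : {v : InfinitePlace K // v.IsReal}, (sgnHom v.2).ker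
  have hA : A.relIndex (WW ℓ lam) ≠ 0 ∧ A.relIndex (WW ℓ lam) ≤ ℓ ^ T.card := by
    refine ⟨Subgroup.relIndex_iInf_ne_zero fun v => (relIndex_Hv_W hℓ lam v.1).1, ?_⟩
    refine (Subgroup.relIndex_iInf_le _ ).trans ?_
    refine (Finset.prod_le_pow_card _ _ ℓ fun v _ => (relIndex_Hv_W hℓ lam v.1).2).trans ?_
    simp
  have hP' : ∀ v : {v : InfinitePlace K // v.IsReal}, (sgnHom v.2).ker.relIndex (WW ℓ lam) ≠ 0 ∧
      (sgnHom v.2).ker.relIndex (WW ℓ lam) ≤ ℓ := by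
    intro v
    have h1 := sgn_index v.2
    rw [← Subgroup.relIndex_top_right] at h1
    exact ⟨fun h => h1.1 (Subgroup.relIndex_eq_zero_of_le_right le_top h),
      (Subgroup.relIndex_le_of_le_right le_top h1.1).trans (h1.2.trans hℓ.two_le)⟩
  have hP : P.relIndex (WW ℓ lam) ≠ 0 ∧ P.relIndex (WW ℓ lam) ≤ ℓ ^ (InfinitePlace.nrRealPlaces K) := by
    refine ⟨Subgroup.relIndex_iInf_ne_zero fun v => (hP' v).1, ?_⟩
    refine (Subgroup.relIndex_iInf_le _ ).trans ?_
    refine (Finset.prod_le_pow_card _ _ ℓ fun v _ => (hP' v).2).trans ?_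
    rw [Finset.card_univ]
  have h3 : (A ⊓ P).relIndex (WW ℓ lam) ≤ ℓ ^ T.card * ℓ ^ (InfinitePlace.nrRealPlaces K) :=
    Subgroup.relIndex_inf_le.trans (Nat.mul_le_mul hA.2 hP.2)
  refine le_trans ?_ h3
  rw [← Subgroup.inf_relIndex_right (A ⊓ P) (WW ℓ lam)]
  have h0 : (A ⊓ P ⊓ WW ℓ lam).relIndex (WW ℓ lam) ≠ 0 := by
    rw [Subgroup.inf_relIndex_right]
    exact Subgroup.relIndex_inf_ne_zero hA.1 hP.1
  refine Subgroup.relIndex_le_of_le_left ?_ h0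
  rintro α ⟨⟨h1, h2⟩, h4⟩
  obtain ⟨b, hb⟩ := exists_root hℓ hζ lam hlam α h4 (fun v hv => sgn_pos hv (Subgroup.mem_iInf.1 h2 ⟨v, hv⟩))
    T h' hTL hcop hgen (fun v hv => mem_Hv (Subgroup.mem_iInf.1 h1 ⟨v, hv⟩))
  refine ⟨b, ?_, hb⟩
  have h5 : ∀ v ∈ Lam lam, ord v α = 0 := mem_B0.1 h4.1
  change b ∈ Bn lam 0
  rw [mem_B0]
  intro v hv
  have h6 := h5 v hv
  rw [← hb, ord_pow] at h6
  rcases mul_eq_zero.1 h6 with h | h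
  · exact absurd (by exact_mod_cast h) hℓ.ne_zero
  · exact h

noncomputable def W0 (ℓ : ℕ) (lam : Kˣ) : Subgroup Kˣ :=
  (Bn lam ℓ ⊔ (Bn lam 0).map (powMonoidHom ℓ)) ⊓ WW ℓ lam

/-- many unramified Kummer generators -/
theorem index_W0 {ℓ : ℕ} (hℓ : ℓ.Prime) {ζ : K}
    (hζ : IsPrimitiveRoot ζ ℓ) (lam : Kˣ) (hlam : (lam : K) = 1 - ζ) :
    ctors K ℓ ≤ ((Bn lam 0).map (powMonoidHom ℓ)).relIndex (W0 ℓ lam) := by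
  obtain ⟨T, h', hTL, hTc, hcop, hgen⟩ := exists_T hℓ lam
  have i1 := index_W hℓ hζ lam
  have i2 := index_W_le hℓ hζ lam hlam T h' hTL hcop hgen
  have i3 := index_B hℓ hζ hlam
  have hc := ctors_pos (K := K) ℓ
  have f1 := InfinitePlace.card_add_two_mul_card_eq_rank K
  have f2 := InfinitePlace.card_eq_nrRealPlaces_add_nrComplexPlaces K
  rw [← f1] at i3
  rw [f2] at i1
  set r1 := InfinitePlace.nrRealPlaces K
  set r2 := InfinitePlace.nrComplexPlaces K
  have hBW := pow_le_WW (ℓ := ℓ) lam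
  set Bl : Subgroup Kˣ := (Bn lam 0).map (powMonoidHom ℓ) with hBl
  have hW : WW ℓ lam ≤ Bn lam 0 := fun x hx => hx.1
  have j1 : Bl.relIndex (W0 ℓ lam) * (W0 ℓ lam).relIndex (WW ℓ lam) = Bl.relIndex (WW ℓ lam) :=
    Subgroup.relIndex_mul_relIndex Bl (W0 ℓ lam) (WW ℓ lam) (le_inf le_sup_right hBW) inf_le_right
  have j2 : (W0 ℓ lam).relIndex (WW ℓ lam) = (Bn lam ℓ ⊔ Bl).relIndex (WW ℓ lam) :=
    Subgroup.inf_relIndex_right (Bn lam ℓ ⊔ Bl) (WW ℓ lam)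
  have j3 : (Bn lam ℓ ⊔ Bl).relIndex (WW ℓ lam) = (Bn lam ℓ ⊔ Bl).relIndex (Bn lam ℓ ⊔ WW ℓ lam) := by
    rw [← Subgroup.relIndex_sup_right (WW ℓ lam) (Bn lam ℓ ⊔ Bl)]
    congr 1
    apply le_antisymm
    · exact sup_le le_sup_right (sup_le le_sup_left (hBW.trans le_sup_right))
    · exact sup_le (le_sup_left.trans le_sup_right) le_sup_left
  have j4 : (Bn lam ℓ ⊔ Bl).relIndex (Bn lam ℓ ⊔ WW ℓ lam) * (Bn lam ℓ ⊔ WW ℓ lam).relIndex (Bn lam 0) =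
      (Bn lam ℓ ⊔ Bl).relIndex (Bn lam 0) :=
    Subgroup.relIndex_mul_relIndex (Bn lam ℓ ⊔ Bl) (Bn lam ℓ ⊔ WW ℓ lam) (Bn lam 0)
      (sup_le le_sup_left (hBW.trans le_sup_right)) (sup_le (Bn_mono (Nat.zero_le _)) hW)
  rw [← j3, ← j2] at j4
  generalize Bl.relIndex (W0 ℓ lam) = z at *
  generalize (W0 ℓ lam).relIndex (WW ℓ lam) = q at *
  generalize Bl.relIndex (WW ℓ lam) = x at *
  generalize (Bn lam ℓ ⊔ WW ℓ lam).relIndex (Bn lam 0) = p at *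
  generalize (Bn lam ℓ ⊔ Bl).relIndex (Bn lam 0) = y at *
  generalize ctors K ℓ = c at *
  generalize ℓ ^ T.card = t at *
  have hL1 : 0 < ℓ ^ (2 * r1 + 2 * r2) := pow_pos hℓ.pos _
  have k1 : x ≤ p * c * ℓ ^ r1 := i2.trans (Nat.mul_le_mul_right _ hTc)
  have k2 : q * x ≤ ℓ ^ (2 * r1 + 2 * r2) * c := by
    calc q * x ≤ q * (p * c * ℓ ^ r1) := Nat.mul_le_mul_left _ k1
      _ = (q * p) * (c * ℓ ^ r1) := by ring
      _ ≤ ℓ ^ (r1 + 2 * r2) * (c * ℓ ^ r1) := by rw [j4]; exact Nat.mul_le_mul_right _ i3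
      _ = _ := by ring
  have k3 : ℓ ^ (2 * r1 + 2 * r2) * c * c ≤ z * (ℓ ^ (2 * r1 + 2 * r2) * c) := by
    calc ℓ ^ (2 * r1 + 2 * r2) * c * c = (ℓ ^ (r1 + r2) * c) * (ℓ ^ (r1 + r2) * c) := by ring
      _ ≤ x * x := Nat.mul_le_mul i1 i1
      _ = z * (q * x) := by rw [← mul_assoc, j1]
      _ ≤ _ := Nat.mul_le_mul_left _ k2
  have : (ℓ ^ (2 * r1 + 2 * r2) * c) * c ≤ (ℓ ^ (2 * r1 + 2 * r2) * c) * z := by rw [mul_comm _ z]; exact k3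
  exact Nat.le_of_mul_le_mul_left this (Nat.mul_pos hL1 hc)
end
end CFT
end P4i

section P7a
open NumberField IsDedekindDomain HeightOneSpectrum
open scoped nonZeroDivisors Pointwise
set_option linter.unusedSectionVars false
namespace CFT
section
open Filter Topology
variable {ι : Type*}

/-- the completely multiplicative function on divisors attached to `f` -/
noncomputable def mulf (f : ι → ℂ) (a : ι →₀ ℕ) : ℂ := a.prod fun i k => f i ^ k

lemma mulf_zero (f : ι → ℂ) : mulf f 0 = 1 := by simp [mulf]

lemma mulf_add (f : ι → ℂ) (a b : ι →₀ ℕ) : mulf f (a + b) = mulf f a * mulf f b := by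
  classical
  unfold mulf
  exact Finsupp.prod_add_index' (by simp) (by intros; rw [pow_add])

lemma mulf_single (f : ι → ℂ) (i : ι) : mulf f (Finsupp.single i 1) = f i := by
  simp [mulf]

open Classical in
noncomputable def sv (f : ι → ℂ) (S : Finset ι) (a : ι →₀ ℕ) : ℂ := if ∀ i ∈ S, a i = 0 then mulf f a else 0

lemma sv_le (f : ι → ℂ) (S : Finset ι) (a : ι →₀ ℕ) : ‖sv f S a‖ ≤ ‖mulf f a‖ := by
  unfold sv; split_ifs
  · exact le_rfl
  · simp

lemma sv_summable {f : ι → ℂ} (hf : Summable fun a => ‖mulf f a‖) (S : Finset ι) : Summable (sv f S) :=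
  (Summable.of_nonneg_of_le (fun _ => norm_nonneg _) (sv_le f S) hf).of_norm

lemma sieve {f : ι → ℂ} (hf : Summable fun a => ‖mulf f a‖) (S : Finset ι) :
    (∏ i ∈ S, (1 - f i)) * ∑' a, mulf f a = ∑' a, sv f S a := by
  classical
  induction S using Finset.induction_on with
  | empty => simp [sv]
  | insert i S hi ih =>
    rw [Finset.prod_insert hi, mul_assoc, ih]
    have h1 : ∀ a, sv f S a = sv f (insert i S) a + (if a i = 0 then 0 else sv f S a) := by
      intro a
      unfold sv
      by_cases h : a i = 0
      · simp [h]
      · have : ¬ (∀ j ∈ insert i S, a j = 0) := fun h' => h (h' i (Finset.mem_insert_self _ _))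
        rw [if_neg this, if_neg h, zero_add]
    have hinj : Function.Injective (fun b : ι →₀ ℕ => b + Finsupp.single i 1) := add_left_injective _
    have h2 : ∑' a, (if a i = 0 then 0 else sv f S a) = f i * ∑' b, sv f S b := by
      rw [← tsum_mul_left, ← hinj.tsum_eq]
      · apply tsum_congr
        intro b
        have hb : (b + Finsupp.single i 1 : ι →₀ ℕ) i ≠ 0 := by simp
        rw [if_neg hb]
        have : (∀ j ∈ S, (b + Finsupp.single i 1 : ι →₀ ℕ) j = 0) ↔ ∀ j ∈ S, b j = 0 := by
          refine forall₂_congr fun j hj => ?_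
          have : i ≠ j := fun h => hi (h ▸ hj)
          simp [Finsupp.single_apply, this]
        unfold sv
        simp only [this, mulf_add, mulf_single]
        split_ifs
        · ring
        · simp
      · intro a ha
        have ha' : a i ≠ 0 := by
          intro h; apply ha; simp [h]
        refine ⟨a - Finsupp.single i 1, ?_⟩
        simp only
        ext j
        by_cases hj : j = i
        · subst hj; simp; omega
        · simp [Finsupp.single_apply, Ne.symm hj]
    have hs1 := sv_summable hf S
    have hs2 := sv_summable hf (insert i S)
    have hs3 : Summable fun a => (if a i = 0 then 0 else sv f S a) := by
      have := hs1.sub hs2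
      refine this.congr fun a => ?_
      linear_combination h1 a
    have h3 : ∑' a, sv f S a = ∑' a, sv f (insert i S) a + f i * ∑' b, sv f S b := by
      rw [← h2, ← hs2.tsum_add hs3]
      exact tsum_congr h1
    rw [sub_mul, one_mul]
    linear_combination h3

lemma sv_tendsto {f : ι → ℂ} (hf : Summable fun a => ‖mulf f a‖) :
    Tendsto (fun S => ∑' a, sv f S a) atTop (𝓝 1) := by
  classical
  have h1 : (1 : ℂ) = ∑' a : ι →₀ ℕ, if a = 0 then 1 else 0 := by rw [tsum_ite_eq]
  rw [h1]
  refine tendsto_tsum_of_dominated_convergence hf ?_ (Eventually.of_forall fun S a => sv_le f S a)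
  intro a
  refine tendsto_const_nhds.congr' ?_
  filter_upwards [eventually_ge_atTop a.support] with S hS
  unfold sv
  by_cases h : a = 0
  · subst h; simp [mulf_zero]
  · rw [if_neg h, if_neg]
    intro h'
    apply h
    ext j
    by_contra hj
    exact hj (h' j (hS (Finsupp.mem_support_iff.2 hj)))

/-- Euler product -/
theorem euler {f : ι → ℂ} (hf : Summable fun a => ‖mulf f a‖) :
    Tendsto (fun S : Finset ι => (∏ i ∈ S, (1 - f i)) * ∑' a, mulf f a) atTop (𝓝 1) := by
  simp_rw [sieve hf]; exact sv_tendsto hf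

/-- partial Euler products of nonnegative series -/
theorem euler_le {f : ι → ℝ} (hf0 : ∀ i, 0 ≤ f i) (hf : Summable fun a => ‖mulf (fun i => (f i : ℂ)) a‖) (S : Finset ι) :
    1 ≤ (∏ i ∈ S, (1 - f i)) * ∑' a, ‖mulf (fun i => (f i : ℂ)) a‖ := by
  have h1 : ∀ a, mulf (fun i => (f i : ℂ)) a = ((‖mulf (fun i => (f i : ℂ)) a‖ : ℝ) : ℂ) := by
    intro a
    have : mulf (fun i => (f i : ℂ)) a = ((a.prod fun i k => f i ^ k : ℝ) : ℂ) := by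
      simp [mulf, Finsupp.prod]
    rw [this, Complex.norm_real, Real.norm_of_nonneg]
    exact Finset.prod_nonneg fun i _ => pow_nonneg (hf0 i) _
  have h2 := sieve hf S
  have h3 : ((((∏ i ∈ S, (1 - f i)) * ∑' a, ‖mulf (fun i => (f i : ℂ)) a‖ : ℝ)) : ℂ) = 
     ((∑' a, ‖sv (fun i => (f i : ℂ)) S a‖ : ℝ) : ℂ) := by
    rw [Complex.ofReal_mul, Complex.ofReal_tsum, Complex.ofReal_tsum]
    simp_rw [← h1]
    push_cast
    rw [h2]
    apply tsum_congr
    intro a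
    unfold sv
    split_ifs
    · exact h1 a
    · simp
  rw [Complex.ofReal_inj.1 h3]
  have h4 := (sv_summable hf S).norm.le_tsum 0 (fun _ _ => norm_nonneg _)
  simpa [sv, mulf_zero] using h4
end
end CFT
end P7a

section P7b
open NumberField IsDedekindDomain HeightOneSpectrum
open scoped nonZeroDivisors Pointwise
set_option linter.unusedSectionVars false
namespace CFT
section
open Filter Topology Units dirichletUnitTheorem

noncomputable def tent (t : ℝ) : ℝ := max 0 (1 - |t|)

lemma tent_nonneg (t : ℝ) : 0 ≤ tent t := le_max_left _ _

lemma tent_le_one (t : ℝ) : tent t ≤ 1 := max_le zero_le_one (by linarith [abs_nonneg t])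

lemma tent_lip (s t : ℝ) : |tent s - tent t| ≤ |s - t| := by
  unfold tent
  have := abs_max_sub_max_le_abs (1 - |s|) (1 - |t|) 0
  rw [show 1 - |s| - (1 - |t|) = -(|s| - |t|) by ring, abs_neg] at this
  rw [max_comm, max_comm 0]
  exact this.trans (abs_abs_sub_abs_le_abs_sub s t)

lemma tent_eq_zero {t : ℝ} (h : 1 ≤ |t|) : tent t = 0 := by
  unfold tent; rw [max_eq_left]; linarith

lemma tent_sum (t : ℝ) : ∑ m ∈ ({-⌊t⌋, -⌊t⌋ - 1} : Finset ℤ), tent (t + m) = 1 := by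
  rw [Finset.sum_pair (by omega)]
  push_cast
  have h0 := Int.fract_nonneg t
  have h1 := Int.fract_lt_one t
  have e1 : t + -(⌊t⌋ : ℝ) = Int.fract t := by rw [Int.fract]; ring
  have e2 : t + (-(⌊t⌋ : ℝ) - 1) = Int.fract t - 1 := by rw [Int.fract]; ring
  rw [e1, e2]
  unfold tent
  rw [abs_of_nonneg h0, abs_of_nonpos (by linarith), max_eq_right (by linarith), max_eq_right (by linarith)]
  ring

lemma tent_support {t : ℝ} {m : ℤ} (h : m ∉ ({-⌊t⌋, -⌊t⌋ - 1} : Finset ℤ)) : tent (t + m) = 0 := by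
  apply tent_eq_zero
  by_contra! h'
  apply h
  rw [abs_lt] at h'
  have h0 := Int.floor_le t
  have h1 := Int.lt_floor_add_one t
  have a1 : (-1 - 1 : ℝ) < m + ⌊t⌋ := by linarith
  have a2 : ((m : ℝ) + ⌊t⌋) < 1 := by linarith
  have a1' : -1 - 1 < m + ⌊t⌋ := by exact_mod_cast a1
  have a2' : m + ⌊t⌋ < 1 := by exact_mod_cast a2
  simp only [Finset.mem_insert, Finset.mem_singleton]
  omega

variable (K : Type*) [Field K] [NumberField K]

open Classical in
/-- projection of log vectors to `logSpace` -/
noncomputable def lproj : (InfinitePlace K → ℝ) →ₗ[ℝ] logSpace K where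
  toFun a := fun w => (w.1.mult : ℝ) * (a w.1 - (∑ v, (v.mult : ℝ) * a v) * (Module.finrank ℚ K : ℝ)⁻¹)
  map_add' a b := by
    ext w; simp only [Pi.add_apply, mul_add, Finset.sum_add_distrib]; ring
  map_smul' c a := by
    ext w
    have : ∑ v : InfinitePlace K, (v.mult : ℝ) * (c * a v) = c * ∑ v : InfinitePlace K, (v.mult : ℝ) * a v := by
      rw [Finset.mul_sum]; exact Finset.sum_congr rfl fun i _ => by ring
    simp only [Pi.smul_apply, _root_.smul_eq_mul, RingHom.id_apply, this]
    ring

variable {K}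

noncomputable def lg (x : K) : InfinitePlace K → ℝ := fun w => Real.log (w x)

lemma lg_mul {x y : K} (hx : x ≠ 0) (hy : y ≠ 0) : lg (x * y) = lg x + lg y := by
  ext w
  simp only [lg, map_mul, Pi.add_apply]
  rw [Real.log_mul]
  · exact (AbsoluteValue.ne_zero_iff w.1).2 hx
  · exact (AbsoluteValue.ne_zero_iff w.1).2 hy

lemma sum_lg {x : K} (hx : x ≠ 0) : ∑ w : InfinitePlace K, (w.mult : ℝ) * lg x w = Real.log |(Algebra.norm ℚ x : ℝ)| := by
  have := InfinitePlace.prod_eq_abs_norm x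
  have h2 := congrArg Real.log this
  rw [Real.log_prod] at h2
  · simpa [lg, Real.log_pow] using h2
  · intro w _
    exact pow_ne_zero _ ((AbsoluteValue.ne_zero_iff w.1).2 hx)

lemma sum_lg_unit (u : (𝓞 K)ˣ) : ∑ w : InfinitePlace K, (w.mult : ℝ) * lg (u : K) w = 0 := by
  rw [sum_lg (coe_ne_zero u)]
  have := NumberField.isUnit_iff_norm.1 u.isUnit
  have h : |Algebra.norm ℚ (u : K)| = 1 := by
    rw [← this, RingOfIntegers.coe_norm]
  have h2 : (|(Algebra.norm ℚ (u : K) : ℝ)|) = 1 := by exact_mod_cast congrArg (Rat.cast (K := ℝ)) h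
  rw [h2, Real.log_one]

lemma lproj_unit (u : (𝓞 K)ˣ) : lproj K (lg (u : K)) = logEmbedding K (Additive.ofMul u) := by
  ext w
  simp only [lproj, LinearMap.coe_mk, AddHom.coe_mk, sum_lg_unit, zero_mul, sub_zero]
  rw [logEmbedding_component]; rfl

lemma sum_mult : ∑ w : InfinitePlace K, (w.mult : ℝ) = Module.finrank ℚ K := by
  exact_mod_cast InfinitePlace.sum_mult_eq

lemma lproj_const (c : ℝ) : lproj K (fun _ => c) = 0 := by
  ext w
  simp only [lproj, LinearMap.coe_mk, AddHom.coe_mk, ← Finset.sum_mul, sum_mult]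
  have : (Module.finrank ℚ K : ℝ) ≠ 0 := by exact_mod_cast Module.finrank_pos.ne'
  field_simp
  simp

open Classical in
noncomputable def lbasis (K : Type*) [Field K] [NumberField K] : Module.Basis (Fin (rank K)) ℝ (logSpace K) :=
  Module.Basis.ofZLatticeBasis ℝ (unitLattice K) (basisUnitLattice K)

noncomputable def crd (a : InfinitePlace K → ℝ) (i : Fin (rank K)) : ℝ := (lbasis K).repr (lproj K a) i

lemma crd_add (a b : InfinitePlace K → ℝ) (i) : crd (a + b) i = crd a i + crd b i := by
  simp [crd]

lemma crd_const (c : ℝ) (i) : crd (fun _ : InfinitePlace K => c) i = 0 := by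
  simp [crd, lproj_const]

lemma lg_torsion {ζ : (𝓞 K)ˣ} (hζ : ζ ∈ torsion K) : lproj K (lg (ζ : K)) = 0 := by
  rw [lproj_unit, logEmbedding_eq_zero_iff]; exact hζ

lemma crd_unit (ζ : torsion K) (e : Fin (rank K) → ℤ) (i) :
    crd (lg ((ζ.1 * ∏ i, (fundSystem K i) ^ (e i) : (𝓞 K)ˣ) : K)) i = e i := by
  unfold crd
  rw [lproj_unit, ofMul_mul, map_add, logEmbedding_eq_zero_iff.2 ζ.2, zero_add, ofMul_prod, map_sum]
  have : ∀ j, logEmbedding K (Additive.ofMul (fundSystem K j ^ e j)) = (e j : ℝ) • lbasis K j := by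
    intro j
    rw [ofMul_zpow, map_zsmul, logEmbedding_fundSystem, lbasis, Module.Basis.ofZLatticeBasis_apply, Int.cast_smul_eq_zsmul]
  simp_rw [this]
  rw [map_sum, Finsupp.finsetSum_apply]
  simp [Finsupp.single_apply]

noncomputable def phi (a : InfinitePlace K → ℝ) : ℝ := ∏ i, tent (crd a i)

lemma phi_nonneg (a : InfinitePlace K → ℝ) : 0 ≤ phi a := Finset.prod_nonneg fun _ _ => tent_nonneg _

lemma phi_le_one (a : InfinitePlace K → ℝ) : phi a ≤ 1 :=
  Finset.prod_le_one (fun _ _ => tent_nonneg _) fun _ _ => tent_le_one _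

noncomputable def unitEquiv (K : Type*) [Field K] [NumberField K] : torsion K × (Fin (rank K) → ℤ) ≃ (𝓞 K)ˣ :=
  Equiv.ofBijective (fun p => p.1.1 * ∏ i, (fundSystem K i) ^ (p.2 i)) (by
    constructor
    · intro p q h
      obtain ⟨z, -, hz⟩ := exist_unique_eq_mul_prod K (p.1.1 * ∏ i, (fundSystem K i) ^ (p.2 i))
      rw [hz p rfl, hz q h]
    · intro u
      obtain ⟨z, hz, -⟩ := exist_unique_eq_mul_prod K u
      exact ⟨z, hz.symm⟩)

theorem unit_sum (a : InfinitePlace K → ℝ) :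
    HasSum (fun u : (𝓞 K)ˣ => phi (a + lg (u : K))) (torsionOrder K) := by
  classical
  have : Fintype (torsion K) := Fintype.ofFinite _
  rw [← (unitEquiv K).hasSum_iff]
  have h1 : ∀ p : torsion K × (Fin (rank K) → ℤ), ((fun u : (𝓞 K)ˣ => phi (a + lg (u : K))) ∘ (unitEquiv K)) p =
      ∏ i, tent (crd a i + p.2 i) := by
    intro p
    simp only [Function.comp, phi, crd_add]
    refine Finset.prod_congr rfl fun i _ => ?_
    congr 2
    exact crd_unit p.1 p.2 i
  rw [funext h1]
  set T : Fin (rank K) → Finset ℤ := fun i => {-⌊crd a i⌋, -⌊crd a i⌋ - 1}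
  have h2 : ∑ p ∈ (Finset.univ : Finset (torsion K)) ×ˢ (Fintype.piFinset T), ∏ i, tent (crd a i + p.2 i) = torsionOrder K := by
    rw [Finset.sum_product]
    simp only
    have := Finset.prod_univ_sum T (fun i (m : ℤ) => tent (crd a i + m))
    rw [← this]
    rw [Finset.prod_congr rfl fun i _ => tent_sum (crd a i)]
    simp [torsionOrder, Nat.card_eq_fintype_card]
  rw [← h2]
  apply hasSum_sum_of_ne_finset_zero
  intro p hp
  have : ∃ i, p.2 i ∉ T i := by
    by_contra! h
    exact hp (Finset.mem_product.2 ⟨Finset.mem_univ _, Fintype.mem_piFinset.2 h⟩)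
  obtain ⟨i, hi⟩ := this
  exact Finset.prod_eq_zero (Finset.mem_univ i) (tent_support hi)
end
end CFT
end P7b

section P7c
open NumberField IsDedekindDomain HeightOneSpectrum
open scoped nonZeroDivisors Pointwise
set_option linter.unusedSectionVars false
namespace CFT
section
open Filter Topology Units dirichletUnitTheorem
variable {K : Type*} [Field K] [NumberField K]

lemma abs_prod_le {ι : Type*} (s : Finset ι) (f g : ι → ℝ) (hf : ∀ i, 0 ≤ f i ∧ f i ≤ 1) (hg : ∀ i, 0 ≤ g i ∧ g i ≤ 1) :
    |∏ i ∈ s, f i - ∏ i ∈ s, g i| ≤ ∑ i ∈ s, |f i - g i| := by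
  classical
  induction s using Finset.induction_on with
  | empty => simp
  | insert i s hi ih =>
    rw [Finset.prod_insert hi, Finset.prod_insert hi, Finset.sum_insert hi]
    have e : f i * ∏ x ∈ s, f x - g i * ∏ x ∈ s, g x = (f i - g i) * ∏ x ∈ s, f x + g i * (∏ x ∈ s, f x - ∏ x ∈ s, g x) := by
      ring
    rw [e]
    refine (abs_add_le _ _).trans (add_le_add ?_ ?_)
    · rw [abs_mul]
      refine mul_le_of_le_one_right (abs_nonneg _) ?_
      rw [abs_of_nonneg (Finset.prod_nonneg fun j _ => (hf j).1)]
      exact Finset.prod_le_one (fun j _ => (hf j).1) fun j _ => (hf j).2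
    · rw [abs_mul, abs_of_nonneg (hg i).1]
      exact (mul_le_of_le_one_left (abs_nonneg _) (hg i).2).trans ih

lemma crd_bound : ∃ L : ℝ, 0 ≤ L ∧ ∀ (a b : InfinitePlace K → ℝ) i, |crd a i - crd b i| ≤ L * ‖a - b‖ := by
  classical
  let f : (InfinitePlace K → ℝ) →ₗ[ℝ] (Fin (rank K) → ℝ) :=
    (lbasis K).equivFun.toLinearMap.comp (lproj K)
  refine ⟨‖LinearMap.toContinuousLinearMap f‖, norm_nonneg _, fun a b i => ?_⟩
  have h1 := (LinearMap.toContinuousLinearMap f).le_opNorm (a - b)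
  refine le_trans ?_ h1
  have h2 : crd a i - crd b i = f (a - b) i := by
    rw [map_sub]; rfl
  rw [h2, ← Real.norm_eq_abs]
  exact norm_le_pi_norm (f (a - b)) i

lemma phi_lip : ∃ L : ℝ, 0 ≤ L ∧ ∀ (a b : InfinitePlace K → ℝ), |phi a - phi b| ≤ L * ‖a - b‖ := by
  obtain ⟨L, hL, h⟩ := crd_bound (K := K)
  refine ⟨rank K * L, by positivity, fun a b => ?_⟩
  unfold phi
  refine (abs_prod_le _ _ _ (fun i => ⟨tent_nonneg _, tent_le_one _⟩) (fun i => ⟨tent_nonneg _, tent_le_one _⟩)).trans ?_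
  refine (Finset.sum_le_sum fun i _ => (tent_lip _ _).trans (h a b i)).trans ?_
  simp [mul_assoc]

lemma phi_support : ∃ B : ℝ, 0 ≤ B ∧ ∀ a : InfinitePlace K → ℝ, phi a ≠ 0 → ∀ w w', a w - a w' ≤ B := by
  classical
  set B0 : ℝ := ∑ i, ‖lbasis K i‖ with hB0
  have hB0' : 0 ≤ B0 := Finset.sum_nonneg fun _ _ => norm_nonneg _
  set c : ℝ := ((Fintype.card {w : InfinitePlace K // w ≠ w₀} : ℕ) : ℝ) with hc
  have hc0 : 0 ≤ c := by positivity
  refine ⟨2 * ((c + 1) * B0), by positivity, fun a ha w w' => ?_⟩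
  have h1 : ∀ i, |crd a i| ≤ 1 := by
    intro i
    by_contra! h
    exact ha (Finset.prod_eq_zero (Finset.mem_univ i) (tent_eq_zero h.le))
  have h2 : ‖lproj K a‖ ≤ B0 := by
    rw [← (lbasis K).sum_repr (lproj K a)]
    refine (norm_sum_le _ _).trans (Finset.sum_le_sum fun i _ => ?_)
    rw [norm_smul]
    exact mul_le_of_le_one_left (norm_nonneg _) (h1 i)
  set μ : ℝ := (∑ v : InfinitePlace K, (v.mult : ℝ) * a v) * (Module.finrank ℚ K : ℝ)⁻¹ with hμ
  have h3 : ∀ w : {w : InfinitePlace K // w ≠ w₀}, |(w.1.mult : ℝ) * (a w.1 - μ)| ≤ B0 := fun w =>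
    (norm_le_pi_norm (lproj K a) w).trans h2
  have hm : ∀ w : InfinitePlace K, (1 : ℝ) ≤ w.mult := fun w => by exact_mod_cast InfinitePlace.mult_pos
  have hn : (Module.finrank ℚ K : ℝ) ≠ 0 := by exact_mod_cast Module.finrank_pos.ne'
  have h4 : ∑ w : InfinitePlace K, (w.mult : ℝ) * (a w - μ) = 0 := by
    simp_rw [mul_sub]
    rw [Finset.sum_sub_distrib, ← Finset.sum_mul, sum_mult, hμ]
    field_simp; ring
  have h5 : ∀ w : InfinitePlace K, |(w.mult : ℝ) * (a w - μ)| ≤ (c + 1) * B0 := by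
    intro w
    by_cases hw : w = w₀
    · subst hw
      have : ((w₀ : InfinitePlace K).mult : ℝ) * (a w₀ - μ) = - ∑ w : {w : InfinitePlace K // w ≠ w₀}, (w.1.mult : ℝ) * (a w.1 - μ) := by
        rw [Fintype.sum_eq_add_sum_subtype_ne _ w₀] at h4
        linarith
      rw [this, abs_neg]
      refine (Finset.abs_sum_le_sum_abs _ _).trans ((Finset.sum_le_sum fun w _ => h3 w).trans ?_)
      simp only [Finset.sum_const, Finset.card_univ, nsmul_eq_mul]
      nlinarith
    · refine (h3 ⟨w, hw⟩).trans ?_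
      nlinarith
  have h6 : ∀ w : InfinitePlace K, |a w - μ| ≤ (c + 1) * B0 := by
    intro w
    refine le_trans ?_ (h5 w)
    rw [abs_mul, abs_of_nonneg (show (0 : ℝ) ≤ (w.mult : ℝ) by linarith [hm w])]
    nlinarith [hm w, abs_nonneg (a w - μ)]
  have := abs_le.1 (h6 w)
  have := abs_le.1 (h6 w')
  linarith

noncomputable def ltr (a : InfinitePlace K → ℝ) : ℝ := ∑ w, (w.mult : ℝ) * a w

noncomputable def FF (s : ℝ) (a : InfinitePlace K → ℝ) : ℝ := phi a * Real.exp (-(s * ltr a))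

lemma ltr_add (a b : InfinitePlace K → ℝ) : ltr (a + b) = ltr a + ltr b := by
  simp [ltr, mul_add, Finset.sum_add_distrib]

lemma ltr_const (c : ℝ) : ltr (fun _ : InfinitePlace K => c) = Module.finrank ℚ K * c := by
  rw [ltr, ← Finset.sum_mul, sum_mult]

lemma phi_const (c : ℝ) (a : InfinitePlace K → ℝ) : phi (a + fun _ => c) = phi a := by
  simp [phi, crd_add, crd_const]

lemma FF_const (s c : ℝ) (a : InfinitePlace K → ℝ) :
    FF s (a + fun _ => c) = Real.exp (-(s * (Module.finrank ℚ K * c))) * FF s a := by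
  rw [FF, FF, phi_const, ltr_add, ltr_const, mul_add, neg_add, Real.exp_add]; ring

lemma ltr_lip (a b : InfinitePlace K → ℝ) : |ltr a - ltr b| ≤ Module.finrank ℚ K * ‖a - b‖ := by
  unfold ltr
  rw [← Finset.sum_sub_distrib, ← sum_mult, Finset.sum_mul]
  refine (Finset.abs_sum_le_sum_abs _ _).trans (Finset.sum_le_sum fun w _ => ?_)
  rw [← mul_sub, abs_mul, abs_of_nonneg (by positivity)]
  exact mul_le_mul_of_nonneg_left (norm_le_pi_norm (a - b) w) (by positivity)

lemma exp_lip {x y M : ℝ} (hx : x ≤ M) (hy : y ≤ M) : |Real.exp x - Real.exp y| ≤ Real.exp M * |x - y| := by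
  wlog h : y ≤ x generalizing x y
  · rw [abs_sub_comm, abs_sub_comm x]; exact this hy hx (le_of_not_ge h)
  rw [abs_of_nonneg (sub_nonneg.2 (Real.exp_le_exp.2 h)), abs_of_nonneg (sub_nonneg.2 h)]
  have h1 := Real.add_one_le_exp (y - x)
  have h2 : Real.exp y = Real.exp x * Real.exp (y - x) := by rw [← Real.exp_add]; ring_nf
  have h3 := Real.exp_pos x
  have h4 : Real.exp x * (x - y) ≤ Real.exp M * (x - y) :=
    mul_le_mul_of_nonneg_right (Real.exp_le_exp.2 hx) (sub_nonneg.2 h)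
  nlinarith

lemma ltr_abs (a : InfinitePlace K → ℝ) : |ltr a| ≤ Module.finrank ℚ K * ‖a‖ := by
  have := ltr_lip a 0
  simpa [ltr] using this

lemma FF_bound {M s : ℝ} (hs : 1 ≤ s ∧ s ≤ 2) {a : InfinitePlace K → ℝ} (ha : ‖a‖ ≤ M) :
    -(s * ltr a) ≤ 2 * (Module.finrank ℚ K * M) := by
  have h1 := (abs_le.1 (ltr_abs a)).1
  have h2 : (Module.finrank ℚ K : ℝ) * ‖a‖ ≤ Module.finrank ℚ K * M := by gcongr
  have h3 : 0 ≤ (Module.finrank ℚ K : ℝ) * ‖a‖ := by positivity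
  nlinarith

lemma FF_lip (M : ℝ) : ∃ C : ℝ, 0 ≤ C ∧ ∀ s : ℝ, 1 ≤ s ∧ s ≤ 2 → ∀ a b : InfinitePlace K → ℝ, ‖a‖ ≤ M → ‖b‖ ≤ M →
    |FF s a - FF s b| ≤ C * ‖a - b‖ := by
  obtain ⟨L, hL, h⟩ := phi_lip (K := K)
  set E := Real.exp (2 * (Module.finrank ℚ K * M))
  have hE : 0 < E := Real.exp_pos _
  refine ⟨L * E + E * (2 * Module.finrank ℚ K), by positivity, fun s hs a b ha hb => ?_⟩
  have e : FF s a - FF s b = (phi a - phi b) * Real.exp (-(s * ltr a)) + phi b * (Real.exp (-(s * ltr a)) - Real.exp (-(s * ltr b))) := by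
    unfold FF; ring
  rw [e, add_mul]
  refine (abs_add_le _ _).trans (add_le_add ?_ ?_)
  · rw [abs_mul, abs_of_pos (Real.exp_pos _), mul_right_comm]
    exact mul_le_mul (h a b) (Real.exp_le_exp.2 (FF_bound hs ha)) (Real.exp_pos _).le (by positivity)
  · rw [abs_mul, abs_of_nonneg (phi_nonneg _)]
    refine (mul_le_of_le_one_left (abs_nonneg _) (phi_le_one _)).trans ?_
    refine (exp_lip (FF_bound hs ha) (FF_bound hs hb)).trans ?_
    rw [mul_assoc]
    refine mul_le_mul_of_nonneg_left ?_ hE.le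
    rw [show -(s * ltr a) - -(s * ltr b) = -(s * (ltr a - ltr b)) by ring, abs_neg, abs_mul, mul_assoc]
    have h1 := ltr_lip a b
    rw [abs_of_nonneg (by linarith [hs.1])]
    exact mul_le_mul hs.2 h1 (abs_nonneg _) (by norm_num)
end
end CFT
end P7c

section P7d
open NumberField IsDedekindDomain HeightOneSpectrum
open scoped nonZeroDivisors Pointwise
set_option linter.unusedSectionVars false
namespace CFT
section
open Filter Topology Units dirichletUnitTheorem
variable {K : Type*} [Field K] [NumberField K]

open Classical in
noncomputable def HH (s : ℝ) (y : InfinitePlace K → ℝ) : ℝ :=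
  if ∀ w, y w ≠ 0 then FF s (fun w => Real.log (y w)) else 0

lemma HH_nonneg (s : ℝ) (y : InfinitePlace K → ℝ) : 0 ≤ HH s y := by
  unfold HH; split_ifs
  · exact mul_nonneg (phi_nonneg _) (Real.exp_pos _).le
  · exact le_rfl

lemma HH_homog (s : ℝ) {ρ : ℝ} (hρ : 0 < ρ) (y : InfinitePlace K → ℝ) :
    HH s (ρ • y) = ρ ^ (-(s * Module.finrank ℚ K)) * HH s y := by
  unfold HH
  have h1 : (∀ w, (ρ • y) w ≠ 0) ↔ ∀ w, y w ≠ 0 := by simp [hρ.ne']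
  by_cases h : ∀ w, y w ≠ 0
  · rw [if_pos (h1.2 h), if_pos h]
    have : (fun w => Real.log ((ρ • y) w)) = (fun w => Real.log (y w)) + fun _ => Real.log ρ := by
      ext w
      simp only [Pi.smul_apply, _root_.smul_eq_mul, Pi.add_apply]
      rw [Real.log_mul hρ.ne' (h w), add_comm]
    rw [this, FF_const, Real.rpow_def_of_pos hρ]
    congr 2; ring
  · rw [if_neg h, if_neg (fun h' => h (h1.1 h'))]; simp

lemma log_max_lip {ε a b : ℝ} (hε : 0 < ε) : |Real.log (max a ε) - Real.log (max b ε)| ≤ ε⁻¹ * |a - b| := by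
  wlog h : b ≤ a generalizing a b
  · rw [abs_sub_comm, abs_sub_comm a]; exact this (le_of_not_ge h)
  have hb : 0 < max b ε := lt_max_of_lt_right hε
  have ha : 0 < max a ε := lt_max_of_lt_right hε
  have hab : max b ε ≤ max a ε := max_le_max_right _ h
  rw [abs_of_nonneg (sub_nonneg.2 (Real.log_le_log hb hab)), ← Real.log_div ha.ne' hb.ne']
  refine (Real.log_le_sub_one_of_pos (div_pos ha hb)).trans ?_
  have h1 : max a ε - max b ε ≤ |a - b| := (le_abs_self _).trans (abs_max_sub_max_le_abs _ _ _)
  rw [div_sub_one hb.ne', div_eq_inv_mul]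
  exact mul_le_mul (inv_anti₀ hε (le_max_right _ _)) h1 (by linarith) (by positivity)

/-- on the annulus, `HH` is a truncated `FF` -/
lemma HH_trunc : ∃ ε : ℝ, 0 < ε ∧ ε < 1 ∧ ∀ s, ∀ y : InfinitePlace K → ℝ, (∀ w, 0 ≤ y w) → (∃ w, 1 / 2 ≤ y w) →
    HH s y = FF s (fun w => Real.log (max (y w) ε)) := by
  obtain ⟨B, hB, h⟩ := phi_support (K := K)
  refine ⟨Real.exp (-B) / 4, by positivity, ?_, fun s y hy ⟨w0, hw0⟩ => ?_⟩
  · have : Real.exp (-B) ≤ 1 := Real.exp_le_one_iff.2 (by linarith)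
    linarith
  set ε := Real.exp (-B) / 4 with hε
  have hε0 : 0 < ε := by positivity
  have hlε : Real.log ε = -B - Real.log 4 := by
    rw [hε, Real.log_div (Real.exp_pos _).ne' (by norm_num), Real.log_exp]
  have hl4 : Real.log 4 = 2 * Real.log 2 := by
    rw [show (4 : ℝ) = 2 ^ 2 by norm_num, Real.log_pow]; norm_num
  have hl2 : 0 < Real.log 2 := Real.log_pos (by norm_num)
  have hlhalf : Real.log (1 / 2) = - Real.log 2 := by rw [one_div, Real.log_inv]
  by_cases hc : ∀ w, ε ≤ y w
  · unfold HH
    rw [if_pos fun w => (hε0.trans_le (hc w)).ne']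
    congr 1; ext w; rw [max_eq_left (hc w)]
  · push Not at hc
    obtain ⟨w1, hw1⟩ := hc
    have h1 : phi (fun w => Real.log (max (y w) ε)) = 0 := by
      by_contra hne
      have h2 := h _ hne w0 w1
      rw [max_eq_right hw1.le] at h2
      have h3 : Real.log (1 / 2) ≤ Real.log (max (y w0) ε) := Real.log_le_log (by norm_num) (hw0.trans (le_max_left _ _))
      linarith
    have h4 : HH s y = 0 := by
      unfold HH
      split_ifs with hnz
      · have : phi (fun w => Real.log (y w)) = 0 := by
          by_contra hne
          have h2 := h _ hne w0 w1
          have h3 : Real.log (1 / 2) ≤ Real.log (y w0) := Real.log_le_log (by norm_num) hw0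
          have h5 : Real.log (y w1) ≤ Real.log ε := Real.log_le_log (lt_of_le_of_ne (hy w1) (hnz w1).symm) hw1.le
          linarith
        rw [FF, this, zero_mul]
      · rfl
    rw [h4, FF, h1, zero_mul]

lemma norm_trunc_le {ε : ℝ} (hε : 0 < ε) (hε1 : ε < 1) {y : InfinitePlace K → ℝ} (hy : ‖y‖ ≤ 2) :
    ‖fun w => Real.log (max (y w) ε)‖ ≤ 2 - Real.log ε := by
  have hl : Real.log ε < 0 := Real.log_neg hε hε1
  rw [pi_norm_le_iff_of_nonneg (by linarith)]
  intro w
  have h1 : y w ≤ 2 := (le_abs_self _).trans ((norm_le_pi_norm y w).trans hy)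
  have h2 : Real.log ε ≤ Real.log (max (y w) ε) := Real.log_le_log hε (le_max_right _ _)
  have h3 : Real.log (max (y w) ε) ≤ max (y w) ε - 1 := Real.log_le_sub_one_of_pos (lt_max_of_lt_right hε)
  have h4 : max (y w) ε ≤ 2 := max_le h1 (by linarith)
  rw [Real.norm_eq_abs, abs_le]
  constructor <;> linarith

lemma exists_norm_eq (y : InfinitePlace K → ℝ) (hy : ∀ w, 0 ≤ y w) : ∃ w, y w = ‖y‖ := by
  obtain ⟨w, -, hw⟩ := Finset.exists_mem_eq_sup' (Finset.univ_nonempty (α := InfinitePlace K)) y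
  refine ⟨w, le_antisymm ((le_abs_self _).trans (norm_le_pi_norm y w)) ?_⟩
  rw [pi_norm_le_iff_of_nonneg (hy w)]
  intro v
  rw [Real.norm_of_nonneg (hy v), ← hw]
  exact Finset.le_sup' y (Finset.mem_univ v)

/-- growth bound -/
lemma HH_le : ∃ C : ℝ, 0 ≤ C ∧ ∀ s : ℝ, 1 ≤ s ∧ s ≤ 2 → ∀ y : InfinitePlace K → ℝ, (∀ w, 0 ≤ y w) → 0 < ‖y‖ →
    HH s y ≤ C * ‖y‖ ^ (-(s * Module.finrank ℚ K)) := by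
  obtain ⟨ε, hε, hε1, h⟩ := HH_trunc (K := K)
  refine ⟨Real.exp (2 * (Module.finrank ℚ K * (2 - Real.log ε))), (Real.exp_pos _).le, fun s hs y hy hρ => ?_⟩
  set ρ := ‖y‖ with hρd
  have h1 : y = ρ • (ρ⁻¹ • y) := by rw [smul_smul, mul_inv_cancel₀ hρ.ne', one_smul]
  have hn : ‖ρ⁻¹ • y‖ = 1 := by rw [norm_smul, norm_inv, Real.norm_of_nonneg hρ.le, ← hρd, inv_mul_cancel₀ hρ.ne']
  have hy' : ∀ w, 0 ≤ (ρ⁻¹ • y) w := fun w => mul_nonneg (by positivity) (hy w)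
  have h2 : HH s y = ρ ^ (-(s * Module.finrank ℚ K)) * HH s (ρ⁻¹ • y) := by
    conv_lhs => rw [h1]
    rw [HH_homog s hρ]
  rw [h2, mul_comm]
  refine mul_le_mul_of_nonneg_right ?_ (by positivity)
  obtain ⟨w, hw⟩ := exists_norm_eq _ hy'
  rw [h s _ hy' ⟨w, by rw [hw, hn]; norm_num⟩]
  unfold FF
  refine (mul_le_of_le_one_left (Real.exp_pos _).le (phi_le_one _)).trans ?_
  exact Real.exp_le_exp.2 (FF_bound hs (norm_trunc_le hε hε1 (by rw [hn]; norm_num)))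

/-- difference bound -/
lemma HH_diff : ∃ C : ℝ, 0 ≤ C ∧ ∀ s : ℝ, 1 ≤ s ∧ s ≤ 2 → ∀ y y' : InfinitePlace K → ℝ, (∀ w, 0 ≤ y w) →
    (∀ w, 0 ≤ y' w) → 1 ≤ ‖y‖ → 2 * ‖y' - y‖ ≤ ‖y‖ →
    |HH s y' - HH s y| ≤ C * ‖y' - y‖ * ‖y‖ ^ (-(Module.finrank ℚ K + 1 : ℝ)) := by
  obtain ⟨ε, hε, hε1, h⟩ := HH_trunc (K := K)
  obtain ⟨C, hC, hF⟩ := FF_lip (K := K) (2 - Real.log ε)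
  refine ⟨C * ε⁻¹, by positivity, fun s hs y y' hy hy' h1ρ hd => ?_⟩
  set ρ := ‖y‖ with hρd
  have hρ : 0 < ρ := by linarith
  set d := ‖y' - y‖ with hdd
  have hsm : ∀ z : InfinitePlace K → ℝ, HH s z = ρ ^ (-(s * Module.finrank ℚ K)) * HH s (ρ⁻¹ • z) := by
    intro z
    have h1 : z = ρ • (ρ⁻¹ • z) := by rw [smul_smul, mul_inv_cancel₀ hρ.ne', one_smul]
    conv_lhs => rw [h1]
    rw [HH_homog s hρ]
  have hn : ‖ρ⁻¹ • y‖ = 1 := by rw [norm_smul, norm_inv, Real.norm_of_nonneg hρ.le, ← hρd, inv_mul_cancel₀ hρ.ne']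
  have hnd : ‖ρ⁻¹ • y' - ρ⁻¹ • y‖ = ρ⁻¹ * d := by
    rw [← smul_sub, norm_smul, norm_inv, Real.norm_of_nonneg hρ.le]
  have hnd2 : ρ⁻¹ * d ≤ 1 / 2 := by
    rw [inv_mul_le_iff₀ hρ]; linarith
  have p1 : ∀ w, 0 ≤ (ρ⁻¹ • y) w := fun w => mul_nonneg (by positivity) (hy w)
  have p2 : ∀ w, 0 ≤ (ρ⁻¹ • y') w := fun w => mul_nonneg (by positivity) (hy' w)
  obtain ⟨w, hw⟩ := exists_norm_eq _ p1
  have q1 : 1 / 2 ≤ (ρ⁻¹ • y) w := by rw [hw, hn]; norm_num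
  have q2 : 1 / 2 ≤ (ρ⁻¹ • y') w := by
    have := norm_le_pi_norm (ρ⁻¹ • y' - ρ⁻¹ • y) w
    rw [hnd, Real.norm_eq_abs, Pi.sub_apply, hw, hn] at this
    have := (abs_le.1 this).1
    linarith
  have r2 : ‖ρ⁻¹ • y'‖ ≤ 2 := by
    have := norm_add_le (ρ⁻¹ • y) (ρ⁻¹ • y' - ρ⁻¹ • y)
    rw [add_sub_cancel, hn, hnd] at this
    linarith
  rw [hsm y', hsm y, ← mul_sub, abs_mul, abs_of_nonneg (by positivity), h s _ p1 ⟨w, q1⟩, h s _ p2 ⟨w, q2⟩]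
  have key := hF s hs _ _ (norm_trunc_le hε hε1 r2) (norm_trunc_le hε hε1 (hn.le.trans (by norm_num)))
  have lip : ‖(fun w => Real.log (max ((ρ⁻¹ • y') w) ε)) - fun w => Real.log (max ((ρ⁻¹ • y) w) ε)‖ ≤ ε⁻¹ * (ρ⁻¹ * d) := by
    rw [pi_norm_le_iff_of_nonneg (by positivity)]
    intro w
    refine (log_max_lip hε).trans ?_
    rw [← hnd]
    exact mul_le_mul_of_nonneg_left (norm_le_pi_norm (ρ⁻¹ • y' - ρ⁻¹ • y) w) (by positivity)
  have pw : ρ ^ (-(s * Module.finrank ℚ K)) ≤ ρ ^ (-(Module.finrank ℚ K : ℝ)) := by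
    apply Real.rpow_le_rpow_of_exponent_le h1ρ
    have : (0 : ℝ) ≤ Module.finrank ℚ K := by positivity
    nlinarith [hs.1]
  have e1 : ρ ^ (-(Module.finrank ℚ K + 1 : ℝ)) = ρ ^ (-(Module.finrank ℚ K : ℝ)) * ρ⁻¹ := by
    rw [neg_add, Real.rpow_add hρ, Real.rpow_neg_one]
  rw [e1]
  calc _ ≤ ρ ^ (-(Module.finrank ℚ K : ℝ)) * (C * (ε⁻¹ * (ρ⁻¹ * d))) := by
        refine mul_le_mul pw (key.trans ?_) (abs_nonneg _) (by positivity)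
        exact mul_le_mul_of_nonneg_left lip hC
    _ = _ := by ring
end
end CFT
end P7d

section P7e
open NumberField IsDedekindDomain HeightOneSpectrum
open scoped nonZeroDivisors Pointwise
set_option linter.unusedSectionVars false
namespace CFT
section
open Filter Topology Units dirichletUnitTheorem
variable {K : Type*} [Field K] [NumberField K]

/-- vector of absolute values -/
noncomputable def vec (x : K) : InfinitePlace K → ℝ := fun w => w x

lemma vec_nonneg (x : K) (w : InfinitePlace K) : 0 ≤ vec x w := apply_nonneg w x

open Classical in
lemma norm_vec (x : K) : ‖vec x‖ = ‖mixedEmbedding K x‖ := by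
  obtain ⟨w, hw⟩ := exists_norm_eq (vec x) (vec_nonneg x)
  rw [mixedEmbedding.norm_eq_sup'_normAtPlace]
  simp only [mixedEmbedding.normAtPlace_apply]
  apply le_antisymm
  · rw [← hw]
    exact Finset.le_sup' (fun w : InfinitePlace K => w x) (Finset.mem_univ w)
  · refine Finset.sup'_le _ _ fun v _ => ?_
    have := norm_le_pi_norm (vec x) v
    rw [Real.norm_of_nonneg (vec_nonneg x v)] at this
    exact this

lemma vec_sub_le (x c : K) : ‖vec (x + c) - vec x‖ ≤ ‖vec c‖ := by
  rw [pi_norm_le_iff_of_nonneg (norm_nonneg _)]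
  intro w
  have h1 : w c ≤ ‖vec c‖ := by
    have := norm_le_pi_norm (vec c) w
    rwa [Real.norm_of_nonneg (vec_nonneg c w)] at this
  have h2 : w (x + c) ≤ w x + w c := w.1.add_le x c
  have h3 : w x ≤ w (x + c) + w c := by
    have h4 : w (x + c + -c) ≤ w (x + c) + w (-c) := w.1.add_le (x + c) (-c)
    have h5 : w (-c) = w c := w.1.map_neg c
    rw [h5, add_neg_cancel_right] at h4
    exact h4
  simp only [Pi.sub_apply, vec]
  rw [Real.norm_eq_abs, abs_le]
  constructor <;> linarith

lemma norm_vec_pos {x : K} (hx : x ≠ 0) : 0 < ‖vec x‖ := by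
  rw [norm_pos_iff]
  intro h
  obtain ⟨w⟩ := (inferInstance : Nonempty (InfinitePlace K))
  have := congrFun h w
  exact hx ((map_eq_zero w).1 this)

open Classical in
lemma summable_vec {r : ℝ} (hr : Module.finrank ℚ K < r) : Summable fun x : 𝓞 K => ‖vec (x : K)‖ ^ (-r) := by
  have h1 := ZLattice.summable_norm_rpow (L := mixedEmbedding.integerLattice K) (-r) (by
    rw [ZLattice.rank ℝ (mixedEmbedding.integerLattice K), mixedEmbedding.finrank]
    linarith)
  let e : 𝓞 K → mixedEmbedding.integerLattice K := fun x => ⟨mixedEmbedding K (x : K), x, rfl⟩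
  have he : Function.Injective e := by
    intro x y h
    have := congrArg Subtype.val h
    exact RingOfIntegers.ext (mixedEmbedding_injective K this)
  have h2 := h1.comp_injective he
  refine h2.congr fun x => ?_
  rw [norm_vec]; rfl

noncomputable def GG (s : ℝ) (x : 𝓞 K) : ℝ := HH s (vec (x : K))

lemma GG_nonneg (s : ℝ) (x : 𝓞 K) : 0 ≤ GG s x := HH_nonneg _ _

lemma GG_zero (s : ℝ) : GG s (0 : 𝓞 K) = 0 := by
  unfold GG HH
  rw [if_neg]
  push Not
  obtain ⟨w⟩ := (inferInstance : Nonempty (InfinitePlace K))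
  exact ⟨w, by simp [vec]⟩

lemma GG_eq (s : ℝ) {x : 𝓞 K} (hx : x ≠ 0) :
    GG s x = phi (lg (x : K)) * (Ideal.absNorm (Ideal.span {x}) : ℝ) ^ (-s) := by
  have hx' : (x : K) ≠ 0 := by simpa using hx
  unfold GG HH
  rw [if_pos fun w => (by simpa [vec] using hx')]
  show phi (lg (x : K)) * Real.exp (-(s * ltr (lg (x : K)))) = _
  have h1 : ltr (lg (x : K)) = Real.log (Ideal.absNorm (Ideal.span {x}) : ℝ) := by
    unfold ltr
    rw [sum_lg hx', Ideal.absNorm_span_singleton]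
    congr 1
    rw [← Algebra.coe_norm_int, Nat.cast_natAbs]
    push_cast; rfl
  rw [h1]
  have h2 : 0 < (Ideal.absNorm (Ideal.span {x}) : ℝ) := by
    have : Ideal.absNorm (Ideal.span {x}) ≠ 0 := by
      rw [Ne, Ideal.absNorm_eq_zero_iff]; simpa using hx
    positivity
  rw [Real.rpow_def_of_pos h2]
  congr 2; ring

lemma GG_le_one {s : ℝ} (hs : 1 ≤ s) (x : 𝓞 K) : GG s x ≤ 1 := by
  by_cases hx : x = 0
  · rw [hx, GG_zero]; exact zero_le_one
  rw [GG_eq s hx]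
  refine mul_le_one₀ (phi_le_one _) (by positivity) ?_
  apply Real.rpow_le_one_of_one_le_of_nonpos _ (by linarith)
  have : Ideal.absNorm (Ideal.span {x}) ≠ 0 := by
      rw [Ne, Ideal.absNorm_eq_zero_iff]; simpa using hx
  exact_mod_cast Nat.one_le_iff_ne_zero.2 this

lemma finrank_pos' : (0 : ℝ) < Module.finrank ℚ K := by exact_mod_cast Module.finrank_pos

lemma summable_GG {s : ℝ} (hs : 1 < s ∧ s ≤ 2) : Summable (GG (K := K) s) := by
  obtain ⟨C, hC, h⟩ := HH_le (K := K)
  refine Summable.of_nonneg_of_le (GG_nonneg s) (fun x => ?_) ((summable_vec (K := K) (r := s * Module.finrank ℚ K) (by nlinarith [finrank_pos' (K := K)])).mul_left C)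
  by_cases hx : x = 0
  · rw [hx, GG_zero]; positivity
  · exact h s ⟨hs.1.le, hs.2⟩ _ (vec_nonneg _) (norm_vec_pos (by simpa using hx))

lemma GG_shift (c : 𝓞 K) : ∃ B : ℝ, 0 ≤ B ∧ ∀ s : ℝ, 1 < s ∧ s ≤ 2 → ∀ J : Ideal (𝓞 K),
    |∑' x : J, GG s ((x : 𝓞 K) + c) - ∑' x : J, GG s (x : 𝓞 K)| ≤ B := by
  classical
  obtain ⟨C, hC, h⟩ := HH_diff (K := K)
  set n : ℝ := (Module.finrank ℚ K : ℝ) with hn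
  set d : ℝ := ‖vec (c : K)‖ with hd
  set R : ℝ := 1 + 2 * d with hR
  have hd0 : 0 ≤ d := norm_nonneg _
  let b : 𝓞 K → ℝ := fun x => (C * d + R ^ (n + 1)) * ‖vec (x : K)‖ ^ (-(n + 1)) + if x = 0 then 1 else 0
  have hb : Summable b := by
    refine Summable.add ((summable_vec (by linarith)).mul_left _) ?_
    exact (hasSum_ite_eq (0 : 𝓞 K) (1 : ℝ)).summable
  have hb0 : ∀ x, 0 ≤ b x := fun x => by
    simp only [b]
    split_ifs <;> positivity
  refine ⟨∑' x, b x, tsum_nonneg hb0, fun s hs J => ?_⟩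
  have hG := summable_GG (K := K) hs
  have h1 : Summable fun x : J => GG s ((x : 𝓞 K) + c) :=
    hG.comp_injective (i := fun x : J => (x : 𝓞 K) + c) (fun x y hxy => Subtype.ext (add_right_cancel hxy))
  have h2 : Summable fun x : J => GG s (x : 𝓞 K) := hG.comp_injective Subtype.val_injective
  have hkey : ∀ x : 𝓞 K, |GG s (x + c) - GG s x| ≤ b x := by
    intro x
    have h01 : |GG s (x + c) - GG s x| ≤ 1 := by
      rw [abs_le]
      constructor <;> linarith [GG_nonneg s x, GG_nonneg s (x + c), GG_le_one hs.1.le x, GG_le_one hs.1.le (x + c)]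
    by_cases hx : x = 0
    · refine h01.trans ?_
      simp only [b, hx, if_true]
      have : 0 ≤ (C * d + R ^ (n + 1)) * ‖vec (((0 : 𝓞 K)) : K)‖ ^ (-(n + 1)) := by positivity
      linarith
    simp only [b, if_neg hx, add_zero]
    have hp : 0 < ‖vec (x : K)‖ := norm_vec_pos (by simpa using hx)
    rw [add_mul]
    by_cases hxR : R ≤ ‖vec (x : K)‖
    · have hsub : ‖vec ((x + c : 𝓞 K) : K) - vec (x : K)‖ ≤ d := by
        have := vec_sub_le (x : K) (c : K)
        simpa using this
      have := h s ⟨hs.1.le, hs.2⟩ (vec (x : K)) (vec ((x + c : 𝓞 K) : K)) (vec_nonneg _) (vec_nonneg _)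
        (by linarith) (by linarith)
      refine (this.trans ?_).trans (le_add_of_nonneg_right (by positivity))
      gcongr
    · push Not at hxR
      refine h01.trans (le_trans ?_ (le_add_of_nonneg_left (by positivity)))
      rw [Real.rpow_neg hp.le, ← div_eq_mul_inv, one_le_div (by positivity)]
      exact Real.rpow_le_rpow hp.le hxR.le (by linarith [finrank_pos' (K := K)])
  rw [← h1.tsum_sub h2]
  have h3 : Summable fun x : J => |GG s ((x : 𝓞 K) + c) - GG s (x : 𝓞 K)| := (h1.sub h2).abs
  have h4 : Summable fun x : J => b x := hb.comp_injective Subtype.val_injective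
  calc |∑' x : J, (GG s ((x : 𝓞 K) + c) - GG s (x : 𝓞 K))| ≤ ∑' x : J, |GG s ((x : 𝓞 K) + c) - GG s (x : 𝓞 K)| := by
        simpa only [Real.norm_eq_abs] using norm_tsum_le_tsum_norm (f := fun x : J => GG s ((x : 𝓞 K) + c) - GG s (x : 𝓞 K)) h3
    _ ≤ ∑' x : J, b x := h3.tsum_le_tsum (fun x => hkey x) h4
    _ ≤ ∑' x, b x := hb.tsum_subtype_le _ _ hb0

end
end CFT
end P7e

section P7f
open NumberField IsDedekindDomain HeightOneSpectrum
open scoped nonZeroDivisors Pointwise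
set_option linter.unusedSectionVars false
namespace CFT
section
open Filter Topology Units dirichletUnitTheorem
variable {K : Type*} [Field K] [NumberField K]

noncomputable def cosetEquiv (J : Ideal (𝓞 K)) : (𝓞 K ⧸ J) × J ≃ 𝓞 K :=
  Equiv.ofBijective (fun p => (p.2 : 𝓞 K) + Quotient.out p.1) (by
    have hout : ∀ q : 𝓞 K ⧸ J, (Ideal.Quotient.mk J (Quotient.out q)) = q := fun q => Quotient.out_eq' q
    constructor
    · rintro ⟨q, x⟩ ⟨q', x'⟩ h
      simp only at h
      have h1 := congrArg (Ideal.Quotient.mk J) h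
      rw [map_add, map_add, hout, hout, Ideal.Quotient.eq_zero_iff_mem.2 x.2, Ideal.Quotient.eq_zero_iff_mem.2 x'.2, zero_add, zero_add] at h1
      subst h1
      have := add_right_cancel h
      rw [Subtype.ext this]
    · intro y
      refine ⟨(Ideal.Quotient.mk J y, ⟨y - Quotient.out (Ideal.Quotient.mk J y), ?_⟩), by simp⟩
      rw [← Ideal.Quotient.eq_zero_iff_mem, map_sub, hout, sub_self])

lemma cosetEquiv_apply (J : Ideal (𝓞 K)) (q : 𝓞 K ⧸ J) (x : J) : cosetEquiv J (q, x) = (x : 𝓞 K) + Quotient.out q := rfl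

lemma coset_compare (J : Ideal (𝓞 K)) (hJ : J ≠ ⊥) : ∃ B : ℝ, 0 ≤ B ∧ ∀ s : ℝ, 1 < s ∧ s ≤ 2 →
    |∑' x : 𝓞 K, GG s x - (Ideal.absNorm J : ℝ) * ∑' x : J, GG s (x : 𝓞 K)| ≤ B := by
  classical
  have hfin : Finite (𝓞 K ⧸ J) := Ideal.finiteQuotientOfFreeOfNeBot J hJ
  have : Fintype (𝓞 K ⧸ J) := Fintype.ofFinite _
  choose B hB0 hB using fun c : 𝓞 K => GG_shift c
  refine ⟨∑ q : 𝓞 K ⧸ J, B (Quotient.out q), Finset.sum_nonneg fun _ _ => hB0 _, fun s hs => ?_⟩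
  have hG := summable_GG (K := K) hs
  have h1 : ∑' x : 𝓞 K, GG s x = ∑ q : 𝓞 K ⧸ J, ∑' x : J, GG s ((x : 𝓞 K) + Quotient.out q) := by
    have h3 : Summable fun p : (𝓞 K ⧸ J) × J => GG s (cosetEquiv J p) := (cosetEquiv J).summable_iff (f := GG s).2 hG
    have h4 := h3.tsum_prod
    rw [(cosetEquiv J).tsum_eq (GG s)] at h4
    rw [h4, tsum_fintype]
    refine Finset.sum_congr rfl fun q _ => tsum_congr fun x => ?_
    rw [cosetEquiv_apply]
  have h2 : (Ideal.absNorm J : ℝ) * ∑' x : J, GG s (x : 𝓞 K) = ∑ q : 𝓞 K ⧸ J, ∑' x : J, GG s (x : 𝓞 K) := by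
    rw [Finset.sum_const, nsmul_eq_mul, Finset.card_univ, ← Nat.card_eq_fintype_card]
    rfl
  rw [h1, h2, ← Finset.sum_sub_distrib]
  refine (Finset.abs_sum_le_sum_abs _ _).trans (Finset.sum_le_sum fun q _ => hB _ s hs J)

/-- partial zeta function -/
noncomputable def ZC (s : ℝ) (C : ClassGroup (𝓞 K)) : ℝ :=
  ∑' I : {I : (Ideal (𝓞 K))⁰ // ClassGroup.mk0 I = C}, (Ideal.absNorm (I.1 : Ideal (𝓞 K)) : ℝ) ^ (-s)

set_option maxHeartbeats 400000 in
lemma torsor {s : ℝ} (hs : 1 < s ∧ s ≤ 2) (J : (Ideal (𝓞 K))⁰) :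
    HasSum (fun I : {I : (Ideal (𝓞 K))⁰ // ClassGroup.mk0 I = (ClassGroup.mk0 J)⁻¹} =>
      ((Ideal.absNorm (I.1 : Ideal (𝓞 K)) : ℝ) * (Ideal.absNorm (J : Ideal (𝓞 K)) : ℝ)) ^ (-s) * (torsionOrder K : ℝ))
      (∑' x : (J : Ideal (𝓞 K)), GG s (x : 𝓞 K)) := by
  have hG := summable_GG (K := K) hs
  have hJ0 : (J : Ideal (𝓞 K)) ≠ 0 := nonZeroDivisors.ne_zero J.2
  have hex : ∀ I : {I : (Ideal (𝓞 K))⁰ // ClassGroup.mk0 I = (ClassGroup.mk0 J)⁻¹},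
      ∃ g : 𝓞 K, Ideal.span {g} = (I.1 : Ideal (𝓞 K)) * (J : Ideal (𝓞 K)) := by
    intro I
    have h1 : ClassGroup.mk0 (I.1 * J) = 1 := by rw [map_mul, I.2, inv_mul_cancel]
    have h2 := (ClassGroup.mk0_eq_one_iff (I.1 * J).2).1 h1
    obtain ⟨g, hg⟩ := h2.principal
    exact ⟨g, hg.symm⟩
  choose g hg using hex
  have hI0 : ∀ I : {I : (Ideal (𝓞 K))⁰ // ClassGroup.mk0 I = (ClassGroup.mk0 J)⁻¹}, (I.1 : Ideal (𝓞 K)) ≠ 0 :=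
    fun I => nonZeroDivisors.ne_zero I.1.2
  have hg0 : ∀ I, g I ≠ 0 := by
    intro I h
    have := hg I
    rw [h, Ideal.span_singleton_eq_bot.2 rfl] at this
    exact mul_ne_zero (hI0 I) hJ0 this.symm
  have hgu : ∀ I (u : (𝓞 K)ˣ), Ideal.span {g I * (u : 𝓞 K)} = (I.1 : Ideal (𝓞 K)) * (J : Ideal (𝓞 K)) := by
    intro I u
    rw [Ideal.span_singleton_mul_right_unit u.isUnit, hg]
  have hmem : ∀ I (u : (𝓞 K)ˣ), g I * (u : 𝓞 K) ∈ (J : Ideal (𝓞 K)) := by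
    intro I u
    have h1 : g I * (u : 𝓞 K) ∈ Ideal.span {g I * (u : 𝓞 K)} := Ideal.mem_span_singleton_self _
    have h2 : Ideal.span {g I * (u : 𝓞 K)} ≤ (J : Ideal (𝓞 K)) := by
      rw [hgu I u]; exact Ideal.mul_le_right
    exact h2 h1
  let Φ : {I : (Ideal (𝓞 K))⁰ // ClassGroup.mk0 I = (ClassGroup.mk0 J)⁻¹} × (𝓞 K)ˣ → (J : Ideal (𝓞 K)) :=
    fun p => ⟨g p.1 * (p.2 : 𝓞 K), hmem p.1 p.2⟩
  have hΦ : Function.Injective Φ := by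
    rintro ⟨I, u⟩ ⟨I', u'⟩ h
    have h1 : g I * (u : 𝓞 K) = g I' * (u' : 𝓞 K) := congrArg Subtype.val h
    have h2 := hgu I u
    rw [h1, hgu] at h2
    have h3 : I' = I := Subtype.ext (Subtype.ext (mul_right_cancel₀ hJ0 h2))
    subst h3
    rw [Prod.mk.injEq]
    exact ⟨rfl, Units.ext (mul_left_cancel₀ (hg0 _) h1)⟩
  have hsum : HasSum ((fun x : (J : Ideal (𝓞 K)) => GG s (x : 𝓞 K)) ∘ Φ) (∑' x : (J : Ideal (𝓞 K)), GG s (x : 𝓞 K)) := by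
    rw [hΦ.hasSum_iff]
    · exact (hG.comp_injective Subtype.val_injective).hasSum
    · intro x hx
      by_cases h0 : (x : 𝓞 K) = 0
      · rw [h0, GG_zero]
      exfalso
      apply hx
      have hdvd : (J : Ideal (𝓞 K)) ∣ Ideal.span {(x : 𝓞 K)} := by
        rw [Ideal.dvd_iff_le, Ideal.span_singleton_le_iff_mem]; exact x.2
      obtain ⟨I, hI⟩ := hdvd
      have hIne : I ≠ 0 := by
        rintro rfl
        rw [mul_zero] at hI
        exact h0 (Ideal.span_singleton_eq_bot.1 hI)
      let I' : (Ideal (𝓞 K))⁰ := ⟨I, mem_nonZeroDivisors_of_ne_zero hIne⟩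
      have hcl : ClassGroup.mk0 I' = (ClassGroup.mk0 J)⁻¹ := by
        rw [eq_inv_iff_mul_eq_one, ← map_mul]
        rw [ClassGroup.mk0_eq_one_iff]
        refine ⟨⟨(x : 𝓞 K), ?_⟩⟩
        show I * (J : Ideal (𝓞 K)) = _
        rw [mul_comm, ← hI]
      have h5 : Ideal.span {g ⟨I', hcl⟩} = Ideal.span {(x : 𝓞 K)} := by
        rw [hg, hI, mul_comm]
      rw [Ideal.span_singleton_eq_span_singleton] at h5
      obtain ⟨u, hu⟩ := h5
      exact ⟨(⟨I', hcl⟩, u), Subtype.ext hu⟩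
  have hfib : ∀ I, HasSum (fun u : (𝓞 K)ˣ => ((fun x : (J : Ideal (𝓞 K)) => GG s (x : 𝓞 K)) ∘ Φ) (I, u))
      (((Ideal.absNorm (I.1 : Ideal (𝓞 K)) : ℝ) * (Ideal.absNorm (J : Ideal (𝓞 K)) : ℝ)) ^ (-s) * (torsionOrder K : ℝ)) := by
    intro I
    have h1 := (unit_sum (lg (g I : K))).mul_left (((Ideal.absNorm (I.1 : Ideal (𝓞 K)) : ℝ) * (Ideal.absNorm (J : Ideal (𝓞 K)) : ℝ)) ^ (-s))
    have h2 : ∀ u : (𝓞 K)ˣ, GG s (g I * (u : 𝓞 K)) = ((Ideal.absNorm (I.1 : Ideal (𝓞 K)) : ℝ) * (Ideal.absNorm (J : Ideal (𝓞 K)) : ℝ)) ^ (-s) *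
        phi (lg (g I : K) + lg (u : K)) := by
      intro u
      have hu0 : g I * (u : 𝓞 K) ≠ 0 := mul_ne_zero (hg0 I) u.ne_zero
      rw [GG_eq s hu0, hgu, map_mul, mul_comm, Nat.cast_mul]
      rw [← lg_mul (x := (g I : K)) (y := (u : K)) (by simpa using hg0 I) (by simp)]
      congr 3
    rw [← funext h2] at h1
    exact h1
  exact hsum.prod_fiberwise hfib

lemma torsionOrder_pos' : (0 : ℝ) < torsionOrder K := by
  exact_mod_cast Nat.pos_of_ne_zero (torsionOrder_ne_zero K)

lemma absNorm_pos' (I : (Ideal (𝓞 K))⁰) : (0 : ℝ) < Ideal.absNorm (I : Ideal (𝓞 K)) := by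
  have : Ideal.absNorm (I : Ideal (𝓞 K)) ≠ 0 := by
    rw [Ne, Ideal.absNorm_eq_zero_iff]; exact nonZeroDivisors.ne_zero I.2
  positivity

lemma ZC_hasSum' {s : ℝ} (hs : 1 < s ∧ s ≤ 2) (J : (Ideal (𝓞 K))⁰) :
    HasSum (fun I : {I : (Ideal (𝓞 K))⁰ // ClassGroup.mk0 I = (ClassGroup.mk0 J)⁻¹} =>
      (Ideal.absNorm (I.1 : Ideal (𝓞 K)) : ℝ) ^ (-s))
      ((Ideal.absNorm (J : Ideal (𝓞 K)) : ℝ) ^ s * (torsionOrder K : ℝ)⁻¹ * ∑' x : (J : Ideal (𝓞 K)), GG s (x : 𝓞 K)) := by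
  refine ((torsor hs J).mul_left ((Ideal.absNorm (J : Ideal (𝓞 K)) : ℝ) ^ s * (torsionOrder K : ℝ)⁻¹)).congr_fun fun I => ?_
  have h1 := absNorm_pos' J
  have h2 := absNorm_pos' I.1
  rw [Real.mul_rpow h2.le h1.le, Real.rpow_neg h1.le]
  have := torsionOrder_pos' (K := K)
  have := (Real.rpow_pos_of_pos h1 s).ne'
  field_simp

lemma exists_J (C : ClassGroup (𝓞 K)) : ∃ J : (Ideal (𝓞 K))⁰, (ClassGroup.mk0 J)⁻¹ = C := by
  obtain ⟨J, hJ⟩ := ClassGroup.mk0_surjective C⁻¹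
  exact ⟨J, by rw [hJ, inv_inv]⟩

lemma ZC_summable {s : ℝ} (hs : 1 < s ∧ s ≤ 2) (C : ClassGroup (𝓞 K)) :
    Summable (fun I : {I : (Ideal (𝓞 K))⁰ // ClassGroup.mk0 I = C} => (Ideal.absNorm (I.1 : Ideal (𝓞 K)) : ℝ) ^ (-s)) := by
  obtain ⟨J, rfl⟩ := exists_J C
  exact (ZC_hasSum' hs J).summable

lemma ZC_eq {s : ℝ} (hs : 1 < s ∧ s ≤ 2) (J : (Ideal (𝓞 K))⁰) :
    ZC s (ClassGroup.mk0 J)⁻¹ = (Ideal.absNorm (J : Ideal (𝓞 K)) : ℝ) ^ s * (torsionOrder K : ℝ)⁻¹ * ∑' x : (J : Ideal (𝓞 K)), GG s (x : 𝓞 K) :=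
  (ZC_hasSum' hs J).tsum_eq

lemma ZC_one {s : ℝ} (hs : 1 < s ∧ s ≤ 2) :
    ZC s (1 : ClassGroup (𝓞 K)) = (torsionOrder K : ℝ)⁻¹ * ∑' x : 𝓞 K, GG s x := by
  have h := ZC_eq (K := K) hs 1
  rw [map_one, inv_one] at h
  rw [h]
  have h2 : ∑' x : ((1 : (Ideal (𝓞 K))⁰) : Ideal (𝓞 K)), GG s (x : 𝓞 K) = ∑' x : 𝓞 K, GG s x := by
    have : ((1 : (Ideal (𝓞 K))⁰) : Ideal (𝓞 K)) = ⊤ := Ideal.one_eq_top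
    rw [this]
    exact tsum_univ (fun x : 𝓞 K => GG s x)
  rw [h2]
  simp

/-- all partial zeta functions agree up to `N J ^ (s-1)` and a bounded error -/
lemma ZC_compare (C : ClassGroup (𝓞 K)) : ∃ N B : ℝ, 1 ≤ N ∧ 0 ≤ B ∧ ∀ s : ℝ, 1 < s ∧ s ≤ 2 →
    |ZC s C - N ^ (s - 1) * ZC s (1 : ClassGroup (𝓞 K))| ≤ B := by
  obtain ⟨J, rfl⟩ := exists_J C
  obtain ⟨B, hB0, hB⟩ := coset_compare (J : Ideal (𝓞 K)) (nonZeroDivisors.ne_zero J.2)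
  set N : ℝ := (Ideal.absNorm (J : Ideal (𝓞 K)) : ℝ) with hN
  have hN0 : 0 < N := absNorm_pos' J
  have hN1 : 1 ≤ N := by
    have : 0 < Ideal.absNorm (J : Ideal (𝓞 K)) := by rw [hN] at hN0; exact_mod_cast hN0
    rw [hN]; exact_mod_cast this
  have ht := torsionOrder_pos' (K := K)
  refine ⟨N, N * ((torsionOrder K : ℝ)⁻¹ * B), hN1, by positivity, fun s hs => ?_⟩
  rw [ZC_eq hs, ZC_one hs]
  have h1 : N ^ s = N ^ (s - 1) * N := by
    rw [← Real.rpow_add_one hN0.ne']; congr 1; ring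
  rw [← hN, h1]
  set X := ∑' x : (J : Ideal (𝓞 K)), GG s (x : 𝓞 K)
  set Y := ∑' x : 𝓞 K, GG s x
  have h2 : N ^ (s - 1) * N * (torsionOrder K : ℝ)⁻¹ * X - N ^ (s - 1) * ((torsionOrder K : ℝ)⁻¹ * Y) =
     - (N ^ (s - 1) * ((torsionOrder K : ℝ)⁻¹ * (Y - N * X))) := by ring
  rw [h2, abs_neg, abs_mul, abs_mul, abs_of_pos (by positivity), abs_of_pos (by positivity)]
  have h3 : N ^ (s - 1) ≤ N := by
    conv_rhs => rw [← Real.rpow_one N]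
    exact Real.rpow_le_rpow_of_exponent_le hN1 (by linarith [hs.2])
  have := hB s hs
  gcongr

end
end CFT
end P7f

section P7g
open NumberField IsDedekindDomain HeightOneSpectrum
open scoped nonZeroDivisors Pointwise
set_option linter.unusedSectionVars false
namespace CFT
section
open Filter Topology Units dirichletUnitTheorem
variable {K : Type*} [Field K] [NumberField K]

variable (K) in
noncomputable def zet (s : ℝ) : ℝ := ∑' I : (Ideal (𝓞 K))⁰, (Ideal.absNorm (I : Ideal (𝓞 K)) : ℝ) ^ (-s)

lemma nrm_nonneg (s : ℝ) (I : (Ideal (𝓞 K))⁰) : 0 ≤ (Ideal.absNorm (I : Ideal (𝓞 K)) : ℝ) ^ (-s) := by positivity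

lemma zet_summable {s : ℝ} (hs : 1 < s ∧ s ≤ 2) :
    Summable fun I : (Ideal (𝓞 K))⁰ => (Ideal.absNorm (I : Ideal (𝓞 K)) : ℝ) ^ (-s) := by
  rw [← (Equiv.sigmaFiberEquiv (ClassGroup.mk0 : (Ideal (𝓞 K))⁰ → ClassGroup (𝓞 K))).summable_iff]
  refine (summable_sigma_of_nonneg fun x => ?_).2 ⟨fun C => ZC_summable hs C, Summable.of_finite⟩
  exact nrm_nonneg s _

lemma ZC_le_zet {s : ℝ} (hs : 1 < s ∧ s ≤ 2) (C : ClassGroup (𝓞 K)) : ZC s C ≤ zet K s :=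
  (zet_summable (K := K) hs).tsum_subtype_le _ {I | ClassGroup.mk0 I = C} (nrm_nonneg s)

lemma ZC_nonneg (s : ℝ) (C : ClassGroup (𝓞 K)) : 0 ≤ ZC s C := tsum_nonneg fun _ => nrm_nonneg s _

lemma zet_eq {s : ℝ} (hs : 1 < s ∧ s ≤ 2) : dedekindZeta K (s : ℂ) = (zet K s : ℂ) := by
  let ν : (Ideal (𝓞 K))⁰ → ℕ := fun I => Ideal.absNorm (I : Ideal (𝓞 K))
  have h1 : HasSum (fun p : Σ n, {I : (Ideal (𝓞 K))⁰ // ν I = n} => (ν p.2.1 : ℝ) ^ (-s)) (zet K s) :=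
    (Equiv.sigmaFiberEquiv ν).hasSum_iff (f := fun I => (ν I : ℝ) ^ (-s)).2 (zet_summable hs).hasSum
  have hfin : ∀ n, Finite {I : (Ideal (𝓞 K))⁰ // ν I = n} := by
    intro n
    have := (Ideal.finite_setOfPred_absNorm_eq (S := 𝓞 K) n).to_subtype
    refine Finite.of_injective (β := {I : Ideal (𝓞 K) | Ideal.absNorm I = n}) (fun I => ⟨(I.1 : Ideal (𝓞 K)), I.2⟩) ?_
    intro I I' h
    exact Subtype.ext (Subtype.ext (Subtype.mk.inj h))
  have h2 : HasSum (fun n : ℕ => (Nat.card {I : (Ideal (𝓞 K))⁰ // ν I = n} : ℝ) * (n : ℝ) ^ (-s)) (zet K s) := by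
    refine h1.sigma fun n => ?_
    have : Fintype {I : (Ideal (𝓞 K))⁰ // ν I = n} := Fintype.ofFinite _
    have h3 := hasSum_fintype (fun c : {I : (Ideal (𝓞 K))⁰ // ν I = n} => (ν c.1 : ℝ) ^ (-s))
    rw [Finset.sum_congr rfl (fun c _ => by rw [c.2])] at h3
    rw [Finset.sum_const, Finset.card_univ, ← Nat.card_eq_fintype_card, nsmul_eq_mul] at h3
    exact h3
  unfold dedekindZeta LSeries
  have h3 := (Complex.hasSum_ofReal.2 h2).tsum_eq
  rw [← h3]
  refine tsum_congr fun n => ?_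
  rw [LSeries.term_def]
  split_ifs with hn
  · have : IsEmpty {I : (Ideal (𝓞 K))⁰ // ν I = n} := ⟨fun I => by
      have h : Ideal.absNorm (I.1 : Ideal (𝓞 K)) = 0 := I.2.trans hn
      rw [Ideal.absNorm_eq_zero_iff] at h
      exact nonZeroDivisors.ne_zero I.1.2 h⟩
    simp
  · have hc : Nat.card {I : Ideal (𝓞 K) // Ideal.absNorm I = n} = Nat.card {I : (Ideal (𝓞 K))⁰ // ν I = n} := by
      refine Nat.card_congr ⟨fun I => ⟨⟨I.1, mem_nonZeroDivisors_of_ne_zero ?_⟩, I.2⟩, fun I => ⟨I.1.1, I.2⟩, fun _ => rfl, fun _ => rfl⟩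
      intro h0
      have h := I.2
      rw [h0, Ideal.zero_eq_bot, Ideal.absNorm_bot] at h
      exact hn h.symm
    rw [hc]
    push_cast
    rw [Complex.ofReal_cpow (by positivity), Complex.ofReal_neg, Complex.cpow_neg, div_eq_mul_inv]
    simp

lemma zet_tendsto : Tendsto (fun s : ℝ => (s - 1) * zet K s) (𝓝[>] 1) (𝓝 (dedekindZeta_residue K)) := by
  have h1 := (Complex.continuous_re.tendsto _).comp (tendsto_sub_one_mul_dedekindZeta_nhdsGT K)
  rw [Complex.ofReal_re] at h1
  refine h1.congr' ?_
  have : ∀ᶠ s : ℝ in 𝓝[>] 1, 1 < s ∧ s ≤ 2 := by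
    filter_upwards [Ioc_mem_nhdsGT (show (1 : ℝ) < 2 by norm_num)] with s hs using hs
  filter_upwards [this] with s hs
  simp only [Function.comp]
  rw [zet_eq hs]
  rw [← Complex.ofReal_one, ← Complex.ofReal_sub, ← Complex.ofReal_mul, Complex.ofReal_re]

/-- bounds near 1 -/
lemma zet_bounds : ∃ c C : ℝ, 0 < c ∧ 0 < C ∧ ∀ᶠ s : ℝ in 𝓝[>] 1, c ≤ (s - 1) * zet K s ∧ (s - 1) * zet K s ≤ C := by
  have h0 := dedekindZeta_residue_pos K
  refine ⟨dedekindZeta_residue K / 2, 2 * dedekindZeta_residue K, by positivity, by positivity, ?_⟩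
  filter_upwards [zet_tendsto.eventually (Icc_mem_nhds (show dedekindZeta_residue K / 2 < dedekindZeta_residue K by linarith)
    (show dedekindZeta_residue K < 2 * dedekindZeta_residue K by linarith))] with s hs using hs

lemma rpow_sub_one_le {N s : ℝ} (hN : 1 ≤ N) (hs : 1 < s ∧ s ≤ 2) : |N ^ (s - 1) - 1| ≤ N * Real.log N * (s - 1) := by
  have hl := Real.log_nonneg hN
  have h1 : N ^ (s - 1) = Real.exp (Real.log N * (s - 1)) := Real.rpow_def_of_pos (by linarith) _
  have h2 : 1 ≤ N ^ (s - 1) := Real.one_le_rpow hN (by linarith [hs.1])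
  rw [abs_of_nonneg (by linarith), h1]
  have h3 := exp_lip (x := Real.log N * (s - 1)) (y := 0) (M := Real.log N) (by nlinarith [hs.2]) hl
  rw [Real.exp_zero, Real.exp_log (by linarith), sub_zero, abs_of_nonneg (by rw [← h1]; linarith),
    abs_of_nonneg (mul_nonneg hl (by linarith [hs.1]))] at h3
  linarith

/-- all partial zeta functions agree up to a bounded error -/
lemma ZC_bounded (C : ClassGroup (𝓞 K)) : ∃ B : ℝ, 0 ≤ B ∧ ∀ᶠ s : ℝ in 𝓝[>] 1, |ZC s C - ZC s (1 : ClassGroup (𝓞 K))| ≤ B := by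
  obtain ⟨N, B, hN, hB, h⟩ := ZC_compare C
  obtain ⟨c0, A, hc0, hA, h2⟩ := zet_bounds (K := K)
  refine ⟨B + N * Real.log N * A, by have := Real.log_nonneg hN; positivity, ?_⟩
  filter_upwards [h2, Ioc_mem_nhdsGT (show (1 : ℝ) < 2 by norm_num)] with s hA' hs
  have h3 := h s hs
  have h4 := rpow_sub_one_le hN hs
  have h5 : |(N ^ (s - 1) - 1) * ZC s (1 : ClassGroup (𝓞 K))| ≤ N * Real.log N * A := by
    rw [abs_mul, abs_of_nonneg (ZC_nonneg _ _)]
    have h6 := ZC_le_zet hs (1 : ClassGroup (𝓞 K))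
    calc _ ≤ N * Real.log N * (s - 1) * zet K s := by
          refine mul_le_mul h4 h6 (ZC_nonneg _ _) ?_
          exact (abs_nonneg _).trans h4
      _ = N * Real.log N * ((s - 1) * zet K s) := by ring
      _ ≤ _ := mul_le_mul_of_nonneg_left hA'.2 (mul_nonneg (by linarith) (Real.log_nonneg hN))
  have h7 : ZC s C - ZC s (1 : ClassGroup (𝓞 K)) = (ZC s C - N ^ (s - 1) * ZC s (1 : ClassGroup (𝓞 K))) +
    (N ^ (s - 1) - 1) * ZC s (1 : ClassGroup (𝓞 K)) := by ring
  rw [h7]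
  exact (abs_add_le _ _).trans (add_le_add h3 h5)

noncomputable def Lf (χ : ClassGroup (𝓞 K) →* ℂ) (s : ℝ) : ℂ :=
  ∑' I : (Ideal (𝓞 K))⁰, χ (ClassGroup.mk0 I) * (((Ideal.absNorm (I : Ideal (𝓞 K)) : ℝ) ^ (-s) : ℝ) : ℂ)

lemma chi_norm (χ : ClassGroup (𝓞 K) →* ℂ) (C : ClassGroup (𝓞 K)) : ‖χ C‖ = 1 := by
  have h : (χ C) ^ Fintype.card (ClassGroup (𝓞 K)) = 1 := by rw [← map_pow, pow_card_eq_one, map_one]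
  exact Complex.norm_eq_one_of_pow_eq_one h Fintype.card_ne_zero

lemma Lf_eq (χ : ClassGroup (𝓞 K) →* ℂ) {s : ℝ} (hs : 1 < s ∧ s ≤ 2) : Lf χ s = ∑ C, χ C * (ZC s C : ℂ) := by
  have hsum : Summable fun I : (Ideal (𝓞 K))⁰ => χ (ClassGroup.mk0 I) * (((Ideal.absNorm (I : Ideal (𝓞 K)) : ℝ) ^ (-s) : ℝ) : ℂ) := by
    refine Summable.of_norm ((zet_summable (K := K) hs).congr fun I => ?_)
    rw [norm_mul, chi_norm, one_mul, Complex.norm_real, Real.norm_of_nonneg (nrm_nonneg s I)]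
  let e := Equiv.sigmaFiberEquiv (ClassGroup.mk0 : (Ideal (𝓞 K))⁰ → ClassGroup (𝓞 K))
  have h1 : Summable ((fun I : (Ideal (𝓞 K))⁰ => χ (ClassGroup.mk0 I) * (((Ideal.absNorm (I : Ideal (𝓞 K)) : ℝ) ^ (-s) : ℝ) : ℂ)) ∘ e) :=
    e.summable_iff.2 hsum
  unfold Lf
  rw [← e.tsum_eq]
  have h2 := h1.tsum_sigma
  refine h2.trans ((tsum_fintype _).trans (Finset.sum_congr rfl fun C _ => ?_))
  unfold ZC
  rw [Complex.ofReal_tsum, ← tsum_mul_left]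
  refine tsum_congr fun I => ?_
  show χ (ClassGroup.mk0 I.1) * _ = _
  rw [I.2]; rfl

lemma Lf_bounded (χ : ClassGroup (𝓞 K) →* ℂ) (hχ : χ ≠ 1) : ∃ B : ℝ, 0 ≤ B ∧ ∀ᶠ s : ℝ in 𝓝[>] 1, ‖Lf χ s‖ ≤ B := by
  choose B hB0 hB using fun C : ClassGroup (𝓞 K) => ZC_bounded C
  refine ⟨∑ C, B C, Finset.sum_nonneg fun _ _ => hB0 _, ?_⟩
  have hall : ∀ᶠ s : ℝ in 𝓝[>] 1, ∀ C, |ZC s C - ZC s (1 : ClassGroup (𝓞 K))| ≤ B C := eventually_all.2 hB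
  filter_upwards [hall, Ioc_mem_nhdsGT (show (1 : ℝ) < 2 by norm_num)] with s h hs
  rw [Lf_eq χ hs]
  have h0 : ∑ C, χ C = 0 := sum_hom_units_eq_zero χ hχ
  have h1 : ∑ C, χ C * (ZC s C : ℂ) = ∑ C, χ C * ((ZC s C - ZC s (1 : ClassGroup (𝓞 K)) : ℝ) : ℂ) := by
    simp only [Complex.ofReal_sub, mul_sub, Finset.sum_sub_distrib]
    rw [← Finset.sum_mul, h0, zero_mul, sub_zero]
  rw [h1]
  refine (norm_sum_le _ _).trans (Finset.sum_le_sum fun C _ => ?_)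
  rw [norm_mul, chi_norm, one_mul, Complex.norm_real]
  exact h C

lemma Lf_one (s : ℝ) : Lf (1 : ClassGroup (𝓞 K) →* ℂ) s = (zet K s : ℂ) := by
  unfold Lf zet
  rw [Complex.ofReal_tsum]
  refine tsum_congr fun I => ?_
  rw [MonoidHom.one_apply, one_mul]

end
end CFT
end P7g

section P7h
open NumberField IsDedekindDomain HeightOneSpectrum
open scoped nonZeroDivisors Pointwise
set_option linter.unusedSectionVars false
namespace CFT
section
open Filter Topology
variable {K : Type*} [Field K] [NumberField K]

noncomputable def pI (v : HS K) : (Ideal (𝓞 K))⁰ := ⟨v.asIdeal, mem_nonZeroDivisors_of_ne_zero v.ne_bot⟩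

/-- class of a prime -/
noncomputable def pcl (v : HS K) : ClassGroup (𝓞 K) := ClassGroup.mk0 (pI v)

noncomputable def EI (a : HS K →₀ ℕ) : (Ideal (𝓞 K))⁰ := a.prod fun v k => pI v ^ k

lemma EI_add (a b : HS K →₀ ℕ) : EI (a + b) = EI a * EI b := by
  classical
  exact Finsupp.prod_add_index' (by simp) (by intros; rw [pow_add])

lemma EI_single (v : HS K) (k : ℕ) : EI (Finsupp.single v k) = pI v ^ k := by
  simp [EI]

lemma EI_inj : Function.Injective (EI (K := K)) := by
  have key : ∀ (a : HS K →₀ ℕ) (v : HS K), FractionalIdeal.count K v (((EI a : (Ideal (𝓞 K))⁰) : Ideal (𝓞 K)) : FractionalIdeal (𝓞 K)⁰ K) = a v := by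
    intro a v
    have h1 := FractionalIdeal.count_finsuppProd K v (a.mapRange (fun n : ℕ => (n : ℤ)) (by simp))
    rw [Finsupp.mapRange_apply] at h1
    rw [← h1]
    congr 1
    rw [Finsupp.prod_mapRange_index (by simp)]
    unfold EI
    simp only [Finsupp.prod]
    rw [Submonoid.coe_finsetProd]
    rw [show ∀ I : Ideal (𝓞 K), (I : FractionalIdeal (𝓞 K)⁰ K) = FractionalIdeal.coeIdealHom (𝓞 K)⁰ K I from fun _ => rfl, map_prod]
    simp [pI, FractionalIdeal.coeIdeal_pow]
  intro a b h
  ext v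
  have := key a v
  rw [h, key b v] at this
  exact_mod_cast this.symm

lemma EI_surj : Function.Surjective (EI (K := K)) := by
  have key : ∀ I : Ideal (𝓞 K), I ≠ 0 → ∃ a : HS K →₀ ℕ, ((EI a : (Ideal (𝓞 K))⁰) : Ideal (𝓞 K)) = I := by
    intro I
    refine UniqueFactorizationMonoid.induction_on_prime I (fun h => absurd rfl h) (fun x hx _ => ⟨0, ?_⟩) (fun a p ha hp ih _ => ?_)
    · rw [Ideal.isUnit_iff] at hx
      rw [hx]; simp [EI]
    · obtain ⟨b, hb⟩ := ih ha
      refine ⟨Finsupp.single ⟨p, Ideal.isPrime_of_prime hp, hp.ne_zero⟩ 1 + b, ?_⟩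
      rw [EI_add, EI_single, pow_one, Submonoid.coe_mul, hb]
      rfl
  intro I
  obtain ⟨a, ha⟩ := key I (nonZeroDivisors.ne_zero I.2)
  exact ⟨a, Subtype.ext ha⟩

noncomputable def EE : (HS K →₀ ℕ) ≃ (Ideal (𝓞 K))⁰ := Equiv.ofBijective EI ⟨EI_inj, EI_surj⟩

/-- local factor -/
noncomputable def xv (s : ℝ) (v : HS K) : ℝ := (Ideal.absNorm v.asIdeal : ℝ) ^ (-s)

lemma xv_pos (s : ℝ) (v : HS K) : 0 < xv s v := by
  have := absNorm_gt_one v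
  unfold xv; positivity

lemma xv_lt_one {s : ℝ} (hs : 1 < s) (v : HS K) : xv s v < 1 := by
  have := absNorm_gt_one v
  exact Real.rpow_lt_one_of_one_lt_of_neg (by exact_mod_cast this) (by linarith)

lemma mulf_EI (χ : ClassGroup (𝓞 K) →* ℂ) (s : ℝ) (a : HS K →₀ ℕ) :
    mulf (fun v => χ (pcl v) * (xv s v : ℂ)) a =
      χ (ClassGroup.mk0 (EI a)) * (((Ideal.absNorm ((EI a : (Ideal (𝓞 K))⁰) : Ideal (𝓞 K)) : ℝ) ^ (-s) : ℝ) : ℂ) := by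
  have hmul : ∀ a b : HS K →₀ ℕ, (Ideal.absNorm ((EI (a + b) : (Ideal (𝓞 K))⁰) : Ideal (𝓞 K)) : ℝ) ^ (-s) =
      (Ideal.absNorm ((EI a : (Ideal (𝓞 K))⁰) : Ideal (𝓞 K)) : ℝ) ^ (-s) * (Ideal.absNorm ((EI b : (Ideal (𝓞 K))⁰) : Ideal (𝓞 K)) : ℝ) ^ (-s) := by
    intro a b
    rw [EI_add, Submonoid.coe_mul, map_mul, Nat.cast_mul, Real.mul_rpow (by positivity) (by positivity)]
  have hone : ∀ (v : HS K) (k : ℕ), mulf (fun v => χ (pcl v) * (xv s v : ℂ)) (Finsupp.single v k) =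
      χ (ClassGroup.mk0 (EI (Finsupp.single v k))) * (((Ideal.absNorm ((EI (Finsupp.single v k) : (Ideal (𝓞 K))⁰) : Ideal (𝓞 K)) : ℝ) ^ (-s) : ℝ) : ℂ) := by
    intro v k
    induction k with
    | zero => simp [mulf_zero, EI]
    | succ k ih =>
      rw [Finsupp.single_add, mulf_add, ih, mulf_single, hmul, EI_add, map_mul, map_mul, EI_single v 1, pow_one]
      push_cast
      unfold pcl xv
      have : ((pI v : (Ideal (𝓞 K))⁰) : Ideal (𝓞 K)) = v.asIdeal := rfl
      rw [this]
      ring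
  induction a using Finsupp.induction with
  | zero => simp [mulf_zero, EI]
  | single_add v k a _ _ ih =>
    rw [mulf_add, ih, hone, hmul, EI_add (Finsupp.single v k) a, map_mul, map_mul]
    push_cast
    ring

lemma mulf_norm (χ : ClassGroup (𝓞 K) →* ℂ) (s : ℝ) (a : HS K →₀ ℕ) :
    ‖mulf (fun v => χ (pcl v) * (xv s v : ℂ)) a‖ = (Ideal.absNorm ((EE a : (Ideal (𝓞 K))⁰) : Ideal (𝓞 K)) : ℝ) ^ (-s) := by
  rw [mulf_EI, norm_mul, chi_norm, one_mul, Complex.norm_real, Real.norm_of_nonneg (nrm_nonneg s _)]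
  rfl

lemma mulf_summable (χ : ClassGroup (𝓞 K) →* ℂ) {s : ℝ} (hs : 1 < s ∧ s ≤ 2) :
    Summable fun a => ‖mulf (fun v => χ (pcl v) * (xv s v : ℂ)) a‖ := by
  simp_rw [mulf_norm]
  exact (EE (K := K)).summable_iff (f := fun I : (Ideal (𝓞 K))⁰ => (Ideal.absNorm (I : Ideal (𝓞 K)) : ℝ) ^ (-s)).2 (zet_summable hs)

lemma Lf_euler (χ : ClassGroup (𝓞 K) →* ℂ) {s : ℝ} (hs : 1 < s ∧ s ≤ 2) :
    Tendsto (fun S : Finset (HS K) => (∏ v ∈ S, ‖1 - χ (pcl v) * (xv s v : ℂ)‖) * ‖Lf χ s‖) atTop (𝓝 1) := by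
  have h1 := (euler (mulf_summable χ hs)).norm
  rw [norm_one] at h1
  refine h1.congr fun S => ?_
  rw [norm_mul, norm_prod]
  congr 2
  unfold Lf
  rw [← (EE (K := K)).tsum_eq]
  exact tsum_congr fun a => mulf_EI χ s a

lemma zet_euler_le {s : ℝ} (hs : 1 < s ∧ s ≤ 2) (S : Finset (HS K)) :
    1 ≤ (∏ v ∈ S, (1 - xv s v)) * zet K s := by
  have hf : (fun v : HS K => ((xv s v : ℝ) : ℂ)) = fun v => (1 : ClassGroup (𝓞 K) →* ℂ) (pcl v) * (xv s v : ℂ) := by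
    ext v; simp
  have h0 : Summable fun a => ‖mulf (fun v : HS K => ((xv s v : ℝ) : ℂ)) a‖ := by rw [hf]; exact mulf_summable 1 hs
  have h1 := euler_le (fun v => (xv_pos s v).le) h0 S
  have h2 : ∑' a, ‖mulf (fun v : HS K => ((xv s v : ℝ) : ℂ)) a‖ = zet K s := by
    rw [hf]
    simp_rw [mulf_norm]
    exact (EE (K := K)).tsum_eq (fun I : (Ideal (𝓞 K))⁰ => (Ideal.absNorm (I : Ideal (𝓞 K)) : ℝ) ^ (-s))
  rwa [h2] at h1

lemma zet_pos {s : ℝ} (hs : 1 < s ∧ s ≤ 2) : 0 < zet K s := by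
  have := zet_euler_le (K := K) hs ∅
  simp at this; linarith

end
end CFT
end P7h

section P7i
open NumberField IsDedekindDomain HeightOneSpectrum
open scoped nonZeroDivisors Pointwise
set_option linter.unusedSectionVars false
namespace CFT
section
open Filter Topology
variable {K M : Type*} [Field K] [NumberField K] [Field M] [NumberField M] [Algebra K M]

lemma ncard_over (v : HS K) : (v.asIdeal.primesOver (𝓞 M)).ncard = Nat.card {w : HS M // und K w = v} := by
  rw [← Nat.card_coe_set_eq]
  refine Nat.card_congr ⟨fun P => ⟨⟨P.1, P.2.1, ?_⟩, ?_⟩, fun w => ⟨w.1.asIdeal, w.1.isPrime, ?_⟩, fun _ => rfl, fun _ => rfl⟩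
  · have := P.2.2
    exact Ideal.ne_bot_of_liesOver_of_ne_bot v.ne_bot P.1
  · ext1
    exact P.2.2.over.symm
  · obtain ⟨w, rfl⟩ := w; infer_instance

lemma over_split [IsGalois K M] {p : ℕ} (hp : p.Prime) (hdeg : Nat.card (M ≃ₐ[K] M) = p) (v : HS K)
    (h : ∃ w w' : HS M, und K w = v ∧ und K w' = v ∧ w ≠ w') :
    Nat.card {w : HS M // und K w = v} = p ∧ ∀ w : HS M, und K w = v → Ideal.absNorm w.asIdeal = Ideal.absNorm v.asIdeal := by
  obtain ⟨w, w', hw, hw', hne⟩ := h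
  have hfin := finite_over (M := M) v
  have h1 : 1 < Nat.card {w : HS M // und K w = v} := by
    rw [Finite.one_lt_card_iff_nontrivial]
    exact ⟨⟨w, hw⟩, ⟨w', hw'⟩, fun h => hne (congrArg Subtype.val h)⟩
  have hc : Nat.card {w : HS M // und K w = v} = p := by
    have h2 := fund_id (K := K) w
    rw [hw, hdeg, mul_assoc, ncard_over] at h2
    rcases (Nat.dvd_prime hp).1 (Dvd.intro _ h2) with h3 | h3
    · omega
    · exact h3
  refine ⟨hc, fun u hu => ?_⟩
  have h2 := fund_id (K := K) u
  rw [hu, hdeg, mul_assoc, ncard_over, hc] at h2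
  have h3 : eram K u * u.asIdeal.inertiaDeg (𝓞 K) = 1 := by
    apply Nat.eq_of_mul_eq_mul_left hp.pos; omega
  rw [absNorm_und (K := K) u, Nat.eq_one_of_mul_eq_one_left h3, pow_one, hu]

lemma euler_prod_root {ℓ : ℕ} (hℓ : ℓ.Prime) {z : ℂ} (hz : z ^ ℓ = 1) (x : ℝ) (hx : 0 < x ∧ x < 1) :
    (z = 1 → ∏ i ∈ Finset.range ℓ, ‖1 - z ^ i * (x : ℂ)‖ = (1 - x) ^ ℓ) ∧
    (z ≠ 1 → ∏ i ∈ Finset.range ℓ, ‖1 - z ^ i * (x : ℂ)‖ ≤ 1) := by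
  constructor
  · rintro rfl
    simp only [one_pow, one_mul, Finset.prod_const, Finset.card_range]
    rw [← Complex.ofReal_one, ← Complex.ofReal_sub, Complex.norm_real, Real.norm_of_nonneg (by linarith)]
  · intro hz1
    have hprim : IsPrimitiveRoot z ℓ := by
      have := Fact.mk hℓ
      have := IsPrimitiveRoot.orderOf z
      rwa [orderOf_eq_prime hz hz1] at this
    have hx0 : (x : ℂ) ≠ 0 := by exact_mod_cast hx.1.ne'
    have h1 := prod_sub_pow hℓ.pos hprim ((x : ℂ)⁻¹)
    have h2 : ∏ i ∈ Finset.range ℓ, (1 - z ^ i * (x : ℂ)) = 1 - (x : ℂ) ^ ℓ := by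
      have : ∀ i ∈ Finset.range ℓ, (1 - z ^ i * (x : ℂ)) = (x : ℂ) * ((x : ℂ)⁻¹ - z ^ i) := by
        intro i _
        field_simp
      rw [Finset.prod_congr rfl this, Finset.prod_mul_distrib, h1, Finset.prod_const, Finset.card_range, inv_pow]
      field_simp
    rw [← norm_prod, h2, ← Complex.ofReal_one, ← Complex.ofReal_pow, ← Complex.ofReal_sub, Complex.norm_real, Real.norm_eq_abs]
    have h3 : 0 ≤ x ^ ℓ := by have := hx.1; positivity
    have h4 : x ^ ℓ ≤ 1 := pow_le_one₀ hx.1.le hx.2.le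
    rw [abs_of_nonneg (by linarith)]; linarith

/-- key inequality -/
lemma zeta_ineq [IsGalois K M] {p ℓ : ℕ} (hp : p.Prime) (hℓ : ℓ.Prime) (hdeg : Nat.card (M ≃ₐ[K] M) = p)
    (χ : ClassGroup (𝓞 K) →* ℂ) (hχ : ∀ C, χ C ^ ℓ = 1)
    (hsp : ∀ v : HS K, χ (pcl v) ≠ 1 → ∃ w w' : HS M, und K w = v ∧ und K w' = v ∧ w ≠ w')
    {s : ℝ} (hs : 1 < s ∧ s ≤ 2) :
    zet K s ^ (ℓ * p) ≤ (∏ i ∈ Finset.range ℓ, ‖Lf (χ ^ i) s‖) ^ p * zet M s ^ ℓ := by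
  classical
  have hover : ∀ v : HS K, Fintype {w : HS M // und K w = v} := fun v => by
    have := finite_over (M := M) v
    exact Fintype.ofFinite _
  -- local inequality
  have hloc : ∀ v : HS K, (∏ i ∈ Finset.range ℓ, ‖1 - (χ ^ i) (pcl v) * (xv s v : ℂ)‖) ^ p *
      (∏ w : {w : HS M // und K w = v}, (1 - xv s w.1)) ^ ℓ ≤ (1 - xv s v) ^ (ℓ * p) := by
    intro v
    have hx : 0 < xv s v ∧ xv s v < 1 := ⟨xv_pos s v, xv_lt_one hs.1 v⟩
    obtain ⟨e1, e2⟩ := euler_prod_root hℓ (hχ (pcl v)) (xv s v) hx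
    simp only [MonoidHom.pow_apply]
    have hw01 : ∀ w : {w : HS M // und K w = v}, 0 ≤ 1 - xv s w.1 ∧ 1 - xv s w.1 ≤ 1 := fun w =>
      ⟨by linarith [xv_lt_one hs.1 w.1], by linarith [xv_pos s w.1]⟩
    by_cases h : χ (pcl v) = 1
    · rw [e1 h, ← pow_mul]
      refine mul_le_of_le_one_right (by have := hx.2; exact pow_nonneg (by linarith) _) ?_
      exact pow_le_one₀ (Finset.prod_nonneg fun w _ => (hw01 w).1) (Finset.prod_le_one (fun w _ => (hw01 w).1) fun w _ => (hw01 w).2)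
    · obtain ⟨hc, hN⟩ := over_split hp hdeg v (hsp v h)
      have h3 : ∏ w : {w : HS M // und K w = v}, (1 - xv s w.1) = (1 - xv s v) ^ p := by
        rw [Finset.prod_congr rfl (g := fun _ => 1 - xv s v), Finset.prod_const, Finset.card_univ, ← Nat.card_eq_fintype_card, hc]
        intro w _
        unfold xv
        rw [hN w.1 w.2]
      rw [h3, ← pow_mul, mul_comm p ℓ]
      refine mul_le_of_le_one_left (pow_nonneg (by linarith [hx.2]) _) ?_
      exact pow_le_one₀ (Finset.prod_nonneg fun _ _ => norm_nonneg _) (e2 h)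
  have hz := zet_pos (K := K) hs
  have hz' := zet_pos (K := M) hs
  -- finite level
  let A : Finset (HS K) → ℝ := fun S => (∏ i ∈ Finset.range ℓ, ((∏ v ∈ S, ‖1 - (χ ^ i) (pcl v) * (xv s v : ℂ)‖) * ‖Lf (χ ^ i) s‖)) ^ p
  let C : Finset (HS K) → ℝ := fun S => ((∏ v ∈ S, ‖1 - (1 : ClassGroup (𝓞 K) →* ℂ) (pcl v) * (xv s v : ℂ)‖) * ‖Lf (1 : ClassGroup (𝓞 K) →* ℂ) s‖) ^ (ℓ * p)
  have hA : Tendsto A atTop (𝓝 1) := by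
    have : Tendsto A atTop (𝓝 ((∏ i ∈ Finset.range ℓ, (1 : ℝ)) ^ p)) :=
      (tendsto_finsetProd _ fun i _ => Lf_euler (χ ^ i) hs).pow p
    simpa using this
  have hC : Tendsto C atTop (𝓝 1) := by
    have : Tendsto C atTop (𝓝 ((1 : ℝ) ^ (ℓ * p))) := (Lf_euler 1 hs).pow _
    simpa using this
  set R : ℝ := (∏ i ∈ Finset.range ℓ, ‖Lf (χ ^ i) s‖) ^ p * zet M s ^ ℓ with hR
  have hfinite : ∀ S, A S * zet K s ^ (ℓ * p) ≤ C S * R := by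
    intro S
    have hA' : A S = (∏ v ∈ S, (∏ i ∈ Finset.range ℓ, ‖1 - (χ ^ i) (pcl v) * (xv s v : ℂ)‖) ^ p) * (∏ i ∈ Finset.range ℓ, ‖Lf (χ ^ i) s‖) ^ p := by
      simp only [A]
      rw [Finset.prod_mul_distrib, mul_pow, Finset.prod_comm, Finset.prod_pow]
    have hC' : C S = (∏ v ∈ S, (1 - xv s v) ^ (ℓ * p)) * zet K s ^ (ℓ * p) := by
      simp only [C]
      rw [Lf_one, Complex.norm_real, Real.norm_of_nonneg hz.le, mul_pow, Finset.prod_pow]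
      congr 2
      refine Finset.prod_congr rfl fun v _ => ?_
      rw [MonoidHom.one_apply, one_mul, ← Complex.ofReal_one, ← Complex.ofReal_sub, Complex.norm_real,
        Real.norm_of_nonneg (by linarith [xv_lt_one hs.1 v])]
    -- primes above
    have hB : 1 ≤ (∏ v ∈ S, (∏ w : {w : HS M // und K w = v}, (1 - xv s w.1)) ^ ℓ) * zet M s ^ ℓ := by
      have h1 := zet_euler_le (K := M) hs (S.biUnion fun v => Finset.univ.image (fun w : {w : HS M // und K w = v} => w.1))
      rw [Finset.prod_biUnion] at h1
      · rw [Finset.prod_congr rfl (fun v _ => Finset.prod_image (fun a _ b _ hab => Subtype.ext hab))] at h1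
        rw [Finset.prod_pow, ← mul_pow]
        exact one_le_pow₀ h1
      · intro v _ v' _ hne
        rw [Function.onFun, Finset.disjoint_left]
        intro w hw hw'
        simp only [Finset.mem_image, Finset.mem_univ, true_and, Subtype.exists, exists_prop, exists_eq_right] at hw hw'
        exact hne (hw.symm.trans hw')
    set P1 := ∏ v ∈ S, (∏ i ∈ Finset.range ℓ, ‖1 - (χ ^ i) (pcl v) * (xv s v : ℂ)‖) ^ p with hP1
    set P2 := ∏ v ∈ S, (∏ w : {w : HS M // und K w = v}, (1 - xv s w.1)) ^ ℓ with hP2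
    set P3 := ∏ v ∈ S, (1 - xv s v) ^ (ℓ * p) with hP3
    have hP : P1 * P2 ≤ P3 := by
      rw [hP1, hP2, ← Finset.prod_mul_distrib]
      refine Finset.prod_le_prod (fun v _ => ?_) fun v _ => hloc v
      refine mul_nonneg (pow_nonneg (Finset.prod_nonneg fun _ _ => norm_nonneg _) _) (pow_nonneg (Finset.prod_nonneg fun w _ => ?_) _)
      linarith [xv_lt_one hs.1 w.1]
    have hP10 : 0 ≤ P1 := Finset.prod_nonneg fun v _ => pow_nonneg (Finset.prod_nonneg fun _ _ => norm_nonneg _) _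
    set Q := (∏ i ∈ Finset.range ℓ, ‖Lf (χ ^ i) s‖) ^ p with hQ
    have hQ0 : 0 ≤ Q := pow_nonneg (Finset.prod_nonneg fun _ _ => norm_nonneg _) _
    rw [hA', hC', hR]
    have hzz : 0 ≤ zet K s ^ (ℓ * p) := by positivity
    have hzz' : 0 ≤ zet M s ^ ℓ := by positivity
    calc P1 * Q * zet K s ^ (ℓ * p) ≤ P1 * Q * zet K s ^ (ℓ * p) * (P2 * zet M s ^ ℓ) :=
          le_mul_of_one_le_right (by positivity) hB
      _ = (P1 * P2) * (zet K s ^ (ℓ * p) * (Q * zet M s ^ ℓ)) := by ring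
      _ ≤ P3 * (zet K s ^ (ℓ * p) * (Q * zet M s ^ ℓ)) := mul_le_mul_of_nonneg_right hP (by positivity)
      _ = _ := by ring
  have h1 := le_of_tendsto_of_tendsto' (hA.mul_const (zet K s ^ (ℓ * p))) (hC.mul_const R) hfinite
  simpa using h1

end
end CFT
end P7i

section P7j
open NumberField IsDedekindDomain HeightOneSpectrum
open scoped nonZeroDivisors Pointwise
set_option linter.unusedSectionVars false
namespace CFT
section
open Filter Topology
variable {K M : Type*} [Field K] [NumberField K] [Field M] [NumberField M] [Algebra K M]

theorem exists_nonsplit [IsGalois K M] {p ℓ : ℕ} (hp : p.Prime) (hℓ : ℓ.Prime) (hℓ2 : ℓ ≠ 2) (hdeg : Nat.card (M ≃ₐ[K] M) = p)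
    (χ : ClassGroup (𝓞 K) →* Multiplicative (ZMod ℓ)) (hχ : χ ≠ 1) :
    ∃ v : HS K, χ (pcl v) ≠ 1 ∧ ∀ w w' : HS M, und K w = v → und K w' = v → w = w' := by
  by_contra hcon
  push Not at hcon
  have := Fact.mk hℓ
  have hNZ : NeZero ℓ := ⟨hℓ.ne_zero⟩
  let ψ : ClassGroup (𝓞 K) →* ℂ := (ZMod.stdAddChar (N := ℓ)).toMonoidHom.comp χ
  have hψ : ∀ C, ψ C = ZMod.stdAddChar (χ C).toAdd := fun _ => rfl
  have hψ1 : ∀ C i, (ψ ^ i) C = 1 ↔ χ C ^ i = 1 := by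
    intro C i
    rw [MonoidHom.pow_apply, hψ, ← AddChar.map_nsmul_eq_pow]
    rw [show (1 : ℂ) = ZMod.stdAddChar (0 : ZMod ℓ) from (AddChar.map_zero_eq_one _).symm, (ZMod.injective_stdAddChar).eq_iff]
    rfl
  have hpow : ∀ C, χ C ^ ℓ = 1 := by
    intro C
    apply Multiplicative.toAdd.injective
    rw [toAdd_pow, nsmul_eq_mul, CharP.cast_eq_zero, zero_mul, toAdd_one]
  have hne : ∀ i ∈ Finset.Ico 1 ℓ, ψ ^ i ≠ 1 := by
    intro i hi h
    apply hχ
    ext1 C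
    have h1 : χ C ^ i = 1 := (hψ1 C i).1 (by rw [h]; rfl)
    have h2 := hpow C
    rw [Finset.mem_Ico] at hi
    have h3 : Nat.Coprime i ℓ := (Nat.Coprime.symm ((Nat.Prime.coprime_iff_not_dvd hℓ).2 fun hd => by
      have := Nat.le_of_dvd (by omega) hd; omega))
    have h4 := orderOf_dvd_of_pow_eq_one h1
    have h5 := orderOf_dvd_of_pow_eq_one h2
    have h6 := Nat.dvd_gcd h4 h5
    rw [h3.gcd_eq_one, Nat.dvd_one, orderOf_eq_one_iff] at h6
    exact h6
  have hB : ∀ i : Finset.Ico 1 ℓ, ∃ B : ℝ, 0 ≤ B ∧ ∀ᶠ s : ℝ in 𝓝[>] 1, ‖Lf (ψ ^ (i : ℕ)) s‖ ≤ B := fun i => Lf_bounded _ (hne i i.2)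
  choose B hB0 hB using hB
  set b := ∏ i, B i with hb
  have hb0 : 0 ≤ b := Finset.prod_nonneg fun i _ => hB0 i
  obtain ⟨c, C, hc, hC, h1⟩ := zet_bounds (K := K)
  obtain ⟨c', C', hc', hC', h2⟩ := zet_bounds (K := M)
  have h3 : ∀ᶠ s : ℝ in 𝓝[>] 1, C ^ p * b ^ p * C' ^ ℓ * (s - 1) < c ^ (ℓ * p) := by
    have : Tendsto (fun s : ℝ => C ^ p * b ^ p * C' ^ ℓ * (s - 1)) (𝓝[>] 1) (𝓝 (C ^ p * b ^ p * C' ^ ℓ * (1 - 1))) :=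
      Tendsto.mono_left (Continuous.tendsto (by fun_prop) 1) nhdsWithin_le_nhds
    rw [sub_self, mul_zero] at this
    exact this.eventually (gt_mem_nhds (by positivity))
  have hall : ∀ᶠ s : ℝ in 𝓝[>] 1, ∀ i : Finset.Ico 1 ℓ, ‖Lf (ψ ^ (i : ℕ)) s‖ ≤ B i := eventually_all.2 hB
  obtain ⟨s, ⟨⟨⟨hs, h1⟩, h2⟩, h3⟩, h4⟩ := ((((Filter.Eventually.and (Ioc_mem_nhdsGT (show (1 : ℝ) < 2 by norm_num)) h1).and h2).and h3).and hall).exists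
  have hin := zeta_ineq hp hℓ hdeg ψ (fun C => by rw [← MonoidHom.pow_apply]; exact (hψ1 C ℓ).2 (hpow C)) (fun v hv => by
    obtain ⟨w, w', e1, e2, e3⟩ := hcon v (fun h => hv (by have := (hψ1 (pcl v) 1).2 (by rw [h, one_pow]); rwa [pow_one] at this))
    exact ⟨w, w', e1, e2, e3⟩) hs
  have hz := zet_pos (K := K) hs
  have hz' := zet_pos (K := M) hs
  have h5 : ∏ i ∈ Finset.range ℓ, ‖Lf (ψ ^ i) s‖ ≤ zet K s * b := by
    rw [Finset.range_eq_Ico, Finset.prod_eq_prod_Ico_succ_bot hℓ.pos, pow_zero, Lf_one, Complex.norm_real, Real.norm_of_nonneg hz.le]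
    refine mul_le_mul_of_nonneg_left ?_ hz.le
    rw [hb, ← Finset.prod_coe_sort]
    exact Finset.prod_le_prod (fun _ _ => norm_nonneg _) fun i _ => h4 i
  have h6 : (∏ i ∈ Finset.range ℓ, ‖Lf (ψ ^ i) s‖) ^ p ≤ (zet K s * b) ^ p :=
    pow_le_pow_left₀ (Finset.prod_nonneg fun _ _ => norm_nonneg _) h5 p
  have hℓ3 : 3 ≤ ℓ := by have := hℓ.two_le; omega
  obtain ⟨e, he⟩ : ∃ e, ℓ * p = p + ℓ + e + 1 := by
    have : p + ℓ + 1 ≤ ℓ * p := by have := hp.two_le; nlinarith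
    exact ⟨ℓ * p - (p + ℓ + 1), by omega⟩
  set t := s - 1 with ht
  have ht0 : 0 < t := by rw [ht]; linarith [hs.1]
  have ht1 : t ≤ 1 := by rw [ht]; linarith [hs.2]
  set z := zet K s
  set z' := zet M s
  have h7 : c ^ (ℓ * p) ≤ C ^ p * b ^ p * C' ^ ℓ * t := by
    calc c ^ (ℓ * p) ≤ (t * z) ^ (ℓ * p) := pow_le_pow_left₀ hc.le h1.1 _
      _ = t ^ (ℓ * p) * z ^ (ℓ * p) := mul_pow _ _ _
      _ ≤ t ^ (ℓ * p) * ((z * b) ^ p * z' ^ ℓ) := by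
        refine mul_le_mul_of_nonneg_left (hin.trans ?_) (by positivity)
        exact mul_le_mul_of_nonneg_right h6 (by positivity)
      _ = (t * z) ^ p * b ^ p * (t * z') ^ ℓ * (t * t ^ e) := by rw [he]; ring
      _ ≤ C ^ p * b ^ p * C' ^ ℓ * (t * 1) := by
        have := h1.2
        have := h2.2
        have : t ^ e ≤ 1 := pow_le_one₀ ht0.le ht1
        gcongr
      _ = _ := by ring
  linarith

/-- nonsplit primes generate `Cl/ℓ` -/
theorem nonsplit_gen [IsGalois K M] {p ℓ : ℕ} (hp : p.Prime) (hℓ : ℓ.Prime) (hℓ2 : ℓ ≠ 2) (hdeg : Nat.card (M ≃ₐ[K] M) = p)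
    (H : Subgroup (ClassGroup (𝓞 K))) (hH : ∀ a, a ^ ℓ ∈ H)
    (hH' : ∀ v : HS K, (∀ w w' : HS M, und K w = v → und K w' = v → w = w') → pcl v ∈ H) : H = ⊤ := by
  rw [eq_top_iff]
  intro a _
  by_contra ha
  obtain ⟨θ, h1, h2⟩ := exists_char hℓ H hH a ha
  obtain ⟨v, hv, hv'⟩ := exists_nonsplit hp hℓ hℓ2 hdeg θ (fun h => h2 (by rw [h]; rfl))
  exact hv (h1 _ (hH' v hv'))

end
end CFT
end P7j

section P5a
open NumberField IsDedekindDomain HeightOneSpectrum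
open scoped nonZeroDivisors Pointwise
set_option linter.unusedSectionVars false
namespace CFT
section
variable {F L : Type} [Field F] [NumberField F] [Field L] [NumberField L] [Algebra F L]

/-- `ℓ`-torsion characters of the Galois group which are everywhere unramified -/
def VV (ℓ : ℕ) (F L : Type*) [Field F] [NumberField F] [Field L] [NumberField L] [Algebra F L] :
    Subgroup ((L ≃ₐ[F] L) →* Multiplicative (ZMod ℓ)) where
  carrier := {φ | ∀ (w : HS L) (τ : L ≃ₐ[F] L), (∀ r : 𝓞 L, τ • r - r ∈ w.asIdeal) → φ τ = 1}
  mul_mem' := fun ha hb w τ h => by rw [MonoidHom.mul_apply, ha w τ h, hb w τ h, one_mul]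
  one_mem' := fun _ _ _ => rfl
  inv_mem' := fun ha w τ h => by rw [MonoidHom.inv_apply, ha w τ h, inv_one]

lemma mem_VV {ℓ : ℕ} {φ : (L ≃ₐ[F] L) →* Multiplicative (ZMod ℓ)} :
    φ ∈ VV ℓ F L ↔ ∀ (w : HS L) (τ : L ≃ₐ[F] L), (∀ r : 𝓞 L, τ • r - r ∈ w.asIdeal) → φ τ = 1 := Iff.rfl

lemma finite_VV {ℓ : ℕ} (hℓ : ℓ.Prime) : Finite (VV ℓ F L) := by
  have : NeZero ℓ := ⟨hℓ.ne_zero⟩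
  have : Finite (Multiplicative (ZMod ℓ)) := inferInstanceAs (Finite (ZMod ℓ))
  have : Finite ((L ≃ₐ[F] L) →* Multiplicative (ZMod ℓ)) := Finite.of_injective _ DFunLike.coe_injective
  infer_instance

lemma W0_local {ℓ : ℕ} {lam α : Fˣ} (hα : α ∈ W0 ℓ lam) (v : HS F) :
    ∃ c : Fˣ, α / c ^ ℓ ∈ PU v (ℓ * (ord v lam).toNat) := by
  by_cases hv : v ∈ Lam lam
  · obtain ⟨β, hβ, c', hc', rfl⟩ := Subgroup.mem_sup.1 hα.1
    obtain ⟨c, hc, rfl⟩ := hc'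
    refine ⟨c, ?_⟩
    rw [powMonoidHom_apply, mul_div_cancel_right]
    exact mem_Bn.1 hβ v hv
  · have h0 : ord v lam = 0 := by_contra fun h => hv (mem_Lam.2 h)
    obtain ⟨k, hk⟩ := (mem_WW.1 hα.2).2 v
    obtain ⟨c, hc⟩ := approx_ord {v} (fun _ => k)
    refine ⟨c, ?_⟩
    rw [h0, Int.toNat_zero, mul_zero, mem_PU_zero, ord_div, ord_pow, hc v (by simp), hk, sub_self]

lemma kum_char [IsGalois F L] {ℓ : ℕ} (hℓ : ℓ.Prime) {ζ : F} (hζ : IsPrimitiveRoot ζ ℓ) {lam α : Fˣ}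
    (hlam : (lam : F) = 1 - ζ) (hα : α ∈ W0 ℓ lam) (a : Lˣ) (ha : a ^ ℓ = Units.map (algebraMap F L : F →* L) α) :
    ∃ φ ∈ VV ℓ F L, ∀ g : L ≃ₐ[F] L, g (a : L) = algebraMap F L ζ ^ (φ g).toAdd.val * a := by
  have := Fact.mk hℓ
  have hζL : IsPrimitiveRoot (algebraMap F L ζ) ℓ := hζ.map_of_injective (algebraMap F L).injective
  have haL : (a : L) ^ ℓ = algebraMap F L α := by
    have := congrArg Units.val ha
    simpa using this
  have hk : ∀ g : L ≃ₐ[F] L, ∃ k : ZMod ℓ, g (a : L) = algebraMap F L ζ ^ k.val * a := by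
    intro g
    have h1 : (g (a : L) / a) ^ ℓ = 1 := by
      rw [div_pow, ← map_pow, haL, AlgEquiv.commutes, div_self]
      exact (map_ne_zero _).2 α.ne_zero
    obtain ⟨i, hi, hi'⟩ := hζL.eq_pow_of_pow_eq_one h1
    refine ⟨(i : ZMod ℓ), ?_⟩
    rw [ZMod.val_natCast, Nat.mod_eq_of_lt hi, hi', div_mul_cancel₀ _ a.ne_zero]
  choose k hk using hk
  have hinj : ∀ x y : ZMod ℓ, algebraMap F L ζ ^ x.val = algebraMap F L ζ ^ y.val → x = y := by
    intro x y h
    exact ZMod.val_injective _ (hζL.pow_inj x.val_lt y.val_lt h)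
  have hadd : ∀ x y : ZMod ℓ, algebraMap F L ζ ^ (x + y).val = algebraMap F L ζ ^ x.val * algebraMap F L ζ ^ y.val := by
    intro x y
    rw [ZMod.val_add, ← pow_add, ← pow_eq_pow_mod _ hζL.pow_eq_one]
  let φ : (L ≃ₐ[F] L) →* Multiplicative (ZMod ℓ) := MonoidHom.mk' (fun g => Multiplicative.ofAdd (k g)) (by
    intro g h
    apply Multiplicative.toAdd.injective
    apply hinj
    apply mul_right_cancel₀ a.ne_zero
    rw [toAdd_ofAdd, ← hk, toAdd_mul, toAdd_ofAdd, toAdd_ofAdd, hadd, AlgEquiv.mul_apply, hk h, map_mul, map_pow, AlgEquiv.commutes, hk g]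
    ring)
  refine ⟨φ, ?_, hk⟩
  intro w τ hτ
  obtain ⟨c, hc⟩ := W0_local hα (und F w)
  let ι := Units.map (algebraMap F L : F →* L)
  have hlamL : ((ι lam : Lˣ) : L) = 1 - algebraMap F L ζ := by
    simp [ι, hlam]
  have hm : ((eram F w * (ord (und F w) lam).toNat : ℕ) : ℤ) = ord w (ι lam) := by
    rw [ord_algebraMap, Nat.cast_mul, Int.toNat_of_nonneg (ord_lam_nonneg hℓ hζ hlam _)]
  have hpu : (a / ι c) ^ ℓ ∈ PU w (ℓ * (eram F w * (ord (und F w) lam).toNat)) := by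
    have := PU_map hc
    rw [map_div, map_pow] at this
    rw [div_pow, ha]
    convert this using 2
    ring
  have hc' : τ ((ι c : Lˣ) : L) = ι c := AlgEquiv.commutes _ _
  have hτa : τ ((a / ι c : Lˣ) : L) = (algebraMap F L ζ ^ (k τ).val) * ((a / ι c : Lˣ) : L) := by
    rw [Units.val_div_eq_div_val, map_div₀, hk τ, hc', mul_div_assoc]
  have h1 := kum_fix hℓ hζL (ι lam) hlamL hτ (AlgEquiv.commutes _ _) hm hpu
    (by rw [← pow_mul, mul_comm, pow_mul, hζL.pow_eq_one, one_pow]) hτa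
  apply Multiplicative.toAdd.injective
  apply hinj
  change algebraMap F L ζ ^ (k τ).val = algebraMap F L ζ ^ (0 : ZMod ℓ).val
  rw [ZMod.val_zero, pow_zero]
  rw [h1] at hτa
  exact (mul_eq_right₀ (a / ι c : Lˣ).ne_zero).1 hτa.symm

end
section
variable {F L : Type} [Field F] [NumberField F] [Field L] [NumberField L] [Algebra F L]

/-- the Kummer case -/
theorem kum_top [IsGalois F L] {ℓ : ℕ} (hℓ : ℓ.Prime) {ζ : F} (hζ : IsPrimitiveRoot ζ ℓ) {lam : Fˣ}
    (hlam : (lam : F) = 1 - ζ) (hroot : ∀ α ∈ W0 ℓ lam, ∃ a : Lˣ, a ^ ℓ = Units.map (algebraMap F L : F →* L) α) :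
    ctors F ℓ ≤ Nat.card (VV ℓ F L) := by
  have := finite_VV (F := F) (L := L) hℓ
  refine (index_W0 hℓ hζ lam hlam).trans ?_
  have h := fun α : W0 ℓ lam => (hroot α α.2)
  choose a ha using h
  have h := fun α : W0 ℓ lam => kum_char hℓ hζ hlam α.2 (a α) (ha α)
  choose φ hφ hφ' using h
  let f : (W0 ℓ lam) ⧸ (((Bn lam 0).map (powMonoidHom ℓ)).subgroupOf (W0 ℓ lam)) → VV ℓ F L := fun x => ⟨φ x.out, hφ _⟩
  rw [Subgroup.relIndex, Subgroup.index_eq_card]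
  refine Nat.card_le_card_of_injective f fun x y hxy => ?_
  have hxy : φ x.out = φ y.out := congrArg Subtype.val hxy
  rw [← x.out_eq', ← y.out_eq', QuotientGroup.eq, Subgroup.mem_subgroupOf]
  set α := x.out
  set β := y.out
  have hfix : ∀ g : L ≃ₐ[F] L, g ((a β / a α : Lˣ) : L) = ((a β / a α : Lˣ) : L) := by
    intro g
    have hz : algebraMap F L ζ ^ (φ β g).toAdd.val ≠ 0 := pow_ne_zero _ ((map_ne_zero _).2 (hζ.ne_zero hℓ.ne_zero))
    rw [Units.val_div_eq_div_val, map_div₀, hφ', hφ', hxy, mul_div_mul_left _ _ hz]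
  obtain ⟨c, hc⟩ := (IsGalois.mem_range_algebraMap_iff_fixed _).2 hfix
  have hc0 : c ≠ 0 := fun h => (a β / a α).ne_zero (by rw [← hc, h, map_zero])
  have hcα : (Units.mk0 c hc0) ^ ℓ = (α : Fˣ)⁻¹ * (β : Fˣ) := by
    apply Units.map_injective (f := (algebraMap F L : F →* L)) (algebraMap F L).injective
    have : Units.map (algebraMap F L : F →* L) (Units.mk0 c hc0) = a β / a α := Units.ext hc
    rw [map_pow, this, map_mul, map_inv, ← ha, ← ha, div_pow]
    rw [div_eq_mul_inv, mul_comm]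
  have hB : (α : Fˣ)⁻¹ * (β : Fˣ) ∈ Bn lam 0 := mul_mem (inv_mem (mem_WW.1 α.2.2).1) (mem_WW.1 β.2.2).1
  refine ⟨Units.mk0 c hc0, ?_, hcα⟩
  rw [SetLike.mem_coe, mem_B0]
  rw [mem_B0] at hB
  intro v hv
  have h1 := hB v hv
  rw [← hcα, ord_pow] at h1
  exact (mul_eq_zero.1 h1).resolve_left (by exact_mod_cast hℓ.ne_zero)

end
end CFT
end P5a

section P6a
open NumberField IsDedekindDomain HeightOneSpectrum
open scoped nonZeroDivisors Pointwise
set_option linter.unusedSectionVars false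
namespace CFT
section
variable {G : Type*} [Group G] {H : Subgroup G} [H.FiniteIndex] {A : Type*} [CommGroup A]

lemma transfer_pow (φ : H →* A) (h : G) (a : A)
    (key : ∀ (k : ℕ) (g : G) (hk : g⁻¹ * h ^ k * g ∈ H), φ ⟨g⁻¹ * h ^ k * g, hk⟩ = a ^ k) :
    MonoidHom.transfer φ h = a ^ H.index := by
  classical
  have := H.fintypeQuotientOfFiniteIndex
  rw [MonoidHom.transfer_eq_prod_quotient_orbitRel_zpowers_quot, Subgroup.index_eq_sum_minimalPeriod H h, ← Finset.prod_pow_eq_pow_sum]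
  exact Finset.prod_congr rfl fun q _ => key _ _ _

lemma cyc_gen {D C : Type*} [Group D] [Group C] [IsCyclic C] (f : D →* C) : ∃ h, ∀ g, ∃ n : ℤ, f (g * h ^ n) = 1 := by
  have hc : IsCyclic f.range := Subgroup.isCyclic _
  obtain ⟨⟨_, h, rfl⟩, hc⟩ := hc
  refine ⟨h, fun g => ?_⟩
  obtain ⟨n, hn⟩ := hc ⟨f g, g, rfl⟩
  have hn : f h ^ n = f g := congrArg Subtype.val hn
  exact ⟨-n, by rw [map_mul, map_zpow, ← hn, zpow_neg, mul_inv_cancel]⟩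
end

section
variable {F L : Type*} [Field F] [NumberField F] [Field L] [NumberField L] [Algebra F L]

lemma gact_iff_stab (g : L ≃ₐ[F] L) (w : HS L) : gact g w = w ↔ g ∈ MulAction.stabilizer (L ≃ₐ[F] L) w.asIdeal :=
  ⟨fun h => congrArg HeightOneSpectrum.asIdeal h, fun h => HeightOneSpectrum.ext h⟩

lemma decomp (w : HS L) :
    (∀ g h : L ≃ₐ[F] L, gact g w = w → gact h w = w → ∀ r : 𝓞 L, (g * h * g⁻¹ * h⁻¹) • r - r ∈ w.asIdeal) ∧
    (∃ h : L ≃ₐ[F] L, gact h w = w ∧ ∀ g : L ≃ₐ[F] L, gact g w = w → ∃ n : ℤ, ∀ r : 𝓞 L, (g * h ^ n) • r - r ∈ w.asIdeal) := by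
  have hmax := w.isMaximal
  have hmax' := (und F w).isMaximal
  let _ : Field (𝓞 L ⧸ w.asIdeal) := Ideal.Quotient.field _
  let _ : Field (𝓞 F ⧸ (und F w).asIdeal) := Ideal.Quotient.field _
  have hfin : Finite (𝓞 L ⧸ w.asIdeal) := Ideal.finiteQuotientOfFreeOfNeBot _ w.ne_bot
  have hcyc : IsCyclic ((𝓞 L ⧸ w.asIdeal) ≃ₐ[𝓞 F ⧸ (und F w).asIdeal] (𝓞 L ⧸ w.asIdeal)) := inferInstance
  let f := Ideal.Quotient.stabilizerHom w.asIdeal (und F w).asIdeal (L ≃ₐ[F] L)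
  have hf : ∀ g, f g = 1 ↔ ∀ r : 𝓞 L, (g : L ≃ₐ[F] L) • r - r ∈ w.asIdeal := by
    intro g
    rw [← MonoidHom.mem_ker, Ideal.Quotient.ker_stabilizerHom]
    rfl
  constructor
  · intro g h hg hh
    have := (hf (⟨g, (gact_iff_stab g w).1 hg⟩ * ⟨h, (gact_iff_stab h w).1 hh⟩ * ⟨g, (gact_iff_stab g w).1 hg⟩⁻¹ * ⟨h, (gact_iff_stab h w).1 hh⟩⁻¹)).1
    refine this ?_
    simp only [map_mul, map_inv]
    have hcomm : ∀ a b : ((𝓞 L ⧸ w.asIdeal) ≃ₐ[𝓞 F ⧸ (und F w).asIdeal] (𝓞 L ⧸ w.asIdeal)), a * b = b * a := by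
      obtain ⟨c, hc⟩ := hcyc
      intro a b
      obtain ⟨m, rfl⟩ := hc a
      obtain ⟨n, rfl⟩ := hc b
      change c ^ m * c ^ n = c ^ n * c ^ m
      rw [← zpow_add, ← zpow_add, add_comm]
    rw [hcomm (f _) (f _), mul_inv_cancel_right, mul_inv_cancel]
  · obtain ⟨h, hh⟩ := cyc_gen f
    refine ⟨h, (gact_iff_stab _ w).2 h.2, fun g hg => ?_⟩
    obtain ⟨n, hn⟩ := hh ⟨g, (gact_iff_stab g w).1 hg⟩
    exact ⟨n, (hf _).1 hn⟩
end

section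
variable {F F' L : Type} [Field F] [NumberField F] [Field F'] [NumberField F'] [Field L] [NumberField L] [Algebra F L]
  [Algebra F F'] [Algebra F' L] [IsScalarTower F F' L]

lemma und_und (w : HS L) : und F (und F' w) = und F w := by
  ext1
  change Ideal.comap (algebraMap (𝓞 F) (𝓞 F')) (Ideal.comap (algebraMap (𝓞 F') (𝓞 L)) w.asIdeal) = Ideal.comap (algebraMap (𝓞 F) (𝓞 L)) w.asIdeal
  rw [Ideal.comap_comap, ← IsScalarTower.algebraMap_eq]

/-- restriction of scalars on Galois groups -/
def rho (F : Type) {F' L : Type} [Field F] [Field F'] [Field L] [Algebra F L]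
  [Algebra F F'] [Algebra F' L] [IsScalarTower F F' L] : (L ≃ₐ[F'] L) →* (L ≃ₐ[F] L) where
  toFun := AlgEquiv.restrictScalars F
  map_one' := rfl
  map_mul' _ _ := rfl

lemma rho_inj : Function.Injective (rho F : (L ≃ₐ[F'] L) →* (L ≃ₐ[F] L)) := fun a b h => by
  ext x
  exact DFunLike.congr_fun h x

lemma rho_smul (x : L ≃ₐ[F'] L) (r : 𝓞 L) : (rho F x) • r = x • r := rfl

lemma gact_rho (x : L ≃ₐ[F'] L) (w : HS L) : gact (rho F x) w = gact x w := by
  ext1; rfl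

theorem cor_exists [IsGalois F L] [IsGalois F' L] {ℓ : ℕ} {φ : (L ≃ₐ[F'] L) →* Multiplicative (ZMod ℓ)} (hφ : φ ∈ VV ℓ F' L) :
    ∃ ψ ∈ VV ℓ F L, ∀ w : HS L, (∀ q : HS F', und F q = und F w → q = und F' w) →
      ∀ h : L ≃ₐ[F'] L, gact h w = w → ψ (rho F h) = φ h ^ (Module.finrank F F') := by
  let e := MonoidHom.ofInjective (rho_inj (F := F) (F' := F') (L := L))
  let φ' : (rho F : (L ≃ₐ[F'] L) →* (L ≃ₐ[F] L)).range →* Multiplicative (ZMod ℓ) := φ.comp e.symm.toMonoidHom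
  have hφ' : ∀ x hx, φ' ⟨rho F x, hx⟩ = φ x := by
    intro x hx
    change φ (e.symm _) = _
    congr 1
    rw [MulEquiv.symm_apply_eq]
    rfl
  have hindex : (rho F : (L ≃ₐ[F'] L) →* (L ≃ₐ[F] L)).range.index = Module.finrank F F' := by
    have h1 := Subgroup.card_mul_index (rho F : (L ≃ₐ[F'] L) →* (L ≃ₐ[F] L)).range
    have h2 : Nat.card (rho F : (L ≃ₐ[F'] L) →* (L ≃ₐ[F] L)).range = Module.finrank F' L := by
      rw [← IsGalois.card_aut_eq_finrank F' L]
      exact Nat.card_congr e.symm.toEquiv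
    have : FiniteDimensional F F' := Module.Finite.of_restrictScalars_finite ℚ F F'
    rw [h2, IsGalois.card_aut_eq_finrank, ← Module.finrank_mul_finrank F F' L, mul_comm] at h1
    exact Nat.eq_of_mul_eq_mul_right (Module.finrank_pos) h1
  refine ⟨MonoidHom.transfer φ', ?_, ?_⟩
  · intro w τ hτ
    rw [transfer_pow φ' τ 1, one_pow]
    intro k g hk
    rw [one_pow]
    obtain ⟨x, hx⟩ := hk
    have : φ' ⟨g⁻¹ * τ ^ k * g, ⟨x, hx⟩⟩ = φ x := by
      rw [← hφ' x ⟨x, rfl⟩]; congr 2; exact hx.symm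
    rw [this]
    refine hφ (gact g⁻¹ w) x fun r => ?_
    rw [← rho_smul (F := F) x, hx]
    have h1 : τ ^ k ∈ w.asIdeal.inertia (L ≃ₐ[F] L) := pow_mem ((mem_inertia_iff w τ).2 hτ) k
    have h2 := (mem_inertia_iff w _).1 h1 (g • r)
    have h3 : (g⁻¹ * τ ^ k * g) • r - r = g⁻¹ • ((τ ^ k) • (g • r) - g • r) := by
      rw [smul_sub, inv_smul_smul, mul_smul, mul_smul]
    rw [h3]
    exact Ideal.smul_mem_pointwise_smul _ _ _ h2
  · intro w hw h hh
    rw [transfer_pow φ' (rho F h) (φ h), hindex]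
    intro k g hk
    -- decompose `g⁻¹ = η d`
    have h1 : und F' w = und F' (gact g⁻¹ w) := by
      refine (hw _ ?_).symm
      rw [und_und, und_gact]
    obtain ⟨η, hη⟩ := exists_gact w (gact g⁻¹ w) h1
    set d := (rho F η)⁻¹ * g⁻¹ with hd
    have hdw : gact d w = w := by
      rw [hd, gact_mul, ← hη, ← map_inv, gact_rho, ← gact_mul, inv_mul_cancel]
      ext1; exact one_smul _ _
    have hg : g⁻¹ = rho F η * d := by rw [hd, mul_inv_cancel_left]
    have hkw : gact (h ^ k) w = w := by
      rw [gact_iff_stab] at hh ⊢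
      exact pow_mem hh k
    have hcom := (decomp w).1 d (rho F (h ^ k)) hdw (by rw [gact_rho, hkw])
    have hexp : g⁻¹ * rho F h ^ k * g = rho F η * ((d * rho F (h ^ k) * d⁻¹ * (rho F (h ^ k))⁻¹)) * rho F (h ^ k) * (rho F η)⁻¹ := by
      have hg' : g = d⁻¹ * (rho F η)⁻¹ := by rw [← mul_inv_rev, ← hg, inv_inv]
      rw [hg]; nth_rw 1 [hg']; rw [map_pow]; group
    have hmem : d * rho F (h ^ k) * d⁻¹ * (rho F (h ^ k))⁻¹ ∈ (rho F : (L ≃ₐ[F'] L) →* (L ≃ₐ[F] L)).range := by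
      have e1 : d * rho F (h ^ k) * d⁻¹ * (rho F (h ^ k))⁻¹ = (rho F η)⁻¹ * (g⁻¹ * rho F h ^ k * g) * rho F η * (rho F (h ^ k))⁻¹ := by
        rw [hexp]; group
      rw [e1]
      exact mul_mem (mul_mem (mul_mem (inv_mem ⟨η, rfl⟩) hk) ⟨η, rfl⟩) (inv_mem ⟨h ^ k, rfl⟩)
    obtain ⟨x, hx⟩ := hmem
    have hx1 : φ x = 1 := hφ w x fun r => by
      rw [← rho_smul (F := F) x, hx]; exact hcom r
    rw [← hx, ← map_mul, ← map_mul, ← map_inv, ← map_mul] at hexp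
    have : φ' ⟨g⁻¹ * rho F h ^ k * g, hk⟩ = φ (η * x * h ^ k * η⁻¹) := by
      rw [← hφ' _ ⟨_, rfl⟩]; congr 2
    rw [this, map_mul, map_mul, map_mul, hx1, map_inv, mul_one, mul_comm (φ η), mul_inv_cancel_right, map_pow]

end
end CFT
end P6a

section P6b
open NumberField IsDedekindDomain HeightOneSpectrum
open scoped nonZeroDivisors Pointwise
set_option linter.unusedSectionVars false
namespace CFT
section
variable {F M L : Type} [Field F] [NumberField F] [Field M] [NumberField M] [Field L] [NumberField L] [Algebra F L]
  [Algebra F M] [Algebra M L] [IsScalarTower F M L]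

lemma exists_ord_one (v : HS F) : ∃ x : Fˣ, ord v x = 1 := by
  obtain ⟨y, hy⟩ := approx_ord {v} (fun _ => 1)
  exact ⟨y, hy v (by simp)⟩

lemma eram_tower (w : HS L) : eram F w = eram M w * eram F (und M w) := by
  obtain ⟨x, hx⟩ := exists_ord_one (und F w)
  have h1 := ord_algebraMap (K := F) w x
  have h2 := ord_algebraMap (K := M) w (Units.map (algebraMap F M : F →* M) x)
  have h3 := ord_algebraMap (K := F) (und M w) x
  have h4 : Units.map (algebraMap M L : M →* L) (Units.map (algebraMap F M : F →* M) x) = Units.map (algebraMap F L : F →* L) x := by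
    ext; exact (IsScalarTower.algebraMap_apply F M L _).symm
  rw [h4, h3, h1, und_und, hx, mul_one, mul_one] at h2
  exact_mod_cast h2

lemma exists_rho (g : L ≃ₐ[F] L) (h : ∀ x : M, g (algebraMap M L x) = algebraMap M L x) :
    ∃ x : L ≃ₐ[M] L, rho F x = g :=
  ⟨AlgEquiv.ofRingEquiv (f := g.toRingEquiv) h, by ext; rfl⟩

lemma und_lift {g : L ≃ₐ[F] L} {τ : M ≃ₐ[F] M} (h : ∀ x : M, g (algebraMap M L x) = algebraMap M L (τ x)) (w : HS L) :
    und M (gact g w) = gact τ (und M w) := by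
  ext r
  change algebraMap (𝓞 M) (𝓞 L) r ∈ g • w.asIdeal ↔ r ∈ τ • (und M w).asIdeal
  rw [Ideal.mem_pointwise_smul_iff_inv_smul_mem, Ideal.mem_pointwise_smul_iff_inv_smul_mem]
  change _ ↔ algebraMap (𝓞 M) (𝓞 L) _ ∈ w.asIdeal
  have : g⁻¹ • algebraMap (𝓞 M) (𝓞 L) r = algebraMap (𝓞 M) (𝓞 L) (τ⁻¹ • r) := by
    rw [inv_smul_eq_iff]
    apply RingOfIntegers.ext
    change algebraMap M L (r : M) = g (algebraMap M L ((τ⁻¹ • r : 𝓞 M) : M))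
    rw [h]
    congr 1
    exact (AlgEquiv.apply_symm_apply τ (r : M)).symm
  rw [this]

variable [IsGalois F L] [IsGalois M L] [IsGalois F M] {ℓ : ℕ}
  {φ : (L ≃ₐ[F] L) →* Multiplicative (ZMod ℓ)}

lemma eram_of_VV (hφ : φ ∈ VV ℓ F L)
    (hM : ∀ g : L ≃ₐ[F] L, φ g = 1 ↔ ∀ x : M, g (algebraMap M L x) = algebraMap M L x) (v : HS M) : eram F v = 1 := by
  obtain ⟨w, rfl⟩ := exists_over (M := L) v
  have h1 := eram_tower (F := F) (M := M) w
  have h2 : eram F w ≤ eram M w := by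
    rw [← card_inertia, ← card_inertia]
    have hx : ∀ g : w.asIdeal.inertia (L ≃ₐ[F] L), ∃ x : w.asIdeal.inertia (L ≃ₐ[M] L), rho F (x : L ≃ₐ[M] L) = g := by
      intro g
      obtain ⟨x, hx⟩ := exists_rho (M := M) (g : L ≃ₐ[F] L) ((hM g).1 (hφ w g ((mem_inertia_iff w _).1 g.2)))
      refine ⟨⟨x, (mem_inertia_iff w _).2 fun r => ?_⟩, hx⟩
      rw [← rho_smul (F := F) x, hx]
      exact (mem_inertia_iff w _).1 g.2 r
    choose f hf using hx
    refine Nat.card_le_card_of_injective f fun a b hab => ?_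
    apply Subtype.ext
    rw [← hf, ← hf, hab]
  rw [h1] at h2
  have h3 := eram_ne_zero (K := M) w
  have h4 := eram_ne_zero (K := F) (und M w)
  have h5 : eram F (und M w) ≤ 1 := by
    by_contra hcon
    have : 2 ≤ eram F (und M w) := by omega
    have := Nat.mul_le_mul_left (eram M w) this
    omega
  omega

lemma stab_of_VV 
    (hM : ∀ g : L ≃ₐ[F] L, φ g = 1 ↔ ∀ x : M, g (algebraMap M L x) = algebraMap M L x) (v : HS M)
    (hv : ∀ w : HS L, und F w = und F v → ∀ g : L ≃ₐ[F] L, gact g w = w → φ g = 1)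
    (τ : M ≃ₐ[F] M) (hτ : gact τ v = v) : τ = 1 := by
  obtain ⟨w, rfl⟩ := exists_over (M := L) v
  obtain ⟨g, hg⟩ : ∃ g : L ≃ₐ[F] L, ∀ x : M, g (algebraMap M L x) = algebraMap M L (τ x) :=
    ⟨τ.liftNormal L, fun x => AlgEquiv.liftNormal_commutes τ L x⟩
  have h1 := und_lift hg w
  rw [hτ] at h1
  obtain ⟨η, hη⟩ := exists_gact w (gact g w) h1.symm
  have h2 : gact ((rho F η)⁻¹ * g) w = w := by
    rw [gact_mul, ← hη, ← map_inv, gact_rho, ← gact_mul, inv_mul_cancel]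
    ext1; exact one_smul _ _
  have h3 := hv w (by rw [und_und]) _ h2
  have h4 : φ (rho F η) = 1 := (hM _).2 fun x => η.commutes x
  rw [map_mul, map_inv, h4, inv_one, one_mul, hM] at h3
  ext x
  apply (algebraMap M L).injective
  rw [← hg, h3]; rfl

theorem split_contra (hℓ : ℓ.Prime) (hℓ2 : ℓ ≠ 2) (hdeg : Nat.card (M ≃ₐ[F] M) = ℓ) (hφ : φ ∈ VV ℓ F L)
    (hM : ∀ g : L ≃ₐ[F] L, φ g = 1 ↔ ∀ x : M, g (algebraMap M L x) = algebraMap M L x)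
    (T : Finset (HS F)) (h' : ℕ) (hh' : Nat.Coprime h' ℓ)
    (H1 : ∀ D : HS F →₀ ℤ, ∃ γ : Fˣ, ∀ u ∉ T, ord u γ = h' * D u)
    (hT : ∀ w : HS L, und F w ∈ T → ∀ g : L ≃ₐ[F] L, gact g w = w → φ g = 1) : False := by
  have : IsUnramifiedAtInfinitePlaces F M := IsUnramifiedAtInfinitePlaces_of_odd_card_aut
    (by rw [hdeg]; exact hℓ.odd_of_ne_two hℓ2)
  obtain ⟨TM, hTM, hcard⟩ := exists_TM (M := M) T (fun v hv τ hτ => stab_of_VV hM v (fun w hw => hT w (by rw [hw]; exact hv)) τ hτ)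
  refine FI hℓ hdeg ?_ T TM hTM (by rw [hcard, hdeg]) ∅ (fun w _ => eram_of_VV hφ hM w) (fun w hw => by simp at hw) h' hh' H1 1 ?_ ?_
  · rw [IsUnramifiedAtInfinitePlaces.card_infinitePlace F M, mul_comm, ← hdeg, IsGalois.card_aut_eq_finrank]
  · intro y
    exact ⟨1, funext fun i => absurd i.2 (Finset.notMem_empty _)⟩
  · intros; rfl
end

section
variable {F L : Type} [Field F] [NumberField F] [Field L] [NumberField L] [Algebra F L] [IsGalois F L] {ℓ : ℕ}

lemma fixed_facts (hℓ : ℓ.Prime) {φ : (L ≃ₐ[F] L) →* Multiplicative (ZMod ℓ)} (hφ1 : φ ≠ 1) :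
    IsGalois F (IntermediateField.fixedField φ.ker) ∧ Nat.card ((IntermediateField.fixedField φ.ker) ≃ₐ[F] (IntermediateField.fixedField φ.ker)) = ℓ ∧
    Module.finrank F (IntermediateField.fixedField φ.ker) = ℓ ∧
    ∀ g : L ≃ₐ[F] L, φ g = 1 ↔ ∀ x : IntermediateField.fixedField φ.ker,
      g (algebraMap (IntermediateField.fixedField φ.ker) L x) = algebraMap (IntermediateField.fixedField φ.ker) L x := by
  have : NeZero ℓ := ⟨hℓ.ne_zero⟩
  have : FiniteDimensional F L := Module.Finite.of_restrictScalars_finite ℚ F L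
  have h0 : IsGalois F (IntermediateField.fixedField φ.ker) := IsGalois.of_fixedField_normal_subgroup φ.ker
  have h1 : Module.finrank F (IntermediateField.fixedField φ.ker) = ℓ := by
    have h2 := IntermediateField.finrank_fixedField_eq_card φ.ker
    have h3 := Module.finrank_mul_finrank F (IntermediateField.fixedField φ.ker) L
    have h4 := Subgroup.card_mul_index φ.ker
    rw [Subgroup.index_ker, IsGalois.card_aut_eq_finrank, ← h3, h2, mul_comm] at h4
    have h5 := Nat.eq_of_mul_eq_mul_right Nat.card_pos h4
    rw [← h5]
    obtain ⟨g0, hg0⟩ : ∃ g, φ g ≠ 1 := by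
      by_contra hcon
      push Not at hcon
      exact hφ1 (MonoidHom.ext hcon)
    have h6 : Function.Surjective φ := surj_of_ne_one hℓ φ g0 hg0
    rw [MonoidHom.range_eq_top.2 h6, Subgroup.card_top, Nat.card_congr Multiplicative.toAdd, Nat.card_zmod]
  refine ⟨h0, by rw [IsGalois.card_aut_eq_finrank, h1], h1, fun g => ?_⟩
  rw [← MonoidHom.mem_ker]
  constructor
  · intro hg x
    exact x.2 ⟨g, hg⟩
  · intro h
    rw [← IntermediateField.fixingSubgroup_fixedField φ.ker, IntermediateField.mem_fixingSubgroup_iff]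
    exact fun x hx => h ⟨x, hx⟩

theorem VV_eq_one (hℓ : ℓ.Prime) (hℓ2 : ℓ ≠ 2) {φ : (L ≃ₐ[F] L) →* Multiplicative (ZMod ℓ)} (hφ : φ ∈ VV ℓ F L)
    (T : Finset (HS F)) (h' : ℕ) (hh' : Nat.Coprime h' ℓ)
    (H1 : ∀ D : HS F →₀ ℤ, ∃ γ : Fˣ, ∀ u ∉ T, ord u γ = h' * D u)
    (hT : ∀ w : HS L, und F w ∈ T → ∀ g : L ≃ₐ[F] L, gact g w = w → φ g = 1) : φ = 1 := by
  by_contra hφ1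
  obtain ⟨h1, h2, -, h3⟩ := fixed_facts hℓ hφ1
  have : NumberField (IntermediateField.fixedField φ.ker) := NumberField.of_intermediateField _
  exact split_contra (M := IntermediateField.fixedField φ.ker) hℓ hℓ2 h2 hφ h3 T h' hh' H1 hT
end
end CFT
end P6b

section P6c
open NumberField IsDedekindDomain HeightOneSpectrum
open scoped nonZeroDivisors Pointwise
set_option linter.unusedSectionVars false
namespace CFT
section
variable {ι : Type} {ℓ : ℕ}

/-- Independence of the basis vectors indexed by `s` modulo `P`. -/
def Ind (ℓ : ℕ) (P : AddSubgroup (ι →₀ ℤ)) (s : Set ι) : Prop :=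
  ∀ D : ι →₀ ℤ, (∀ v ∉ s, D v = 0) → D ∈ P → ∀ v, (ℓ : ℤ) ∣ D v

lemma lin_alg_aux (hℓ : ℓ.Prime) {Q : Type} [AddCommGroup Q] [Module (ZMod ℓ) Q] [Finite Q] (π : (ι →₀ ℤ) →+ Q)
    (hπ : Function.Surjective π) (P : AddSubgroup (ι →₀ ℤ)) (hPQ : P.index = Nat.card Q) (hPk : ∀ D, π D = 0 ↔ D ∈ P) (s t : Set ι)
    (hs : Ind ℓ P s) (hst : s ⊆ t)
    (ht : ∀ H : AddSubgroup (ι →₀ ℤ), P ≤ H → (∀ v ∈ t, Finsupp.single v 1 ∈ H) → H = ⊤) :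
    ∃ b : Finset ι, s ⊆ b ∧ (b : Set ι) ⊆ t ∧ Ind ℓ P b ∧ (∀ D, ∃ A : ι →₀ ℤ, (∀ v ∉ b, A v = 0) ∧ D - A ∈ P) ∧
      P.index = ℓ ^ b.card := by
  have := Fact.mk hℓ
  let c : ι → Q := fun v => π (Finsupp.single v 1)
  have hmk : ∀ n : ι →₀ ℤ, π n =
      Finsupp.linearCombination (ZMod ℓ) c (n.mapRange (Int.cast : ℤ → ZMod ℓ) (by simp)) := by
    intro n
    induction n using Finsupp.induction_linear with
    | zero => simp
    | add a b ha hb =>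
      rw [map_add, ha, hb, Finsupp.mapRange_add (by simp), map_add]
    | single v k =>
      rw [Finsupp.mapRange_single, Finsupp.linearCombination_single, Int.cast_smul_eq_zsmul, ← map_zsmul]
      simp
  have hlift : ∀ (S : Set ι) (l : ι →₀ ZMod ℓ), l ∈ Finsupp.supported (ZMod ℓ) (ZMod ℓ) S →
      ∃ n : ι →₀ ℤ, (∀ v ∉ S, n v = 0) ∧ n.mapRange (Int.cast : ℤ → ZMod ℓ) (by simp) = l := by
    intro S l hl
    refine ⟨l.mapRange (fun a => (a.val : ℤ)) (by simp), fun v hv => ?_, by ext v; simp⟩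
    have : l v = 0 := by
      by_contra hcon
      exact hv (hl (Finsupp.mem_support_iff.2 hcon))
    simp [this]
  have hli : LinearIndepOn (ZMod ℓ) c s := by
    rw [linearIndepOn_iff]
    intro l hl h0
    obtain ⟨n, hn, rfl⟩ := hlift s l hl
    rw [← hmk] at h0
    have h1 := hs n hn ((hPk _).1 h0)
    ext v
    simpa using (ZMod.intCast_zmod_eq_zero_iff_dvd _ _).2 (h1 v)
  obtain ⟨b, hbt, hsb, hspan, hb⟩ := exists_linearIndepOn_extension hli hst
  have hspt : Submodule.span (ZMod ℓ) (c '' t) = ⊤ := by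
    have h1 := ht ((Submodule.span (ZMod ℓ) (c '' t)).toAddSubgroup.comap (π)) (by
      intro D hD
      have : π D = 0 := (hPk _).2 hD
      rw [AddSubgroup.mem_comap, this]; exact zero_mem _)
      (fun v hv => Submodule.subset_span ⟨v, hv, rfl⟩)
    rw [eq_top_iff]
    intro x _
    obtain ⟨D, rfl⟩ := hπ x
    have : D ∈ (⊤ : AddSubgroup (ι →₀ ℤ)) := trivial
    rw [← h1] at this
    exact this
  have hspb : Submodule.span (ZMod ℓ) (c '' b) = ⊤ := by
    rw [eq_top_iff, ← hspt]
    exact Submodule.span_le.2 hspan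
  have hbfin : b.Finite := by
    have : Finite b := hb.linearIndependent.finite
    exact Set.toFinite b
  have hcard : P.index = ℓ ^ hbfin.toFinset.card := by
    have B : Module.Basis b (ZMod ℓ) (Q) := Module.Basis.mk hb.linearIndependent (by
      rw [← hspb, Set.image_eq_range])
    have := hbfin.fintype
    rw [hPQ, Module.natCard_eq_pow_finrank (K := ZMod ℓ), Nat.card_zmod, Module.finrank_eq_card_basis B]
    congr 1
    rw [← Set.toFinset_card]; congr 1; ext; simp
  refine ⟨hbfin.toFinset, by simpa using hsb, by simpa using hbt, ?_, ?_, hcard⟩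
  · intro D hD hDP v
    rw [linearIndepOn_iff] at hb
    have h1 := hb (D.mapRange (Int.cast : ℤ → ZMod ℓ) (by simp)) (by
      intro v hv
      by_contra hcon
      have h2 : D v = 0 := hD v (by simpa using hcon)
      simp [h2] at hv) (by rw [← hmk]; exact (hPk _).2 hDP)
    rw [← ZMod.intCast_zmod_eq_zero_iff_dvd]
    simpa using DFunLike.congr_fun h1 v
  · intro D
    have h1 : π D ∈ Submodule.span (ZMod ℓ) (c '' b) := by rw [hspb]; trivial
    obtain ⟨l, hl, h2⟩ := (Finsupp.mem_span_image_iff_linearCombination (ZMod ℓ)).1 h1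
    obtain ⟨n, hn, rfl⟩ := hlift b l hl
    refine ⟨n, by simpa using hn, ?_⟩
    rw [← hmk] at h2
    rw [← hPk]
    rw [map_sub, h2, sub_self]

lemma lin_alg (hℓ : ℓ.Prime) (P : AddSubgroup (ι →₀ ℤ)) (hP : ∀ D, ℓ • D ∈ P) (hfin : P.index ≠ 0) (s t : Set ι)
    (hs : Ind ℓ P s) (hst : s ⊆ t)
    (ht : ∀ H : AddSubgroup (ι →₀ ℤ), P ≤ H → (∀ v ∈ t, Finsupp.single v 1 ∈ H) → H = ⊤) :
    ∃ b : Finset ι, s ⊆ b ∧ (b : Set ι) ⊆ t ∧ Ind ℓ P b ∧ (∀ D, ∃ A : ι →₀ ℤ, (∀ v ∉ b, A v = 0) ∧ D - A ∈ P) ∧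
      P.index = ℓ ^ b.card := by
  have hQ : ∀ x : (ι →₀ ℤ) ⧸ P, ℓ • x = 0 := by
    intro x
    obtain ⟨D, rfl⟩ := QuotientAddGroup.mk'_surjective P x
    rw [← map_nsmul]
    exact (QuotientAddGroup.eq_zero_iff _).2 (hP D)
  have hF : P.FiniteIndex := ⟨hfin⟩
  have : Finite ((ι →₀ ℤ) ⧸ P) := AddSubgroup.finite_quotient_of_finiteIndex
  let _ : Module (ZMod ℓ) ((ι →₀ ℤ) ⧸ P) := AddCommGroup.zmodModule hQ
  exact lin_alg_aux hℓ (QuotientAddGroup.mk' P) (QuotientAddGroup.mk'_surjective P) P rfl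
    (fun D => QuotientAddGroup.eq_zero_iff D) s t hs hst ht
end

section
variable {F : Type} [Field F] [NumberField F] {ℓ : ℕ}

/-- Divisors that are principal up to an `ℓ`-th multiple. -/
noncomputable def PL (ℓ : ℕ) (F : Type) [Field F] [NumberField F] : AddSubgroup (HS F →₀ ℤ) :=
  (nsmulAddMonoidHom (α := Additive (ClassGroup (𝓞 F))) ℓ).range.comap cl

lemma mem_PL {D : HS F →₀ ℤ} : D ∈ PL ℓ F ↔ ∃ (x : Fˣ) (E : HS F →₀ ℤ), D = dv x + ℓ • E := by
  constructor
  · rintro ⟨a, ha⟩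
    obtain ⟨E, rfl⟩ := cl_surjective a
    have : cl (D - ℓ • E) = 0 := by
      rw [map_sub, map_nsmul, ← ha]; exact sub_self _
    obtain ⟨x, hx⟩ := (cl_eq_zero_iff _).1 this
    exact ⟨x, E, by rw [hx]; abel⟩
  · rintro ⟨x, E, rfl⟩
    exact ⟨cl E, by rw [map_add, cl_dv, zero_add, map_nsmul]; rfl⟩

lemma PL_index : (PL ℓ F).index = ctors F ℓ := by
  rw [PL, AddSubgroup.index_comap_of_surjective _ cl_surjective]
  have h1 := AddSubgroup.card_mul_index (nsmulAddMonoidHom (α := Additive (ClassGroup (𝓞 F))) ℓ).range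
  have h2 := AddSubgroup.card_mul_index (nsmulAddMonoidHom (α := Additive (ClassGroup (𝓞 F))) ℓ).ker
  rw [AddSubgroup.index_ker] at h2
  rw [← h2, mul_comm] at h1
  have h3 := Nat.eq_of_mul_eq_mul_right Nat.card_pos h1
  rw [h3]
  exact Nat.card_congr (Equiv.subtypeEquiv Additive.toMul fun a => Iff.rfl)

lemma PL_index_ne : (PL ℓ F).index ≠ 0 := by
  rw [PL_index]; exact (ctors_pos ℓ).ne'

lemma PL_gen_H1 (hℓ : ℓ.Prime) (T : Finset (HS F)) (hT : ∀ D, ∃ A : HS F →₀ ℤ, (∀ v ∉ T, A v = 0) ∧ D - A ∈ PL ℓ F) :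
    ∃ h' : ℕ, Nat.Coprime h' ℓ ∧ ∀ D : HS F →₀ ℤ, ∃ γ : Fˣ, ∀ u ∉ T, ord u γ = h' * D u := by
  obtain ⟨a, h', hh', hc⟩ := Nat.exists_eq_pow_mul_and_not_dvd (n := Nat.card (Additive (ClassGroup (𝓞 F)))) Nat.card_pos.ne' ℓ hℓ.ne_one
  refine ⟨h', Nat.Coprime.symm ((Nat.Prime.coprime_iff_not_dvd hℓ).2 hh'), ?_⟩
  have key : ∀ (a : ℕ) (D : HS F →₀ ℤ), ∃ (A : HS F →₀ ℤ) (x : Fˣ) (E : HS F →₀ ℤ), (∀ v ∉ T, A v = 0) ∧ D = A + dv x + ℓ ^ a • E := by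
    intro a D
    induction a with
    | zero => exact ⟨0, 1, D, by simp, by simp [dv_one]⟩
    | succ a ih =>
      obtain ⟨A, x, E, hA, hD⟩ := ih
      obtain ⟨B, hB, hE⟩ := hT E
      obtain ⟨y, E', hE'⟩ := mem_PL.1 hE
      refine ⟨A + ℓ ^ a • B, x * y ^ (ℓ ^ a), E', fun v hv => by simp [hA v hv, hB v hv], ?_⟩
      rw [dv_mul, dv_pow, hD, show E = B + (dv y + ℓ • E') by rw [← hE']; abel, pow_succ, mul_smul, smul_add, smul_add]
      abel
  intro D
  obtain ⟨A, x, E, hA, hD⟩ := key a D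
  have h1 : cl ((ℓ ^ a * h') • E) = 0 := by
    rw [map_nsmul, ← hc, card_nsmul_eq_zero']
  obtain ⟨z, hz⟩ := (cl_eq_zero_iff _).1 h1
  refine ⟨x ^ h' * z, fun u hu => ?_⟩
  rw [ord_mul, ord_pow, ← dv_apply z u, hz, hD]
  simp [hA u hu]
  ring
end
end CFT
end P6c

section P6d
open NumberField IsDedekindDomain HeightOneSpectrum
open scoped nonZeroDivisors Pointwise
set_option linter.unusedSectionVars false
namespace CFT
section
variable {F F' : Type} [Field F] [NumberField F] [Field F'] [NumberField F'] [Algebra F F'] {ℓ p : ℕ}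

lemma cl_single (v : HS F) : cl (Finsupp.single v 1) = Additive.ofMul (pcl v) := by
  have h1 : cl (Finsupp.single v 1) = Additive.ofMul (ClassGroup.mk F (plI v)) := by
    have : idl (Finsupp.single v 1) = Additive.ofMul (plI v) := by simp [idl]
    rw [cl, AddMonoidHom.comp_apply, this]; rfl
  have h2 : plI v = FractionalIdeal.mk0 F (pI v) := Units.ext rfl
  rw [h1, h2, ClassGroup.mk_mk0]; rfl

lemma nonsplit_PL [IsGalois F F'] (hp : p.Prime) (hℓ : ℓ.Prime) (hℓ2 : ℓ ≠ 2) (hdeg : Nat.card (F' ≃ₐ[F] F') = p)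
    (H : AddSubgroup (HS F →₀ ℤ)) (hH : PL ℓ F ≤ H)
    (hH' : ∀ v ∈ {v : HS F | ∀ w w' : HS F', und F w = v → und F w' = v → w = w'}, Finsupp.single v 1 ∈ H) : H = ⊤ := by
  have h1 := nonsplit_gen (M := F') hp hℓ hℓ2 hdeg (AddSubgroup.toSubgroup' (H.map cl)) (by
    intro a
    obtain ⟨D, hD⟩ := cl_surjective (Additive.ofMul a)
    exact ⟨ℓ • D, hH (mem_PL.2 ⟨1, D, by rw [dv_one, zero_add]⟩), by rw [map_nsmul, hD]; rfl⟩)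
    (fun v hv => ⟨_, hH' v hv, cl_single v⟩)
  rw [eq_top_iff]
  intro D _
  have h2 : (cl D).toMul ∈ (⊤ : Subgroup (ClassGroup (𝓞 F))) := trivial
  rw [← h1] at h2
  obtain ⟨D', hD', h3⟩ := h2
  have h4 : cl (D - D') = 0 := by rw [map_sub, h3]; exact sub_self _
  obtain ⟨x, hx⟩ := (cl_eq_zero_iff _).1 h4
  have h5 := H.add_mem (hH (mem_PL.2 ⟨x, 0, by rw [smul_zero, add_zero]⟩)) hD'
  rwa [hx, sub_add_cancel] at h5

lemma ord_prod {ι : Type*} (s : Finset ι) (f : ι → Fˣ) (v : HS F) : ord v (∏ i ∈ s, f i) = ∑ i ∈ s, ord v (f i) := by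
  classical
  induction s using Finset.induction_on with
  | empty => simp [ord_one]
  | insert a s ha ih => rw [Finset.prod_insert ha, Finset.sum_insert ha, ord_mul, ih]

lemma ord_norm [IsGalois F F'] [Fintype (F' ≃ₐ[F] F')] (w : HS F') (x : F'ˣ) :
    eram F w * ord (und F w) (Units.map (Algebra.norm F) x) = ∑ σ : F' ≃ₐ[F] F', ord (gact σ w) x := by
  have : FiniteDimensional F F' := Module.Finite.of_restrictScalars_finite ℚ F F'
  rw [← ord_algebraMap]
  have h1 : Units.map (algebraMap F F' : F →* F') (Units.map (Algebra.norm F) x) = ∏ σ : F' ≃ₐ[F] F', σ⁻¹ • x := by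
    ext
    rw [Units.coe_prod]
    refine (Algebra.norm_eq_prod_automorphisms F (x : F')).trans ?_
    refine Eq.trans ?_ (Equiv.prod_comp (Equiv.inv (F' ≃ₐ[F] F')) (fun σ => σ (x : F'))).symm
    congr!
  rw [h1, ord_prod]
  refine Finset.sum_congr rfl fun σ _ => ?_
  rw [← ord_gact σ w, smul_inv_smul]

lemma ind_up [IsGalois F F'] (hℓ : ℓ.Prime) (hp : p.Prime) (hpl : p ≠ ℓ) (hdeg : Nat.card (F' ≃ₐ[F] F') = p) (I : Finset (HS F))
    (hI : Ind ℓ (PL ℓ F) I) (hns : ∀ v ∈ I, ∀ w w' : HS F', und F w = v → und F w' = v → w = w')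
    (q : HS F → HS F') (hq : ∀ v, und F (q v) = v) : Ind ℓ (PL ℓ F') (q '' I) := by
  classical
  have : FiniteDimensional F F' := Module.Finite.of_restrictScalars_finite ℚ F F'
  have := Fintype.ofFinite (F' ≃ₐ[F] F')
  have hℓZ : Prime (ℓ : ℤ) := Nat.prime_iff_prime_int.1 hℓ
  have hnp : ∀ m : ℕ, m ∣ p → ¬ ((ℓ : ℤ) ∣ m) := by
    intro m hm h
    exact hpl ((Nat.prime_dvd_prime_iff_eq hℓ hp).1 ((Int.natCast_dvd_natCast.1 h).trans hm)).symm
  intro D hD hDP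
  obtain ⟨x, E, hxE⟩ := mem_PL.1 hDP
  set y := Units.map (Algebra.norm F) x with hy
  have hx : ∀ w, ord w x = D w - ℓ * E w := by
    intro w
    rw [hxE]; simp
  have he : ∀ w : HS F', (ℓ : ℤ) ∣ eram F w * ord (und F w) y - ∑ σ : F' ≃ₐ[F] F', D (gact σ w) := by
    intro w
    rw [hy, ord_norm, ← Finset.sum_sub_distrib]
    exact Finset.dvd_sum fun σ _ => by rw [hx]; exact ⟨- E (gact σ w), by ring⟩
  have hew : ∀ w : HS F', ¬ ((ℓ : ℤ) ∣ eram F w) := fun w => hnp _ (hdeg ▸ eram_dvd w)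
  have h1 : ∀ v ∉ I, (ℓ : ℤ) ∣ ord v y := by
    intro v hv
    have h2 := he (q v)
    rw [hq, Finset.sum_eq_zero, sub_zero] at h2
    · exact (hℓZ.dvd_or_dvd h2).resolve_left (hew _)
    · intro σ _
      apply hD
      rintro ⟨u, hu, h3⟩
      have h4 := congrArg (und F) h3
      rw [hq, und_gact, hq] at h4
      exact hv (h4 ▸ hu)
  have h2 := hI ((dv y).filter (· ∈ I)) (fun v hv => Finsupp.filter_apply_neg _ _ hv) (mem_PL.2 ⟨y,
    -((dv y).filter (· ∉ I)).mapRange (· / (ℓ : ℤ)) (by simp), by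
      ext v
      by_cases hv : v ∈ I
      · simp [hv]
      · simp [hv, Int.mul_ediv_cancel' (h1 v hv)]⟩)
  intro w
  by_cases hw : w ∈ q '' I
  · obtain ⟨v, hv, rfl⟩ := hw
    have h3 := h2 v
    have hv' : v ∈ I := hv
    rw [Finsupp.filter_apply_pos _ _ hv', dv_apply] at h3
    have h4 := he (q v)
    have h5 : ∀ σ : F' ≃ₐ[F] F', gact σ (q v) = q v := fun σ =>
      hns v hv' _ _ (by rw [und_gact, hq]) (hq v)
    simp only [h5, hq] at h4
    rw [Finset.sum_const, Finset.card_univ, ← Nat.card_eq_fintype_card, hdeg] at h4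
    have h6 := (dvd_sub_right (h3.mul_left _)).1 h4
    rw [nsmul_eq_mul] at h6
    exact (hℓZ.dvd_or_dvd h6).resolve_left (hnp p dvd_rfl)
  · rw [hD w hw]; exact dvd_zero _
end

section
variable {F L : Type} [Field F] [NumberField F] [Field L] [NumberField L] [Algebra F L] {ℓ : ℕ}

lemma kills [IsGalois F L] {φ : (L ≃ₐ[F] L) →* Multiplicative (ZMod ℓ)} (hφ : φ ∈ VV ℓ F L) (W : HS L) (h : L ≃ₐ[F] L)
    (hh : ∀ g, gact g W = W → ∃ n : ℤ, ∀ r : 𝓞 L, (g * h ^ n) • r - r ∈ W.asIdeal) (h1 : φ h = 1)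
    (w : HS L) (hw : und F w = und F W) (g : L ≃ₐ[F] L) (hg : gact g w = w) : φ g = 1 := by
  obtain ⟨τ, rfl⟩ := exists_gact W w hw.symm
  obtain ⟨n, hn⟩ := hh (τ⁻¹ * g * τ) (by
    rw [gact_mul, gact_mul, hg, ← gact_mul, inv_mul_cancel]
    ext1; exact one_smul _ _)
  have h2 := mem_VV.1 hφ W _ hn
  rw [map_mul, map_zpow, h1, one_zpow, mul_one, map_mul, map_mul, mul_comm, ← mul_assoc, ← map_mul, mul_inv_cancel, map_one, one_mul] at h2
  exact h2
end

section
variable {F F' L : Type} [Field F] [NumberField F] [Field F'] [NumberField F'] [Field L] [NumberField L] [Algebra F L]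
  [Algebra F F'] [Algebra F' L] [IsScalarTower F F' L] {ℓ p : ℕ}

theorem descent [IsGalois F L] [IsGalois F' L] [IsGalois F F'] (hℓ : ℓ.Prime) (hℓ2 : ℓ ≠ 2) (hp : p.Prime) (hpl : p ≠ ℓ)
    (hdeg : Nat.card (F' ≃ₐ[F] F') = p) (hF' : ctors F' ℓ ≤ Nat.card (VV ℓ F' L)) : ctors F ℓ ≤ Nat.card (VV ℓ F L) := by
  classical
  have : NeZero ℓ := ⟨hℓ.ne_zero⟩
  have := finite_VV (F := F) (L := L) hℓ
  have := finite_VV (F := F') (L := L) hℓ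
  have : FiniteDimensional F F' := Module.Finite.of_restrictScalars_finite ℚ F F'
  obtain ⟨I, -, hIns, hI, -, hIc⟩ := lin_alg hℓ (PL ℓ F) (fun D => mem_PL.2 ⟨1, D, by rw [dv_one, zero_add]⟩) PL_index_ne ∅
    {v : HS F | ∀ w w' : HS F', und F w = v → und F w' = v → w = w'} (fun D hD _ v => by
      rw [hD v (Set.notMem_empty v)]; exact dvd_zero _) (Set.empty_subset _) (nonsplit_PL hp hℓ hℓ2 hdeg)
  choose q hq using fun v : HS F => exists_over (M := F') v
  have hind := ind_up hℓ hp hpl hdeg I hI (fun v hv => hIns hv) q hq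
  obtain ⟨T, hT, -, -, hTg, hTc⟩ := lin_alg hℓ (PL ℓ F') (fun D => mem_PL.2 ⟨1, D, by rw [dv_one, zero_add]⟩) PL_index_ne _
    Set.univ hind (Set.subset_univ _) (by
      intro H _ h
      rw [eq_top_iff]
      intro D _
      induction D using Finsupp.induction_linear with
      | zero => exact zero_mem _
      | add a b ha hb => exact add_mem (ha trivial) (hb trivial)
      | single v k =>
        have := H.zsmul_mem (h v trivial) k
        rwa [Finsupp.smul_single, smul_eq_mul, mul_one] at this)
  obtain ⟨h', hh', H1⟩ := PL_gen_H1 hℓ T hTg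
  choose W hW using fun v : HS F' => exists_over (M := L) v
  choose h hh1 hh2 using fun v : HS F' => (decomp (F := F') (W v)).2
  let Φ : VV ℓ F' L →* (T → Multiplicative (ZMod ℓ)) :=
    { toFun := fun φ u => φ.1 (h u)
      map_one' := rfl
      map_mul' := fun _ _ => rfl }
  have hΦ : Function.Injective Φ := by
    rw [injective_iff_map_eq_one]
    rintro ⟨φ, hφ⟩ h0
    refine Subtype.ext (VV_eq_one hℓ hℓ2 hφ T h' hh' H1 ?_)
    intro w hw g hg
    exact kills hφ (W (und F' w)) (h (und F' w)) (hh2 _) (congrFun h0 ⟨_, hw⟩) w (hW _).symm g hg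
  have hcardM : Nat.card (Multiplicative (ZMod ℓ)) = ℓ := by
    rw [Nat.card_congr Multiplicative.toAdd, Nat.card_zmod]
  have hΦs : Function.Surjective Φ := by
    refine (hΦ.bijective_of_nat_card_le ?_).2
    rw [Nat.card_fun, hcardM, Nat.card_eq_fintype_card, Fintype.card_coe, ← hTc, PL_index]
    exact hF'
  obtain ⟨k, hk⟩ : ∃ k : ℕ, ∀ a : Multiplicative (ZMod ℓ), (a ^ k) ^ p = a := by
    have hcop : Nat.Coprime p ℓ := (Nat.coprime_primes hp hℓ).2 hpl
    obtain ⟨k, -, hk⟩ := Nat.exists_mul_mod_eq_one_of_coprime hcop hℓ.one_lt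
    refine ⟨k, fun a => ?_⟩
    have ha : a ^ ℓ = 1 := by
      have := pow_card_eq_one' (x := a)
      rwa [hcardM] at this
    rw [← pow_mul, mul_comm k p, ← Nat.div_add_mod (p * k) ℓ, hk, pow_add, pow_mul, ha, one_pow, one_mul, pow_one]
  rw [← PL_index, hIc]
  have hcI : ℓ ^ I.card = Nat.card (I → Multiplicative (ZMod ℓ)) := by
    rw [Nat.card_fun, hcardM, Nat.card_eq_fintype_card, Fintype.card_coe]
  rw [hcI]
  refine Nat.card_le_card_of_surjective (fun (ψ : VV ℓ F L) (i : I) => ψ.1 (rho F (h (q i)))) ?_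
  intro f
  obtain ⟨⟨φ, hφ⟩, hφf⟩ := hΦs (fun u => if hu : und F u.1 ∈ I then f ⟨und F u.1, hu⟩ ^ k else 1)
  obtain ⟨ψ, hψ, hψφ⟩ := cor_exists (F := F) hφ
  refine ⟨⟨ψ, hψ⟩, funext fun i => ?_⟩
  have h1 := hψφ (W (q i)) (by
    intro q' hq'
    have h2 := und_und (F := F) (F' := F') (W (q i))
    rw [hW] at h2 ⊢
    rw [← h2, hq] at hq'
    exact hIns i.2 _ _ hq' (hq _)) (h (q i)) (hh1 _)
  have h2 : φ (h (q i)) = f i ^ k := by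
    have h3 := congrFun hφf ⟨q i, hT ⟨i, i.2, rfl⟩⟩
    refine h3.trans ?_
    have h4 : und F (q i) ∈ I := by rw [hq]; exact i.2
    rw [dif_pos h4]
    congr 2
    exact Subtype.ext (hq i)
  rw [h2, ← IsGalois.card_aut_eq_finrank, hdeg, hk] at h1
  exact h1
end
end CFT
end P6d

section P6e
open NumberField IsDedekindDomain HeightOneSpectrum
open scoped nonZeroDivisors Pointwise
set_option linter.unusedSectionVars false
namespace CFT
section
variable {F F' L : Type} [Field F] [NumberField F] [Field F'] [NumberField F'] [Field L] [NumberField L] [Algebra F L]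
  [Algebra F' L] {ℓ : ℕ}

lemma transp_ctors (e : F ≃+* F') : ctors F' ℓ = ctors F ℓ := by
  let f := ClassGroup.mulEquiv (RingOfIntegers.mapRingEquiv e)
  refine (Nat.card_congr (Equiv.subtypeEquiv f.toEquiv fun a => ?_)).symm
  change _ ↔ f a ^ ℓ = 1
  rw [← map_pow, map_eq_one_iff _ f.injective]

lemma transp_VV (hℓ : ℓ.Prime) (e : F ≃+* F') (he : ∀ x, algebraMap F' L (e x) = algebraMap F L x) :
    Nat.card (VV ℓ F L) ≤ Nat.card (VV ℓ F' L) := by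
  have := finite_VV (F := F') (L := L) hℓ
  let f : (L ≃ₐ[F'] L) →* (L ≃ₐ[F] L) :=
    { toFun := fun σ => AlgEquiv.ofRingEquiv (f := σ.toRingEquiv) (fun x => by rw [← he]; exact σ.commutes _)
      map_one' := rfl
      map_mul' := fun _ _ => rfl }
  have hf : Function.Surjective f := fun σ =>
    ⟨AlgEquiv.ofRingEquiv (f := σ.toRingEquiv) (fun x => by
      obtain ⟨y, rfl⟩ := e.surjective x
      rw [he]; exact σ.commutes _), rfl⟩
  let Φ : VV ℓ F L → VV ℓ F' L := fun φ => ⟨φ.1.comp f, mem_VV.2 fun w τ h => mem_VV.1 φ.2 w (f τ) h⟩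
  refine Nat.card_le_card_of_injective Φ ?_
  intro φ ψ h
  apply Subtype.ext
  ext σ
  obtain ⟨τ, rfl⟩ := hf σ
  exact DFunLike.congr_fun (congrArg Subtype.val h) τ

lemma transp (hℓ : ℓ.Prime) (e : F ≃+* F') (he : ∀ x, algebraMap F' L (e x) = algebraMap F L x)
    (h : ctors F ℓ ≤ Nat.card (VV ℓ F L)) : ctors F' ℓ ≤ Nat.card (VV ℓ F' L) := by
  rw [transp_ctors e]
  exact h.trans (transp_VV hℓ e he)
end

section
variable {F L : Type} [Field F] [NumberField F] [Field L] [NumberField L] [Algebra F L] [IsGalois F L] {ℓ : ℕ}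
open IntermediateField

lemma exists_step (hℓ : ℓ.Prime) {ζ : L} (hζ : IsPrimitiveRoot ζ ℓ) (hF : ∀ x : F, algebraMap F L x ≠ ζ) :
    ∃ (E : IntermediateField F L) (p : ℕ), IsGalois F E ∧ p.Prime ∧ p ≠ ℓ ∧ Nat.card (E ≃ₐ[F] E) = p ∧ E ≤ F⟮ζ⟯ := by
  have : NeZero ℓ := ⟨hℓ.ne_zero⟩
  have := Fact.mk hℓ
  have : FiniteDimensional F L := Module.Finite.of_restrictScalars_finite ℚ F L
  let χ := hζ.autToPow F
  have hχ : ∀ σ : L ≃ₐ[F] L, χ σ = 1 → σ ζ = ζ := by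
    intro σ h
    have h1 := hζ.autToPow_spec F σ
    change ζ ^ ((χ σ : ZMod ℓ)).val = σ ζ at h1
    have h2 : Fact (1 < ℓ) := ⟨hℓ.one_lt⟩
    rw [← h1, h, Units.val_one, ZMod.val_one, pow_one]
  have h1 : Nat.card χ.range ≠ 1 := by
    intro h1
    obtain ⟨x, hx⟩ := (IsGalois.mem_range_algebraMap_iff_fixed (F := F) ζ).2 (fun σ => by
      apply hχ
      have h2 := (Nat.card_eq_one_iff_unique.1 h1).1
      exact congrArg Subtype.val (h2.elim ⟨χ σ, σ, rfl⟩ 1))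
    exact hF x hx
  obtain ⟨p, hp, hpd⟩ := Nat.exists_prime_and_dvd h1
  let N : Subgroup (L ≃ₐ[F] L) := (powMonoidHom (α := χ.range) p).range.comap χ.rangeRestrict
  have hN : N.index = p := by
    rw [Subgroup.index_comap_of_surjective _ χ.rangeRestrict_surjective, IsCyclic.index_powMonoidHom_range]
    exact Nat.gcd_eq_right hpd
  have hNn : N.Normal := Subgroup.Normal.comap inferInstance _
  have hG : IsGalois F (fixedField N) := IsGalois.of_fixedField_normal_subgroup N
  refine ⟨fixedField N, p, hG, hp, ?_, ?_, ?_⟩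
  · rintro rfl
    have h2 := hpd.trans (Subgroup.card_subgroup_dvd_card χ.range)
    rw [Nat.card_eq_fintype_card, ZMod.card_units] at h2
    have h3 := Nat.le_of_dvd (by have := hp.two_le; omega) h2
    have := hp.two_le
    omega
  · rw [IsGalois.card_aut_eq_finrank]
    have h2 := IntermediateField.finrank_fixedField_eq_card N
    have h3 := Module.finrank_mul_finrank F (fixedField N) L
    have h4 := Subgroup.card_mul_index N
    rw [hN, IsGalois.card_aut_eq_finrank, ← h3, h2, mul_comm] at h4
    exact (Nat.eq_of_mul_eq_mul_right Nat.card_pos h4).symm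
  · rw [← IsGalois.fixedField_fixingSubgroup F⟮ζ⟯]
    refine IntermediateField.fixedField_antitone ?_
    intro σ hσ
    have h2 : σ ζ = ζ := (IntermediateField.mem_fixingSubgroup_iff _ _).1 hσ ζ (mem_adjoin_simple_self F ζ)
    refine ⟨1, ?_⟩
    rw [map_one]
    have h3 := hζ.autToPow_spec F σ
    rw [h2] at h3
    have h4 : ((χ σ : ZMod ℓ)).val = 1 := hζ.pow_inj (ZMod.val_lt _) hℓ.one_lt (h3.trans (pow_one ζ).symm)
    have h5 : Fact (1 < ℓ) := ⟨hℓ.one_lt⟩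
    have h6 : χ σ = 1 := Units.ext (ZMod.val_injective ℓ (by rw [h4, Units.val_one, ZMod.val_one]))
    exact Subtype.ext h6.symm
end

section
variable {K L : Type} [Field K] [NumberField K] [Field L] [NumberField L] [Algebra K L] [IsGalois K L] {ℓ : ℕ}
open IntermediateField

theorem ind_thm (hℓ : ℓ.Prime) {ζ : L} (hζ : IsPrimitiveRoot ζ ℓ) (hbase : ctors K⟮ζ⟯ ℓ ≤ Nat.card (VV ℓ K⟮ζ⟯ L)) :
    ctors K ℓ ≤ Nat.card (VV ℓ K L) := by
  have : FiniteDimensional K L := Module.Finite.of_restrictScalars_finite ℚ K L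
  have key : ∀ (n : ℕ) (F : IntermediateField K L), F ≤ K⟮ζ⟯ → Module.finrank F L = n → ctors F ℓ ≤ Nat.card (VV ℓ F L) := by
    intro n
    induction n using Nat.strong_induction_on with
    | _ n ih =>
    intro F hF hn
    by_cases hζF : ζ ∈ F
    · have : F = K⟮ζ⟯ := le_antisymm hF (adjoin_simple_le_iff.2 hζF)
      subst this
      exact hbase
    · have hℓ2 : ℓ ≠ 2 := by
        rintro rfl
        rw [hζ.eq_neg_one_of_two_right] at hζF
        exact hζF (neg_mem (one_mem _))
      obtain ⟨E, p, hE, hp, hpl, hcard, hle⟩ := exists_step (F := F) hℓ hζ (fun x hx => hζF (hx ▸ x.2))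
      have hEG : IsGalois E L := inferInstance
      have hEF : FiniteDimensional F E := inferInstance
      have h1 := Module.finrank_mul_finrank F E L
      rw [← IsGalois.card_aut_eq_finrank, hcard, hn] at h1
      have hlt : Module.finrank E L < n := by
        rw [← h1]
        have := hp.two_le
        have h0 : 0 < Module.finrank E L := Module.finrank_pos
        nlinarith
      have hle' : E.restrictScalars K ≤ K⟮ζ⟯ := by
        intro x hx
        have h2 : x ∈ F⟮ζ⟯ := hle hx
        have h3 : F⟮ζ⟯ ≤ IntermediateField.extendScalars hF :=
          adjoin_simple_le_iff.2 (mem_adjoin_simple_self K ζ)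
        exact h3 h2
      have h2 := ih _ hlt (E.restrictScalars K) hle' rfl
      have : IsScalarTower F E L := IsScalarTower.of_algebraMap_eq fun x => rfl
      exact descent (F := F) (F' := E) (L := L) hℓ hℓ2 hp hpl hcard h2
  exact transp hℓ (IntermediateField.botEquiv K L).toRingEquiv (fun x => by
    obtain ⟨y, hy⟩ := IntermediateField.mem_bot.1 x.2
    have : x = algebraMap K _ y := Subtype.ext hy.symm
    rw [this]
    change algebraMap K L (IntermediateField.botEquiv K L (algebraMap K _ y)) = _
    rw [IntermediateField.botEquiv_def]; rfl) (key _ ⊥ bot_le rfl)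
end
end CFT
end P6e

section P6f
open NumberField IsDedekindDomain HeightOneSpectrum
open scoped nonZeroDivisors Pointwise
set_option linter.unusedSectionVars false
namespace CFT
section
variable {K Ω : Type} [Field K] [NumberField K] [Field Ω] [Algebra K Ω] [IsAlgClosed Ω] [Algebra.IsAlgebraic K Ω] {ℓ : ℕ}
open IntermediateField

theorem exists_L (hℓ : ℓ.Prime) : ∃ (L : IntermediateField K Ω) (_ : NumberField L), IsGalois K L ∧ ctors K ℓ ≤ Nat.card (VV ℓ K L) := by
  have hc : CharZero Ω := charZero_of_injective_algebraMap (algebraMap K Ω).injective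
  have hℓ0 : NeZero (ℓ : Ω) := ⟨Nat.cast_ne_zero.2 hℓ.ne_zero⟩
  obtain ⟨ζ, hζ⟩ : ∃ ζ : Ω, IsPrimitiveRoot ζ ℓ := by
    obtain ⟨ζ, h⟩ := IsAlgClosed.exists_root (Polynomial.cyclotomic ℓ Ω) (Polynomial.degree_cyclotomic_pos ℓ Ω hℓ.pos).ne'
    exact ⟨ζ, Polynomial.isRoot_cyclotomic_iff.1 h⟩
  have hfE : FiniteDimensional K K⟮ζ⟯ := adjoin.finiteDimensional (Algebra.IsIntegral.isIntegral ζ)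
  have hNE : NumberField K⟮ζ⟯ := NumberField.of_module_finite K _
  let ζE : K⟮ζ⟯ := ⟨ζ, mem_adjoin_simple_self K ζ⟩
  have hζE : IsPrimitiveRoot ζE ℓ := IsPrimitiveRoot.of_map_of_injective (f := algebraMap K⟮ζ⟯ Ω) hζ (algebraMap K⟮ζ⟯ Ω).injective
  let lam : K⟮ζ⟯ˣ := Units.mk0 (1 - ζE) (sub_ne_zero.2 (hζE.ne_one hℓ.one_lt).symm)
  let B := ((Bn lam 0).map (powMonoidHom ℓ)).subgroupOf (W0 ℓ lam)
  have hB : B.FiniteIndex := ⟨fun h0 => by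
    have h1 := index_W0 hℓ hζE lam rfl
    have h2 := ctors_pos (K := K⟮ζ⟯) ℓ
    have h3 : ((Bn lam 0).map (powMonoidHom ℓ)).relIndex (W0 ℓ lam) = 0 := h0
    omega⟩
  have hfB : Finite (W0 ℓ lam ⧸ B) := Subgroup.finite_quotient_of_finiteIndex
  choose r hr using fun x : W0 ℓ lam ⧸ B => IsAlgClosed.exists_pow_nat_eq (((x.out : K⟮ζ⟯ˣ) : K⟮ζ⟯) : Ω) hℓ.pos
  let L1 := IntermediateField.adjoin K (insert ζ (Set.range r))
  have hfL1 : FiniteDimensional K L1 := by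
    have : Finite (insert ζ (Set.range r) : Set Ω) := (Set.finite_range r).insert ζ
    exact IntermediateField.finiteDimensional_adjoin fun x _ => Algebra.IsIntegral.isIntegral x
  let L := IntermediateField.normalClosure K L1 Ω
  have hL1 : L1 ≤ L := IntermediateField.le_normalClosure L1
  have hfL : FiniteDimensional K L := normalClosure.is_finiteDimensional K L1 Ω
  have hNL : NumberField L := NumberField.of_module_finite K _
  have hAC : IsAlgClosure K Ω := ⟨inferInstance, inferInstance⟩
  have hNΩ : Normal K Ω := IsAlgClosure.normal K Ω
  have hnor : Normal K L := normalClosure.normal K L1 Ω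
  have hG : IsGalois K L := IsGalois.mk
  have hζL : ζ ∈ L := hL1 (subset_adjoin _ _ (Set.mem_insert _ _))
  have hEL : K⟮ζ⟯ ≤ L := adjoin_simple_le_iff.2 hζL
  refine ⟨L, hNL, hG, ?_⟩
  let ζL : L := ⟨ζ, hζL⟩
  have hζL' : IsPrimitiveRoot ζL ℓ := IsPrimitiveRoot.of_map_of_injective (f := algebraMap L Ω) hζ (algebraMap L Ω).injective
  refine ind_thm hℓ hζL' ?_
  let _ : Algebra K⟮ζ⟯ L := (inclusion hEL).toRingHom.toAlgebra
  have hst : IsScalarTower K K⟮ζ⟯ L := IsScalarTower.of_algebraMap_eq fun x => rfl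
  have hGE : IsGalois K⟮ζ⟯ L := IsGalois.tower_top_of_isGalois K K⟮ζ⟯ L
  have hmap : K⟮ζL⟯.map L.val = K⟮ζ⟯ := by
    rw [IntermediateField.adjoin_map, Set.image_singleton]; rfl
  let e : K⟮ζL⟯ ≃ₐ[K] K⟮ζ⟯ := (equivMap K⟮ζL⟯ L.val).trans (equivOfEq hmap)
  have h1 : ctors K⟮ζ⟯ ℓ ≤ Nat.card (VV ℓ K⟮ζ⟯ L) := by
    refine kum_top hℓ hζE (lam := lam) rfl ?_
    intro α hα
    let x : W0 ℓ lam ⧸ B := QuotientGroup.mk ⟨α, hα⟩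
    have h2 : (x.out)⁻¹ * ⟨α, hα⟩ ∈ B := QuotientGroup.eq.1 (Quotient.out_eq' x)
    obtain ⟨b, -, hb⟩ := h2
    have h3 : r x ∈ L := hL1 (subset_adjoin _ _ (Set.mem_insert_of_mem _ ⟨x, rfl⟩))
    let s : L := ⟨r x, h3⟩ * algebraMap K⟮ζ⟯ L b
    have hs : s ^ ℓ = algebraMap K⟮ζ⟯ L α := by
      apply Subtype.ext
      have h4 : α = (x.out : K⟮ζ⟯ˣ) * b ^ ℓ := by
        have h5 : b ^ ℓ = (x.out : K⟮ζ⟯ˣ)⁻¹ * α := hb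
        rw [h5, mul_inv_cancel_left]
      have h6 : ((s ^ ℓ : L) : Ω) = (r x * ((b : K⟮ζ⟯) : Ω)) ^ ℓ := rfl
      rw [h6, mul_pow, hr x]
      have h7 : (algebraMap K⟮ζ⟯ L α : Ω) = ((α : K⟮ζ⟯) : Ω) := rfl
      rw [h7, h4]
      push_cast
      rfl
    have hs0 : s ≠ 0 := by
      intro h0
      rw [h0, zero_pow hℓ.ne_zero] at hs
      exact α.ne_zero ((map_eq_zero_iff _ (algebraMap K⟮ζ⟯ L).injective).1 hs.symm)
    exact ⟨Units.mk0 s hs0, Units.ext hs⟩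
  refine transp hℓ e.symm.toRingEquiv (fun x => ?_) h1
  obtain ⟨y, rfl⟩ := e.surjective x
  change algebraMap K⟮ζL⟯ L (e.symm (e y)) = _
  rw [AlgEquiv.symm_apply_apply]
  exact Subtype.ext rfl
end
end CFT
end P6f

section P8a
open NumberField IsDedekindDomain HeightOneSpectrum
open scoped nonZeroDivisors Pointwise
set_option linter.unusedSectionVars false
namespace CFT
section
variable {K M : Type} [Field K] [NumberField K] [Field M] [NumberField M] [Algebra K M]

attribute [local instance] FractionRing.liftAlgebra in
lemma discr_unram (h : ∀ w : HS M, eram K w = 1) :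
    (discr M).natAbs = (discr K).natAbs ^ Module.finrank K M := by
  classical
  have : FiniteDimensional K M := Module.Finite.of_restrictScalars_finite ℚ K M
  rw [natAbs_discr_eq_absNorm_differentIdeal_mul_natAbs_discr_pow K (𝓞 K) M (𝓞 M)]
  have h1 : differentIdeal (𝓞 K) (𝓞 M) = ⊤ := by
    by_contra hne
    obtain ⟨P, hP, hle⟩ := Ideal.exists_le_maximal _ hne
    have h0 : P ≠ ⊥ := by
      rintro rfl
      exact differentIdeal_ne_bot (le_bot_iff.1 hle)
    let w : HS M := ⟨P, hP.isPrime, h0⟩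
    have hp' : (und K w).asIdeal.map (algebraMap (𝓞 K) (𝓞 M)) ≠ ⊥ :=
      (Ideal.map_eq_bot_iff_of_injective (FaithfulSMul.algebraMap_injective _ _)).not.2 (und K w).ne_bot
    obtain ⟨Q, h₁, h₂⟩ := Ideal.eq_prime_pow_mul_coprime hp' P
    have h3 : (und K w).asIdeal.ramificationIdx' P = 1 := h w
    rw [← Ideal.IsDedekindDomain.ramificationIdx'_eq_normalizedFactors_count hp' hP.isPrime h0, h3, pow_one] at h₂
    have := (und K w).isMaximal
    have := Ring.HasFiniteQuotients.finiteQuotient (und K w).ne_bot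
    exact not_dvd_differentIdeal_of_isCoprime (𝓞 K) P Q (Ideal.isCoprime_iff_sup_eq.mpr h₁) h₂.symm (Ideal.dvd_iff_le.2 hle)
  rw [h1, Ideal.absNorm_top, one_mul]
end
end CFT
end P8a

section P8b
open NumberField IsDedekindDomain HeightOneSpectrum
open scoped nonZeroDivisors Pointwise
set_option linter.unusedSectionVars false
namespace CFT

lemma count_lem {G α : Type*} [Group G] {ℓ : ℕ} (hℓ : ℓ.Prime) (V : Subgroup (G →* Multiplicative (ZMod ℓ)))
    [Finite V] (S : Set α) (hS : S.Finite) (m : Subgroup G → α) (hm : Function.Injective m)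
    (h : ∀ φ ∈ V, φ ≠ 1 → m φ.ker ∈ S) : Nat.card V ≤ S.ncard * (ℓ - 1) + 1 := by
  classical
  have : NeZero ℓ := ⟨hℓ.ne_zero⟩
  have hfz : Finite (Multiplicative (ZMod ℓ)) := inferInstanceAs (Finite (ZMod ℓ))
  have hfS : Finite S := hS
  have hg : ∀ N : Subgroup G, ∃ g : G, N ≠ ⊤ → g ∉ N := by
    intro N
    by_cases hN : N = ⊤
    · exact ⟨1, fun h => absurd hN h⟩
    · obtain ⟨g, hg⟩ : ∃ g, g ∉ N := by
        by_contra hc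
        push Not at hc
        exact hN ((Subgroup.eq_top_iff' N).2 hc)
      exact ⟨g, fun _ => hg⟩
  choose g hg using hg
  have hk : ∀ φ : G →* Multiplicative (ZMod ℓ), φ ≠ 1 → φ (g φ.ker) ≠ 1 := by
    intro φ hφ h1
    refine hg φ.ker ?_ h1
    intro ht
    apply hφ
    ext x
    have : x ∈ φ.ker := ht ▸ Subgroup.mem_top x
    rw [MonoidHom.mem_ker.1 this]; rfl
  let f : {φ : V // φ ≠ 1} → S × {z : Multiplicative (ZMod ℓ) // z ≠ 1} := fun φ =>
    have hne : (φ.1 : G →* Multiplicative (ZMod ℓ)) ≠ 1 := fun hc => φ.2 (Subtype.ext hc)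
    (⟨m (φ.1 : G →* Multiplicative (ZMod ℓ)).ker, h _ φ.1.2 hne⟩, ⟨_, hk _ hne⟩)
  have hf : Function.Injective f := by
    rintro ⟨⟨φ, hφ⟩, h1⟩ ⟨⟨ψ, hψ⟩, h2⟩ he
    have hne : φ ≠ 1 := fun hc => h1 (Subtype.ext hc)
    have e1 : m φ.ker = m ψ.ker := congrArg (fun p => (p.1 : α)) he
    have e2 : φ (g φ.ker) = ψ (g ψ.ker) := congrArg (fun p => (p.2 : Multiplicative (ZMod ℓ))) he
    have e3 := hm e1
    rw [← e3] at e2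
    have e4 := hk φ hne
    have hs := surj_of_ne_one hℓ (zpowersHom _ (φ (g φ.ker))) (Multiplicative.ofAdd 1) (by simpa using e4)
    have : φ = ψ := by
      refine MonoidHom.ext fun x => ?_
      obtain ⟨k, hk'⟩ := hs (φ x)
      have hk2 : φ (g φ.ker) ^ (Multiplicative.toAdd k) = φ x := hk'
      have h5 : x * (g φ.ker ^ (Multiplicative.toAdd k))⁻¹ ∈ φ.ker := by
        rw [MonoidHom.mem_ker, map_mul, map_inv, map_zpow, hk2, mul_inv_cancel]
      rw [e3, MonoidHom.mem_ker, map_mul, map_inv, map_zpow, ← e3, ← e2, hk2, mul_inv_eq_one] at h5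
      exact h5.symm
    subst this; rfl
  have h1 := Nat.card_le_card_of_injective f hf
  have c1 : ∀ (X : Type _) [Finite X] (a : X), Nat.card {x : X // x ≠ a} + 1 = Nat.card X := by
    intro X _ a
    rw [← Finite.card_option]
    exact Nat.card_congr (Equiv.optionSubtypeNe a)
  have c2 : ∀ (a : Multiplicative (ZMod ℓ)), Nat.card {x : Multiplicative (ZMod ℓ) // x ≠ a} + 1 = ℓ := by
    intro a
    rw [← Finite.card_option, Nat.card_congr (Equiv.optionSubtypeNe a)]
    exact Nat.card_zmod ℓ
  have := c1 V 1
  have h3 := c2 1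
  rw [Nat.card_prod, Nat.card_coe_set_eq, show Nat.card {x : Multiplicative (ZMod ℓ) // x ≠ 1} = ℓ - 1 by omega] at h1
  omega

lemma absDisc_of_equiv {M0 : Type} [Field M0] [NumberField M0] (M : IntermediateField ℚ (AlgebraicClosure ℚ))
    (e : M0 ≃+* M) : Module.finrank ℚ M = Module.finrank ℚ M0 ∧ absDisc M = (discr M0).natAbs := by
  have hf : FiniteDimensional ℚ M := Module.Finite.equiv (e.toRatAlgEquiv).toLinearEquiv
  refine ⟨(e.toRatAlgEquiv).toLinearEquiv.finrank_eq.symm, ?_⟩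
  have : NumberField M := { to_charZero := inferInstance, to_finiteDimensional := hf }
  unfold absDisc
  rw [dif_pos hf, discr_eq_discr_of_ringEquiv M0 e]

lemma finite_absDisc (N : ℕ) : {M : IntermediateField ℚ (AlgebraicClosure ℚ) | FiniteDimensional ℚ M ∧ absDisc M = N}.Finite := by
  refine ((NumberField.finite_of_discr_bdd (AlgebraicClosure ℚ) N).image Subtype.val).subset ?_
  rintro M ⟨h1, h2⟩
  refine ⟨⟨M, h1⟩, ?_, rfl⟩
  unfold absDisc at h2
  rw [dif_pos h1] at h2
  rw [Set.mem_ofPred_eq, Int.abs_eq_natAbs, ← h2]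

theorem count_main (n : ℕ) (hn : 2 ≤ n) (ℓ : ℕ) (hℓ : ℓ.Prime)
    (K : IntermediateField ℚ (AlgebraicClosure ℚ)) (hK : Module.finrank ℚ K = n) :
    clTors K ℓ ≤ ({M : IntermediateField ℚ (AlgebraicClosure ℚ) |
          Module.finrank ℚ M = n * ℓ ∧ K ≤ M ∧ absDisc M = (absDisc K) ^ ℓ}).ncard * (ℓ - 1) + 1 := by
  have hfK : FiniteDimensional ℚ K := FiniteDimensional.of_finrank_pos (by omega)
  have hNK : NumberField K := { to_charZero := inferInstance, to_finiteDimensional := hfK }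
  have hA0 : Algebra.IsAlgebraic ℚ (AlgebraicClosure ℚ) := by
    have h := AlgebraicClosure.isAlgebraic ℚ
    have he : (DivisionRing.toRatAlgebra : Algebra ℚ (AlgebraicClosure ℚ)) = AlgebraicClosure.instAlgebra ℚ :=
      Subsingleton.elim _ _
    exact he ▸ h
  have hA : Algebra.IsAlgebraic K (AlgebraicClosure ℚ) := Algebra.IsAlgebraic.tower_top (K := ℚ) K
  obtain ⟨L, hL, hG, hc⟩ := exists_L (K := K) (Ω := AlgebraicClosure ℚ) hℓ
  have hfL : FiniteDimensional K L := Module.Finite.of_restrictScalars_finite ℚ K L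
  have hfV := finite_VV (F := K) (L := L) hℓ
  refine hc.trans ?_
  refine count_lem hℓ (VV ℓ K L) _ ?_ (fun N => (IntermediateField.lift (IntermediateField.fixedField N)).restrictScalars ℚ) ?_ ?_
  · refine (finite_absDisc (absDisc K ^ ℓ)).subset ?_
    rintro M ⟨h1, -, h2⟩
    exact ⟨FiniteDimensional.of_finrank_pos (by rw [h1]; exact Nat.mul_pos (by omega) hℓ.pos), h2⟩
  · intro N N' h
    have h1 := IntermediateField.lift_injective _ (IntermediateField.restrictScalars_injective ℚ h)
    rw [← IntermediateField.fixingSubgroup_fixedField N, h1, IntermediateField.fixingSubgroup_fixedField]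
  · intro φ hφ hφ1
    obtain ⟨g1, g2, g3, g4⟩ := fixed_facts hℓ hφ1
    have hN0 : NumberField (IntermediateField.fixedField φ.ker) := NumberField.of_intermediateField _
    have hd := discr_unram (K := K) (M := IntermediateField.fixedField φ.ker) (fun w => eram_of_VV hφ g4 w)
    let e : IntermediateField.fixedField φ.ker ≃+*
        (IntermediateField.lift (IntermediateField.fixedField φ.ker)).restrictScalars ℚ :=
      (IntermediateField.liftAlgEquiv (IntermediateField.fixedField φ.ker)).toRingEquiv
    obtain ⟨a1, a2⟩ := absDisc_of_equiv _ e
    refine ⟨?_, ?_, ?_⟩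
    · have hfree : Module.Free K (IntermediateField.fixedField φ.ker) := Module.Free.of_divisionRing K _
      have ht := Module.finrank_mul_finrank ℚ K (IntermediateField.fixedField φ.ker)
      rw [hK, g3] at ht
      exact a1.trans ht.symm
    · intro x hx
      exact IntermediateField.algebraMap_mem (IntermediateField.lift (IntermediateField.fixedField φ.ker)) (⟨x, hx⟩ : K)
    · rw [a2, hd, g3, (absDisc_of_equiv K (RingEquiv.refl K)).2]
end CFT
end P8b

/-- If `K` is a degree-`n` field with `|Cl_K[ℓ]| = ℓ^r` (`ℓ` prime), then
there are at least `(ℓ^r − 1)/(ℓ − 1)` degree-`nℓ` fields `M ⊇ K` in `ℚ̄` with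
`D_M = D_K^ℓ`. -/
theorem count_unramified_degree_ell_extensions
    (n : ℕ) (hn : 2 ≤ n) (ℓ : ℕ) (hℓ : ℓ.Prime)
    (K : IntermediateField ℚ (AlgebraicClosure ℚ)) (hK : Module.finrank ℚ K = n)
    (r : ℕ) (hr : clTors K ℓ = ℓ ^ r) :
    ((ℓ : ℝ) ^ r - 1) / ((ℓ : ℝ) - 1) ≤
      (({M : IntermediateField ℚ (AlgebraicClosure ℚ) |
          Module.finrank ℚ M = n * ℓ ∧ K ≤ M ∧ absDisc M = (absDisc K) ^ ℓ}).ncard : ℝ) := by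
  have h := CFT.count_main n hn ℓ hℓ K hK
  rw [hr] at h
  have h1 : (1 : ℝ) < ℓ := by exact_mod_cast hℓ.one_lt
  rw [div_le_iff₀ (by linarith)]
  have h2 := (Nat.cast_le (α := ℝ)).2 h
  rw [Nat.cast_add, Nat.cast_mul, Nat.cast_sub hℓ.one_lt.le, Nat.cast_pow, Nat.cast_one] at h2
  linarith
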